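/- Let θ > 0 and γ ∈ [1, 3/2) be given. Let 1 ≤ n₁ < n₂ < ⋯ be the increasing enumeration of the positive integers n such that all prime factors of n are at most n^θ. Then there exist constants c₁, c₂ > 0 depending only on γ and θ such that for all sufficiently large x, c₁ · x ≤ ∑_{i : n_i ≤ x} (n_{i+1} − n_i)^γ ≤ c₂ · x. -/

import Mathlib

open scoped Classical

/-- `∑_{i : n_i ≤ x} (n_{i+1} - n_i)^γ` for the increasing enumeration `a`. -/
noncomputable def gapPowerSum (a : ℕ → ℕ) (γ x : ℝ) : ℝ :=
  ∑ i ∈ (Finset.range (⌊x⌋₊ + 1)).filter (fun i : ℕ => (a i : ℝ) ≤ x),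
    ((a (i + 1) : ℝ) - (a i : ℝ)) ^ γ

namespace SmoothGaps

open MeasureTheory Finset Filter Topology Real ComplexConjugate
open Complex (I)

variable {T T₁ Y Y₀ Y₁ X x y a b α β e σ θ δ ε η N M lam H H₀ C c t γ A V K v R : ℝ} {r n p m q k i : ℕ} {F : ℝ → ℂ} {g : ℕ → ℝ} {B : Finset ℕ}

/-- The two-sided exponential `e^{-a|u| + iτu}`. -/
noncomputable def expAbs (a τ u : ℝ) : ℂ := Complex.exp ((-a * |u| : ℝ) + (τ * u : ℝ) * I)

theorem integrable_and_integral_expAbs (τ : ℝ) (ha : 0 < a) :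
    Integrable (expAbs a τ) ∧ ∫ u, expAbs a τ u = (2 * a / (a ^ 2 + τ ^ 2) : ℝ) := by
  have hn : 0 < (a + τ * I).re := by simpa
  have hp : (-a + τ * I).re < 0 := by simpa
  have h0 : Set.EqOn (expAbs a τ) (fun u => Complex.exp ((a + τ * I) * u)) (Set.Iic 0) := fun u hu => by
    rw [expAbs, abs_of_nonpos hu]; congr 1; push_cast; ring
  have h1 : Set.EqOn (expAbs a τ) (fun u => Complex.exp ((-a + τ * I) * u)) (Set.Ioi 0) := fun u hu => by
    rw [expAbs, abs_of_pos hu]; congr 1; push_cast; ring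
  have i0 := (integrableOn_exp_mul_complex_Iic hn 0).congr_fun h0.symm measurableSet_Iic
  have i1 := (integrableOn_exp_mul_complex_Ioi hp 0).congr_fun h1.symm measurableSet_Ioi
  refine ⟨by simpa using i0.union i1, ?_⟩
  rw [← intervalIntegral.integral_Iic_add_Ioi i0 i1, setIntegral_congr_fun measurableSet_Iic h0,
    setIntegral_congr_fun measurableSet_Ioi h1, integral_exp_mul_complex_Iic hn, integral_exp_mul_complex_Ioi hp]
  have h2 : a + τ * I ≠ 0 := fun h => by simp [h] at hn
  have h3 : -a + τ * I ≠ 0 := fun h => by simp [h] at hp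
  have h4 : (a ^ 2 + τ ^ 2) = -((a + τ * I) * (-a + τ * I)) := by linear_combination τ ^ 2 * Complex.I_sq
  push_cast
  rw [h4]
  simp
  field_simp
  ring

/-- The (unnormalised) Cauchy weight of width `T`. -/
noncomputable def cauchyWeight (T t : ℝ) : ℝ := T / (T ^ 2 + t ^ 2)

theorem cauchyWeight_nonneg (hT : 0 < T) (t : ℝ) : 0 ≤ cauchyWeight T t := by
  unfold cauchyWeight; positivity

theorem continuous_cauchyWeight (hT : 0 < T) : Continuous (cauchyWeight T) := by
  unfold cauchyWeight
  exact continuous_const.div (by fun_prop) (fun t => by positivity)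

theorem cauchyWeight_le (hT : 0 < T) (t : ℝ) : cauchyWeight T t ≤ 1 / T := by
  unfold cauchyWeight
  rw [div_le_div_iff₀ (by positivity) hT]; nlinarith [sq_nonneg t]

theorem cauchyWeight_eq (hT : 0 < T) (t : ℝ) :
    cauchyWeight T t = T⁻¹ * (1 + (t / T) ^ 2)⁻¹ := by
  unfold cauchyWeight; field_simp

theorem integrable_cauchyWeight (hT : 0 < T) : Integrable (cauchyWeight T) := by
  rw [(funext (cauchyWeight_eq hT))]
  exact (integrable_inv_one_add_sq.comp_div hT.ne').const_mul _

theorem integral_inv_one_add_sq_mul_exp (u : ℝ) :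
    ∫ w : ℝ, Complex.exp ((u * w : ℝ) * I) * ((1 + w ^ 2)⁻¹ : ℝ) = (π * exp (-|u|) : ℝ) := by
  have hpi : 0 < 2 * π := by positivity
  have hF : FourierTransform.fourier (expAbs (2 * π) 0) = fun w => ((π⁻¹ * (1 + w ^ 2)⁻¹ : ℝ) : ℂ) := by
    funext w
    rw [fourier_real_eq_integral_exp_smul]
    calc _ = ∫ v, expAbs (2 * π) (-(2 * π) * w) v := by
          congr 1; funext v
          rw [smul_eq_mul, expAbs, expAbs, ← Complex.exp_add]; congr 1; push_cast; ring
      _ = _ := by rw [(integrable_and_integral_expAbs _ hpi).2]; grind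
  have hFi : Integrable (FourierTransform.fourier (expAbs (2 * π) 0)) := by
    rw [hF]; exact (integrable_inv_one_add_sq.const_mul _).ofReal
  have hc : Continuous (expAbs (2 * π) 0) := by unfold expAbs; fun_prop
  have key := congrFun (hc.fourierInv_fourier_eq (integrable_and_integral_expAbs 0 hpi).1 hFi) (u / (2 * π))
  rw [fourierInv_eq', hF, expAbs, abs_div, abs_of_pos hpi, neg_mul, mul_div_cancel₀ _ hpi.ne'] at key
  simp only [zero_mul, Complex.ofReal_zero, add_zero] at key
  rw [Complex.ofReal_mul, Complex.ofReal_exp, ← key, ← integral_const_mul]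
  congr 1; funext w
  have h1 : 2 * π * inner ℝ w (u / (2 * π)) = u * w := by
    change 2 * π * (u / (2 * π) * w) = _
    field_simp
  rw [h1, smul_eq_mul, mul_left_comm, ← Complex.ofReal_mul, mul_inv_cancel_left₀ pi_ne_zero]

theorem integral_cauchyWeight_mul_exp (hT : 0 < T) (u : ℝ) :
    ∫ t : ℝ, Complex.exp ((u * t : ℝ) * I) * (cauchyWeight T t : ℝ) = (π * exp (-(T * |u|)) : ℝ) := by
  have h := Measure.integral_comp_div (fun w => Complex.exp ((u * T * w : ℝ) * I) * ((1 + w ^ 2)⁻¹ : ℝ)) T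
  rw [integral_inv_one_add_sq_mul_exp] at h
  have e t : Complex.exp ((u * t : ℝ) * I) * (cauchyWeight T t)
      = (T⁻¹) * (Complex.exp ((u * T * (t / T) : ℝ) * I) * ((1 + (t / T) ^ 2)⁻¹ : ℝ)) := by
    rw [cauchyWeight_eq hT, mul_assoc u, mul_div_cancel₀ _ hT.ne']; push_cast; ring
  simp_rw [e]
  rw [integral_const_mul, h, abs_of_pos hT, abs_mul, abs_of_pos hT, Complex.real_smul, ← Complex.ofReal_mul,
    ← Complex.ofReal_mul, inv_mul_cancel_left₀ hT.ne', mul_comm |u|]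

/-- `y ^ (-it)`. -/
noncomputable def chi (y t : ℝ) : ℂ := Complex.exp (((-(t * log y) : ℝ) : ℂ) * I)

theorem norm_chi (y t : ℝ) : ‖chi y t‖ = 1 := by
  unfold chi; rw [Complex.norm_exp_ofReal_mul_I]

theorem chi_mul (hx : x ≠ 0) (hy : y ≠ 0) (t : ℝ) : chi (x * y) t = chi x t * chi y t := by
  unfold chi
  rw [← Complex.exp_add, log_mul hx hy]; congr 1; push_cast; ring

theorem chi_one (t : ℝ) : chi 1 t = 1 := by simp [chi]

theorem continuous_chi (y : ℝ) : Continuous (chi y) := by unfold chi; fun_prop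

theorem star_chi (y t : ℝ) : conj (chi y t) = chi y (-t) := by
  unfold chi
  rw [← Complex.exp_conj]; congr 1; simp

theorem chi_mul_star_chi (x y t : ℝ) : chi x t * conj (chi y t)
    = Complex.exp (((log y - log x) * t : ℝ) * I) := by
  rw [star_chi]
  unfold chi; rw [← Complex.exp_add]; congr 1; push_cast; ring

theorem sum_mul_le_of_row_sum_le {ι : Type*} (s : Finset ι) (b : ι → ℝ) (E : ι → ι → ℝ) (B : ℝ)
    (hE : ∀ i j, 0 ≤ E i j) (hsymm : ∀ i j, E i j = E j i)
    (hB : ∀ i ∈ s, ∑ j ∈ s, E i j ≤ B) :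
    ∑ i ∈ s, ∑ j ∈ s, b i * b j * E i j ≤ B * ∑ i ∈ s, b i ^ 2 := by
  have h1 : ∑ i ∈ s, ∑ j ∈ s, b i * b j * E i j
      ≤ ∑ i ∈ s, ∑ j ∈ s, (b i ^ 2 / 2 * E i j + b j ^ 2 / 2 * E i j) := by
    refine sum_le_sum fun i _ => sum_le_sum fun j _ => ?_
    nlinarith [mul_nonneg (sq_nonneg (b i - b j)) (hE i j)]
  have h2 : ∑ i ∈ s, ∑ j ∈ s, b j ^ 2 / 2 * E i j = ∑ i ∈ s, ∑ j ∈ s, b i ^ 2 / 2 * E i j := by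
    rw [sum_comm]
    simp_all
  simp_rw [sum_add_distrib] at h1
  rw [h2] at h1
  refine h1.trans ?_
  rw [← two_mul, mul_sum, mul_sum]
  refine sum_le_sum fun i hi => ?_
  rw [← mul_sum]
  have := hB i hi
  nlinarith

theorem sum_exp_neg_le (F : Finset ℕ) (hF : ∀ k ∈ F, 1 ≤ k) (hc : 0 < c) :
    ∑ k ∈ F, exp (-(c * k)) ≤ 1 / c := by
  set r := exp (-c) with hr
  have hr0 : 0 < r := exp_pos _
  have hr1 : r < 1 := by rw [hr, exp_lt_one_iff]; linarith
  have h1 : ∑ k ∈ F, exp (-(c * k)) = r * ∑ k ∈ F.image (fun k => k - 1), r ^ k := by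
    rw [sum_image, mul_sum]
    · refine sum_congr rfl fun k hk => ?_
      rw [← pow_succ', Nat.sub_add_cancel (hF k hk), hr, ← exp_nat_mul]; congr 1; ring
    · intro x hx y hy hxy
      grind
  have h2 : ∑ k ∈ F.image (fun k => k - 1), r ^ k ≤ (1 - r)⁻¹ := by
    rw [← tsum_geometric_of_lt_one hr0.le hr1]
    exact (summable_geometric_of_lt_one hr0.le hr1).sum_le_tsum _ (fun i _ => by positivity)
  rw [h1]
  refine (mul_le_mul_of_nonneg_left h2 hr0.le).trans ?_
  rw [← div_eq_mul_inv, div_le_div_iff₀ (by linarith) hc]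
  have h4 : r * exp c = 1 := by rw [hr, ← exp_add]; simp
  nlinarith [add_one_le_exp c]

theorem abs_sub_div_le_abs_log_sub (hx : 0 < x) (hy : 0 < y) (hxY : x ≤ Y) (hyY : y ≤ Y) :
    |x - y| / Y ≤ |log x - log y| := by
  wlog h : y ≤ x generalizing x y
  · grind
  rw [abs_of_nonneg (by linarith), abs_of_nonneg (by linarith [log_le_log hy h])]
  have h1 := one_sub_inv_le_log_of_pos (div_pos hx hy)
  rw [log_div hx.ne' hy.ne'] at h1
  refine le_trans ?_ h1
  rw [inv_div, one_sub_div hx.ne']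
  gcongr

theorem sum_exp_neg_abs_log_le (s : Finset ℕ) (hT : 0 < T)
    (hs : ∀ n ∈ s, 1 ≤ n ∧ (n : ℝ) ≤ Y) (hn : n ∈ s) :
    ∑ m ∈ s, exp (-(T * |log m - log n|)) ≤ 1 + 2 * Y / T := by
  have hY : 0 < Y := by
    have := hs n hn
    have h1 : (1:ℝ) ≤ n := by exact_mod_cast this.1
    linarith [this.2]
  have hc : 0 < T / Y := by positivity
  have key : ∀ m ∈ s, exp (-(T * |log m - log n|))
      ≤ exp (-(T / Y * |(m : ℝ) - n|)) := by
    intro m hm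
    rw [exp_le_exp, neg_le_neg_iff]
    have h1 : (1:ℝ) ≤ n := by exact_mod_cast (hs n hn).1
    have h2 : (1:ℝ) ≤ m := by exact_mod_cast (hs m hm).1
    have := abs_sub_div_le_abs_log_sub (by linarith) (by linarith) (hs m hm).2 (hs n hn).2
    calc T / Y * |(m : ℝ) - n| = T * (|(m : ℝ) - n| / Y) := by ring
      _ ≤ _ := by gcongr
  refine (sum_le_sum key).trans ?_
  have hsplit : s = (s.filter (· < n)) ∪ ((s.filter (· = n)) ∪ (s.filter (n < ·))) := by
    grind
  have hpos : ∀ F : Finset ℕ, 0 ≤ ∑ m ∈ F, exp (-(T / Y * |(m : ℝ) - n|)) := fun F =>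
    sum_nonneg fun _ _ => (exp_pos _).le
  have hun : ∀ F G : Finset ℕ, ∑ m ∈ F ∪ G, exp (-(T / Y * |(m : ℝ) - n|)) ≤
      ∑ m ∈ F, exp (-(T / Y * |(m : ℝ) - n|)) + ∑ m ∈ G, exp (-(T / Y * |(m : ℝ) - n|)) := by
    intro F G
    rw [← sum_union_inter]; linarith [hpos (F ∩ G)]
  have b1 : ∑ m ∈ s.filter (· < n), exp (-(T / Y * |(m : ℝ) - n|)) ≤ 1 / (T / Y) := by
    refine le_trans (le_of_eq ?_) (sum_exp_neg_le ((s.filter (· < n)).image (fun m => n - m)) ?_ hc)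
    · rw [sum_image]
      · refine sum_congr rfl fun m hm => ?_
        have h := (mem_filter.1 hm).2
        rw [Nat.cast_sub h.le, abs_sub_comm, abs_of_nonneg]
        have : (m : ℝ) < n := by exact_mod_cast h
        linarith
      · intro x hx y hy hxy
        grind
    grind
  have b2 : ∑ m ∈ s.filter (n < ·), exp (-(T / Y * |(m : ℝ) - n|)) ≤ 1 / (T / Y) := by
    refine le_trans (le_of_eq ?_) (sum_exp_neg_le ((s.filter (n < ·)).image (fun m => m - n)) ?_ hc)
    · rw [sum_image]
      · refine sum_congr rfl fun m hm => ?_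
        have h := (mem_filter.1 hm).2
        rw [Nat.cast_sub h.le, abs_of_nonneg]
        have : (n : ℝ) < m := by exact_mod_cast h
        linarith
      · intro x hx y hy hxy
        grind
    grind
  have b3 : ∑ m ∈ s.filter (· = n), exp (-(T / Y * |(m : ℝ) - n|)) ≤ 1 := by
    rw [filter_eq']; simp [hn]
  have e : 1 / (T / Y) = Y / T := by rw [one_div_div]
  grind

theorem integrable_sum_mul_cauchyWeight (hT : 0 < T) (x y : ℝ) (c : ℂ) :
    Integrable fun t => c * (chi x t * conj (chi y t)) * ((cauchyWeight T t : ℝ) : ℂ) := by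
  refine ((integrable_cauchyWeight hT).ofReal (𝕜 := ℂ)).bdd_mul (c := ‖c‖) ?_ ?_
  · exact Continuous.aestronglyMeasurable (continuous_const.mul ((continuous_chi x).mul (Complex.continuous_conj.comp (continuous_chi y))))
  · refine .of_forall fun t => ?_
    rw [norm_mul, norm_mul, RCLike.norm_conj, norm_chi, norm_chi]; simp

theorem meanValue (s : Finset ℕ) (a : ℕ → ℂ) (hT : 0 < T)
    (hs : ∀ n ∈ s, 1 ≤ n ∧ (n : ℝ) ≤ Y) :
    ∫ t, ‖∑ n ∈ s, a n * chi n t‖ ^ 2 * cauchyWeight T t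
      ≤ π * (1 + 2 * Y / T) * ∑ n ∈ s, ‖a n‖ ^ 2 := by
  have h1 : ∀ t, ((‖∑ n ∈ s, a n * chi n t‖ ^ 2 * cauchyWeight T t : ℝ) : ℂ)
      = ∑ n ∈ s, ∑ m ∈ s, (a n * conj (a m)) * (chi n t * conj (chi m t))
          * (cauchyWeight T t : ℂ) := by
    intro t
    push_cast
    rw [← Complex.mul_conj', map_sum, sum_mul_sum, sum_mul]
    refine sum_congr rfl fun n _ => ?_
    rw [sum_mul]
    grind
  have h2 : ((∫ t, ‖∑ n ∈ s, a n * chi n t‖ ^ 2 * cauchyWeight T t : ℝ) : ℂ)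
      = ∑ n ∈ s, ∑ m ∈ s, (a n * conj (a m)) *
        ((π * exp (-(T * |log m - log n|)) : ℝ) : ℂ) := by
    rw [← integral_complex_ofReal]
    simp_rw [h1]
    rw [integral_finsetSum _ (fun n _ => integrable_finsetSum _ fun m _ =>
      integrable_sum_mul_cauchyWeight hT _ _ _)]
    refine sum_congr rfl fun n _ => ?_
    rw [integral_finsetSum _ (fun m _ => integrable_sum_mul_cauchyWeight hT _ _ _)]
    refine sum_congr rfl fun m _ => ?_
    rw [← integral_cauchyWeight_mul_exp hT, ← integral_const_mul]
    congr 1; funext t; rw [chi_mul_star_chi]; ring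
  have h3 : ∫ t, ‖∑ n ∈ s, a n * chi n t‖ ^ 2 * cauchyWeight T t
      ≤ ∑ n ∈ s, ∑ m ∈ s, ‖a n‖ * ‖a m‖ * (π * exp (-(T * |log m - log n|))) := by
    refine (le_abs_self _).trans ?_
    rw [← norm_eq_abs, ← Complex.norm_real, h2]
    refine (norm_sum_le _ _).trans (sum_le_sum fun n _ => (norm_sum_le _ _).trans (sum_le_sum fun m _ => ?_))
    rw [norm_mul, norm_mul, RCLike.norm_conj, Complex.norm_real, norm_of_nonneg (by positivity)]
  refine h3.trans ?_
  refine sum_mul_le_of_row_sum_le s (fun n => ‖a n‖) _ _ (fun i j => by positivity)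
    (fun i j => by rw [abs_sub_comm]) (fun n hn => ?_)
  rw [← mul_sum]
  exact mul_le_mul_of_nonneg_left (sum_exp_neg_abs_log_le s hT hs hn) pi_pos.le

/-- A smooth bump on `[-1,1]` together with its rapidly decaying Fourier transform. -/
theorem exists_bump : ∃ (K : ℝ → ℝ) (k : ℝ → ℂ) (c : ℝ), 0 < c ∧ Continuous K ∧ (∀ u, 0 ≤ K u) ∧
    (∀ u, 1 < |u| → K u = 0) ∧ (∀ u, |u| ≤ 1 / 2 → c ≤ K u) ∧ Continuous k ∧
    (∀ A : ℕ, ∃ C : ℝ, 0 < C ∧ ∀ τ, ‖k τ‖ * (1 + |τ|) ^ A ≤ C) ∧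
    ∀ u : ℝ, ((K u : ℝ) : ℂ) = ∫ τ : ℝ, k τ * Complex.exp ((-(u * τ) : ℝ) * I) := by
  let b : ContDiffBump (0 : ℝ) := ⟨1 / 2, 1, by norm_num, by norm_num⟩
  let f : ℝ → ℂ := fun x => (b x : ℂ)
  have hfc : ContDiff ℝ (⊤ : ℕ∞) f := Complex.ofRealCLM.contDiff.comp b.contDiff
  let φ : SchwartzMap ℝ ℂ := (b.hasCompactSupport.comp_left (g := fun x : ℝ => (x : ℂ)) (by simp)).toSchwartzMap hfc
  let ψ : SchwartzMap ℝ ℂ := FourierTransform.fourier φ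
  have hpi : 0 < 2 * π := by positivity
  refine ⟨b, fun τ => ((2 * π)⁻¹ : ℝ) • ψ (-(τ / (2 * π))), 1, one_pos, b.continuous, fun u => b.nonneg,
    ?_, ?_, ?_, ?_, ?_⟩
  · intro u hu
    exact b.zero_of_le_dist (by simpa [b] using hu.le)
  · intro u hu
    exact (b.one_of_mem_closedBall (by simpa [b] using hu)).ge
  · have := ψ.continuous
    fun_prop
  · intro A
    set C := 2 ^ A * ((Finset.Iic (A, 0)).sup fun m => SchwartzMap.seminorm ℝ m.1 m.2) ψ
    have h x : (1 + |x|) ^ A * ‖ψ x‖ ≤ C := by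
      simpa using SchwartzMap.one_add_le_sup_seminorm_apply (𝕜 := ℝ) (m := (A, 0)) le_rfl le_rfl ψ x
    have hC := (by positivity : (0:ℝ) ≤ _).trans (h 0)
    refine ⟨(2 * π)⁻¹ * ((2 * π) ^ A * (C + 1)), by positivity, fun τ => ?_⟩
    set x := -(τ / (2 * π)) with hx
    have hτ : 1 + |τ| ≤ 2 * π * (1 + |x|) := by
      rw [hx, abs_neg, abs_div, abs_of_pos hpi, mul_one_add, mul_div_cancel₀ _ hpi.ne']
      linarith [pi_gt_three]
    rw [norm_smul, norm_of_nonneg (by positivity), mul_assoc]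
    refine mul_le_mul_of_nonneg_left ?_ (by positivity)
    calc _ ≤ ‖ψ x‖ * (2 * π * (1 + |x|)) ^ A := by gcongr
      _ = (2 * π) ^ A * ((1 + |x|) ^ A * ‖ψ x‖) := by rw [mul_pow]; ring
      _ ≤ _ := by gcongr; linarith [h x]
  · intro u
    have hF : FourierTransform.fourier f = ψ := (SchwartzMap.fourier_coe φ).symm
    have hinv := congrFun (hfc.continuous.fourierInv_fourier_eq φ.integrable (hF ▸ ψ.integrable)) u
    rw [hF, fourierInv_eq'] at hinv
    change f u = _
    rw [← hinv]
    have h := Measure.integral_comp_div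
      (fun w => ψ (-w) * Complex.exp ((-(2 * π * w * u) : ℝ) * I)) (2 * π)
    have h2 : ∫ τ, ((2 * π)⁻¹ : ℝ) • ψ (-(τ / (2 * π))) * Complex.exp ((-(u * τ) : ℝ) * I)
      = ((2 * π)⁻¹ : ℝ) • ∫ τ, ψ (-(τ / (2 * π))) * Complex.exp ((-(2 * π * (τ / (2 * π)) * u) : ℝ) * I) := by
      rw [← integral_smul]; congr 1; funext τ
      have : 2 * π * (τ / (2 * π)) * u = u * τ := by field_simp
      rw [this, smul_mul_assoc]
    rw [h2, h, abs_of_pos hpi, smul_smul, inv_mul_cancel₀ hpi.ne', one_smul,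
      ← integral_neg_eq_self]
    congr 1; funext w
    have h3 : inner ℝ (-w) u = u * (-w) := rfl
    rw [h3, smul_eq_mul, mul_comm]; congr 3; push_cast; ring

theorem integral_exp_neg_abs_log (s v : ℝ) :
    IntegrableOn (fun x : ℝ => (x⁻¹ * exp (-|log x - v|))) (Set.Ioi 0) ∧
    ‖∫ x in Set.Ioi (0:ℝ), chi x s * (((x⁻¹ * exp (-|log x - v|)) : ℝ) : ℂ)‖ = 2 / (1 + s ^ 2) := by
  have himg : exp '' Set.univ = Set.Ioi 0 := by rw [Set.image_univ, range_exp]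
  have hder : ∀ x ∈ Set.univ, HasDerivWithinAt exp (exp x) Set.univ x := fun x _ =>
    (hasDerivAt_exp x).hasDerivWithinAt
  constructor
  · rw [← himg, integrableOn_image_iff_integrableOn_abs_deriv_smul MeasurableSet.univ hder
      exp_injective.injOn, integrableOn_univ]
    refine (((integrable_and_integral_expAbs 0 one_pos).1.norm).comp_sub_right v).congr (.of_forall fun u => ?_)
    simp only [expAbs, abs_exp, log_exp, smul_eq_mul]
    rw [← exp_neg, ← mul_assoc, ← exp_add, Complex.norm_exp]; simp
  · rw [← himg, integral_image_eq_integral_abs_deriv_smul MeasurableSet.univ hder exp_injective.injOn]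
    simp only [Measure.restrict_univ]
    have h1 : ∀ u, |exp u| • (chi (exp u) s * ((((exp u)⁻¹ * exp (-|log (exp u) - v|)) : ℝ) : ℂ))
       = Complex.exp ((-(s * v) : ℝ) * I) * expAbs 1 (-s) (u - v) := by
      intro u
      rw [abs_exp, log_exp, expAbs, chi, log_exp, ← Complex.exp_add, Complex.real_smul, Complex.ofReal_mul,
        mul_left_comm, ← mul_assoc, ← mul_assoc, mul_assoc _ (exp u : ℂ), ← Complex.ofReal_mul,
        mul_inv_cancel₀ (exp_pos u).ne', Complex.ofReal_one, mul_one, Complex.ofReal_exp, ← Complex.exp_add]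
      congr 1; push_cast; ring
    simp_rw [h1]
    rw [integral_const_mul, integral_sub_right_eq_self (expAbs 1 (-s)),
      (integrable_and_integral_expAbs _ one_pos).2, norm_mul, Complex.norm_exp_ofReal_mul_I, one_mul, Complex.norm_real,
      norm_of_nonneg (by positivity)]
    ring_nf

theorem integral_inv_one_add_sq_shift (t : ℝ) : ∫ t' : ℝ, (1 + (t - t') ^ 2)⁻¹ = π := by
  rw [integral_sub_left_eq_self (fun x => (1 + x ^ 2)⁻¹)]
  exact integral_univ_inv_one_add_sq

theorem integrable_inv_one_add_sq_shift (t : ℝ) : Integrable fun t' : ℝ => (1 + (t - t') ^ 2)⁻¹ :=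
  integrable_inv_one_add_sq.comp_sub_left t

/-- Schur's test for the kernel `2 / (1 + (t - t')²)`. -/
theorem schur_cauchy (g : ℝ → ℝ) (hg0 : ∀ t, 0 ≤ g t) (hg2 : Integrable fun t => g t ^ 2) :
    ∫ z : ℝ × ℝ, g z.1 * g z.2 * (2 / (1 + (z.1 - z.2) ^ 2)) ∂(volume.prod volume)
      ≤ 2 * π * ∫ t, g t ^ 2 := by
  have hA : Integrable (fun z => g z.1 ^ 2 * (1 + (z.1 - z.2) ^ 2)⁻¹) (volume.prod volume) := by
    refine (integrable_prod_iff ?_).2 ⟨?_, ?_⟩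
    · refine AEStronglyMeasurable.mul (hg2.aestronglyMeasurable.comp_fst) ?_
      fun_prop
    · exact .of_forall fun t => (integrable_inv_one_add_sq_shift t).const_mul (g t ^ 2)
    · have : ∀ t, ∫ t', ‖g t ^ 2 * (1 + (t - t') ^ 2)⁻¹‖ = g t ^ 2 * π := by
        intro t
        rw [← integral_inv_one_add_sq_shift t, ← integral_const_mul]
        congr 1; funext t'
        exact norm_of_nonneg (by positivity)
      simp_rw [this]
      exact hg2.mul_const _
  have hAi : ∫ z, g z.1 ^ 2 * (1 + (z.1 - z.2) ^ 2)⁻¹ ∂(volume.prod volume) = π * ∫ t, g t ^ 2 := by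
    rw [integral_prod _ hA]
    simp_rw [integral_const_mul, integral_inv_one_add_sq_shift]
    rw [integral_mul_const, mul_comm]
  have hB : Integrable (fun z => g z.2 ^ 2 * (1 + (z.2 - z.1) ^ 2)⁻¹) (volume.prod volume) := hA.swap
  have hBi : ∫ z, g z.2 ^ 2 * (1 + (z.2 - z.1) ^ 2)⁻¹ ∂(volume.prod volume) = π * ∫ t, g t ^ 2 := by
    rw [← hAi]
    exact integral_prod_swap (μ := (volume : Measure ℝ)) (ν := (volume : Measure ℝ)) (fun z => g z.1 ^ 2 * (1 + (z.1 - z.2) ^ 2)⁻¹)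
  calc _ ≤ ∫ z, (g z.1 ^ 2 * (1 + (z.1 - z.2) ^ 2)⁻¹ + g z.2 ^ 2 * (1 + (z.2 - z.1) ^ 2)⁻¹) ∂(volume.prod volume) := by
        refine integral_mono_of_nonneg (.of_forall fun z => ?_) (hA.add hB)
          (.of_forall fun z => ?_)
        · have := hg0 z.1; have := hg0 z.2; simp only [Pi.zero_apply]; positivity
        · have e : (1 + (z.2 - z.1) ^ 2)⁻¹ = (1 + (z.1 - z.2) ^ 2)⁻¹ := by congr 1; ring
          have h0 : 0 ≤ (1 + (z.1 - z.2) ^ 2)⁻¹ := by positivity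
          simp only
          rw [e, div_eq_mul_inv]
          nlinarith [mul_nonneg (sq_nonneg (g z.1 - g z.2)) h0]
    _ = _ := by rw [integral_add hA hB, hAi, hBi]; ring

/-- `∫ g(t) x^{it} dt` has controlled mean square in `log x`. -/
theorem lintegral_norm_sq_le (g : ℝ → ℂ) (hg : Integrable g) (hg2 : Integrable fun t => ‖g t‖ ^ 2) (v : ℝ) :
    ∫⁻ x in Set.Ioi (0:ℝ), ENNReal.ofReal (‖∫ t, g t * chi x (-t)‖ ^ 2 * (x⁻¹ * exp (-|log x - v|)))
      ≤ ENNReal.ofReal (2 * π * ∫ t, ‖g t‖ ^ 2) := by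
  set w := fun x => x⁻¹ * exp (-|log x - v|) with hw
  have hchim : Measurable (fun p : ℝ × ℝ => chi p.1 p.2) := by
    unfold chi
    fun_prop
  have hV : ∀ x, ((‖∫ t, g t * chi x (-t)‖ ^ 2 * w x : ℝ) : ℂ)
      = ∫ z, g z.1 * conj (g z.2) * chi x (z.2 - z.1) * (w x : ℂ) ∂(volume.prod volume) := by
    intro x
    push_cast
    rw [← Complex.mul_conj', ← integral_conj, ← integral_prod_mul, ← integral_mul_const]
    congr 1; funext z
    rw [map_mul, star_chi, neg_neg]
    have : chi x (z.2 - z.1) = chi x (-z.1) * chi x z.2 := by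
      unfold chi; rw [← Complex.exp_add]; congr 1; push_cast; ring
    rw [this]; ring
  have hgg : Integrable (fun z => g z.1 * conj (g z.2)) (volume.prod volume) := by
    have hg' : Integrable (fun t => conj (g t)) := by
      exact (Complex.conjLIE.toContinuousLinearEquiv.toContinuousLinearMap).integrable_comp hg
    exact hg.mul_prod hg'
  have hint : Integrable (fun p : ℝ × (ℝ × ℝ) => g p.2.1 * conj (g p.2.2) * chi p.1 (p.2.2 - p.2.1) * (w p.1 : ℂ))
      ((volume.restrict (Set.Ioi 0)).prod (volume.prod volume)) := by
    have h1 : Integrable (fun p : ℝ × (ℝ × ℝ) => (w p.1 : ℂ) * (g p.2.1 * conj (g p.2.2)))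
      ((volume.restrict (Set.Ioi 0)).prod (volume.prod volume)) := (Integrable.ofReal ((integral_exp_neg_abs_log 0 v).1) (𝕜 := ℂ)).mul_prod hgg
    have h2 := h1.bdd_mul (c := 1) (f := fun p : ℝ × (ℝ × ℝ) => chi p.1 (p.2.2 - p.2.1)) ?_ ?_
    · grind
    · refine Measurable.aestronglyMeasurable ?_
      fun_prop
    · exact .of_forall fun p => (norm_chi _ _).le
  have hVi : Integrable (fun x => ((‖∫ t, g t * chi x (-t)‖ ^ 2 * w x : ℝ) : ℂ)) (volume.restrict (Set.Ioi 0)) := by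
    simp_rw [hV]
    exact hint.integral_prod_left
  have hVi' : Integrable (fun x => (‖∫ t, g t * chi x (-t)‖ ^ 2 * w x)) (volume.restrict (Set.Ioi 0)) := by
    exact hVi.re.congr (.of_forall fun x => Complex.ofReal_re _)
  have hnn : ∀ x ∈ Set.Ioi 0, 0 ≤ ‖∫ t, g t * chi x (-t)‖ ^ 2 * w x := by
    intro x hx
    have : 0 < x := hx
    simp only [hw]; positivity
  rw [← ofReal_integral_eq_lintegral_ofReal hVi' ((ae_restrict_iff' measurableSet_Ioi).2 (.of_forall hnn))]
  refine ENNReal.ofReal_le_ofReal ?_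
  have h5 : ((∫ x in Set.Ioi 0, ‖∫ t, g t * chi x (-t)‖ ^ 2 * w x : ℝ) : ℂ)
      = ∫ z, g z.1 * conj (g z.2) * (∫ x in Set.Ioi 0, chi x (z.2 - z.1) * (w x : ℂ)) ∂(volume.prod volume) := by
    rw [← integral_complex_ofReal]
    simp_rw [hV]
    rw [integral_integral_swap hint]
    congr 1; funext z
    rw [← integral_const_mul]
    congr 1; funext x; ring
  refine le_trans ?_ (schur_cauchy (fun t => ‖g t‖) (fun t => norm_nonneg _) hg2)
  refine (le_abs_self _).trans ?_
  rw [← norm_eq_abs, ← Complex.norm_real, h5]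
  refine (norm_integral_le_integral_norm _).trans (le_of_eq ?_)
  congr 1; funext z
  rw [norm_mul, norm_mul, RCLike.norm_conj, (integral_exp_neg_abs_log (z.2 - z.1) v).2]
  congr 3; ring

/-- The ratio of the endpoints of all long sums. -/
noncomputable def kap : ℝ := exp 7

theorem kap_pos : 0 < kap := exp_pos _

theorem one_lt_kap : 1 < kap := by unfold kap; rw [one_lt_exp_iff]; norm_num

theorem natCast_mem_Ioc_floor (hY : 0 ≤ Y) :
    m ∈ Ioc ⌊Y⌋₊ ⌊kap * Y⌋₊ ↔ Y < m ∧ (m : ℝ) ≤ kap * Y := by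
  rw [mem_Ioc, Nat.floor_lt hY, Nat.le_floor_iff (mul_nonneg kap_pos.le hY)]

noncomputable def zsum (Y t : ℝ) : ℂ := ∑ m ∈ Ioc ⌊Y⌋₊ ⌊kap * Y⌋₊, chi m t

noncomputable def zint (Y t : ℝ) : ℂ := ∫ y in Y..(kap * Y), chi y t

noncomputable def zstar (Y t : ℝ) : ℂ := zsum Y t - zint Y t

/-- `∑ d^{-it} Z*_Y(t)` over a finite family of pairs `(d, Y)`. -/
noncomputable def famPoly {ι : Type*} (I : Finset ι) (d : ι → ℕ) (Y : ι → ℝ) (t : ℝ) : ℂ :=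
  ∑ i ∈ I, chi (d i) t * zstar (Y i) t

theorem continuous_zsum (Y : ℝ) : Continuous (zsum Y) := by
  unfold zsum; exact continuous_finsetSum _ fun m _ => continuous_chi m

theorem integral_chi (ha : 0 < a) (hab : a ≤ b) (t : ℝ) :
    ∫ y in a..b, chi y t = (b * chi b t - a * chi a t) / (1 - t * I) := by
  have hne : (1 - t * I) ≠ 0 := fun h => by
    have := congrArg Complex.re h; simp at this
  have hpos : ∀ y ∈ Set.uIcc a b, 0 < y := fun y hy => by
    rw [Set.uIcc_of_le hab] at hy; exact ha.trans_le hy.1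
  have hder : ∀ y ∈ Set.uIcc a b, HasDerivAt (fun y => y * chi y t / (1 - t * I)) (chi y t) y := by
    intro y hy
    have hy0 := hpos y hy
    have h1 : HasDerivAt (fun y => ((-(t * log y) : ℝ) : ℂ) * I) (((-(t * y⁻¹) : ℝ) : ℂ) * I) y :=
      (((hasDerivAt_log hy0.ne').const_mul t).neg.ofReal_comp).mul_const _
    refine ((((hasDerivAt_id y).ofReal_comp).mul h1.cexp).div_const (1 - t * I)).congr_deriv ?_
    rw [div_eq_iff hne]
    have : (y : ℂ) ≠ 0 := by exact_mod_cast hy0.ne'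
    change 1 * chi y t + y * (chi y t * _) = _
    push_cast
    field_simp
    ring
  rw [intervalIntegral.integral_eq_sub_of_hasDerivAt hder]
  · ring
  · refine ContinuousOn.intervalIntegrable ?_
    unfold chi
    refine Continuous.comp_continuousOn Complex.continuous_exp ?_
    exact ContinuousOn.mul (Complex.continuous_ofReal.comp_continuousOn ((continuousOn_const.mul (continuousOn_log.mono fun y hy => (hpos y hy).ne')).neg)) continuousOn_const

theorem zint_eq (hY : 0 < Y) (t : ℝ) :
    zint Y t = ((kap * Y : ℝ) * chi (kap * Y) t - Y * chi Y t) / (1 - t * I) :=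
  integral_chi hY (by nlinarith [one_lt_kap]) t

theorem one_sub_mul_I_ne_zero (t : ℝ) : (1 - t * I : ℂ) ≠ 0 := fun h => by
  have := congrArg Complex.re h; simp at this

theorem continuous_zint (hY : 0 < Y) : Continuous (zint Y) := by
  have := funext (zint_eq hY)
  rw [this]
  have := continuous_chi (kap * Y)
  have := continuous_chi Y
  exact Continuous.div (by fun_prop) (by fun_prop) one_sub_mul_I_ne_zero

theorem norm_zint_le (hY : 0 < Y) (t : ℝ) :
    ‖zint Y t‖ ≤ 4 * kap * Y / (1 + |t|) := by
  have h1 : (1 + |t|) / 2 ≤ ‖1 - t * I‖ := by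
    have ha := Complex.abs_re_le_norm (1 - t * I)
    have hb := Complex.abs_im_le_norm (1 - t * I)
    simp at ha hb
    linarith
  rw [zint_eq hY, norm_div]
  have h2 : ‖((kap * Y : ℝ) * chi (kap * Y) t - Y * chi Y t : ℂ)‖ ≤ 2 * kap * Y := by
    refine (norm_sub_le _ _).trans ?_
    rw [norm_mul, norm_mul, norm_chi, norm_chi, Complex.norm_real, Complex.norm_real,
      norm_of_nonneg (by have := kap_pos; positivity), norm_of_nonneg hY.le]
    nlinarith [one_lt_kap]
  have h3 : 0 < 1 + |t| := by positivity
  rw [div_le_div_iff₀ (by linarith) h3]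
  have := kap_pos
  have h5 : 0 ≤ 2 * kap * Y := by positivity
  nlinarith

theorem norm_zint_le' (hY : 0 < Y) (t : ℝ) : ‖zint Y t‖ ≤ 4 * kap * Y := by
  refine (norm_zint_le hY t).trans ?_
  have := kap_pos
  exact div_le_self (by positivity) (by linarith [abs_nonneg t])

theorem norm_zsum_le (hY : 0 < Y) (t : ℝ) : ‖zsum Y t‖ ≤ kap * Y := by
  unfold zsum
  refine (norm_sum_le _ _).trans ?_
  simp_rw [norm_chi]
  have := kap_pos
  have h2 : ((#(Ioc ⌊Y⌋₊ ⌊kap * Y⌋₊) : ℕ) : ℝ) ≤ ⌊kap * Y⌋₊ := by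
    simp
  simpa using h2.trans (Nat.floor_le (by positivity))

theorem norm_zstar_le (hY : 0 < Y) (t : ℝ) : ‖zstar Y t‖ ≤ 5 * kap * Y := by
  have := norm_zsum_le hY t; have := norm_zint_le' hY t
  refine (norm_sub_le _ _).trans ?_
  linarith

theorem continuous_zstar (hY : 0 < Y) : Continuous (zstar Y) :=
  (continuous_zsum Y).sub (continuous_zint hY)

theorem continuous_famPoly {ι : Type*} (I : Finset ι) (d : ι → ℕ) (Y : ι → ℝ) (hY : ∀ i ∈ I, 0 < Y i) :
    Continuous (famPoly I d Y) := by
  unfold famPoly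
  exact continuous_finsetSum _ fun i hi => (continuous_chi _).mul (continuous_zstar (hY i hi))

theorem norm_famPoly_le {ι : Type*} (I : Finset ι) (d : ι → ℕ) (Y : ι → ℝ) (hY : ∀ i ∈ I, 0 < Y i) (t : ℝ) :
    ‖famPoly I d Y t‖ ≤ ∑ i ∈ I, 5 * kap * Y i := by
  unfold famPoly
  refine (norm_sum_le _ _).trans (sum_le_sum fun i hi => ?_)
  rw [norm_mul, norm_chi, one_mul]
  exact norm_zstar_le (hY i hi) t

structure IsBump (K : ℝ → ℝ) (k : ℝ → ℂ) (c : ℝ) : Prop where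
  c_pos : 0 < c
  cont : Continuous K
  nonneg : ∀ u, 0 ≤ K u
  zero : ∀ u, 1 < |u| → K u = 0
  lower : ∀ u, |u| ≤ 1 / 2 → c ≤ K u
  cont_k : Continuous k
  decay : ∀ A : ℕ, ∃ C : ℝ, 0 < C ∧ ∀ τ, ‖k τ‖ * (1 + |τ|) ^ A ≤ C
  repr : ∀ u : ℝ, ((K u : ℝ) : ℂ) = ∫ τ : ℝ, k τ * Complex.exp ((-(u * τ) : ℝ) * I)

theorem exists_isBump : ∃ K k c, IsBump K k c := by
  obtain ⟨K, k, c, h1, h2, h3, h4, h5, h6, h7, h8⟩ := exists_bump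
  exact ⟨K, k, c, h1, h2, h3, h4, h5, h6, h7, h8⟩

namespace IsBump

variable {K : ℝ → ℝ} {k : ℝ → ℂ} {c : ℝ}

theorem integrable_k (h : IsBump K k c) : Integrable k := by
  obtain ⟨C, hC, hd⟩ := h.decay 2
  refine (integrable_inv_one_add_sq.const_mul C).mono' h.cont_k.aestronglyMeasurable
    (.of_forall fun τ => ?_)
  rw [← div_eq_mul_inv, le_div_iff₀ (by positivity)]
  refine le_trans ?_ (hd τ)
  gcongr
  nlinarith [abs_nonneg τ, sq_abs τ]

theorem integrable_comp_div (h : IsBump K k c) (hT : 0 < T) : Integrable fun t => k (t / T) :=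
  h.integrable_k.comp_div hT.ne'

theorem exists_norm_sq_le (h : IsBump K k c) : ∃ C : ℝ, 0 < C ∧ ∀ T : ℝ, 0 < T → ∀ t,
    ‖k (t / T)‖ ^ 2 ≤ C * T * cauchyWeight T t := by
  obtain ⟨C, hC, hd⟩ := h.decay 1
  refine ⟨C ^ 2, by positivity, fun T hT t => ?_⟩
  have h1 := hd (t / T)
  rw [cauchyWeight_eq hT, mul_assoc, ← mul_assoc T, mul_inv_cancel₀ hT.ne', one_mul, ← div_eq_mul_inv,
    le_div_iff₀ (by positivity)]
  calc ‖k (t / T)‖ ^ 2 * (1 + (t / T) ^ 2) ≤ (‖k (t / T)‖ * (1 + |t / T|) ^ 1) ^ 2 := by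
        rw [mul_pow, pow_one]; gcongr
        nlinarith [abs_nonneg (t / T), sq_abs (t / T)]
    _ ≤ C ^ 2 := by gcongr

theorem repr_log (h : IsBump K k c) (hT : 0 < T) (x y : ℝ) :
    ((K (T * (log y - log x)) : ℝ) : ℂ)
      = (T⁻¹ : ℝ) * ∫ t, k (t / T) * chi y t * chi x (-t) := by
  rw [h.repr]
  have h1 := Measure.integral_comp_div (fun τ => k τ * Complex.exp ((-(T * (log y - log x) * τ) : ℝ) * I)) T
  have h2 : ∫ t, k (t / T) * chi y t * chi x (-t) = ∫ t, k (t / T) * Complex.exp ((-(T * (log y - log x) * (t / T)) : ℝ) * I) := by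
    congr 1; funext t
    rw [mul_assoc]; congr 1
    unfold chi; rw [← Complex.exp_add]; congr 1
    have : T * (log y - log x) * (t / T) = (log y - log x) * t := by field_simp
    rw [this]; push_cast; ring
  rw [h2, h1, abs_of_pos hT, Complex.real_smul, ← mul_assoc, ← Complex.ofReal_mul, inv_mul_cancel₀ hT.ne']
  simp

theorem integrable_mul_chi (h : IsBump K k c) (hT : 0 < T) (x y : ℝ) :
    Integrable fun t => k (t / T) * chi y t * chi x (-t) := by
  have h1 := (h.integrable_comp_div hT).bdd_mul (c := 1) (f := fun t => chi y t * chi x (-t)) ?_ ?_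
  · grind
  · exact ((continuous_chi y).mul ((continuous_chi x).comp continuous_neg)).aestronglyMeasurable
  · exact .of_forall fun t => by rw [norm_mul, norm_chi, norm_chi]; simp

theorem integral_repr (h : IsBump K k c) (hT : 0 < T) (x : ℝ) {d : ℝ} (hd : 0 < d)
    (ha : 0 < a) (hab : a ≤ b) :
    ((∫ y in a..b, K (T * (log (d * y) - log x)) : ℝ) : ℂ)
      = (T⁻¹ : ℝ) * ∫ t, k (t / T) * (chi d t * ∫ y in a..b, chi y t) * chi x (-t) := by
  rw [intervalIntegral.integral_of_le hab, ← integral_complex_ofReal]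
  simp_rw [h.repr_log hT]
  rw [integral_const_mul]
  congr 1
  have hmeas : Measurable (fun p : ℝ × ℝ => chi (d * p.1) p.2) := by
    unfold chi
    fun_prop
  have hint : Integrable (Function.uncurry fun (y t) => k (t / T) * chi (d * y) t * chi x (-t))
      ((volume.restrict (Set.Ioc a b)).prod volume) := by
    have h1 : Integrable (fun p => 1 * k (p.2 / T)) ((volume.restrict (Set.Ioc a b)).prod volume) :=
      (integrable_const (1:ℂ)).mul_prod (h.integrable_comp_div hT)
    have h2 := h1.bdd_mul (c := 1) (f := fun p => chi (d * p.1) p.2 * chi x (-p.2)) ?_ ?_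
    · refine h2.congr (.of_forall fun p => ?_)
      simp only [Function.uncurry]; ring
    · exact (hmeas.mul (((continuous_chi x).comp continuous_neg).measurable.comp measurable_snd)).aestronglyMeasurable
    · exact .of_forall fun p => by rw [norm_mul, norm_chi, norm_chi]; simp
  rw [integral_integral_swap hint]
  congr 1; funext t
  rw [intervalIntegral.integral_of_le hab, ← integral_const_mul, ← integral_const_mul, ← integral_mul_const]
  refine setIntegral_congr_fun measurableSet_Ioc fun y hy => ?_
  rw [chi_mul hd.ne' (ha.trans hy.1).ne']

theorem continuousOn_comp_log (h : IsBump K k c) (T x : ℝ) {d : ℝ} (hd : 0 < d) (ha : 0 < a) :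
    ContinuousOn (fun y => K (T * (log (d * y) - log x))) (Set.Icc a b) := by
  refine h.cont.comp_continuousOn (continuousOn_const.mul (ContinuousOn.sub ?_ continuousOn_const))
  exact (continuousOn_const.mul continuousOn_id).log fun y hy => (mul_pos hd (ha.trans_le hy.1)).ne'

theorem integral_lower (h : IsBump K k c) (hT : 1 ≤ T) {d : ℝ} (hd : 0 < d) (hX : 0 < X)
    (hY : 0 < Y) (h1 : X ≤ d * Y) (h2 : d * Y ≤ exp 3 * X) (hx1 : exp 4 * X ≤ x) (hx2 : x ≤ exp 6 * X) :
    c * X / (2 * T) * (1 / d) ≤ ∫ y in Y..(kap * Y), K (T * (log (d * y) - log x)) := by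
  have hx := lt_of_lt_of_le (by positivity) hx1
  set a := x / d with ha
  set b := x / d * (1 + 1 / (2 * T)) with hb
  have ha0 : 0 < a := by positivity
  have hT0 : 0 < T := by linarith
  have hb' : b = a + a * (1 / (2 * T)) := by rw [hb, ha]; ring
  have hba : a ≤ b := by simp_all
  have e3 : exp 3 * 1 ≤ exp 4 := by rw [mul_one]; exact exp_le_exp.2 (by norm_num)
  have hYa : Y ≤ a := by
    rw [ha, le_div_iff₀ hd]
    nlinarith
  have hbY : b ≤ kap * Y := by
    have h3 : a ≤ exp 6 * Y := by
      rw [ha, div_le_iff₀ hd]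
      calc x ≤ exp 6 * X := hx2
        _ ≤ exp 6 * (d * Y) := by gcongr
        _ = _ := by ring
    have h4 : 1 / (2 * T) ≤ 1 := by
      rw [div_le_one (by positivity)]; linarith
    have h5 : 2 ≤ exp 1 := by have := add_one_le_exp 1; linarith
    have h6 : kap = exp 6 * exp 1 := by rw [← exp_add, kap]; norm_num
    rw [hb', h6]
    nlinarith
  have hI : ∀ p q, Y ≤ p → p ≤ q → IntervalIntegrable (fun y => K (T * (log (d * y) - log x))) volume p q := by
    intro p q hp hpq
    refine ContinuousOn.intervalIntegrable ?_
    rw [Set.uIcc_of_le hpq]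
    exact h.continuousOn_comp_log T x hd (hY.trans_le hp)
  have hmain : ∫ y in a..b, c ≤ ∫ y in a..b, K (T * (log (d * y) - log x)) := by
    refine intervalIntegral.integral_mono_on hba (by simp) (hI a b hYa hba) fun y hy => h.lower _ ?_
    have hy0 := ha0.trans_le hy.1
    have hdy : x ≤ d * y := by
      have := hy.1; rw [ha, div_le_iff₀ hd] at this; linarith
    have h8 : d * y / x ≤ 1 + 1 / (2 * T) := by
      rw [div_le_iff₀ hx]
      have : d * y ≤ d * b := by gcongr; exact hy.2
      grind
    have h9 : log (d * y) - log x ≤ 1 / (2 * T) := by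
      rw [← log_div (by positivity) hx.ne']
      linarith [log_le_sub_one_of_pos (show 0 < d * y / x by positivity)]
    have h10 : 0 ≤ log (d * y) - log x := by linarith [log_le_log hx hdy]
    rw [abs_of_nonneg (by positivity)]
    calc T * (log (d * y) - log x) ≤ T * (1 / (2 * T)) := by gcongr
      _ = 1 / 2 := by field_simp
  have hmono : ∫ y in a..b, K (T * (log (d * y) - log x)) ≤ ∫ y in Y..(kap * Y), K (T * (log (d * y) - log x)) := by
    refine intervalIntegral.integral_mono_interval hYa hba hbY (.of_forall fun y => h.nonneg _) ?_
    grind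
  refine le_trans ?_ (hmain.trans hmono)
  rw [intervalIntegral.integral_const, hb', smul_eq_mul]
  have hXx : X ≤ x := by
    refine le_trans ?_ hx1
    nlinarith [add_one_le_exp 4]
  have := h.c_pos
  calc c * X / (2 * T) * (1 / d) ≤ c * x / (2 * T) * (1 / d) := by gcongr
    _ = _ := by rw [ha]; field_simp; ring

theorem eq_zero_of_far (h : IsBump K k c) {n : ℝ} (hT : 1 ≤ T) (hx : 0 < x) (hn : 0 < n)
    (hH : 2 * x / T ≤ H) (hfar : H < |n - x|) : K (T * (log n - log x)) = 0 := by
  refine h.zero _ ?_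
  by_contra hcon
  push Not at hcon
  have hT0 : 0 < T := by linarith
  rw [abs_mul, abs_of_pos hT0] at hcon
  have h1 : |log n - log x| ≤ 1 / T := by rw [le_div_iff₀ hT0]; linarith
  have h3 := abs_exp_sub_one_le (h1.trans (by rw [div_le_one hT0]; exact hT))
  rw [exp_sub, exp_log hn, exp_log hx] at h3
  have h4 : |n - x| = x * |n / x - 1| := by
    rw [← abs_of_pos hx, ← abs_mul, abs_of_pos hx]; congr 1; field_simp
  have h5 : |n - x| ≤ 2 * x / T := by
    rw [h4]
    calc x * |n / x - 1| ≤ x * (2 * (1 / T)) := by gcongr; linarith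
      _ = _ := by ring
  linarith

end IsBump

namespace IsBump

variable {K : ℝ → ℝ} {k : ℝ → ℂ} {c : ℝ}

theorem fam_repr (h : IsBump K k c) (hT : 0 < T) (x : ℝ) {ι : Type*} (I : Finset ι) (d : ι → ℕ) (Y : ι → ℝ)
    (hd : ∀ i ∈ I, 1 ≤ d i) (hY : ∀ i ∈ I, 0 < Y i) :
    ((∑ i ∈ I, ((∑ m ∈ Ioc ⌊Y i⌋₊ ⌊kap * Y i⌋₊, K (T * (log (d i * m) - log x)))
      - ∫ y in (Y i)..(kap * Y i), K (T * (log (d i * y) - log x))) : ℝ) : ℂ)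
      = (T⁻¹ : ℝ) * ∫ t, k (t / T) * famPoly I d Y t * chi x (-t) := by
  have hint : ∀ i ∈ I, Integrable fun t => k (t / T) * (chi (d i) t * zstar (Y i) t) * chi x (-t) := by
    intro i hi
    have h1 := (h.integrable_comp_div hT).bdd_mul (c := 5 * kap * Y i)
      (f := fun t => (chi (d i) t * zstar (Y i) t) * chi x (-t)) ?_ ?_
    · grind
    · exact (((continuous_chi _).mul (continuous_zstar (hY i hi))).mul ((continuous_chi x).comp continuous_neg)).aestronglyMeasurable
    · refine .of_forall fun t => ?_
      rw [norm_mul, norm_mul, norm_chi, norm_chi, one_mul, mul_one]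
      exact norm_zstar_le (hY i hi) t
  have e1 : ∫ t, k (t / T) * famPoly I d Y t * chi x (-t) = ∑ i ∈ I, ∫ t, k (t / T) * (chi (d i) t * zstar (Y i) t) * chi x (-t) := by
    rw [← integral_finsetSum _ hint]
    congr 1; funext t
    unfold famPoly
    rw [mul_sum, sum_mul]
  rw [e1, Complex.ofReal_sum, mul_sum]
  refine sum_congr rfl fun i hi => ?_
  have hdi : (0:ℝ) < d i := by exact_mod_cast hd i hi
  have hY0 := hY i hi
  rw [Complex.ofReal_sub, h.integral_repr hT x hdi hY0 (by nlinarith [one_lt_kap]), Complex.ofReal_sum]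
  simp_rw [h.repr_log hT]
  rw [← mul_sum, ← integral_finsetSum _ (fun m _ => h.integrable_mul_chi hT _ _), ← mul_sub,
    ← integral_sub]
  · congr 1
    refine integral_congr_ae (.of_forall fun t => ?_)
    simp only [zstar, zsum, zint]
    have e : ∀ m ∈ Ioc ⌊Y i⌋₊ ⌊kap * Y i⌋₊, k (t / T) * chi (d i * m) t * chi x (-t) = k (t / T) * (chi (d i) t * chi m t) * chi x (-t) := by
      intro m hm
      rw [chi_mul hdi.ne' (by have := (mem_Ioc.1 hm).1; exact_mod_cast (by omega : m ≠ 0))]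
    rw [sum_congr rfl e, ← sum_mul, ← mul_sum, ← mul_sum]
    ring
  · exact integrable_finsetSum _ (fun m _ => h.integrable_mul_chi hT _ _)
  · have h1 := (h.integrable_comp_div hT).bdd_mul (c := 4 * kap * Y i)
      (f := fun t => (chi (d i) t * zint (Y i) t) * chi x (-t)) ?_ ?_
    · exact h1.congr (.of_forall fun t => by simp only [zint]; ring)
    · exact (((continuous_chi _).mul (continuous_zint hY0)).mul ((continuous_chi x).comp continuous_neg)).aestronglyMeasurable
    · refine .of_forall fun t => ?_
      rw [norm_mul, norm_mul, norm_chi, norm_chi, one_mul, mul_one]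
      exact norm_zint_le' hY0 t

end IsBump

/-- If the family avoids a neighbourhood of many `x`, then `famPoly` has large mean square. -/
theorem transfer : ∃ (k : ℝ → ℂ) (c C : ℝ), Continuous k ∧ 0 < c ∧ 0 < C ∧
    (∀ A : ℕ, ∃ D : ℝ, 0 < D ∧ ∀ τ, ‖k τ‖ * (1 + |τ|) ^ A ≤ D) ∧
    ∀ (X T : ℝ), 1 ≤ X → 1 ≤ T → ∀ {ι : Type} (I : Finset ι) (d : ι → ℕ) (Y : ι → ℝ) (L : ℝ),
      (∀ i ∈ I, 1 ≤ d i) → (∀ i ∈ I, 0 < Y i) → (∀ i ∈ I, X ≤ d i * Y i ∧ d i * Y i ≤ exp 3 * X) →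
      0 < L → L ≤ ∑ i ∈ I, 1 / (d i : ℝ) →
      ∀ U : Set ℝ, MeasurableSet U →
      ∫ t in Uᶜ, ‖famPoly I d Y t‖ * ‖k (t / T)‖ ≤ c * X * L →
      ∀ H : ℝ, 2 * exp 6 * X / T ≤ H →
      volume {x : ℝ | exp 4 * X ≤ x ∧ x ≤ exp 6 * X ∧ ∀ i ∈ I, ∀ m : ℕ, Y i < m → (m : ℝ) ≤ kap * Y i →
        H < |(d i * m : ℝ) - x|} ≤ ENNReal.ofReal (C * T / (X * L ^ 2) *
          ∫ t in U, ‖famPoly I d Y t‖ ^ 2 * cauchyWeight T t) := by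
  obtain ⟨K, k, c, h⟩ := exists_isBump
  obtain ⟨D, hD, hkD⟩ := h.exists_norm_sq_le
  have hc := h.c_pos
  refine ⟨k, c / 4, 2 * π * D * (c / 4)⁻¹ ^ 2 * exp 7, h.cont_k, by positivity, by positivity, h.decay, ?_⟩
  intro X T hX hT ι I d Y L hd hY hdY hL0 hL U hU hsmall H hH
  have hT0 : 0 < T := by linarith
  have hX0 : 0 < X := by linarith
  set F := famPoly I d Y
  set g := fun t => k (t / T) * F t with hg
  set B := ∑ i ∈ I, 5 * kap * Y i
  have hFc := continuous_famPoly I d Y hY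
  have hFB := norm_famPoly_le I d Y hY
  have hgc := (h.cont_k.comp (continuous_id.div_const T)).mul hFc
  have hgi : Integrable g := by
    have h1 := (h.integrable_comp_div hT0).bdd_mul (c := B) (f := F) hFc.aestronglyMeasurable (.of_forall hFB)
    exact h1.congr (.of_forall fun t => by simp only [hg]; ring)
  have hFw : Integrable fun t => ‖F t‖ ^ 2 * cauchyWeight T t := by
    refine (integrable_cauchyWeight hT0).bdd_mul (c := B ^ 2) (hFc.norm.pow 2).aestronglyMeasurable (.of_forall fun t => ?_)
    rw [norm_pow, norm_norm]
    exact pow_le_pow_left₀ (norm_nonneg _) (hFB t) 2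
  have hgF : ∀ t, ‖g t‖ ^ 2 ≤ D * T * (‖F t‖ ^ 2 * cauchyWeight T t) := by
    intro t
    simp only [hg]
    rw [norm_mul, mul_pow]
    calc _ ≤ (D * T * cauchyWeight T t) * ‖F t‖ ^ 2 := by gcongr; exact hkD T hT0 t
      _ = _ := by ring
  have hg2 : Integrable fun t => ‖g t‖ ^ 2 :=
    (hFw.const_mul (D * T)).mono' (hgc.norm.pow 2).aestronglyMeasurable
      (.of_forall fun t => by
        rw [norm_of_nonneg (by positivity)]; exact hgF t)
  set g' := U.indicator g with hg'
  have hg'i := hgi.indicator hU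
  have hg'2e : (fun t => ‖g' t‖ ^ 2) = U.indicator fun t => ‖g t‖ ^ 2 := by
    funext t
    simp only [hg', Set.indicator]
    split_ifs <;> simp
  have hg'2 : Integrable fun t => ‖g' t‖ ^ 2 := by rw [hg'2e]; exact hg2.indicator hU
  set V := fun x => ∫ t, g' t * chi x (-t) with hV
  set v := log X + 5
  set δ := (c / 4) ^ 2 * X * L ^ 2 * exp (-7) with hδ
  have hδ0 : 0 < δ := by positivity
  -- on the bad set the integrand is large
  have hbad : {x : ℝ | exp 4 * X ≤ x ∧ x ≤ exp 6 * X ∧ ∀ i ∈ I, ∀ m : ℕ, Y i < m → m ≤ kap * Y i →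
        H < |(d i * m) - x|} ⊆ {x | ENNReal.ofReal δ ≤ (Set.Ioi 0).indicator (fun x => ENNReal.ofReal (‖V x‖ ^ 2 * (x⁻¹ * exp (-|log x - v|)))) x} := by
    rintro x ⟨hx1, hx2, hx3⟩
    have hx0 := lt_of_lt_of_le (by positivity) hx1
    rw [Set.mem_ofPred_eq, Set.indicator_of_mem (show x ∈ Set.Ioi 0 from hx0)]
    refine ENNReal.ofReal_le_ofReal ?_
    have hzero : ∀ i ∈ I, ∑ m ∈ Ioc ⌊Y i⌋₊ ⌊kap * Y i⌋₊, K (T * (log (d i * m) - log x)) = 0 := by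
      intro i hi
      refine sum_eq_zero fun m hm => ?_
      have hm' := (natCast_mem_Ioc_floor (hY i hi).le).1 hm
      have hdi : 0 < d i := by exact_mod_cast hd i hi
      have hm0 := (hY i hi).trans hm'.1
      refine h.eq_zero_of_far hT hx0 (by positivity) (le_trans ?_ hH) (hx3 i hi m hm'.1 hm'.2)
      rw [mul_assoc 2]
      gcongr
    have hlow : c * X / (2 * T) * L ≤ ∑ i ∈ I, ∫ y in (Y i)..(kap * Y i), K (T * (log (d i * y) - log x)) := by
      refine le_trans (mul_le_mul_of_nonneg_left hL (by positivity)) ?_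
      rw [mul_sum]
      exact sum_le_sum fun i hi => (h.integral_lower hT (by exact_mod_cast hd i hi) hX0 (hY i hi) (hdY i hi).1 (hdY i hi).2 hx1 hx2)
    have hnorm := congrArg norm (h.fam_repr hT0 x I d Y hd hY)
    rw [sum_congr rfl (fun i hi => by rw [hzero i hi, zero_sub]), Complex.norm_real, sum_neg_distrib, norm_neg,
      norm_mul, Complex.norm_real, norm_of_nonneg (by positivity : 0 ≤ T⁻¹)] at hnorm
    have h1 : c * X / 2 * L ≤ ‖∫ t, g t * chi x (-t)‖ := by
      have h2 := hlow.trans (le_abs_self _)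
      rw [← norm_eq_abs, hnorm] at h2
      have h3 : c * X / (2 * T) * L = T⁻¹ * (c * X / 2 * L) := by field_simp
      rw [h3] at h2
      exact le_of_mul_le_mul_left h2 (by positivity)
    have hmc : AEStronglyMeasurable (fun t => chi x (-t)) volume := ((continuous_chi x).comp continuous_neg).aestronglyMeasurable
    have hgx : Integrable fun t => g t * chi x (-t) := by
      refine (hgi.bdd_mul hmc (.of_forall (fun t => (norm_chi _ _).le))).congr (.of_forall fun t => by simp only; ring)
    have h2 : ∫ t, g t * chi x (-t) = V x + ∫ t in Uᶜ, g t * chi x (-t) := by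
      rw [← integral_add_compl hU hgx, hV, ← integral_indicator hU]
      congr 2; funext t
      simp only [hg', Set.indicator]
      split_ifs <;> simp
    have h3 : ‖∫ t in Uᶜ, g t * chi x (-t)‖ ≤ c / 4 * X * L := by
      refine (norm_integral_le_integral_norm _).trans (le_trans (le_of_eq ?_) hsmall)
      congr 1; funext t
      simp only [hg]
      rw [norm_mul, norm_mul, norm_chi, mul_one, mul_comm]
    have h4 : c / 4 * X * L ≤ ‖V x‖ := by
      rw [h2] at h1
      linarith [norm_add_le (V x) (∫ t in Uᶜ, g t * chi x (-t))]
    have h5 : exp (-7) * X⁻¹ ≤ x⁻¹ * exp (-|log x - v|) := by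
      have l1 : log x ≤ 6 + log X := by
        rw [← log_exp 6, ← log_mul (exp_pos 6).ne' hX0.ne']
        exact log_le_log hx0 hx2
      have l2 : 4 + log X ≤ log x := by
        rw [← log_exp 4, ← log_mul (exp_pos 4).ne' hX0.ne']
        exact log_le_log (by positivity) hx1
      have l3 : |log x - v| ≤ 1 := by grind
      have l4 : exp (-6) * X⁻¹ ≤ x⁻¹ := by
        rw [exp_neg, ← mul_inv]
        exact inv_anti₀ hx0 hx2
      calc exp (-7) * X⁻¹ = exp (-6) * X⁻¹ * exp (-1) := by
            rw [mul_right_comm, ← exp_add]; norm_num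
        _ ≤ _ := by gcongr
    calc δ = (c / 4 * X * L) ^ 2 * (exp (-7) * X⁻¹) := by rw [hδ]; field_simp
      _ ≤ _ := by gcongr
  have hVc : Measurable V := by
    have hcont : StronglyMeasurable (Function.uncurry fun (x t) => g' t * chi x (-t)) := by
      refine Measurable.stronglyMeasurable ?_
      refine ((hgc.measurable.indicator hU).comp measurable_snd).mul ?_
      unfold chi
      fun_prop
    exact hcont.integral_prod_right.measurable
  have hmark := mul_meas_ge_le_lintegral (μ := volume) (f := (Set.Ioi 0).indicator (fun x => ENNReal.ofReal (‖V x‖ ^ 2 * (x⁻¹ * exp (-|log x - v|))))) (by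
    refine Measurable.indicator ?_ measurableSet_Ioi
    have := measurable_log
    fun_prop) (ENNReal.ofReal δ)
  rw [lintegral_indicator measurableSet_Ioi] at hmark
  have hfin := (mul_le_mul_right (measure_mono (μ := volume) hbad) (ENNReal.ofReal δ)).trans (hmark.trans (lintegral_norm_sq_le g' hg'i hg'2 v))
  have hI : ∫ t, ‖g' t‖ ^ 2 ≤ D * T * ∫ t in U, ‖F t‖ ^ 2 * cauchyWeight T t := by
    rw [hg'2e, integral_indicator hU, ← integral_const_mul]
    exact integral_mono hg2.integrableOn (hFw.integrableOn.const_mul _) hgF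
  rw [mul_comm, ← ENNReal.le_div_iff_mul_le (Or.inl (by simpa using hδ0)) (Or.inl ENNReal.ofReal_ne_top)] at hfin
  refine hfin.trans ?_
  rw [← ENNReal.ofReal_div_of_pos hδ0]
  refine ENNReal.ofReal_le_ofReal ?_
  rw [div_le_iff₀ hδ0]
  calc 2 * π * ∫ t, ‖g' t‖ ^ 2 ≤ 2 * π * (D * T * ∫ t in U, ‖F t‖ ^ 2 * cauchyWeight T t) := by
        gcongr
    _ = _ := by
        have : exp 7 * exp (-7) = 1 := by rw [← exp_add]; simp
        grind

/-- `e^{iφ}`. -/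
noncomputable def ee (x : ℝ) : ℂ := Complex.exp ((x : ℂ) * I)

theorem norm_ee (x : ℝ) : ‖ee x‖ = 1 := Complex.norm_exp_ofReal_mul_I x

theorem ee_add (x y : ℝ) : ee (x + y) = ee x * ee y := by
  unfold ee; rw [← Complex.exp_add]; congr 1; push_cast; ring

theorem star_ee (x : ℝ) : conj (ee x) = ee (-x) := by
  unfold ee; rw [← Complex.exp_conj]; congr 1; simp

theorem ee_eq (x : ℝ) : ee x = (cos x : ℂ) + (sin x : ℂ) * I := by
  unfold ee; rw [Complex.exp_mul_I]; push_cast; rfl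

/-- half cotangent of the half angle -/
noncomputable def hcot (δ : ℝ) : ℝ := cos (δ / 2) / (2 * sin (δ / 2))

theorem one_sub_ee_mul (h0 : 0 < δ) (h1 : δ ≤ π) :
    (1 - ee δ) * (1 / 2 + (hcot δ : ℂ) * I) = 1 := by
  have hs' : (sin (δ / 2) : ℂ) ≠ 0 := by exact_mod_cast (sin_pos_of_pos_of_lt_pi (by linarith) (by linarith [pi_pos])).ne'
  have hc : cos δ = 1 - 2 * sin (δ / 2) ^ 2 := by
    have := cos_two_mul (δ / 2); have h2 := sin_sq_add_cos_sq (δ / 2)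
    grind
  have hsn : sin δ = 2 * sin (δ / 2) * cos (δ / 2) := by
    have := sin_two_mul (δ / 2)
    grind
  have h2 : (sin (δ / 2) : ℂ) ^ 2 + (cos (δ / 2) : ℂ) ^ 2 = 1 := by
    simp
  rw [ee_eq, hc, hsn, hcot]
  push_cast
  push_cast at hs' h2
  ring_nf
  rw [Complex.I_sq]
  grind

theorem hcot_antitone (ha : 0 < a) (hab : a ≤ b) (hb : b ≤ π) : hcot b ≤ hcot a := by
  unfold hcot
  have hs : 0 < sin (a / 2) := sin_pos_of_pos_of_lt_pi (by linarith) (by linarith [pi_pos])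
  have h1 : sin (a / 2) ≤ sin (b / 2) := sin_le_sin_of_le_of_le_pi_div_two (by linarith) (by linarith) (by linarith)
  have h2 : cos (b / 2) ≤ cos (a / 2) := cos_le_cos_of_nonneg_of_le_pi (by linarith) (by linarith) (by linarith)
  gcongr
  exact (cos_nonneg_of_mem_Icc ⟨by linarith, by linarith⟩).trans h2

theorem hcot_bound {l : ℝ} (hl : 0 < l) (hla : l ≤ a) (ha : a ≤ π) : 0 ≤ hcot a ∧ hcot a ≤ π / (2 * l) := by
  unfold hcot
  have hs' : l / π ≤ sin (a / 2) := by
    refine le_trans ?_ (mul_le_sin (by linarith) (by linarith))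
    rw [div_mul_div_comm, mul_comm π, mul_div_mul_left _ _ two_ne_zero]
    gcongr
  have h3 : 0 ≤ cos (a / 2) := cos_nonneg_of_mem_Icc ⟨by linarith, by linarith⟩
  have h4 : 0 < l / π := by positivity
  constructor
  · have : 0 < sin (a / 2) := by linarith
    positivity
  · calc cos (a / 2) / (2 * sin (a / 2)) ≤ 1 / (2 * (l / π)) := by
          gcongr; exact cos_le_one _
      _ = _ := by field_simp

/-- Discrete Kuzmin–Landau inequality. -/
theorem kuzmin_landau (φ : ℕ → ℝ) (N : ℕ) (l : ℝ) (hl : 0 < l)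
    (h1 : ∀ n < N, l ≤ φ (n + 1) - φ n) (h2 : ∀ n < N, φ (n + 1) - φ n ≤ π)
    (h3 : ∀ n, n + 1 < N → φ (n + 2) - φ (n + 1) ≤ φ (n + 1) - φ n) :
    ‖∑ n ∈ range N, ee (φ n)‖ ≤ (2 * π) / l := by
  set w : ℕ → ℂ := fun n => 1 / 2 + (hcot (φ (n + 1) - φ n) : ℂ) * I with hw
  have hz : ∀ n < N, ee (φ n) = (ee (φ n) - ee (φ (n + 1))) * w n := by
    intro n hn
    have e : φ (n + 1) = φ n + (φ (n + 1) - φ n) := by ring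
    have := one_sub_ee_mul (hl.trans_le (h1 n hn)) (h2 n hn)
    have e' : ee (φ (n + 1)) = ee (φ n) * ee (φ (n + 1) - φ n) := by rw [← ee_add, ← e]
    grind
  have hlp : ∀ n < N, l ≤ π := by grind
  -- partial summation
  have key : ∀ M, M + 1 ≤ N → ‖(∑ n ∈ range (M + 1), ee (φ n)) + ee (φ (M + 1)) * w M‖
      ≤ ‖w 0‖ + (hcot (φ (M + 1) - φ M) - hcot (φ 1 - φ 0)) := by
    intro M
    induction M with
    | zero =>
      intro h
      rw [sum_range_one, hz 0 (by omega)]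
      simp only [zero_add, sub_self, add_zero]
      have : (ee (φ 0) - ee (φ 1)) * w 0 + ee (φ 1) * w 0 = ee (φ 0) * w 0 := by ring
      rw [this, norm_mul, norm_ee, one_mul]
    | succ M ih =>
      intro h
      have ih' := ih (by omega)
      rw [sum_range_succ]
      have e1 : ∑ n ∈ range (M + 1), ee (φ n) + ee (φ (M + 1)) + ee (φ (M + 1 + 1)) * w (M + 1)
        = (∑ n ∈ range (M + 1), ee (φ n) + ee (φ (M + 1)) * w M) + ee (φ (M + 1)) * (w (M + 1) - w M) := by
        grind
      rw [e1]
      refine (norm_add_le _ _).trans ?_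
      have e2 : w (M + 1) - w M = ((hcot (φ (M + 1 + 1) - φ (M + 1)) - hcot (φ (M + 1) - φ M) : ℝ) : ℂ) * I := by
        simp only [hw]; push_cast; ring
      have e3 := hcot_antitone (hl.trans_le (h1 (M + 1) (by omega))) (h3 M (by omega)) (h2 M (by omega))
      rw [norm_mul, norm_ee, one_mul, e2, norm_mul, Complex.norm_I, mul_one, Complex.norm_real, norm_of_nonneg (by linarith)]
      linarith
  have hwb : ∀ n < N, ‖w n‖ ≤ 1 / 2 + hcot (φ (n + 1) - φ n) := by
    intro n hn
    refine (norm_add_le _ _).trans ?_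
    rw [norm_mul, Complex.norm_I, mul_one, Complex.norm_real, norm_of_nonneg (hcot_bound hl (h1 n hn) (h2 n hn)).1]
    simp
  rcases Nat.eq_zero_or_pos N with h0 | h0
  · subst h0; simp only [range_zero, sum_empty, norm_zero]; have := pi_pos; positivity
  obtain ⟨M, rfl⟩ : ∃ M, N = M + 1 := ⟨N - 1, by omega⟩
  have k1 := key M le_rfl
  have k2 := hwb 0 (by omega)
  have k3 := hwb M (by omega)
  have k4 := (hcot_bound hl (h1 M (by omega)) (h2 M (by omega))).2
  have k6 : 1 ≤ π / l := by rw [one_le_div hl]; exact hlp 0 (by omega)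
  have k7 : ‖∑ n ∈ range (M + 1), ee (φ n)‖ ≤ ‖(∑ n ∈ range (M + 1), ee (φ n)) + ee (φ (M + 1)) * w M‖ + ‖w M‖ := by
    have := norm_sub_le ((∑ n ∈ range (M + 1), ee (φ n)) + ee (φ (M + 1)) * w M) (ee (φ (M + 1)) * w M)
    rwa [add_sub_cancel_right, norm_mul, norm_ee, one_mul] at this
  have e4 : π / (2 * l) = π / l / 2 := by rw [div_div, mul_comm]
  grind

/-- van der Corput's differencing inequality. -/
theorem vanDerCorput (z : ℕ → ℂ) (M Q : ℕ) (hQ : 0 < Q) (B : ℕ → ℝ)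
    (hB : ∀ q < Q, ‖∑ n ∈ range (M - q), z n * conj (z (n + q))‖ ≤ B q) :
    ‖∑ n ∈ range M, z n‖ ^ 2 ≤ (M + Q) / Q * (2 * ∑ q ∈ range Q, B q) := by
  set f : ℕ → ℂ := fun k => if Q ≤ k ∧ k < Q + M then z (k - Q) else 0 with hf
  have hB0 := fun q hq => (norm_nonneg _).trans (hB q (mem_range.1 hq))
  have hshift : ∀ j ≤ Q, ∑ m ∈ range (M + Q), f (m + j) = ∑ n ∈ range M, z n := by
    intro j hj
    have e1 : ∑ m ∈ range (M + Q), f (m + j) = ∑ k ∈ Ico j (M + Q + j), f k := by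
      rw [range_eq_Ico, sum_Ico_add', zero_add]
    have e2 : ∑ k ∈ Ico Q (M + Q), f k = ∑ k ∈ Ico j (M + Q + j), f k := by
      refine sum_subset (fun k hk => ?_) (fun k _ hk => ?_)
      · rw [mem_Ico] at hk ⊢; omega
      grind
    have e3 := sum_Ico_add' f 0 M Q
    rw [zero_add] at e3
    rw [e1, ← e2, ← e3, ← range_eq_Ico]
    refine sum_congr rfl fun n hn => ?_
    grind
  have hcorr : ∀ j q, j + q < Q → ‖∑ m ∈ range (M + Q), f (m + j) * conj (f (m + (j + q)))‖ ≤ B q := by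
    intro j q hj
    refine le_trans (le_of_eq ?_) (hB q (by omega))
    congr 1
    have e1 : ∑ m ∈ range (M + Q), f (m + j) * conj (f (m + (j + q))) = ∑ k ∈ Ico j (M + Q + j), f k * conj (f (k + q)) := by
      have e3 := sum_Ico_add' (fun k => f k * conj (f (k + q))) 0 (M + Q) j
      rw [zero_add] at e3
      rw [range_eq_Ico, ← e3]
      simp only [add_assoc]
    have e2 : ∑ k ∈ Ico Q (M - q + Q), f k * conj (f (k + q)) = ∑ k ∈ Ico j (M + Q + j), f k * conj (f (k + q)) := by
      refine sum_subset (fun k hk => ?_) (fun k _ hk => ?_)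
      · rw [mem_Ico] at hk ⊢; omega
      grind
    have e3 := sum_Ico_add' (fun k => f k * conj (f (k + q))) 0 (M - q) Q
    rw [zero_add] at e3
    rw [e1, ← e2, ← e3, ← range_eq_Ico]
    refine sum_congr rfl fun n hn => ?_
    have := mem_range.1 hn
    simp only [hf]; rw [if_pos (by omega), if_pos (by omega)]
    congr 2
    · omega
    · congr 1; omega
  have hcorr' : ∀ j ∈ range Q, ∀ j' ∈ range Q, ‖∑ m ∈ range (M + Q), f (m + j) * conj (f (m + j'))‖ ≤ B (if j ≤ j' then j' - j else j - j') := by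
    intro j hj j' hj'
    rw [mem_range] at hj hj'
    split_ifs with h
    · have := hcorr j (j' - j) (by omega)
      rwa [Nat.add_sub_cancel' h] at this
    · have := hcorr j' (j - j') (by omega)
      rw [Nat.add_sub_cancel' (by omega)] at this
      refine le_trans (le_of_eq ?_) this
      rw [← RCLike.norm_conj, map_sum]
      congr 1
      refine sum_congr rfl fun m _ => ?_
      rw [map_mul, Complex.conj_conj, mul_comm]
  set S := ∑ n ∈ range M, z n
  have h1 : Q * S = ∑ m ∈ range (M + Q), ∑ j ∈ range Q, f (m + j) := by
    rw [sum_comm, sum_congr rfl (fun j hj => hshift j (mem_range.1 hj).le)]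
    simp
  have h2 : Q ^ 2 * ‖S‖ ^ 2 ≤ (M + Q) * ∑ m ∈ range (M + Q), ‖∑ j ∈ range Q, f (m + j)‖ ^ 2 := by
    have : Q * ‖S‖ = ‖∑ m ∈ range (M + Q), ∑ j ∈ range Q, f (m + j)‖ := by
      rw [← h1, norm_mul]; simp
    rw [← mul_pow, this]
    calc _ ≤ (∑ m ∈ range (M + Q), ‖∑ j ∈ range Q, f (m + j)‖) ^ 2 := by
          gcongr; exact norm_sum_le _ _
      _ ≤ (#(range (M + Q)) : ℝ) * ∑ m ∈ range (M + Q), ‖∑ j ∈ range Q, f (m + j)‖ ^ 2 := sq_sum_le_card_mul_sum_sq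
      _ = _ := by rw [card_range]; push_cast; rfl
  have h3 : ∑ m ∈ range (M + Q), ‖∑ j ∈ range Q, f (m + j)‖ ^ 2 ≤ ∑ j ∈ range Q, ∑ j' ∈ range Q, B (if j ≤ j' then j' - j else j - j') := by
    have e : ((∑ m ∈ range (M + Q), ‖∑ j ∈ range Q, f (m + j)‖ ^ 2 : ℝ) : ℂ) = ∑ j ∈ range Q, ∑ j' ∈ range Q, ∑ m ∈ range (M + Q), f (m + j) * conj (f (m + j')) := by
      push_cast
      simp_rw [← Complex.mul_conj', map_sum, sum_mul_sum]
      rw [sum_comm]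
      refine sum_congr rfl fun j _ => ?_
      rw [sum_comm]
    refine (le_abs_self _).trans ?_
    rw [← norm_eq_abs, ← Complex.norm_real, e]
    refine (norm_sum_le _ _).trans (sum_le_sum fun j hj => (norm_sum_le _ _).trans (sum_le_sum fun j' hj' => hcorr' j hj j' hj'))
  have h4 : ∀ j ∈ range Q, ∑ j' ∈ range Q, B (if j ≤ j' then j' - j else j - j') ≤ 2 * ∑ q ∈ range Q, B q := by
    intro j hj
    have hj := mem_range.1 hj
    rw [two_mul, ← sum_filter_add_sum_filter_not (range Q) (fun j' => j ≤ j')]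
    refine add_le_add ?_ ?_
    · rw [sum_congr rfl (g := fun j' => B (j' - j)) (fun j' hj' => by rw [if_pos (mem_filter.1 hj').2]),
        ← sum_image (f := B) (g := fun j' => j' - j)]
      · refine sum_le_sum_of_subset_of_nonneg (fun q hq => ?_) (fun q hq _ => hB0 q hq)
        obtain ⟨a, ha, rfl⟩ := mem_image.1 hq
        have := (mem_filter.1 ha).1; rw [mem_range] at this ⊢; omega
      · intro a ha b hb hab
        have := (mem_filter.1 ha).2; have := (mem_filter.1 hb).2; simp only at hab; omega
    · rw [sum_congr rfl (g := fun j' => B (j - j')) (fun j' hj' => by rw [if_neg (mem_filter.1 hj').2]),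
        ← sum_image (f := B) (g := fun j' => j - j')]
      · refine sum_le_sum_of_subset_of_nonneg (fun q hq => ?_) (fun q hq _ => hB0 q hq)
        obtain ⟨a, ha, rfl⟩ := mem_image.1 hq
        rw [mem_range]; omega
      · intro a ha b hb hab
        have := (mem_filter.1 ha).2; have := (mem_filter.1 hb).2; simp only at hab; omega
  have h5 := sum_le_sum h4
  rw [sum_const, card_range, nsmul_eq_mul] at h5
  have hQ' : (0:ℝ) < Q := by exact_mod_cast hQ
  have h6 : Q ^ 2 * ‖S‖ ^ 2 ≤ (M + Q) * (Q * (2 * ∑ q ∈ range Q, B q)) :=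
    by nlinarith
  rw [div_mul_eq_mul_div, le_div_iff₀ hQ']
  nlinarith

theorem norm_chi_sub_chi_le (x y t : ℝ) : ‖chi x t - chi y t‖ ≤ |t| * |log x - log y| := by
  have e : chi x t - chi y t = chi y t * (Complex.exp (I * ((-(t * (log x - log y)) : ℝ) : ℂ)) - 1) := by
    unfold chi
    rw [mul_sub, ← Complex.exp_add, mul_one]
    congr 2
    push_cast; ring
  rw [e, norm_mul, norm_chi, one_mul]
  refine (norm_exp_I_mul_ofReal_sub_one_le).trans ?_
  rw [norm_eq_abs, abs_neg, abs_mul]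

theorem intervalIntegrable_chi (ha : 0 < a) (hb : 0 < b) (t : ℝ) :
    IntervalIntegrable (fun y => chi y t) volume a b := by
  refine ContinuousOn.intervalIntegrable ?_
  unfold chi
  refine Continuous.comp_continuousOn Complex.continuous_exp ?_
  refine ContinuousOn.mul ?_ continuousOn_const
  refine Complex.continuous_ofReal.comp_continuousOn ?_
  refine (continuousOn_const.mul ?_).neg
  exact continuousOn_log.mono fun y hy => by
    exact ((lt_min ha hb).trans_le hy.1).ne'

/-- Comparison of the sum and the integral by total variation. -/
theorem norm_zstar_le_one_add (hY : 0 < Y) (t : ℝ) : ‖zstar Y t‖ ≤ 5 * kap * (1 + |t|) := by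
  have hk := one_lt_kap
  rcases lt_or_ge Y 1 with h | h
  · refine (norm_zstar_le hY t).trans ?_
    gcongr; linarith [abs_nonneg t]
  set a := ⌊Y⌋₊
  set b := ⌊kap * Y⌋₊
  have ha1 := Nat.one_le_floor_iff _ |>.2 h
  have hab : a ≤ b := Nat.floor_mono (by nlinarith)
  have ha1' : (1:ℝ) ≤ a := by exact_mod_cast ha1
  have hb1' : (1:ℝ) ≤ b := by exact_mod_cast ha1.trans hab
  have hYa := Nat.lt_floor_add_one Y
  have hYa' := Nat.floor_le hY.le
  have hYb : kap * Y < b + 1 := Nat.lt_floor_add_one _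
  have hYb' : b ≤ kap * Y := Nat.floor_le (by positivity)
  have hsum : zsum Y t = ∑ k ∈ Ico a b, chi (k + 1) t := by
    have := sum_Ico_add' (fun k : ℕ => chi k t) a b 1
    push_cast at this
    rw [this, zsum]
    refine sum_congr (by grind) fun _ _ => rfl
  have hint : ∫ y in a..b, chi y t = ∑ k ∈ Ico a b, ∫ y in k..k+1, chi y t := by
    have := intervalIntegral.sum_integral_adjacent_intervals_Ico (f := fun y => chi y t) (μ := volume) (a := fun k => k) hab
      (fun k hk => intervalIntegrable_chi (by have := hk.1; exact_mod_cast (by omega : 0 < k)) (by positivity) t)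
    push_cast at this
    rw [← this]
  have hz : zint Y t = (∫ y in a..b, chi y t) - (∫ y in a..Y, chi y t) + (∫ y in b..(kap * Y), chi y t) := by
    have i1 := intervalIntegral.integral_add_adjacent_intervals (intervalIntegrable_chi (a := a) (b := Y) (by linarith) hY t) (intervalIntegrable_chi (b := kap * Y) hY (by positivity) t)
    have i2 := intervalIntegral.integral_add_adjacent_intervals
      (intervalIntegrable_chi (a := a) (b := b) (by linarith) (by linarith) t)
      (intervalIntegrable_chi (b := kap * Y) (by linarith) (by positivity) t)
    rw [zint]
    linear_combination i1 - i2
  have hb1 : ‖∫ y in a..Y, chi y t‖ ≤ 1 := by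
    refine (intervalIntegral.norm_integral_le_of_norm_le_const (C := 1) fun y _ => (norm_chi y t).le).trans ?_
    grind
  have hb2 : ‖∫ y in b..(kap * Y), chi y t‖ ≤ 1 := by
    refine (intervalIntegral.norm_integral_le_of_norm_le_const (C := 1) fun y _ => (norm_chi y t).le).trans ?_
    grind
  have hterm : ∀ k ∈ Ico a b, ‖chi (k + 1) t - ∫ y in k..k+1, chi y t‖ ≤ |t| * (2 / Y) := by
    intro k hk
    have hka : (a:ℝ) ≤ k := by exact_mod_cast (mem_Ico.1 hk).1
    have hk0 : (0:ℝ) < k := by linarith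
    have e : chi (k + 1) t - ∫ y in k..k+1, chi y t = ∫ y in k..k+1, (chi (k + 1) t - chi y t) := by
      rw [intervalIntegral.integral_sub (by simp) (intervalIntegrable_chi hk0 (by positivity) t)]
      simp
    rw [e]
    refine (intervalIntegral.norm_integral_le_of_norm_le_const (C := |t| * (2 / Y)) fun y hy => ?_).trans (by simp)
    rw [Set.uIoc_of_le (by linarith)] at hy
    refine (norm_chi_sub_chi_le _ _ _).trans ?_
    gcongr
    have hy0 := hk0.trans hy.1
    rw [abs_of_nonneg (by linarith [log_le_log hy0 hy.2]), ← log_div (by positivity) hy0.ne']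
    refine (log_le_sub_one_of_pos (by positivity)).trans ?_
    rw [div_sub_one hy0.ne', div_le_div_iff₀ hy0 hY]
    nlinarith [hy.1, hy.2]
  have hd : ‖zsum Y t - ∫ y in a..b, chi y t‖ ≤ 2 * kap * |t| := by
    rw [hsum, hint, ← sum_sub_distrib]
    refine (norm_sum_le _ _).trans ((sum_le_sum hterm).trans ?_)
    rw [sum_const, Nat.card_Ico, nsmul_eq_mul]
    have : ((b - a : ℕ) : ℝ) ≤ kap * Y := by
      refine le_trans ?_ hYb'; exact_mod_cast Nat.sub_le _ _
    calc _ ≤ kap * Y * (|t| * (2 / Y)) := by gcongr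
      _ = _ := by field_simp
  have e : zstar Y t = (zsum Y t - ∫ y in a..b, chi y t) + (∫ y in a..Y, chi y t) - (∫ y in b..(kap * Y), chi y t) := by
    rw [zstar, hz]; ring
  rw [e]
  refine (norm_sub_le _ _).trans ?_
  have := norm_add_le (zsum Y t - ∫ y in a..b, chi y t) (∫ y in a..Y, chi y t)
  nlinarith [abs_nonneg t]

/-- Iterated backward-signed difference `f n - f (n + 1)`. -/
def bdiff : ℕ → (ℕ → ℝ) → ℕ → ℝ
  | 0, f => f
  | k + 1, f => bdiff k (fun n => f n - f (n + 1))

theorem bdiff_sub (k : ℕ) (f g : ℕ → ℝ) (n : ℕ) :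
    bdiff k (fun n => f n - g n) n = bdiff k f n - bdiff k g n := by
  induction k generalizing f g n with
  | zero => rfl
  | succ k ih =>
    simp only [bdiff]
    rw [← ih]
    congr 1; ext m; ring

theorem bdiff_shift (k q : ℕ) (f : ℕ → ℝ) (n : ℕ) :
    bdiff k (fun n => f (n + q)) n = bdiff k f (n + q) := by
  induction k generalizing f n with
  | zero => rfl
  | succ k ih =>
    simp only [bdiff]
    grind

theorem bdiff_succ' (k : ℕ) (f : ℕ → ℝ) (n : ℕ) : bdiff (k + 1) f n = bdiff k f n - bdiff k f (n + 1) := by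
  simp only [bdiff]
  rw [bdiff_sub, bdiff_shift]

theorem bdiff_correlation (k q : ℕ) (f : ℕ → ℝ) (n : ℕ) :
    bdiff k (fun n => f n - f (n + q)) n = ∑ i ∈ range q, bdiff (k + 1) f (n + i) := by
  rw [bdiff_sub, bdiff_shift]
  simp_rw [bdiff_succ']
  rw [eq_comm]
  simpa [add_assoc] using (sum_range_sub' (fun i => bdiff k f (n + i)) q)

/-- The `k`-th difference of `φ` lies in `[l, h l]` and is antitone on `[0, M)`. -/
def DiffBound (k : ℕ) (φ : ℕ → ℝ) (M : ℕ) (l h : ℝ) : Prop :=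
  (∀ n < M, l ≤ bdiff k φ n) ∧ (∀ n < M, bdiff k φ n ≤ h * l) ∧
    ∀ n, n + 1 < M → bdiff k φ (n + 1) ≤ bdiff k φ n

theorem DiffBound.correlation {φ : ℕ → ℝ} {M : ℕ} {l h : ℝ} (H : DiffBound (k + 1) φ M l h) (q : ℕ) :
    DiffBound k (fun n => φ n - φ (n + q)) (M - q) (q * l) h := by
  obtain ⟨h1, h2, h3⟩ := H
  refine ⟨fun n hn => ?_, fun n hn => ?_, fun n hn => ?_⟩
  · rw [bdiff_correlation]
    calc q * l = ∑ i ∈ range q, l := by simp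
      _ ≤ _ := sum_le_sum fun i hi => h1 _ (by have := mem_range.1 hi; omega)
  · rw [bdiff_correlation]
    calc _ ≤ ∑ i ∈ range q, h * l := sum_le_sum fun i hi => h2 _ (by have := mem_range.1 hi; omega)
      _ = h * (q * l) := by simp; ring
  · rw [bdiff_correlation, bdiff_correlation]
    refine sum_le_sum fun i hi => ?_
    grind

theorem norm_sum_ee_le (φ : ℕ → ℝ) (M : ℕ) : ‖∑ n ∈ range M, ee (φ n)‖ ≤ M := by
  refine (norm_sum_le _ _).trans ?_
  simp [norm_ee]

theorem norm_sum_ee_neg (φ : ℕ → ℝ) (M : ℕ) : ‖∑ n ∈ range M, ee (-φ n)‖ = ‖∑ n ∈ range M, ee (φ n)‖ := by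
  rw [← RCLike.norm_conj, map_sum]
  congr 1
  refine sum_congr rfl fun n _ => ?_
  rw [star_ee, neg_neg]

theorem DiffBound.kuzmin_landau {φ : ℕ → ℝ} {M : ℕ} {l h : ℝ} (H : DiffBound 1 φ M l h) (hl : 0 < l)
    (hh : h * l ≤ π) : ‖∑ n ∈ range M, ee (φ n)‖ ≤ 2 * π / l := by
  obtain ⟨h1, h2, h3⟩ := H
  simp only [bdiff] at h1 h2 h3
  rw [← norm_sum_ee_neg]
  refine SmoothGaps.kuzmin_landau (fun n => -φ n) M l hl ?_ ?_ ?_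
  · intro n hn; linarith [h1 n hn]
  · intro n hn; linarith [h2 n hn]
  · intro n hn; linarith [h3 n hn]

/-- One differencing step. -/
theorem DiffBound.weyl_step {φ : ℕ → ℝ} {M : ℕ} {l h B : ℝ} (H : DiffBound (k + 1) φ M l h)
    (hMN : (M:ℝ) ≤ N) (hN : 1 ≤ N) (Q q₀ : ℕ) (hQ : 0 < Q) (hQN : (Q:ℝ) ≤ 2 * N) (hq₀ : 1 ≤ q₀) (hB0 : 0 ≤ B)
    (hB : ∀ q, q₀ ≤ q → q < Q → ∀ ψ : ℕ → ℝ, ∀ M' : ℕ, (M':ℝ) ≤ N → DiffBound k ψ M' (q * l) h →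
      ‖∑ n ∈ range M', ee (ψ n)‖ ≤ B) :
    ‖∑ n ∈ range M, ee (φ n)‖ ^ 2 ≤ 6 * N * (q₀ * N / Q + B) := by
  have key := vanDerCorput (fun n => ee (φ n)) M Q hQ (fun q => (if q < q₀ then N else 0) + B) (fun q hq => by
    have e : ∑ n ∈ range (M - q), ee (φ n) * conj (ee (φ (n + q))) = ∑ n ∈ range (M - q), ee ((fun n => φ n - φ (n + q)) n) := by
      refine sum_congr rfl fun n _ => ?_
      rw [star_ee, ← ee_add]; rfl
    have hM' : ((M - q : ℕ) : ℝ) ≤ N := le_trans (by exact_mod_cast Nat.sub_le _ _) hMN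
    rw [e]
    split_ifs with h
    · refine (norm_sum_ee_le _ _).trans ?_
      linarith
    · rw [zero_add]
      exact hB q (by omega) hq _ _ hM' (H.correlation q))
  refine key.trans ?_
  rw [sum_add_distrib, sum_const, card_range, nsmul_eq_mul, ← sum_filter, sum_const, nsmul_eq_mul]
  have hc : ((#((range Q).filter (fun q => q < q₀)) : ℕ) : ℝ) ≤ q₀ := by
    have : (range Q).filter (fun q => q < q₀) ⊆ range q₀ := by grind
    have := card_le_card this
    simp_all
  calc (M + Q) / Q * (2 * (#((range Q).filter (fun q => q < q₀)) * N + Q * B))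
      ≤ (N + 2 * N) / Q * (2 * (q₀ * N + Q * B)) := by gcongr
    _ = _ := by field_simp; ring

theorem weyl_one (h η : ℝ) (hh : 1 ≤ h) (N l : ℝ) (hN : 1 ≤ N) (h1 : N ^ (-1 + η) ≤ l)
    (h2 : l ≤ N ^ (-η)) (M : ℕ) (hMN : (M:ℝ) ≤ N) (φ : ℕ → ℝ) (H : DiffBound 1 φ M l h) :
    ‖∑ n ∈ range M, ee (φ n)‖ ≤ (2 * π + h) * N ^ (1 - η) := by
  have hN0 : 0 < N := by linarith
  have hpi := pi_pos
  have hp : 0 < N ^ (1 - η) := by positivity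
  rcases le_or_gt (h * l) π with hc | hc
  · have hl := (by positivity : 0 < N ^ (-1 + η)).trans_le h1
    refine (H.kuzmin_landau hl hc).trans ?_
    calc 2 * π / l ≤ 2 * π / N ^ (-1 + η) := by gcongr
      _ = 2 * π * N ^ (1 - η) := by
        rw [div_eq_mul_inv, ← rpow_neg hN0.le]; congr 2; ring
      _ ≤ _ := by nlinarith
  · have h3 : 1 ≤ h * N ^ (-η) := by
      have : h * l ≤ h * N ^ (-η) := by gcongr
      linarith [pi_gt_three]
    refine (norm_sum_ee_le _ _).trans (hMN.trans ?_)
    calc N = 1 * N := by ring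
      _ ≤ h * N ^ (-η) * N := by gcongr
      _ = h * N ^ (1 - η) := by
        rw [mul_assoc, ← rpow_add_one hN0.ne']; congr 2; ring
      _ ≤ _ := by nlinarith

theorem weyl (k : ℕ) : ∀ h η : ℝ, 1 ≤ h → 0 < η → ∃ δ : ℝ, 0 < δ ∧ ∃ C : ℝ, 0 < C ∧ ∀ N l : ℝ, 1 ≤ N → N ^ (-1 + η) ≤ l →
    l ≤ N ^ (-η) → ∀ M : ℕ, (M:ℝ) ≤ N → ∀ φ : ℕ → ℝ, DiffBound (k + 1) φ M l h →
    ‖∑ n ∈ range M, ee (φ n)‖ ≤ C * N ^ (1 - δ) := by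
  induction k with
  | zero =>
    intro h η hh hη
    exact ⟨η, hη, 2 * π + h, by positivity, fun N l hN h1 h2 M hM φ H => weyl_one h η hh N l hN h1 h2 M hM φ H⟩
  | succ k ih =>
    intro h η hh hη
    obtain ⟨δ, hδ, C, hC, hk⟩ := ih h (min (η / 2) 1) hh (by positivity)
    set ε := min (η / 2) 1
    have hε1 : ε ≤ 1 := min_le_right _ _
    have hε2 : ε ≤ η / 2 := min_le_left _ _
    set μ := min δ ε
    have hμ1 : μ ≤ 1 := (min_le_right _ _).trans hε1
    refine ⟨μ / 2, by positivity, sqrt (6 * (1 + C)), by positivity, fun N l hN h1 h2 M hM φ H => ?_⟩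
    have hN0 : 0 < N := by linarith
    have hQN : N ^ ε ≤ N := by simpa using rpow_le_rpow_of_exponent_le hN hε1
    have hQc : N ^ ε ≤ ⌈N ^ ε⌉₊ := Nat.le_ceil _
    have hl0 : 0 < l := (by positivity : 0 < N ^ (-1 + η)).trans_le h1
    have key := H.weyl_step (N := N) (B := C * N ^ (1 - δ)) hM hN ⌈N ^ ε⌉₊ 1 (Nat.ceil_pos.2 (by positivity))
      (by have := Nat.ceil_lt_add_one (show 0 ≤ N ^ ε by positivity); linarith) le_rfl (by positivity) (by
        intro q hq hqQ ψ M' hM' H'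
        have hq1 : (1:ℝ) ≤ q := by exact_mod_cast hq
        have hqQ' := Nat.lt_ceil.1 hqQ
        refine hk N (q * l) hN ?_ ?_ M' hM' ψ H'
        · calc N ^ (-1 + ε) ≤ N ^ (-1 + η) := rpow_le_rpow_of_exponent_le hN (by linarith)
            _ ≤ l := h1
            _ ≤ q * l := by nlinarith
        · calc q * l ≤ N ^ ε * N ^ (-η) := by gcongr
            _ = N ^ (ε - η) := by rw [← rpow_add hN0]; congr 1
            _ ≤ _ := rpow_le_rpow_of_exponent_le hN (by linarith))
    refine le_of_sq_le_sq ?_ (by positivity)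
    refine key.trans ?_
    rw [mul_pow, sq_sqrt (by positivity), ← rpow_natCast, ← rpow_mul hN0.le]
    have e1 : ((1:ℕ):ℝ) * N / (⌈N ^ ε⌉₊ : ℝ) ≤ N ^ (1 - μ) := by
      calc _ ≤ ((1:ℕ):ℝ) * N / N ^ ε := by gcongr
        _ = N ^ (1 - ε) := by rw [rpow_sub hN0, rpow_one]; simp
        _ ≤ _ := rpow_le_rpow_of_exponent_le hN (by linarith [min_le_right δ ε])
    have e2 : N ^ (1 - δ) ≤ N ^ (1 - μ) := rpow_le_rpow_of_exponent_le hN (by linarith [min_le_left δ ε])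
    have e3 : N ^ ((1 - μ / 2) * (2:ℕ)) = N * N ^ (1 - μ) := by
      rw [← rpow_one_add' hN0.le (by push_cast; linarith)]; congr 1; push_cast; ring
    rw [e3]
    calc 6 * N * (((1:ℕ):ℝ) * N / ⌈N ^ ε⌉₊ + C * N ^ (1 - δ)) ≤ 6 * N * (N ^ (1 - μ) + C * N ^ (1 - μ)) := by gcongr
      _ = _ := by ring

theorem weyl_ext (k : ℕ) (h : ℝ) (hh : 1 ≤ h) : ∃ δ : ℝ, 0 < δ ∧ ∃ C : ℝ, 0 < C ∧ ∀ N l : ℝ, 1 ≤ N →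
    N ^ (-(6 / 5) : ℝ) ≤ l → l ≤ N ^ (-(1 / 5) : ℝ) → ∀ M : ℕ, (M:ℝ) ≤ N → ∀ φ : ℕ → ℝ, DiffBound (k + 2) φ M l h →
    ‖∑ n ∈ range M, ee (φ n)‖ ≤ C * N ^ (1 - δ) := by
  obtain ⟨δ₁, hδ₁, C₁, hC₁, h₁⟩ := weyl (k + 1) h (1 / 5) hh (by norm_num)
  obtain ⟨δ₂, hδ₂, C₂, hC₂, h₂⟩ := weyl k h (1 / 20) hh (by norm_num)
  set μ := min δ₂ (1 / 4)
  have hμ1 : μ ≤ 1 / 4 := min_le_right _ _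
  set δ := min δ₁ (μ / 2)
  refine ⟨δ, (by positivity), C₁ + sqrt (6 * (2 + C₂)), by positivity, fun N l hN h1 h2 M hM φ H => ?_⟩
  have hN0 : 0 < N := by linarith
  rcases le_or_gt (N ^ (-(7 / 10) : ℝ)) l with hl | hl
  · calc _ ≤ C₁ * N ^ (1 - δ₁) := h₁ N l hN ((rpow_le_rpow_of_exponent_le hN (by norm_num)).trans hl) h2 M hM φ H
      _ ≤ C₁ * N ^ (1 - δ) := by
        gcongr
        exact min_le_left _ _
      _ ≤ _ := by
        gcongr
        simp
  · have hl0 := lt_of_lt_of_le (by positivity) h1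
    have hq1 : 1 ≤ N ^ (1 / 4 : ℝ) := one_le_rpow hN (by norm_num)
    have hQN : N ^ (1 / 2 : ℝ) ≤ N := by simpa using rpow_le_rpow_of_exponent_le hN (show (1 / 2 : ℝ) ≤ 1 by norm_num)
    have hQc := Nat.le_ceil (N ^ (1 / 2 : ℝ))
    have hqc' := Nat.ceil_lt_add_one (show 0 ≤ N ^ (1 / 4 : ℝ) by positivity)
    have hQc' := Nat.ceil_lt_add_one (show 0 ≤ N ^ (1 / 2 : ℝ) by positivity)
    have key := H.weyl_step (N := N) (B := C₂ * N ^ (1 - δ₂)) hM hN ⌈N ^ (1 / 2 : ℝ)⌉₊ ⌈N ^ (1 / 4 : ℝ)⌉₊ (Nat.ceil_pos.2 (by positivity))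
      (by linarith) (Nat.one_le_ceil_iff.2 (by positivity)) (by positivity) (by
        intro q hq hqQ ψ M' hM' H'
        have hq1 := Nat.ceil_le.1 hq
        have hqQ' := Nat.lt_ceil.1 hqQ
        refine h₂ N (q * l) hN ?_ ?_ M' hM' ψ H'
        · calc N ^ (-1 + 1 / 20 : ℝ) = N ^ (1 / 4 : ℝ) * N ^ (-(6 / 5) : ℝ) := by rw [← rpow_add hN0]; norm_num
            _ ≤ q * l := by gcongr
        · calc q * l ≤ N ^ (1 / 2 : ℝ) * N ^ (-(7 / 10) : ℝ) := by gcongr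
            _ = N ^ (-(1 / 5) : ℝ) := by rw [← rpow_add hN0]; norm_num
            _ ≤ _ := rpow_le_rpow_of_exponent_le hN (by norm_num))
    have e1 : (⌈N ^ (1 / 4 : ℝ)⌉₊ : ℝ) * N / (⌈N ^ (1 / 2 : ℝ)⌉₊ : ℝ) ≤ 2 * N ^ (1 - μ) := by
      calc _ ≤ (2 * N ^ (1 / 4 : ℝ)) * N / N ^ (1 / 2 : ℝ) := by gcongr; linarith
        _ = 2 * N ^ (3 / 4 : ℝ) := by
          rw [mul_assoc, ← rpow_add_one hN0.ne', mul_div_assoc, ← rpow_sub hN0]; norm_num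
        _ ≤ _ := by gcongr; linarith
    have e2 : N ^ (1 - δ₂) ≤ N ^ (1 - μ) := rpow_le_rpow_of_exponent_le hN (by linarith [min_le_left δ₂ (1 / 4)])
    have e3 : N ^ ((1 - μ / 2) * (2:ℕ)) = N * N ^ (1 - μ) := by
      rw [← rpow_one_add' hN0.le (by push_cast; linarith)]; congr 1; push_cast; ring
    have e4 : ‖∑ n ∈ range M, ee (φ n)‖ ≤ sqrt (6 * (2 + C₂)) * N ^ (1 - μ / 2) := by
      refine le_of_sq_le_sq ?_ (by positivity)
      refine key.trans ?_
      rw [mul_pow, sq_sqrt (by positivity), ← rpow_natCast, ← rpow_mul hN0.le, e3]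
      calc _ ≤ 6 * N * (2 * N ^ (1 - μ) + C₂ * N ^ (1 - μ)) := by gcongr
        _ = _ := by ring
    calc _ ≤ _ := e4
      _ ≤ sqrt (6 * (2 + C₂)) * N ^ (1 - δ) := by
        gcongr
        exact min_le_right _ _
      _ ≤ _ := by gcongr; linarith

/-- `k`-th iterated difference of `log (x + 1) - log x`, up to sign. -/
noncomputable def dlog (k : ℕ) (x : ℝ) : ℝ := ∫ u in (0:ℝ)..1, (k.factorial : ℝ) / ∏ i ∈ range (k + 1), (x + u + i)

theorem dlog_integrable (k : ℕ) (hx : 0 < x) :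
    IntervalIntegrable (fun u : ℝ => (k.factorial : ℝ) / ∏ i ∈ range (k + 1), (x + u + i)) volume 0 1 := by
  refine ContinuousOn.intervalIntegrable ?_
  rw [Set.uIcc_of_le zero_le_one]
  refine ContinuousOn.div continuousOn_const (by fun_prop) fun u hu => ?_
  refine (prod_pos fun i _ => ?_).ne'
  have := hu.1; positivity

theorem dlog_zero (hx : 0 < x) : dlog 0 x = log (x + 1) - log x := by
  unfold dlog
  simp only [Nat.factorial_zero, Nat.cast_one, zero_add, prod_range_one, Nat.cast_zero, add_zero]
  rw [(intervalIntegral.integral_comp_add_left (fun u => 1 / u) (a := 0) (b := 1) x), integral_one_div_of_pos (by linarith) (by linarith), add_zero, log_div (by positivity) hx.ne']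

theorem dlog_sub (k : ℕ) (hx : 0 < x) : dlog k x - dlog k (x + 1) = dlog (k + 1) x := by
  unfold dlog
  rw [← intervalIntegral.integral_sub (dlog_integrable k hx) (dlog_integrable k (by linarith))]
  refine intervalIntegral.integral_congr fun u hu => ?_
  rw [Set.uIcc_of_le zero_le_one] at hu
  have hu0 := hu.1
  have e1 : ∏ i ∈ range (k + 1), (x + u + i) = (x + u) * ∏ i ∈ range k, (x + 1 + u + i) := by
    rw [prod_range_succ', mul_comm]
    grind
  have e2 : ∏ i ∈ range (k + 1 + 1), (x + u + i) = (x + u) * ∏ i ∈ range (k + 1), (x + 1 + u + i) := by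
    rw [prod_range_succ', mul_comm]
    grind
  rw [e1, e2, prod_range_succ]
  rw [Nat.factorial_succ]
  push_cast
  field_simp
  ring

theorem dlog_le (k : ℕ) (hy : 0 < y) (hyx : y ≤ x) : dlog k x ≤ k.factorial / y ^ (k + 1) := by
  unfold dlog
  refine (intervalIntegral.integral_mono_on zero_le_one (dlog_integrable k (hy.trans_le hyx)) (g := fun _ => k.factorial / y ^ (k + 1)) (by simp) fun u hu => ?_).trans (by simp)
  gcongr
  rw [← card_range (k + 1), ← prod_const, card_range]
  exact prod_le_prod (fun _ _ => hy.le) fun i _ => by grind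

theorem le_dlog (k : ℕ) (hx : 0 < x) (hyx : x + 1 + k ≤ y) : k.factorial / y ^ (k + 1) ≤ dlog k x := by
  unfold dlog
  refine le_trans (by simp) (intervalIntegral.integral_mono_on zero_le_one (f := fun _ => k.factorial / y ^ (k + 1)) (by simp) (dlog_integrable k hx) fun u hu => ?_)
  have hu0 := hu.1
  gcongr
  rw [← card_range (k + 1), ← prod_const, card_range]
  refine prod_le_prod (fun _ _ => by positivity) fun i hi => ?_
  have : (i:ℝ) ≤ k := by simp_all
  linarith [hu.2]

theorem bdiff_log (k : ℕ) (t : ℝ) (hx : 0 < x) (n : ℕ) :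
    bdiff (k + 1) (fun n : ℕ => -(t * log (x + n))) n = t * dlog k (x + n) := by
  induction k generalizing n with
  | zero =>
    simp only [bdiff]
    rw [dlog_zero (by positivity)]
    grind
  | succ k ih =>
    rw [bdiff_succ', ih, ih, ← dlog_sub k (by positivity)]
    grind

theorem diffBound_log (k : ℕ) (ht : 0 ≤ t) (hy : 0 < y) (hyx : y ≤ x) (hN : 0 < N) (M : ℕ) (hM : x + M + k ≤ N) :
    DiffBound (k + 1) (fun n : ℕ => -(t * log (x + n))) M (t / N ^ (k + 1)) (k.factorial * (N / y) ^ (k + 1)) := by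
  have hx := hy.trans_le hyx
  refine ⟨fun n hn => ?_, fun n hn => ?_, fun n hn => ?_⟩
  · rw [bdiff_log k t hx]
    have h1 : 1 ≤ k.factorial := by exact_mod_cast Nat.factorial_pos k
    have hn' : (n:ℝ) + 1 ≤ M := by exact_mod_cast hn
    calc t / N ^ (k + 1) ≤ t * (k.factorial / N ^ (k + 1)) := by
          rw [div_eq_mul_inv, div_eq_mul_inv]; gcongr
          simp_all
      _ ≤ _ := by gcongr; exact le_dlog k (by positivity) (by linarith)
  · rw [bdiff_log k t hx]
    calc t * dlog k (x + n) ≤ t * (k.factorial / y ^ (k + 1)) := by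
          gcongr; exact dlog_le k hy (by linarith)
      _ = _ := by rw [div_pow]; field_simp
  · have : bdiff (k + 1 + 1) (fun n => -(t * log (x + n))) n = _ := bdiff_succ' _ _ _
    rw [bdiff_log _ t hx] at this
    have h2 : 0 ≤ dlog (k + 1) (x + n) := le_trans (by positivity) (le_dlog (k + 1) (by positivity) le_rfl)
    linarith [mul_nonneg ht h2]

theorem zsum_eq_range (Y t : ℝ) : zsum Y t = ∑ n ∈ range (⌊kap * Y⌋₊ - ⌊Y⌋₊), ee (-(t * log ((⌊Y⌋₊ + 1 : ℝ) + n))) := by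
  have e : Ioc ⌊Y⌋₊ ⌊kap * Y⌋₊ = Ico (⌊Y⌋₊ + 1) (⌊kap * Y⌋₊ + 1) := by grind
  rw [zsum, e, sum_Ico_eq_sum_range, Nat.add_sub_add_right]
  refine sum_congr rfl fun n _ => ?_
  unfold chi ee
  push_cast
  ring_nf

theorem norm_zsum_neg (Y t : ℝ) : ‖zsum Y (-t)‖ = ‖zsum Y t‖ := by
  rw [← RCLike.norm_conj, zsum, zsum, map_sum]
  simp_rw [star_chi, neg_neg]

theorem norm_zsum_abs (Y t : ℝ) : ‖zsum Y |t|‖ = ‖zsum Y t‖ := by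
  rcases abs_choice t with h | h <;> rw [h]
  exact norm_zsum_neg Y t

theorem diffBound_zsum (k : ℕ) (ht : 0 ≤ t) (hY : 0 < Y) (hk : (k:ℝ) + 1 ≤ Y) :
    DiffBound (k + 1) (fun n : ℕ => -(t * log ((⌊Y⌋₊ + 1 : ℝ) + n))) (⌊kap * Y⌋₊ - ⌊Y⌋₊) (t / (2 * kap * Y) ^ (k + 1))
      (k.factorial * (2 * kap) ^ (k + 1)) := by
  have hkap := one_lt_kap
  have h := diffBound_log k (x := ⌊Y⌋₊ + 1) (N := 2 * kap * Y) ht hY (Nat.lt_floor_add_one Y).le (by positivity) (⌊kap * Y⌋₊ - ⌊Y⌋₊) (by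
    rw [Nat.cast_sub (Nat.floor_mono (by nlinarith))]
    nlinarith [Nat.floor_le (show 0 ≤ kap * Y by positivity)])
  grind

theorem card_le_two_kap_mul (hY : 0 < Y) : ((⌊kap * Y⌋₊ - ⌊Y⌋₊ : ℕ) : ℝ) ≤ 2 * kap * Y := by
  have := kap_pos
  have h2 : ((⌊kap * Y⌋₊ - ⌊Y⌋₊ : ℕ) : ℝ) ≤ ⌊kap * Y⌋₊ := by exact_mod_cast Nat.sub_le _ _
  nlinarith [Nat.floor_le (show 0 ≤ kap * Y by positivity), mul_pos this hY]

theorem exists_norm_zsum_le_range (K : ℕ) : ∃ δ : ℝ, 0 < δ ∧ δ ≤ 1 ∧ ∃ C : ℝ, 0 < C ∧ ∀ Y t : ℝ, 1 ≤ Y →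
    (2 * kap * Y) ^ (2 / 5 : ℝ) ≤ t → t ≤ (2 * kap * Y) ^ (K + 4 / 5 : ℝ) → ‖zsum Y t‖ ≤ C * (2 * kap * Y) ^ (1 - δ) := by
  have hkap := one_lt_kap
  induction K with
  | zero =>
    obtain ⟨δ, hδ, C, hC, h⟩ := weyl 0 ((Nat.factorial 0) * (2 * kap) ^ (0 + 1)) (1 / 5) (by simp; linarith) (by norm_num)
    refine ⟨min δ 1, by positivity, min_le_right _ _, C, hC, fun Y t hY h1 h2 => ?_⟩
    have hN1 : 1 ≤ 2 * kap * Y := by nlinarith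
    have hN0 : 0 < 2 * kap * Y := by linarith
    have ht := lt_of_lt_of_le (by positivity) h1
    rw [zsum_eq_range]
    refine (h (2 * kap * Y) (t / (2 * kap * Y) ^ (0 + 1)) hN1 ?_ ?_ _ (card_le_two_kap_mul (by linarith)) _ (diffBound_zsum 0 ht.le (by linarith) (by simpa using hY))).trans ?_
    · rw [le_div_iff₀ (by positivity), zero_add, pow_one, ← rpow_add_one hN0.ne']
      exact (rpow_le_rpow_of_exponent_le hN1 (by norm_num)).trans h1
    · rw [div_le_iff₀ (by positivity), zero_add, pow_one, ← rpow_add_one hN0.ne']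
      linarith
    · gcongr
      exact min_le_left _ _
  | succ K ih =>
    obtain ⟨δ₁, hδ₁, hδ₁', C₁, hC₁, h₁⟩ := ih
    obtain ⟨δ₂, hδ₂, C₂, hC₂, h₂⟩ := weyl_ext K ((Nat.factorial (K + 1)) * (2 * kap) ^ (K + 2)) (by
      have e1 : (1:ℝ) ≤ (K + 1).factorial := by exact_mod_cast Nat.factorial_pos _
      have e2 : (1:ℝ) ≤ (2 * kap) ^ (K + 2) := one_le_pow₀ (by linarith)
      nlinarith)
    refine ⟨min δ₁ δ₂, by positivity, (min_le_left _ _).trans hδ₁', C₁ + C₂ + kap * (K + 2), by positivity, fun Y t hY h1 h2 => ?_⟩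
    have hK : 0 ≤ kap * (K + 2) := by positivity
    have hN1 : 1 ≤ 2 * kap * Y := by nlinarith
    have hN0 : 0 < 2 * kap * Y := by linarith
    have ht := lt_of_lt_of_le (by positivity) h1
    rcases le_or_gt t ((2 * kap * Y) ^ (K + 4 / 5 : ℝ)) with h3 | h3
    · refine (h₁ Y t hY h1 h3).trans ?_
      gcongr
      · linarith
      · exact min_le_left _ _
    rcases le_or_gt ((K + 1 : ℕ) + 1 : ℝ) Y with h4 | h4
    · rw [zsum_eq_range]
      have hp : (2 * kap * Y) ^ (K + 2) = (2 * kap * Y) ^ (K + 2 : ℝ) := by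
        rw [← rpow_natCast]; push_cast; rfl
      refine (h₂ (2 * kap * Y) (t / (2 * kap * Y) ^ (K + 2)) hN1 ?_ ?_ _ (card_le_two_kap_mul (by linarith)) _ (diffBound_zsum (K + 1) ht.le (by linarith) h4)).trans ?_
      · rw [le_div_iff₀ (by positivity), hp, ← rpow_add hN0]
        grind
      · rw [div_le_iff₀ (by positivity), hp, ← rpow_add hN0]
        grind
      · gcongr
        · linarith
        · exact min_le_right _ _
    · refine (norm_zsum_le (by linarith) t).trans ?_
      have h5 : (1:ℝ) ≤ (2 * kap * Y) ^ (1 - min δ₁ δ₂) := one_le_rpow hN1 (by linarith [min_le_left δ₁ δ₂])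
      have h6 : kap * Y ≤ kap * (K + 2) := by
        push_cast at h4
        gcongr; linarith
      nlinarith

theorem exists_norm_zstar_le (A : ℝ) : ∃ δ : ℝ, 0 < δ ∧ δ ≤ 1 ∧ ∃ C : ℝ, 0 < C ∧ ∀ Y t : ℝ, 1 ≤ Y →
    |t| ≤ Y ^ A → ‖zstar Y t‖ ≤ C * Y ^ (1 - δ) := by
  have hkap := one_lt_kap
  obtain ⟨δ, hδ, hδ1, C, hC, h⟩ := exists_norm_zsum_le_range ⌈A⌉₊
  refine ⟨min δ (2 / 5), by positivity, (min_le_left _ _).trans hδ1, C * (2 * kap) + 20 * kap * kap, by positivity, fun Y t hY ht => ?_⟩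
  have hY0 : 0 < Y := by linarith
  have hYN : Y ≤ 2 * kap * Y := by nlinarith
  set μ := min δ (2 / 5)
  have hμ1 : μ ≤ δ := min_le_left _ _
  have hμ2 : μ ≤ 2 / 5 := min_le_right _ _
  have hc : (2 * kap * Y) ^ (2 / 5 : ℝ) ≤ 2 * kap * Y ^ (2 / 5 : ℝ) := by
    rw [mul_rpow (by positivity) hY0.le]
    gcongr
    simpa using rpow_le_rpow_of_exponent_le (show 1 ≤ 2 * kap by linarith) (show (2 / 5) ≤ 1 by norm_num)
  have hp : 1 ≤ Y ^ (2 / 5 : ℝ) := one_le_rpow hY (by norm_num)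
  rcases le_or_gt ((2 * kap * Y) ^ (2 / 5 : ℝ)) |t| with h1 | h1
  · have h2 : |t| ≤ (2 * kap * Y) ^ (⌈A⌉₊ + 4 / 5 : ℝ) := by
      refine ht.trans ?_
      calc Y ^ A ≤ Y ^ (⌈A⌉₊ + 4 / 5 : ℝ) := rpow_le_rpow_of_exponent_le hY (by linarith [Nat.le_ceil A])
        _ ≤ _ := by gcongr
    have h3 := h Y |t| hY h1 h2
    rw [norm_zsum_abs] at h3
    have h4 : ‖zint Y t‖ ≤ 4 * kap * Y ^ (1 - μ) := by
      refine (norm_zint_le hY0 t).trans ?_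
      rw [div_le_iff₀ (by positivity)]
      have : Y ^ (2 / 5 : ℝ) ≤ 1 + |t| := by
        have : Y ^ (2 / 5 : ℝ) ≤ (2 * kap * Y) ^ (2 / 5 : ℝ) := by gcongr
        linarith
      calc 4 * kap * Y = 4 * kap * (Y ^ (1 - μ) * Y ^ μ) := by
            rw [← rpow_add hY0]; simp
        _ ≤ 4 * kap * (Y ^ (1 - μ) * Y ^ (2 / 5 : ℝ)) := by gcongr
        _ ≤ 4 * kap * (Y ^ (1 - μ) * (1 + |t|)) := by gcongr
        _ = _ := by ring
    have h5 : (2 * kap * Y) ^ (1 - δ) ≤ 2 * kap * Y ^ (1 - μ) := by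
      rw [mul_rpow (by positivity) hY0.le]
      have a1 : (2 * kap) ^ (1 - δ) ≤ 2 * kap := by
        simpa using rpow_le_rpow_of_exponent_le (show 1 ≤ 2 * kap by linarith) (show 1 - δ ≤ 1 by linarith)
      gcongr
    refine (norm_sub_le _ _).trans ?_
    have h7 : 4 * kap * Y ^ (1 - μ) ≤ 20 * kap * kap * Y ^ (1 - μ) := by gcongr; nlinarith
    nlinarith
  · refine (norm_zstar_le_one_add hY0 t).trans ?_
    have h2 : Y ^ (2 / 5 : ℝ) ≤ Y ^ (1 - μ) := rpow_le_rpow_of_exponent_le hY (by linarith)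
    have h3 : 1 + |t| ≤ 4 * kap * Y ^ (2 / 5 : ℝ) := by nlinarith
    calc 5 * kap * (1 + |t|) ≤ 5 * kap * (4 * kap * Y ^ (1 - μ)) := by gcongr; exact h3.trans (by gcongr)
      _ = 20 * kap * kap * Y ^ (1 - μ) := by ring
      _ ≤ _ := by
        have : 0 ≤ C * (2 * kap) * Y ^ (1 - μ) := by positivity
        nlinarith

theorem sum_range_inv_le (Q : ℕ) : ∑ q ∈ range Q, (1 : ℝ) / (q + 1) ≤ 1 + log (1 + Q) := by
  have h : ∀ n, ∑ q ∈ range (n + 1), (1 : ℝ) / (q + 1) ≤ 1 + log (n + 1) := by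
    intro n
    induction n with
    | zero => simp
    | succ n ih =>
      rw [sum_range_succ]
      have h1 := one_sub_inv_le_log_of_pos (x := ((n + 1) + 1 : ℝ) / (n + 1)) (by positivity)
      rw [log_div (by positivity) (by positivity)] at h1
      have h2 : 1 - (((n + 1 : ℕ) + 1 : ℝ) / (n + 1 : ℕ))⁻¹ = 1 / ((n + 1 : ℕ) + 1) := by field_simp; ring
      push_cast at *
      linarith
  rcases Nat.eq_zero_or_pos Q with rfl | hQ
  · simp
  obtain ⟨n, rfl⟩ : ∃ n, Q = n + 1 := ⟨Q - 1, by omega⟩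
  refine (h n).trans ?_
  have : log (n + 1) ≤ log (1 + (n + 1 : ℕ)) := log_le_log (by positivity) (by push_cast; linarith)
  linarith

theorem norm_zsum_le_mid (hY : 1 ≤ Y) (ht : 2 * Y ≤ t) (ht2 : t ≤ Y ^ 2) :
    ‖zsum Y t‖ ^ 2 ≤ 2000 * kap ^ 4 * (t * (1 + log (1 + t))) := by
  have hkap := one_lt_kap
  have ht0 : 0 < t := by linarith
  have hlog : 0 ≤ log (1 + t) := log_nonneg (by linarith)
  set a := ⌊Y⌋₊
  set M := ⌊kap * Y⌋₊ - ⌊Y⌋₊ with hM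
  have haY := Nat.lt_floor_add_one Y
  have hbY : (⌊kap * Y⌋₊) ≤ kap * Y := Nat.floor_le (by positivity)
  have hMY : M ≤ kap * Y := le_trans (by exact_mod_cast Nat.sub_le _ _) hbY
  have haM : a + M ≤ kap * Y := by
    rw [hM, Nat.cast_sub (Nat.floor_mono (by nlinarith))]; linarith
  set φ : ℕ → ℝ := fun n => -(t * log ((a + 1) + n))
  set Q := ⌈Y ^ 2 / t⌉₊
  have hx1 : 1 ≤ Y ^ 2 / t := by rwa [le_div_iff₀ ht0, one_mul]
  have hxY : Y ^ 2 / t ≤ Y / 2 := by rw [div_le_div_iff₀ ht0 two_pos]; nlinarith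
  have hQ1 : Y ^ 2 / t ≤ Q := Nat.le_ceil _
  have hQ2 : Q ≤ Y ^ 2 / t + 1 := (Nat.ceil_lt_add_one (by positivity)).le
  have hQ0 : 0 < Q := Nat.ceil_pos.2 (by positivity)
  -- correlations
  have hcorr : ∀ q, 1 ≤ q → q < Q → ‖∑ n ∈ range (M - q), ee (φ n - φ (n + q))‖ ≤ 2 * π / (t * q / (4 * kap ^ 2 * Y ^ 2)) := by
    intro q hq hqQ
    have hqx := Nat.lt_ceil.1 hqQ
    have hd : DiffBound 1 (fun n => φ n - φ (n + q)) (M - q) (t * q / (4 * kap ^ 2 * Y ^ 2)) (4 * kap ^ 2) := by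
      have hform : ∀ n, bdiff 1 (fun n => φ n - φ (n + q)) n = ∑ i ∈ range q, t * dlog 1 ((a + 1) + (n + i : ℕ)) := by
        intro n
        rw [bdiff_correlation]
        exact sum_congr rfl fun i _ => bdiff_log 1 t (by positivity) (n + i)
      refine ⟨fun n hn => ?_, fun n hn => ?_, fun n hn => ?_⟩
      · rw [hform]
        calc t * q / (4 * kap ^ 2 * Y ^ 2) = ∑ i ∈ range q, t * (Nat.factorial 1 / (2 * kap * Y) ^ (1 + 1)) := by
              simp; field_simp; ring
          _ ≤ _ := by
            refine sum_le_sum fun i hi => ?_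
            gcongr
            refine le_dlog 1 (by positivity) ?_
            have : (n + i : ℝ) + 1 ≤ M := by exact_mod_cast (by have := mem_range.1 hi; omega)
            grind
      · rw [hform]
        calc _ ≤ ∑ i ∈ range q, t * (Nat.factorial 1 / Y ^ (1 + 1)) := by
              refine sum_le_sum fun i hi => ?_
              gcongr
              exact dlog_le 1 (by linarith) (by linarith)
          _ = _ := by simp; field_simp
      · rw [hform, hform]
        refine sum_le_sum fun i _ => ?_
        have h1 := dlog_sub 1 (x := (a + 1) + (n + i)) (by positivity)
        have h2 : 0 ≤ dlog 2 ((a + 1) + (n + i)) := le_trans (by positivity) (le_dlog 2 (by positivity) le_rfl)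
        gcongr
        grind
    refine hd.kuzmin_landau (by positivity) ?_
    calc 4 * kap ^ 2 * (t * q / (4 * kap ^ 2 * Y ^ 2)) = t * q / Y ^ 2 := by field_simp
      _ ≤ 1 := by rw [div_le_one (by positivity)]; exact (by rw [lt_div_iff₀ ht0] at hqx; linarith)
      _ ≤ _ := by linarith [pi_gt_three]
  have key := vanDerCorput (fun n => ee (φ n)) M Q hQ0 (fun q => if q = 0 then kap * Y else 2 * π / (t * q / (4 * kap ^ 2 * Y ^ 2))) (fun q hq => by
    have e : ∑ n ∈ range (M - q), ee (φ n) * conj (ee (φ (n + q))) = ∑ n ∈ range (M - q), ee (φ n - φ (n + q)) := by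
      refine sum_congr rfl fun n _ => ?_
      rw [star_ee, ← ee_add]; rfl
    rw [e]
    split_ifs with h
    · refine (norm_sum_ee_le (fun n => φ n - φ (n + q)) _).trans ?_
      rw [h, Nat.sub_zero]; exact hMY
    · exact hcorr q (by omega) hq)
  rw [zsum_eq_range]
  refine key.trans ?_
  have hsum : ∑ q ∈ range Q, (if q = 0 then kap * Y else 2 * π / (t * q / (4 * kap ^ 2 * Y ^ 2)))
      ≤ kap * Y + 32 * kap ^ 2 * Y ^ 2 / t * (1 + log (1 + t)) := by
    obtain ⟨Q', hQ'⟩ : ∃ n, Q = n + 1 := ⟨Q - 1, by omega⟩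
    rw [hQ', sum_range_succ', if_pos rfl, add_comm]
    gcongr
    have hQ't : Q' ≤ t := by
      have : (Q' : ℝ) + 1 = Q := by rw [hQ']; push_cast; rfl
      nlinarith
    calc _ = ∑ q ∈ range Q', (8 * π * kap ^ 2 * Y ^ 2 / t) * (1 / (q + 1)) := by
          refine sum_congr rfl fun q _ => ?_
          rw [if_neg (by omega)]
          push_cast
          field_simp; ring
      _ = (8 * π * kap ^ 2 * Y ^ 2 / t) * ∑ q ∈ range Q', (1 : ℝ) / (q + 1) := by rw [mul_sum]
      _ ≤ (8 * 4 * kap ^ 2 * Y ^ 2 / t) * (1 + log (1 + t)) := by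
        gcongr
        · exact pi_le_four
        · refine (sum_range_inv_le Q').trans ?_
          gcongr
      _ = _ := by ring
  have hf : (M + Q) / Q ≤ 2 * kap * t / Y := by
    calc (M + Q) / Q ≤ (kap * Y + kap * Y) / (Y ^ 2 / t) := by gcongr; nlinarith
      _ = _ := by field_simp; ring
  calc _ ≤ 2 * kap * t / Y * (2 * (kap * Y + 32 * kap ^ 2 * Y ^ 2 / t * (1 + log (1 + t)))) := by gcongr
    _ = 4 * kap ^ 2 * t + 128 * kap ^ 3 * Y * (1 + log (1 + t)) := by field_simp; ring
    _ ≤ 4 * kap ^ 4 * (t * (1 + log (1 + t))) + 128 * kap ^ 4 * (t * (1 + log (1 + t))) := by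
      have e1 : kap ^ 2 ≤ kap ^ 4 := pow_le_pow_right₀ hkap.le (by norm_num)
      have e2 : kap ^ 3 ≤ kap ^ 4 := pow_le_pow_right₀ hkap.le (by norm_num)
      have e3 : t ≤ t * (1 + log (1 + t)) := by nlinarith
      have e4 : Y * (1 + log (1 + t)) ≤ t * (1 + log (1 + t)) := by gcongr; linarith
      refine add_le_add ?_ ?_
      · rw [mul_assoc, mul_assoc]; gcongr
      · rw [mul_assoc _ Y]; gcongr
    _ ≤ _ := by
      have : 0 ≤ kap ^ 4 * (t * (1 + log (1 + t))) := by positivity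
      linarith

/-- The square-root bound for the zeta sums. -/
theorem norm_zsum_le_sqrt (hY : 1 ≤ Y) (t : ℝ) :
    ‖zsum Y t‖ ≤ 100 * kap ^ 2 * (Y / (1 + |t|) + sqrt (1 + |t|) * (1 + log (1 + |t|))) := by
  have hkap := one_lt_kap
  have hY0 : 0 < Y := by linarith
  rw [← norm_zsum_abs]
  set u := |t|
  have hu0 := abs_nonneg t
  have hlog : 0 ≤ log (1 + u) := log_nonneg (by linarith)
  have hA : 0 ≤ Y / (1 + u) := by positivity
  have hB : 0 ≤ sqrt (1 + u) * (1 + log (1 + u)) := by positivity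
  have hk2 : kap ≤ kap ^ 2 := by nlinarith
  rcases le_or_gt u 1 with h1 | h1
  · refine (norm_zsum_le hY0 u).trans ?_
    have : Y ≤ 2 * (Y / (1 + u)) := by
      rw [mul_div_assoc', le_div_iff₀ (by linarith)]; nlinarith
    nlinarith
  rcases le_or_gt u (2 * Y) with h2 | h2
  · have hd := diffBound_zsum 0 (t := u) hu0 hY0 (by simpa using hY)
    simp only [zero_add, pow_one, Nat.factorial_zero, Nat.cast_one, one_mul] at hd
    have hub : ∀ n < ⌊kap * Y⌋₊ - ⌊Y⌋₊, bdiff 1 (fun n => -(u * log ((⌊Y⌋₊ + 1) + n))) n ≤ π := by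
      intro n _
      rw [bdiff_log 0 u (by positivity)]
      have := dlog_le 0 (x := (⌊Y⌋₊ + 1) + n) hY0 (by
        have := Nat.lt_floor_add_one Y
        linarith)
      simp at this
      calc _ ≤ u * Y⁻¹ := by gcongr
        _ ≤ 2 * Y * Y⁻¹ := by gcongr
        _ = 2 := by field_simp
        _ ≤ _ := by linarith [pi_gt_three]
    have hd' : DiffBound 1 (fun n => -(u * log ((⌊Y⌋₊ + 1) + n))) (⌊kap * Y⌋₊ - ⌊Y⌋₊) (u / (2 * kap * Y)) (π / (u / (2 * kap * Y))) :=
      ⟨hd.1, fun n hn => (hub n hn).trans_eq (by rw [div_mul_cancel₀]; positivity), hd.2.2⟩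
    rw [zsum_eq_range]
    refine (hd'.kuzmin_landau (by positivity) (by rw [div_mul_cancel₀]; positivity)).trans ?_
    calc 2 * π / (u / (2 * kap * Y)) = 4 * π * kap * (Y / u) := by field_simp; ring
      _ ≤ 4 * 4 * kap ^ 2 * (2 * (Y / (1 + u))) := by
        gcongr
        · exact pi_le_four
        · rw [mul_div_assoc', div_le_div_iff₀ (by linarith) (by linarith)]; nlinarith
      _ ≤ _ := by nlinarith
  rcases le_or_gt u (Y ^ 2) with h3 | h3
  · have hm := norm_zsum_le_mid hY h2.le h3
    have : ‖zsum Y u‖ ≤ 100 * kap ^ 2 * (sqrt (1 + u) * (1 + log (1 + u))) := by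
      refine le_of_sq_le_sq (hm.trans ?_) (by positivity)
      rw [mul_pow, mul_pow, mul_pow, sq_sqrt (by linarith)]
      calc _ ≤ 10000 * kap ^ 4 * ((1 + u) * (1 + log (1 + u)) ^ 2) := by
            gcongr
            · norm_num
            · linarith
            · nlinarith
        _ = _ := by ring
    nlinarith [mul_nonneg (sq_nonneg kap) hA]
  · refine (norm_zsum_le hY0 u).trans ?_
    have : Y ≤ sqrt (1 + u) := le_sqrt_of_sq_le (by linarith)
    have h5 : Y ≤ sqrt (1 + u) * (1 + log (1 + u)) := by nlinarith [sqrt_nonneg (1 + u)]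
    calc kap * Y ≤ kap ^ 2 * (sqrt (1 + u) * (1 + log (1 + u))) := by gcongr
      _ ≤ _ := by nlinarith [mul_nonneg (sq_nonneg kap) hA, mul_nonneg (sq_nonneg kap) hB]

theorem integrable_of_continuous_of_bound {α : Type*} [TopologicalSpace α] [MeasurableSpace α]
    [OpensMeasurableSpace α] [SecondCountableTopology α] {E : Type*} [NormedAddCommGroup E]
    [SecondCountableTopologyEither α E] {ν : Measure α} [IsFiniteMeasure ν] {f : α → E} (hf : Continuous f)
    (C : ℝ) (hC : ∀ x, ‖f x‖ ≤ C) : Integrable f ν :=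
  Integrable.of_bound hf.aestronglyMeasurable C (.of_forall hC)

/-- Duality form of the large values estimate. -/
theorem dual_large_values (hY : 0 < Y) (hR0 : 0 ≤ R) (s : Finset ℕ) (hs : s ⊆ Ioc ⌊Y⌋₊ ⌊kap * Y⌋₊) (a : ℕ → ℂ)
    (U : Set ℝ) (hU : MeasurableSet U) (hUf : volume U ≠ ⊤)
    (hR : ∀ t ∈ U, ∫ t' in U, ‖zsum Y (t - t')‖ ≤ R) :
    ∫ t in U, ‖∑ n ∈ s, a n * chi n t‖ ^ 2 ≤ R * ∑ n ∈ s, ‖a n‖ ^ 2 := by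
  set ν := volume.restrict U with hν
  have : IsFiniteMeasure ν := ⟨by rw [hν, Measure.restrict_apply_univ]; exact lt_top_iff_ne_top.2 hUf⟩
  set A := fun t => ∑ n ∈ s, a n * chi n t with hA
  have hAc : Continuous A := by
    rw [hA]; exact continuous_finsetSum _ fun n _ => continuous_const.mul (continuous_chi n)
  set B := ∑ n ∈ s, ‖a n‖
  have hAB : ∀ t, ‖A t‖ ≤ B := fun t => (norm_sum_le _ _).trans (sum_le_sum fun n _ => by rw [norm_mul, norm_chi, mul_one])
  set I := ∫ t, ‖A t‖ ^ 2 ∂ν with hI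
  have hI0 : 0 ≤ I := by positivity
  set S := Ioc ⌊Y⌋₊ ⌊kap * Y⌋₊
  have hzc := continuous_zsum Y
  have hzb := norm_zsum_le hY
  set c : ℕ → ℂ := fun n => ∫ t, chi n t * conj (A t) ∂ν with hc
  have hci : ∀ n : ℕ, Integrable (fun t => chi n t * conj (A t)) ν := fun n =>
    integrable_of_continuous_of_bound ((continuous_chi n).mul (Complex.continuous_conj.comp hAc)) B (fun t => by
      rw [norm_mul, norm_chi, one_mul, RCLike.norm_conj]; exact hAB t)
  -- expansion
  have h1 : I = ∑ n ∈ s, a n * c n := by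
    simp only [hc]
    simp_rw [← integral_const_mul]
    rw [← integral_finsetSum _ (fun n _ => (hci n).const_mul _), hI, ← integral_complex_ofReal]
    refine integral_congr_ae (.of_forall fun t => ?_)
    push_cast
    rw [← Complex.mul_conj']
    nth_rewrite 1 [hA]
    rw [sum_mul]
    exact sum_congr rfl fun n _ => by ring
  have h2 : I ^ 2 ≤ (∑ n ∈ s, ‖a n‖ ^ 2) * ∑ n ∈ S, ‖c n‖ ^ 2 := by
    have e : I ≤ ∑ n ∈ s, ‖a n‖ * ‖c n‖ := by
      calc I = ‖(I : ℂ)‖ := by rw [Complex.norm_real, norm_of_nonneg hI0]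
        _ ≤ _ := by
          rw [h1]
          exact (norm_sum_le _ _).trans (sum_le_sum fun n _ => (norm_mul _ _).le)
    calc I ^ 2 ≤ (∑ n ∈ s, ‖a n‖ * ‖c n‖) ^ 2 := by gcongr
      _ ≤ (∑ n ∈ s, ‖a n‖ ^ 2) * ∑ n ∈ s, ‖c n‖ ^ 2 := sum_mul_sq_le_sq_mul_sq _ _ _
      _ ≤ _ := by
        gcongr
  -- the kernel
  have h3 : ((∑ n ∈ S, ‖c n‖ ^ 2 : ℝ) : ℂ) = ∫ z, (conj (A z.1) * A z.2) * zsum Y (z.1 - z.2) ∂(ν.prod ν) := by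
    push_cast
    have e : ∀ n ∈ S, (‖c n‖) ^ 2 = ∫ z, (chi n z.1 * conj (A z.1)) * conj (chi n z.2 * conj (A z.2)) ∂(ν.prod ν) := by
      intro n _
      rw [integral_prod_mul (fun t => chi n t * conj (A t)) (fun t => conj (chi n t * conj (A t))),
        integral_conj, ← Complex.mul_conj']
    rw [sum_congr rfl e, ← integral_finsetSum]
    · refine integral_congr_ae (.of_forall fun z => ?_)
      simp only
      rw [zsum, mul_sum]
      refine sum_congr rfl fun n hn => ?_
      have : chi n (z.1 - z.2) = chi n z.1 * conj (chi n z.2) := by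
        rw [star_chi]; unfold chi; rw [← Complex.exp_add]; congr 1; push_cast; ring
      rw [this, map_mul, Complex.conj_conj]; ring
    · intro n _
      refine (hci n).mul_prod (integrable_of_continuous_of_bound (Complex.continuous_conj.comp ((continuous_chi n).mul (Complex.continuous_conj.comp hAc))) B (fun t => ?_))
      simp only [Function.comp, Pi.mul_apply]
      rw [RCLike.norm_conj, norm_mul, norm_chi, one_mul, RCLike.norm_conj]; exact hAB t
  have hKi : Integrable (fun z => ‖A z.1‖ ^ 2 * ‖zsum Y (z.1 - z.2)‖) (ν.prod ν) := by
    refine integrable_of_continuous_of_bound (by fun_prop) (B ^ 2 * (kap * Y)) fun z => ?_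
    rw [norm_of_nonneg (by positivity)]
    gcongr
    · exact hAB _
    · exact hzb _
  have hKi' : Integrable (fun z => ‖A z.2‖ ^ 2 * ‖zsum Y (z.1 - z.2)‖) (ν.prod ν) := by
    refine integrable_of_continuous_of_bound (by fun_prop) (B ^ 2 * (kap * Y)) fun z => ?_
    rw [norm_of_nonneg (by positivity)]
    gcongr
    · exact hAB _
    · exact hzb _
  have h4 : ∫ z, ‖A z.1‖ ^ 2 * ‖zsum Y (z.1 - z.2)‖ ∂(ν.prod ν) ≤ R * I := by
    rw [integral_prod _ hKi, hI, ← integral_const_mul]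
    refine integral_mono_ae hKi.integral_prod_left (Integrable.const_mul (integrable_of_continuous_of_bound (by fun_prop) (B ^ 2) fun t => by
      rw [norm_of_nonneg (by positivity)]; gcongr; exact hAB t) R) ?_
    refine (ae_restrict_iff' hU).2 (.of_forall fun t ht => ?_)
    simp only
    rw [integral_const_mul, mul_comm]
    gcongr
    exact hR t ht
  have h5 : ∫ z, ‖A z.2‖ ^ 2 * ‖zsum Y (z.1 - z.2)‖ ∂(ν.prod ν) = ∫ z, ‖A z.1‖ ^ 2 * ‖zsum Y (z.1 - z.2)‖ ∂(ν.prod ν) := by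
    rw [← integral_prod_swap]
    refine integral_congr_ae (.of_forall fun z => ?_)
    simp only [Prod.fst_swap, Prod.snd_swap]
    rw [← norm_zsum_neg, neg_sub]
  have h6 : ∑ n ∈ S, ‖c n‖ ^ 2 ≤ R * I := by
    calc ∑ n ∈ S, ‖c n‖ ^ 2 = ‖((∑ n ∈ S, ‖c n‖ ^ 2 : ℝ) : ℂ)‖ := by rw [Complex.norm_real, norm_of_nonneg (by positivity)]
      _ ≤ ∫ z, ‖(conj (A z.1) * A z.2) * zsum Y (z.1 - z.2)‖ ∂(ν.prod ν) := by
        rw [h3]; exact norm_integral_le_integral_norm _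
      _ ≤ ∫ z, (1 / 2 * (‖A z.1‖ ^ 2 * ‖zsum Y (z.1 - z.2)‖) + 1 / 2 * (‖A z.2‖ ^ 2 * ‖zsum Y (z.1 - z.2)‖)) ∂(ν.prod ν) := by
        refine integral_mono_of_nonneg (.of_forall fun _ => norm_nonneg _) ((hKi.const_mul _).add (hKi'.const_mul _)) (.of_forall fun z => ?_)
        simp only
        rw [norm_mul, norm_mul, RCLike.norm_conj]
        nlinarith [mul_nonneg (sq_nonneg (‖A z.1‖ - ‖A z.2‖)) (norm_nonneg (zsum Y (z.1 - z.2)))]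
      _ ≤ R * I := by
        rw [integral_add (hKi.const_mul _) (hKi'.const_mul _), integral_const_mul, integral_const_mul, h5]
        linarith
  have hs0 : 0 ≤ ∑ n ∈ s, ‖a n‖ ^ 2 := by positivity
  rcases hI0.eq_or_lt with h0 | h0
  · rw [← h0]; positivity
  nlinarith

theorem integral_inv_one_add_abs (ha : 0 ≤ a) : ∫ v in (-a)..a, 1 / (1 + |v|) = 2 * log (1 + a) := by
  have hc : Continuous fun v : ℝ => 1 / (1 + |v|) := Continuous.div (by fun_prop) (by fun_prop) (fun v => by positivity)
  have h1 : ∫ v in 0..a, 1 / (1 + |v|) = log (1 + a) := by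
    have e : ∫ v in 0..a, 1 / (1 + |v|) = ∫ v in 0..a, 1 / (1 + v) := by
      refine intervalIntegral.integral_congr fun v hv => ?_
      simp_all
    simp_all
  have h2 : ∫ v in (-a)..0, 1 / (1 + |v|) = log (1 + a) := by
    have := intervalIntegral.integral_comp_neg (fun v => 1 / (1 + |v|)) (a := 0) (b := a)
    simp_all
  rw [← intervalIntegral.integral_add_adjacent_intervals (hc.intervalIntegrable _ 0) (hc.intervalIntegrable 0 _), h1, h2]
  ring

theorem row_integral_zsum_le (hY : 1 ≤ Y) (hT : 0 ≤ T) {U : Set ℝ} (hU : MeasurableSet U) (hUT : U ⊆ Set.Icc (-T) T) (ht : t ∈ U) :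
    ∫ t' in U, ‖zsum Y (t - t')‖ ≤ 200 * kap ^ 2 * (1 + log (1 + 2 * T)) * (Y + (volume U).toReal * sqrt (1 + 2 * T)) := by
  have hfin : IsFiniteMeasure (volume.restrict U) := ⟨by rw [Measure.restrict_apply_univ]; exact lt_top_iff_ne_top.2 (ne_top_of_le_ne_top (by simp) (measure_mono hUT))⟩
  have hlog : 0 ≤ log (1 + 2 * T) := log_nonneg (by linarith [kap_pos])
  set c := sqrt (1 + 2 * T) * (1 + log (1 + 2 * T)) with hc
  have hcc : Continuous fun v : ℝ => 1 / (1 + |v|) := Continuous.div (by fun_prop) (by fun_prop) (fun v => by positivity)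
  have hcs := hcc.comp (by fun_prop : Continuous fun t' => t - t')
  have hz := ((continuous_zsum Y).comp (by fun_prop : Continuous fun t' => t - t')).norm
  have hb1 : ∀ v, ‖1 / (1 + |t - v|)‖ ≤ 1 := fun v => by
    rw [norm_of_nonneg (by positivity), div_le_one (by positivity)]
    linarith [abs_nonneg (t - v)]
  have i1 : Integrable (fun t' => 1 / (1 + |t - t'|)) (volume.restrict U) := integrable_of_continuous_of_bound hcs 1 hb1
  have h1 : ∫ t' in U, 1 / (1 + |t - t'|) ≤ 2 * log (1 + 2 * T) := by
    calc ∫ t' in U, 1 / (1 + |t - t'|) ≤ ∫ t' in Set.Icc (t - 2 * T) (t + 2 * T), 1 / (1 + |t - t'|) := by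
          refine setIntegral_mono_set hcs.integrableOn_Icc (.of_forall fun v => by simp only [Pi.zero_apply]; positivity) ?_
          refine LE.le.eventuallyLE fun v hv => ?_
          grind
      _ = ∫ v in (-(2 * T))..(2 * T), 1 / (1 + |v|) := by
          rw [integral_Icc_eq_integral_Ioc, ← intervalIntegral.integral_of_le (by linarith),
            intervalIntegral.integral_comp_sub_left (fun v => 1 / (1 + |v|))]
          congr 1 <;> ring
      _ = _ := integral_inv_one_add_abs (by linarith)
  have hpt : ∀ t' ∈ U, ‖zsum Y (t - t')‖ ≤ 100 * kap ^ 2 * (Y * (1 / (1 + |t - t'|)) + c) := by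
    intro t' ht'
    refine (norm_zsum_le_sqrt hY _).trans ?_
    have : |t - t'| ≤ 2 * T := by
      grind
    rw [mul_one_div]
    gcongr
    rw [hc]; gcongr
    linarith [log_nonneg (show 1 ≤ 1 + |t - t'| by linarith [abs_nonneg (t - t')])]
  calc ∫ t' in U, ‖zsum Y (t - t')‖ ≤ ∫ t' in U, 100 * kap ^ 2 * (Y * (1 / (1 + |t - t'|)) + c) := by
        refine setIntegral_mono_on ?_ ?_ hU hpt
        · exact integrable_of_continuous_of_bound hz (kap * Y) fun v => by rw [norm_norm]; exact norm_zsum_le (by linarith) _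
        · exact ((i1.const_mul Y).add (integrable_const c)).const_mul _
    _ = 100 * kap ^ 2 * (Y * (∫ t' in U, 1 / (1 + |t - t'|)) + (volume U).toReal * c) := by
        rw [integral_const_mul, integral_add (i1.const_mul Y) (integrable_const c), integral_const_mul, integral_const]
        simp [Measure.real]
    _ ≤ 100 * kap ^ 2 * (Y * (2 * log (1 + 2 * T)) + (volume U).toReal * c) := by gcongr
    _ ≤ _ := by
        have e1 : 0 ≤ (volume U).toReal * (sqrt (1 + 2 * T) * (1 + log (1 + 2 * T))) := by positivity
        nlinarith

theorem large_values (hY : 1 ≤ Y) (hT : 0 ≤ T) (s : Finset ℕ) (hs : ∀ n ∈ s, Y < n ∧ (n:ℝ) ≤ kap * Y) (a : ℕ → ℂ)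
    {U : Set ℝ} (hU : MeasurableSet U) (hUT : U ⊆ Set.Icc (-T) T) :
    ∫ t in U, ‖∑ n ∈ s, a n * chi n t‖ ^ 2 ≤
      200 * kap ^ 2 * (1 + log (1 + 2 * T)) * (Y + (volume U).toReal * sqrt (1 + 2 * T)) * ∑ n ∈ s, ‖a n‖ ^ 2 := by
  have hlog : 0 ≤ log (1 + 2 * T) := log_nonneg (by linarith [kap_pos])
  refine dual_large_values (by linarith) (by positivity) s (fun n hn => ?_) a U hU
    (ne_top_of_le_ne_top (by simp) (measure_mono hUT)) (fun t ht => row_integral_zsum_le hY hT hU hUT ht)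
  exact (natCast_mem_Ioc_floor (by linarith)).2 (hs n hn)

/-- Large values estimate for supports of several scales. -/
theorem large_values_multi (hY : 1 ≤ Y) (hT : 0 ≤ T) (J : ℕ) (s : Finset ℕ)
    (hs : ∀ n ∈ s, Y < n ∧ (n:ℝ) ≤ kap ^ J * Y) (a : ℕ → ℂ) {U : Set ℝ} (hU : MeasurableSet U)
    (hUT : U ⊆ Set.Icc (-T) T) :
    ∫ t in U, ‖∑ n ∈ s, a n * chi n t‖ ^ 2 ≤
      J * (200 * kap ^ 2 * (1 + log (1 + 2 * T)) * (kap ^ J * Y + (volume U).toReal * sqrt (1 + 2 * T))) * ∑ n ∈ s, ‖a n‖ ^ 2 := by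
  have hk := one_lt_kap
  have hlog : 0 ≤ log (1 + 2 * T) := log_nonneg (by linarith)
  have hfin : IsFiniteMeasure (volume.restrict U) := ⟨by rw [Measure.restrict_apply_univ]; exact lt_top_iff_ne_top.2 (ne_top_of_le_ne_top (by simp) (measure_mono hUT))⟩
  set sj : ℕ → Finset ℕ := fun j => s.filter (fun n => kap ^ j * Y < n ∧ n ≤ kap ^ (j + 1) * Y) with hsj
  have hdisj : (range J : Set ℕ).PairwiseDisjoint sj := by
    intro i _ j _ hij
    rw [Function.onFun, Finset.disjoint_left]
    intro n hn hn'
    have h1 := (mem_filter.1 hn).2; have h2 := (mem_filter.1 hn').2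
    rcases lt_or_gt_of_ne hij with h | h
    · have : kap ^ (i + 1) * Y ≤ kap ^ j * Y := by gcongr; exacts [hk.le, h]
      linarith [h1.2, h2.1]
    · have : kap ^ (j + 1) * Y ≤ kap ^ i * Y := by gcongr; exacts [hk.le, h]
      linarith [h1.1, h2.2]
  have hcover : s = (range J).biUnion sj := by
    ext n
    simp only [mem_biUnion, mem_range, hsj, mem_filter]
    refine ⟨fun hn => ?_, fun ⟨_, _, h, _⟩ => h⟩
    have hn' := hs n hn
    have hex : ∃ j, n ≤ kap ^ j * Y := ⟨J, hn'.2⟩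
    have hf := Nat.find_spec hex
    have h0 : Nat.find hex ≠ 0 := by simp_all
    obtain ⟨i, hi⟩ := Nat.exists_eq_succ_of_ne_zero h0
    have hmin := Nat.find_min hex (m := i) (by omega)
    have hJ := Nat.find_min' hex hn'.2
    grind
  have hsum : ∀ f : ℕ → ℝ, ∑ n ∈ s, f n = ∑ j ∈ range J, ∑ n ∈ sj j, f n := fun f =>
    (congrArg (fun S => ∑ n ∈ S, f n) hcover).trans (sum_biUnion hdisj)
  have hsumc : ∀ f : ℕ → ℂ, ∑ n ∈ s, f n = ∑ j ∈ range J, ∑ n ∈ sj j, f n := fun f =>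
    (congrArg (fun S => ∑ n ∈ S, f n) hcover).trans (sum_biUnion hdisj)
  have hcont := fun s' => by
    have : Continuous fun t => ∑ n ∈ s', a n * chi n t := continuous_finsetSum _ fun n _ => continuous_const.mul (continuous_chi n)
    exact this.norm.pow 2
  have hint : ∀ s', Integrable (fun t => ‖∑ n ∈ s', a n * chi n t‖ ^ 2) (volume.restrict U) := fun s' =>
    integrable_of_continuous_of_bound (hcont s') ((∑ n ∈ s', ‖a n‖) ^ 2) fun t => by
      rw [norm_pow, norm_norm]
      gcongr
      exact (norm_sum_le _ _).trans (sum_le_sum fun n _ => by rw [norm_mul, norm_chi, mul_one])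
  calc ∫ t in U, ‖∑ n ∈ s, a n * chi n t‖ ^ 2 ≤ ∫ t in U, J * ∑ j ∈ range J, ‖∑ n ∈ sj j, a n * chi n t‖ ^ 2 := by
        refine integral_mono (hint s) ((integrable_finsetSum _ fun j _ => hint (sj j)).const_mul _) fun t => ?_
        rw [hsumc]
        calc _ ≤ (∑ j ∈ range J, ‖∑ n ∈ sj j, a n * chi n t‖) ^ 2 := by gcongr; exact norm_sum_le _ _
          _ ≤ (#(range J) : ℝ) * ∑ j ∈ range J, ‖∑ n ∈ sj j, a n * chi n t‖ ^ 2 := sq_sum_le_card_mul_sum_sq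
          _ = _ := by rw [card_range]
    _ = J * ∑ j ∈ range J, ∫ t in U, ‖∑ n ∈ sj j, a n * chi n t‖ ^ 2 := by
        rw [integral_const_mul, integral_finsetSum _ fun j _ => hint (sj j)]
    _ ≤ J * ∑ j ∈ range J, (200 * kap ^ 2 * (1 + log (1 + 2 * T)) * (kap ^ J * Y + (volume U).toReal * sqrt (1 + 2 * T))) * ∑ n ∈ sj j, ‖a n‖ ^ 2 := by
        gcongr with j hj
        refine (large_values (Y := kap ^ j * Y) ?_ hT (sj j) (fun n hn => ?_) a hU hUT).trans ?_
        · nlinarith [one_le_pow₀ hk.le (n := j)]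
        · have := (mem_filter.1 hn).2
          rw [pow_succ'] at this
          grind
        · refine mul_le_mul_of_nonneg_right ?_ (sum_nonneg fun _ _ => by positivity)
          gcongr
          · exact hk.le
          · exact (mem_range.1 hj).le
    _ = _ := by rw [← mul_sum, ← hsum, ← mul_assoc]

/-- The divisor bound `d(n) ≪ n^ε`. -/
theorem exists_card_divisors_le (hε : 0 < ε) :
    ∃ C : ℝ, 1 ≤ C ∧ ∀ n : ℕ, n ≠ 0 → (#n.divisors : ℝ) ≤ C * (n:ℝ) ^ ε := by
  have hl := mul_pos hε (log_pos one_lt_two)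
  set M := 1 + 1 / (ε * log 2)
  have hM1 : 1 ≤ M := le_add_of_nonneg_right (by positivity)
  set P := ⌈exp (1 / ε)⌉₊
  have hfac (p a : ℕ) (hp : p.Prime) : (a + 1) ≤ (if p < P then M else 1) * (p ^ a) ^ ε := by
    have hp0 : (0:ℝ) < p := by exact_mod_cast hp.pos
    rw [rpow_def_of_pos (by positivity), log_pow]
    refine le_trans ?_ (mul_le_mul_of_nonneg_left (add_one_le_exp _) (by split_ifs <;> positivity))
    split_ifs with h
    · have h2 : ε * log 2 ≤ ε * log p := by gcongr; exact_mod_cast hp.two_le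
      have : a ≤ (a * log p * ε + 1) / (ε * log 2) := by rw [le_div_iff₀ hl]; linarith [mul_le_mul_of_nonneg_left h2 (a.cast_nonneg (α := ℝ))]
      simp only [M, one_add_mul, one_div_mul_eq_div]
      nlinarith
    · have h1 := (le_log_iff_exp_le hp0).2 (Nat.ceil_le.1 (not_lt.1 h))
      rw [div_le_iff₀ hε] at h1
      nlinarith [mul_le_mul_of_nonneg_left h1 a.cast_nonneg]
  refine ⟨M ^ P, one_le_pow₀ hM1, fun n hn => ?_⟩
  rw [Nat.card_divisors hn]
  nth_rw 3 [← Nat.prod_factorization_pow_eq_self hn]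
  rw [Finsupp.prod, Nat.support_factorization]
  push_cast
  rw [← finsetProd_rpow _ _ fun _ _ => by positivity]
  calc _ ≤ ∏ p ∈ n.primeFactors, ((if p < P then M else 1) * (p ^ (n.factorization p)) ^ ε) :=
        prod_le_prod (fun _ _ => by positivity) fun p hp => hfac p _ (Nat.prime_of_mem_primeFactors hp)
    _ = (∏ p ∈ n.primeFactors, (if p < P then M else 1)) * _ := prod_mul_distrib
    _ ≤ _ := by
        gcongr
        rw [prod_ite, prod_const, prod_const_one, mul_one]
        refine pow_le_pow_right₀ hM1 ?_
        calc _ ≤ #(range P) := card_le_card fun p hp => by simpa using (mem_filter.1 hp).2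
          _ = P := card_range P

/-- `F` is a Dirichlet polynomial supported on `(Y₀, Y₁]` with coefficients in `[0, g]`. -/
def IsDP (F : ℝ → ℂ) (g : ℕ → ℝ) (Y₀ Y₁ : ℝ) : Prop :=
  ∃ a : ℕ → ℝ, (∀ n, 0 ≤ a n ∧ a n ≤ g n) ∧
    ∀ t, F t = ∑ n ∈ Ioc ⌊Y₀⌋₊ ⌊Y₁⌋₊, (a n : ℂ) * chi n t

theorem mem_Ioc_floor (h0 : 0 ≤ Y₀) (h1 : 0 ≤ Y₁) :
    n ∈ Ioc ⌊Y₀⌋₊ ⌊Y₁⌋₊ ↔ Y₀ < n ∧ (n:ℝ) ≤ Y₁ := by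
  rw [mem_Ioc, Nat.floor_lt h0, Nat.le_floor_iff h1]

/-- The number of elements of `B` dividing `n`. -/
noncomputable def omegaIn (B : Finset ℕ) (n : ℕ) : ℝ := (#(B.filter (· ∣ n)) : ℝ)

theorem omegaIn_nonneg (B : Finset ℕ) (n : ℕ) : 0 ≤ omegaIn B n := Nat.cast_nonneg _

theorem IsDP.continuous (h : IsDP F g Y₀ Y₁) : Continuous F := by
  obtain ⟨a, -, hF⟩ := h
  rw [(funext hF)]
  exact continuous_finsetSum _ fun n _ => continuous_const.mul (continuous_chi n)

theorem IsDP.sum {F : ℕ → ℝ → ℂ} {g' : ℕ → ℝ} {y₀ y₁ : ℕ → ℝ}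
    (hB : ∀ b ∈ B, 1 ≤ b) (hF : ∀ b ∈ B, IsDP (F b) g (y₀ b) (y₁ b))
    (hy₀ : ∀ b ∈ B, 0 ≤ y₀ b) (hy₁ : ∀ b ∈ B, 0 ≤ y₁ b) (hY₀ : 0 ≤ Y₀) (hY₁ : 0 ≤ Y₁)
    (hb₀ : ∀ b ∈ B, Y₀ ≤ b * y₀ b) (hb₁ : ∀ b ∈ B, b * y₁ b ≤ Y₁)
    (hg : ∀ b ∈ B, ∀ m, b ∣ m → g (m / b) ≤ g m) (hg' : ∀ n, omegaIn B n * g n ≤ g' n) :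
    IsDP (fun t => ∑ b ∈ B, chi b t * F b t) g' Y₀ Y₁ := by
  choose! a ha hFa using hF
  set a' := fun n => ∑ b ∈ B, if b ∣ n ∧ n / b ∈ Ioc ⌊y₀ b⌋₊ ⌊y₁ b⌋₊ then a b (n / b) else 0 with ha'
  refine ⟨a', fun n => ⟨sum_nonneg fun b hb => ?_, ?_⟩, fun t => ?_⟩
  · grind
  · refine le_trans ?_ (hg' n)
    calc a' n ≤ ∑ b ∈ B, if b ∣ n then g n else 0 := by
          refine sum_le_sum fun b hb => ?_
          have hn0 := fun h => ((ha b hb _).1.trans (ha b hb (n / b)).2).trans (hg b hb n h)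
          grind
      _ = _ := by rw [← sum_filter, sum_const, nsmul_eq_mul, omegaIn]
  · simp only [ha']
    push_cast
    simp_rw [sum_mul]
    rw [sum_comm]
    refine sum_congr rfl fun b hb => ?_
    have hb1 := hB b hb
    rw [hFa b hb, mul_sum]
    refine sum_of_injOn (fun m => b * m) (fun x _ y _ h => ?_) (fun m hm => ?_) (fun n _ hn' => ?_) (fun m hm => ?_)
    · exact Nat.eq_of_mul_eq_mul_left hb1 h
    · have hm := (mem_Ioc_floor (hy₀ b hb) (hy₁ b hb)).1 (mem_coe.1 hm)
      refine mem_coe.2 ((mem_Ioc_floor hY₀ hY₁).2 ?_)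
      have : (0:ℝ) < b := by exact_mod_cast hb1
      push_cast
      exact ⟨(hb₀ b hb).trans_lt (by nlinarith [hm.1]), le_trans (by nlinarith [hm.2]) (hb₁ b hb)⟩
    · rw [if_neg, Complex.ofReal_zero, zero_mul]
      rintro ⟨h1, h2⟩
      exact hn' ⟨n / b, mem_coe.2 h2, Nat.mul_div_cancel' h1⟩
    · have hm' := (mem_Ioc.1 hm)
      rw [if_pos ⟨Dvd.intro m rfl, by rwa [Nat.mul_div_cancel_left _ hb1]⟩, Nat.mul_div_cancel_left _ hb1]
      push_cast
      rw [chi_mul (by positivity) (Nat.cast_ne_zero.2 (by omega))]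
      ring

theorem IsDP.one : IsDP (fun _ => 1) (fun _ => 1) (1 / 2) 1 := by
  refine ⟨fun _ => 1, fun n => ⟨by norm_num, le_rfl⟩, fun t => ?_⟩
  have h1 : ⌊(1/2:ℝ)⌋₊ = 0 := by rw [Nat.floor_eq_zero]; norm_num
  rw [h1, Nat.floor_one]
  simp [chi_one]

theorem IsDP.meanValue (h : IsDP F g Y₀ Y₁) (h0 : 0 ≤ Y₀) (h1 : 0 ≤ Y₁) (hT : 0 < T) :
    ∫ t, ‖F t‖ ^ 2 * cauchyWeight T t ≤ π * (1 + 2 * Y₁ / T) * ∑ n ∈ Ioc ⌊Y₀⌋₊ ⌊Y₁⌋₊, g n ^ 2 := by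
  obtain ⟨a, ha, hF⟩ := h
  simp_rw [hF]
  refine (SmoothGaps.meanValue _ (fun n => (a n)) (Y := Y₁) hT fun n hn => ?_).trans ?_
  · have := (mem_Ioc_floor h0 h1).1 hn
    grind
  · have := pi_pos
    gcongr with n hn
    rw [Complex.norm_real, norm_of_nonneg (ha n).1]
    exact (ha n).2

theorem IsDP.large_values (h : IsDP F g Y₀ Y₁) (J : ℕ) (h0 : 1 ≤ Y₀) (h1 : 0 ≤ Y₁)
    (h01 : Y₁ ≤ kap ^ J * Y₀) (hT : 0 ≤ T) {U : Set ℝ} (hU : MeasurableSet U) (hUT : U ⊆ Set.Icc (-T) T) :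
    ∫ t in U, ‖F t‖ ^ 2 ≤ J * (200 * kap ^ 2 * (1 + log (1 + 2 * T)) * (kap ^ J * Y₀ + (volume U).toReal * sqrt (1 + 2 * T)))
      * ∑ n ∈ Ioc ⌊Y₀⌋₊ ⌊Y₁⌋₊, g n ^ 2 := by
  obtain ⟨a, ha, hF⟩ := h
  have hk := kap_pos
  have hlog : 0 ≤ log (1 + 2 * T) := log_nonneg (by linarith)
  simp_rw [hF]
  refine (large_values_multi h0 hT J _ (fun n hn => ?_) (fun n => (a n)) hU hUT).trans ?_
  · have := (mem_Ioc_floor (by linarith) h1).1 hn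
    exact ⟨this.1, this.2.trans h01⟩
  · gcongr with n hn
    rw [Complex.norm_real, norm_of_nonneg (ha n).1]
    exact (ha n).2

/-- A version of `transfer` in which only `|t| ≤ T X^e` matters. -/
theorem transfer_trunc (he : 0 < e) : ∃ c C X₀ : ℝ, 0 < c ∧ 0 < C ∧ 1 ≤ X₀ ∧
    ∀ (X T : ℝ), X₀ ≤ X → 1 ≤ T → T ≤ X → ∀ {ι : Type} (I : Finset ι) (d : ι → ℕ) (Y : ι → ℝ) (L : ℝ),
      (∀ i ∈ I, 1 ≤ d i) → (∀ i ∈ I, 0 < Y i) → (∀ i ∈ I, X ≤ d i * Y i ∧ d i * Y i ≤ exp 3 * X) →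
      0 < L → L = ∑ i ∈ I, 1 / (d i : ℝ) →
      ∀ U : Set ℝ, MeasurableSet U →
      ∫ t in Uᶜ ∩ Set.Icc (-(T * X ^ e)) (T * X ^ e), ‖famPoly I d Y t‖ ≤ c * X * L →
      ∀ H : ℝ, 2 * exp 6 * X / T ≤ H →
      volume {x : ℝ | exp 4 * X ≤ x ∧ x ≤ exp 6 * X ∧ ∀ i ∈ I, ∀ m : ℕ, Y i < m → (m : ℝ) ≤ kap * Y i →
        H < |(d i * m : ℝ) - x|} ≤ ENNReal.ofReal (C * T / (X * L ^ 2) *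
          ∫ t in U, ‖famPoly I d Y t‖ ^ 2 * cauchyWeight T t) := by
  obtain ⟨k, c, C, hk, hc, hC, hdec, htr⟩ := transfer
  set A : ℕ := ⌈3 / e⌉₊ with hA
  obtain ⟨D0, hD0, hk0⟩ := hdec 0
  obtain ⟨D2, hD2, hk2⟩ := hdec 2
  obtain ⟨D, hD, hkA⟩ := hdec (A + 2)
  have hkap := kap_pos
  set E := 5 * kap * exp 3 with hE
  refine ⟨c / (2 * D0), C, max 1 (4 * π * E * D / c), by positivity, hC, le_max_left _ _, ?_⟩
  intro X T hX hT hTX ι I d Y L hd hY hdY hL0 hL U hU hsmall H hH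
  have hX1 := (le_max_left _ _).trans hX
  have hXc := (le_max_right _ _).trans hX
  refine htr X T hX1 hT I d Y L hd hY hdY hL0 hL.le U hU ?_ H hH
  set F := famPoly I d Y
  have hFc := continuous_famPoly I d Y hY
  have hFB : ∀ t, ‖F t‖ ≤ E * X * L := fun t => by
    refine (norm_famPoly_le I d Y hY t).trans ?_
    rw [hL, mul_sum]
    refine sum_le_sum fun i hi => ?_
    rw [mul_one_div, le_div_iff₀ (by exact_mod_cast hd i hi), hE]
    nlinarith [(hdY i hi).2]
  have hT0 : 0 < T := by linarith
  have hX0 : 0 < X := by linarith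
  set f := fun t => ‖F t‖ * ‖k (t / T)‖
  have hfc : Continuous f := by fun_prop
  have hfint : Integrable f := by
    refine Integrable.mono' ((integrable_cauchyWeight hT0).const_mul (E * X * L * D2 * T)) hfc.aestronglyMeasurable
      (.of_forall fun t => ?_)
    rw [norm_of_nonneg (by positivity)]
    have h3 : ‖k (t / T)‖ ≤ D2 * (T * cauchyWeight T t) := by
      rw [cauchyWeight_eq hT0, ← mul_assoc T, mul_inv_cancel₀ hT0.ne', one_mul, ← div_eq_mul_inv, le_div_iff₀ (by positivity)]
      refine le_trans ?_ (hk2 (t / T))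
      gcongr
      nlinarith [abs_nonneg (t / T), sq_abs (t / T)]
    calc f t = ‖F t‖ * ‖k (t / T)‖ := rfl
      _ ≤ (E * X * L) * (D2 * (T * cauchyWeight T t)) := by gcongr; exact hFB t
      _ = _ := by ring
  set T1 := T * X ^ e
  have hT11 : 1 ≤ T1 := by nlinarith [one_le_rpow hX1 he.le]
  rw [← integral_inter_add_sdiff (measurableSet_Icc : MeasurableSet (Set.Icc (-T1) T1)) hfint.integrableOn]
  have p1 : ∫ t in Uᶜ ∩ Set.Icc (-T1) T1, f t ≤ c / 2 * X * L := by
    calc ∫ t in Uᶜ ∩ Set.Icc (-T1) T1, f t ≤ ∫ t in Uᶜ ∩ Set.Icc (-T1) T1, D0 * ‖F t‖ := by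
          refine setIntegral_mono hfint.integrableOn ?_ fun t => ?_
          · exact ((hFc.norm.integrableOn_Icc).mono_set Set.inter_subset_right).const_mul _
          · have := hk0 (t / T)
            rw [pow_zero, mul_one] at this
            calc f t = ‖F t‖ * ‖k (t / T)‖ := rfl
              _ ≤ _ := by rw [mul_comm D0]; gcongr
      _ = D0 * ∫ t in Uᶜ ∩ Set.Icc (-T1) T1, ‖F t‖ := integral_const_mul _ _
      _ ≤ D0 * (c / (2 * D0) * X * L) := by gcongr
      _ = _ := by field_simp
  have p2 : ∫ t in Uᶜ \ Set.Icc (-T1) T1, f t ≤ c / 2 * X * L := by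
    have hpt : ∀ t ∈ Uᶜ \ Set.Icc (-T1) T1, f t ≤ 2 * (E * X * L) * D / X * (1 + t ^ 2)⁻¹ := by
      rintro t ⟨-, ht⟩
      have ht1 : T1 < |t| := by
        grind
      have hq : X ^ e ≤ |t| / T := by rw [le_div_iff₀ hT0, mul_comm]; exact ht1.le
      have hA3 : X ^ (3:ℝ) ≤ (X ^ e) ^ A := by
        rw [← rpow_natCast, ← rpow_mul hX0.le]
        refine rpow_le_rpow_of_exponent_le hX1 ?_
        have := Nat.le_ceil (3 / e)
        rw [div_le_iff₀ he] at this
        rw [hA]; linarith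
      have h5 : X ^ (3:ℝ) * (|t| / T) ^ 2 ≤ (1 + |t / T|) ^ (A + 2) := by
        rw [abs_div, abs_of_pos hT0, pow_add]
        gcongr
        · exact hA3.trans (by gcongr; linarith)
        · linarith
      have h7 : X * (1 + t ^ 2) / 2 ≤ X ^ (3:ℝ) * (|t| / T) ^ 2 := by
        have e1 : X ^ (3:ℝ) = X ^ 3 := by norm_cast
        rw [e1, div_pow, sq_abs, ← mul_div_assoc, le_div_iff₀ (by positivity)]
        have : 1 ≤ t ^ 2 := by rw [← sq_abs]; nlinarith
        have hTX2 : T ^ 2 ≤ X ^ 2 := by gcongr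
        calc X * (1 + t ^ 2) / 2 * T ^ 2 ≤ X * t ^ 2 * X ^ 2 := by gcongr; nlinarith
          _ = _ := by ring
      have h8 : ‖k (t / T)‖ ≤ 2 * D / X * (1 + t ^ 2)⁻¹ := by
        rw [← div_eq_mul_inv, div_div, le_div_iff₀ (by positivity)]
        linarith [(mul_le_mul_of_nonneg_left h7 (norm_nonneg (k (t / T)))).trans ((mul_le_mul_of_nonneg_left h5 (norm_nonneg _)).trans (hkA _))]
      calc f t = ‖F t‖ * ‖k (t / T)‖ := rfl
        _ ≤ (E * X * L) * (2 * D / X * (1 + t ^ 2)⁻¹) := by gcongr; exact hFB t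
        _ = _ := by ring
    calc ∫ t in Uᶜ \ Set.Icc (-T1) T1, f t ≤ ∫ t in Uᶜ \ Set.Icc (-T1) T1, 2 * (E * X * L) * D / X * (1 + t ^ 2)⁻¹ :=
          setIntegral_mono_on hfint.integrableOn (integrable_inv_one_add_sq.const_mul _).integrableOn
            (hU.compl.diff measurableSet_Icc) hpt
      _ ≤ ∫ t, 2 * (E * X * L) * D / X * (1 + t ^ 2)⁻¹ :=
          setIntegral_le_integral (integrable_inv_one_add_sq.const_mul _) (.of_forall fun t => by
            simp only [Pi.zero_apply]; positivity)
      _ = 2 * E * L * D * π := by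
          rw [integral_const_mul, integral_univ_inv_one_add_sq]; field_simp
      _ ≤ _ := by
          rw [div_le_iff₀ hc] at hXc
          nlinarith
  linarith

/-- Monotone with respect to divisibility. -/
def DivMono (g : ℕ → ℝ) : Prop := ∀ ⦃a b : ℕ⦄, a ∣ b → g a ≤ g b

theorem divMono_omegaIn (B : Finset ℕ) : DivMono (omegaIn B) := fun a b h => by
  unfold omegaIn
  gcongr

theorem divMono_const (c : ℝ) : DivMono fun _ => c := fun _ _ _ => le_rfl

theorem DivMono.mul {f : ℕ → ℝ} (hf : DivMono f) (hg : DivMono g) (hf0 : ∀ n, 0 ≤ f n) (hg0 : ∀ n, 0 ≤ g n) :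
    DivMono fun n => f n * g n := fun a b h => mul_le_mul (hf h) (hg h) (hg0 a) (hf0 b)

theorem DivMono.pow {f : ℕ → ℝ} (hf : DivMono f) (hf0 : ∀ n, 0 ≤ f n) (k : ℕ) :
    DivMono fun n => f n ^ k := fun a _ h => pow_le_pow_left₀ (hf0 a) (hf h) k

theorem IsDP.mul_left {b₀ b₁ : ℝ}
    (hB : ∀ b ∈ B, 1 ≤ b ∧ b₀ ≤ b ∧ (b:ℝ) ≤ b₁) (hb₀ : 0 ≤ b₀) (hb₁ : 0 ≤ b₁)
    (hF : IsDP F g Y₀ Y₁) (hY₀ : 0 ≤ Y₀) (hY₁ : 0 ≤ Y₁) (hg : DivMono g) :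
    IsDP (fun t => (∑ b ∈ B, chi b t) * F t) (fun n => omegaIn B n * g n) (b₀ * Y₀) (b₁ * Y₁) := by
  have := IsDP.sum (B := B) (F := fun _ => F) (g := g) (g' := fun n => omegaIn B n * g n) (y₀ := fun _ => Y₀) (y₁ := fun _ => Y₁)
    (Y₀ := b₀ * Y₀) (Y₁ := b₁ * Y₁) (fun b hb => (hB b hb).1) (fun _ _ => hF) (fun _ _ => hY₀) (fun _ _ => hY₁) (by positivity) (by positivity)
    (fun b hb => mul_le_mul_of_nonneg_right (hB b hb).2.1 hY₀) (fun b hb => mul_le_mul_of_nonneg_right (hB b hb).2.2 hY₁)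
    (fun b _ m h => hg (Nat.div_dvd_of_dvd h)) (fun _ => le_rfl)
  simpa only [sum_mul] using this

theorem IsDP.pow_mul {b₀ b₁ : ℝ}
    (hB : ∀ b ∈ B, 1 ≤ b ∧ b₀ ≤ b ∧ (b:ℝ) ≤ b₁) (hb₀ : 0 ≤ b₀) (hb₁ : 0 ≤ b₁)
    (hF : IsDP F g Y₀ Y₁) (hY₀ : 0 ≤ Y₀) (hY₁ : 0 ≤ Y₁) (hg : DivMono g) (hg0 : ∀ n, 0 ≤ g n) (k : ℕ) :
    IsDP (fun t => (∑ b ∈ B, chi b t) ^ k * F t) (fun n => omegaIn B n ^ k * g n) (b₀ ^ k * Y₀) (b₁ ^ k * Y₁) := by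
  induction k with
  | zero => simpa using hF
  | succ k ih =>
    have := IsDP.mul_left hB hb₀ hb₁ ih (by positivity) (by positivity)
      (((divMono_omegaIn B).pow (omegaIn_nonneg B) k).mul hg (fun n => pow_nonneg (omegaIn_nonneg B n) k) hg0)
    grind

theorem IsDP.zsum (Y : ℝ) : IsDP (zsum Y) (fun _ => 1) Y (kap * Y) :=
  ⟨fun _ => 1, fun _ => ⟨zero_le_one, le_rfl⟩, fun t => by simp [SmoothGaps.zsum]⟩

theorem card_Ioc_floor_le (h1 : 0 ≤ Y₁) : (#(Ioc ⌊Y₀⌋₊ ⌊Y₁⌋₊) : ℝ) ≤ Y₁ := by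
  rw [Nat.card_Ioc]
  exact le_trans (by exact_mod_cast Nat.sub_le _ _) (Nat.floor_le h1)

theorem exists_sum_omegaIn_pow_le (k : ℕ) (he : 0 < e) : ∃ C : ℝ, 1 ≤ C ∧ ∀ (B : Finset ℕ) (j : ℕ), (∀ b ∈ B, 1 ≤ b) → j ≤ k →
    ∀ Y₀ Y₁ : ℝ, 0 ≤ Y₀ → 0 ≤ Y₁ → ∑ n ∈ Ioc ⌊Y₀⌋₊ ⌊Y₁⌋₊, (omegaIn B n ^ j) ^ 2 ≤ C * (Y₁ * Y₁ ^ e) := by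
  obtain ⟨C, hC, h⟩ := exists_card_divisors_le (ε := e / (2 * k + 1)) (by positivity)
  refine ⟨C ^ (2 * k), one_le_pow₀ hC, fun B j hB hj Y₀ Y₁ h0 h1 => ?_⟩
  have hterm : ∀ n ∈ Ioc ⌊Y₀⌋₊ ⌊Y₁⌋₊, (omegaIn B n ^ j) ^ 2 ≤ C ^ (2 * k) * Y₁ ^ e := by
    intro n hn
    have hn1 : (1:ℝ) ≤ n := by have := (mem_Ioc.1 hn); exact_mod_cast (by omega : 1 ≤ n)
    have hnY := ((mem_Ioc_floor h0 h1).1 hn).2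
    have hn0 : n ≠ 0 := by rintro rfl; simp at hn1; linarith
    have hle : omegaIn B n ≤ C * n ^ (e / (2 * k + 1)) := by
      refine le_trans ?_ (h n hn0)
      unfold omegaIn
      exact_mod_cast card_le_card fun c hc => Nat.mem_divisors.2 ⟨(mem_filter.1 hc).2, hn0⟩
    have hge : 1 ≤ C * n ^ (e / (2 * k + 1)) := by
      nlinarith [one_le_rpow hn1 (show 0 ≤ e / (2 * k + 1) by positivity)]
    calc (omegaIn B n ^ j) ^ 2 = omegaIn B n ^ (2 * j) := by rw [← pow_mul, mul_comm]
      _ ≤ (C * n ^ (e / (2 * k + 1))) ^ (2 * j) := pow_le_pow_left₀ (omegaIn_nonneg B n) hle _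
      _ ≤ (C * n ^ (e / (2 * k + 1))) ^ (2 * k) := by gcongr
      _ = C ^ (2 * k) * (n ^ (e / (2 * k + 1) * (2 * k : ℕ))) := by
          rw [mul_pow, rpow_mul (by linarith), rpow_natCast]
      _ ≤ C ^ (2 * k) * n ^ e := by
          gcongr
          · rw [div_mul_eq_mul_div, div_le_iff₀ (by positivity)]; push_cast; nlinarith
      _ ≤ _ := by gcongr
  calc _ ≤ ∑ n ∈ Ioc ⌊Y₀⌋₊ ⌊Y₁⌋₊, C ^ (2 * k) * Y₁ ^ e := sum_le_sum hterm
    _ = #(Ioc ⌊Y₀⌋₊ ⌊Y₁⌋₊) * (C ^ (2 * k) * Y₁ ^ e) := by rw [sum_const, nsmul_eq_mul]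
    _ ≤ Y₁ * (C ^ (2 * k) * Y₁ ^ e) := by gcongr; exact card_Ioc_floor_le h1
    _ = _ := by ring

/-- The sum of `m^{-it}` over `Y < m ≤ lam * Y`. -/
noncomputable def zlam (lam Y t : ℝ) : ℂ := ∑ m ∈ Ioc ⌊Y⌋₊ ⌊lam * Y⌋₊, chi m t

theorem continuous_zlam (lam Y : ℝ) : Continuous (zlam lam Y) :=
  continuous_finsetSum _ fun m _ => continuous_chi m

theorem norm_zlam_le (hl : 0 ≤ lam) (hY : 0 ≤ Y) (t : ℝ) : ‖zlam lam Y t‖ ≤ lam * Y := by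
  refine (norm_sum_le _ _).trans ?_
  simp only [norm_chi, sum_const, nsmul_eq_mul, mul_one]
  exact card_Ioc_floor_le (by positivity)

theorem sum_Ioc_eq_sub {a b : ℕ} (h : a ≤ b) (f : ℕ → ℂ) :
    ∑ m ∈ Ioc a b, f m = ∑ m ∈ Ioc 0 b, f m - ∑ m ∈ Ioc 0 a, f m := by
  have h0 : Ioc 0 b = Ioc 0 a ∪ Ioc a b := by grind
  have h1 : Disjoint (Ioc 0 a) (Ioc a b) := by
    simp
  rw [h0, sum_union h1]; ring

theorem zlam_telescope (hl : 1 ≤ lam) (hY : 0 ≤ Y) (t : ℝ) :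
    zlam lam Y t = zsum (lam * Y / kap) t - zsum (Y / kap) t + zlam lam (Y / kap) t := by
  have hk0 := kap_pos
  unfold zlam zsum
  rw [mul_div_cancel₀ _ hk0.ne', mul_div_cancel₀ _ hk0.ne', ← mul_div_assoc]
  have h1 : ∀ Z, 0 ≤ Z → Z / kap ≤ Z := fun Z hZ => div_le_self hZ one_lt_kap.le
  have h2 : Y ≤ lam * Y := by nlinarith
  rw [sum_Ioc_eq_sub (Nat.floor_le_floor h2), sum_Ioc_eq_sub (Nat.floor_le_floor (h1 (lam * Y) (by positivity))),
    sum_Ioc_eq_sub (Nat.floor_le_floor (h1 Y hY)), sum_Ioc_eq_sub (Nat.floor_le_floor (div_le_div_of_nonneg_right h2 hk0.le))]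
  ring

theorem norm_zlam_le_of_zsum {W : ℝ} (hl : 1 ≤ lam) (hlk : lam ≤ kap) (ha : 0 ≤ a) (hW : 0 < W)
    (h : ∀ Y, W ≤ Y → Y ≤ N → ‖zsum Y t‖ ≤ a * Y) :
    ‖zlam lam N t‖ ≤ 4 * a * N + kap ^ 2 * W ∨ N < 0 := by
  have hk0 := kap_pos
  have hk3 : 8 ≤ kap := by
    unfold kap; linarith [add_one_le_exp 7]
  have key : ∀ n, ∀ Y, 0 ≤ Y → Y ≤ N → Y ≤ kap ^ n * W → ‖zlam lam Y t‖ ≤ 4 * a * Y + kap ^ 2 * W := by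
    intro n
    induction n with
    | zero =>
      intro Y hY _ hn
      refine (norm_zlam_le (by linarith) hY t).trans ?_
      nlinarith [mul_nonneg ha hY, mul_pos hk0 hW]
    | succ n ih =>
      intro Y hY hYN hn
      by_cases hYW : Y < kap * W
      · refine (norm_zlam_le (by linarith) hY t).trans ?_
        nlinarith
      · push Not at hYW
        have h1 : W ≤ Y / kap := by rw [le_div_iff₀ hk0]; linarith
        have h2 : Y / kap ≤ lam * Y / kap := by gcongr; nlinarith
        have h3 : lam * Y / kap ≤ Y := by rw [div_le_iff₀ hk0]; nlinarith
        have e1 := h (lam * Y / kap) (h1.trans h2) (h3.trans hYN)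
        have e2 := h (Y / kap) h1 (h2.trans (h3.trans hYN))
        have e3 := ih (Y / kap) (by positivity) (h2.trans (h3.trans hYN))
          (by rw [div_le_iff₀ hk0]; calc Y ≤ _ := hn
                                        _ = _ := by rw [pow_succ]; ring)
        rw [zlam_telescope hl hY]
        have e4 : Y / kap ≤ Y / 8 := by gcongr
        calc _ ≤ ‖zsum (lam * Y / kap) t‖ + ‖zsum (Y / kap) t‖ + ‖zlam lam (Y / kap) t‖ :=
              (norm_add_le _ _).trans (by gcongr; exact norm_sub_le _ _)
          _ ≤ a * Y + a * (Y / 8) + (4 * a * (Y / 8) + kap ^ 2 * W) := by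
              linarith [mul_le_mul_of_nonneg_left e4 ha, mul_le_mul_of_nonneg_left h3 ha]
          _ ≤ _ := by nlinarith [mul_nonneg ha hY]
  by_cases hN : N < 0
  · exact Or.inr hN
  · push Not at hN
    obtain ⟨n, hn⟩ := pow_unbounded_of_one_lt (N / W) one_lt_kap
    rw [div_lt_iff₀ hW] at hn
    exact Or.inl (key n N hN le_rfl hn.le)

theorem norm_zlam_le_div (hl : 1 ≤ lam) (hlk : lam ≤ kap) (hN : 1 ≤ N) (ht : |t| ≤ N ^ (1/3:ℝ)) :
    ‖zlam lam N t‖ ≤ 200 * kap ^ 2 * N / (1 + |t|) := by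
  have hk := one_lt_kap
  have hN0 : 0 < N := by linarith
  have ht0 : 0 < 1 + |t| := by positivity
  have hN3 : 1 ≤ N ^ (1/3:ℝ) := one_le_rpow hN (by norm_num)
  have hsq : (N ^ (1/3:ℝ)) ^ 2 = N ^ (2/3:ℝ) := by rw [← rpow_natCast, ← rpow_mul hN0.le]; norm_num
  have hcube : N ^ (2/3:ℝ) * N ^ (1/3:ℝ) = N := by rw [← rpow_add hN0]; norm_num
  have h1 : ∀ Y, N ^ (2/3:ℝ) ≤ Y → Y ≤ N → ‖zsum Y t‖ ≤ 24 * kap / (1 + |t|) * Y := by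
    intro Y hY _
    have hY0 := lt_of_lt_of_le (by positivity) hY
    have hz : zsum Y t = zstar Y t + zint Y t := by unfold zstar; ring
    rw [hz]
    refine (norm_add_le _ _).trans ((add_le_add (norm_zstar_le_one_add hY0 t) (norm_zint_le hY0 t)).trans ?_)
    have : (1 + |t|) ^ 2 ≤ 4 * Y := by nlinarith
    rw [div_mul_eq_mul_div, ← le_sub_iff_add_le, ← sub_div, le_div_iff₀ ht0]
    nlinarith
  rcases norm_zlam_le_of_zsum hl hlk (by positivity) (by positivity) h1 with h | h
  · refine h.trans ?_
    have h2 : kap ^ 2 * N ^ (2/3:ℝ) ≤ 2 * kap ^ 2 * N / (1 + |t|) := by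
      rw [le_div_iff₀ ht0]
      calc kap ^ 2 * N ^ (2/3:ℝ) * (1 + |t|) ≤ kap ^ 2 * N ^ (2/3:ℝ) * (2 * N ^ (1/3:ℝ)) := by gcongr; linarith
        _ = 2 * kap ^ 2 * (N ^ (2/3:ℝ) * N ^ (1/3:ℝ)) := by ring
        _ = _ := by rw [hcube]
    calc _ ≤ 4 * (24 * kap / (1 + |t|)) * N + 2 * kap ^ 2 * N / (1 + |t|) := by gcongr
      _ = (96 * kap + 2 * kap ^ 2) * N / (1 + |t|) := by ring
      _ ≤ _ := by gcongr; nlinarith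
  · linarith

theorem exists_norm_zlam_le (K : ℝ) (hK : 0 ≤ K) : ∃ δ C : ℝ, 0 < δ ∧ δ ≤ 1/4 ∧ 0 < C ∧ ∀ lam N t : ℝ, 1 ≤ lam → lam ≤ kap → 1 ≤ N →
    N ^ (1/3:ℝ) ≤ |t| → |t| ≤ N ^ K → ‖zlam lam N t‖ ≤ C * N ^ (1 - δ) := by
  obtain ⟨δ, hδ, hδ1, C, hC, h⟩ := exists_norm_zstar_le (2 * K)
  have hk := one_lt_kap
  set δ' := min (δ / 2) (1/4) with hδ'
  have hd1 : δ' ≤ 1/4 := min_le_right _ _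
  have hd2 : δ' ≤ δ / 2 := min_le_left _ _
  refine ⟨δ', 4 * (C + 4 * kap) + kap ^ 2, (by positivity), hd1, by positivity, fun lam N t hl hlk hN ht1 ht2 => ?_⟩
  have hN0 : 0 < N := by linarith
  have h1 : ∀ Y, N ^ (1/2:ℝ) ≤ Y → Y ≤ N → ‖zsum Y t‖ ≤ (C + 4 * kap) * N ^ (-δ') * Y := by
    intro Y hY _
    have hY1 := (one_le_rpow hN (by norm_num)).trans hY
    have hY0 : 0 < Y := by linarith
    have hz : zsum Y t = zstar Y t + zint Y t := by unfold zstar; ring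
    have e1 : ‖zstar Y t‖ ≤ C * N ^ (-δ') * Y := by
      refine (h Y t hY1 (ht2.trans ?_)).trans ?_
      · calc N ^ K = (N ^ (1/2:ℝ)) ^ (2 * K) := by rw [← rpow_mul hN0.le]; ring_nf
          _ ≤ _ := by gcongr
      · rw [sub_eq_neg_add, rpow_add hY0, rpow_one, ← mul_assoc]
        gcongr
        calc Y ^ (-δ) ≤ (N ^ (1/2)) ^ (-δ) := rpow_le_rpow_of_nonpos (by positivity) hY (by linarith)
          _ = N ^ (-(δ / 2)) := by rw [← rpow_mul hN0.le]; ring_nf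
          _ ≤ _ := by gcongr
    have e2 : ‖zint Y t‖ ≤ 4 * kap * N ^ (-δ') * Y := by
      refine (norm_zint_le hY0 t).trans ?_
      rw [div_le_iff₀ (by positivity)]
      have : 1 ≤ N ^ (-δ') * (1 + |t|) := by
        calc 1 ≤ N ^ (-δ' + 1/3) := one_le_rpow hN (by linarith)
          _ = N ^ (-δ') * N ^ (1/3) := rpow_add hN0 _ _
          _ ≤ _ := by gcongr; linarith
      linarith [mul_le_mul_of_nonneg_left this (by positivity : 0 ≤ 4 * kap * Y)]
    rw [hz]
    refine (norm_add_le _ _).trans ?_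
    linarith
  have e3 : N ^ (-δ') * N = N ^ (1 - δ') := by
    rw [sub_eq_neg_add, rpow_add hN0, rpow_one]
  rcases norm_zlam_le_of_zsum hl hlk (by positivity) (by positivity) h1 with h | h
  · refine h.trans ?_
    have : N ^ (1/2:ℝ) ≤ N ^ (1 - δ') := rpow_le_rpow_of_exponent_le hN (by linarith)
    calc _ = 4 * (C + 4 * kap) * (N ^ (-δ') * N) + kap ^ 2 * N ^ (1/2:ℝ) := by ring
      _ ≤ 4 * (C + 4 * kap) * N ^ (1 - δ') + kap ^ 2 * N ^ (1 - δ') := by rw [e3]; gcongr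
      _ = _ := by ring
  · linarith

theorem exists_one_add_log_le (he : 0 < e) : ∃ C : ℝ, 0 < C ∧ ∀ X : ℝ, 1 ≤ X → 1 + log (3 * X) ≤ C * X ^ e := by
  refine ⟨1 + log 3 + 1 / e, ?_, fun X hX => ?_⟩
  · positivity
  have h0 := log_pos (show 1 < 3 by norm_num)
  have h1 := log_le_rpow_div (show 0 ≤ X by linarith) he
  have h2 := one_le_rpow hX he.le
  rw [log_mul (by norm_num) (by linarith)]
  have : X ^ e / e = 1 / e * X ^ e := by ring
  nlinarith

theorem zlam_pow_isDP (hl : 1 ≤ lam) (hN : 0 ≤ N) (k : ℕ)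
    (hF : IsDP F g Y₀ Y₁) (hY₀ : 0 ≤ Y₀) (hY₁ : 0 ≤ Y₁) (hg : DivMono g) (hg0 : ∀ n, 0 ≤ g n) :
    IsDP (fun t => zlam lam N t ^ k * F t) (fun n => omegaIn (Ioc ⌊N⌋₊ ⌊lam * N⌋₊) n ^ k * g n) (N ^ k * Y₀) ((lam * N) ^ k * Y₁) := by
  refine IsDP.pow_mul (fun b hb => ?_) hN (by positivity) hF hY₀ hY₁ hg hg0 k
  have h1 := (mem_Ioc_floor hN (by positivity)).1 hb
  grind

set_option maxHeartbeats 2000000 in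
/-- The set where the polynomial `zlam` is of size at least `N ^ (1 - v)` is small. -/
theorem level_volume (K : ℕ) (hK : 1 ≤ K) (he : 0 < e) (he1 : e ≤ 1/2) : ∃ C : ℝ, 0 < C ∧ ∀ᶠ X : ℝ in atTop,
    ∀ τ v : ℝ, 0 ≤ τ → τ ≤ 1 → 0 ≤ v → v ≤ 1/4 → ∀ U : Set ℝ, MeasurableSet U → U ⊆ Set.Icc (-(X ^ τ)) (X ^ τ) →
    (∀ t ∈ U, X ^ ((1 - v) / K) ≤ ‖zlam (exp (1 / K)) (X ^ (1 / K : ℝ)) t‖) →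
    (volume U).toReal ≤ C * X ^ (e + v * (τ / (1 - 2 * v) + 2 / K)) := by
  set f : ℝ := e / 6 with hf
  have hf0 : 0 < f := by positivity
  obtain ⟨C1, hC1, hS⟩ := exists_sum_omegaIn_pow_le (2 * K + 1) (e := f / 6) (by positivity)
  obtain ⟨C2, hC2, hlog⟩ := exists_one_add_log_le (e := f / 2) (by positivity)
  have hk := one_lt_kap
  set A : ℝ := 200 * kap ^ 2 * C2 * C1 * exp 3 * exp 3 * kap with hA
  have hA0 : 0 < A := by positivity
  refine ⟨2 * A, by positivity, ?_⟩
  have ev1 := (tendsto_rpow_atTop (show 0 < 2 * f by positivity)).eventually_ge_atTop (4 * A)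
  have ev2 := (tendsto_rpow_atTop (show 0 < 3 * f by positivity)).eventually_ge_atTop 2
  filter_upwards [ev1, ev2, eventually_ge_atTop 1] with X hX1 hX2 hX τ v hτ hτ1 hv hv1 U hU hUT hlev
  have hX0 : 0 < X := by linarith
  have hKr : (1:ℝ) ≤ K := by exact_mod_cast hK
  have hK0 : (0:ℝ) < K := by linarith
  set N := X ^ (1 / K : ℝ) with hN
  have hN1 : 1 ≤ N := one_le_rpow hX (by positivity)
  set lam := exp (1 / K) with hlam
  have hlam1 : 1 ≤ lam := one_le_exp (by positivity)
  set k : ℕ := ⌈K * (τ / 2 + 3 * f) / (1 - 2 * v)⌉₊ with hkdef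
  have h12 : 0 < 1 - 2 * v := by linarith
  have hk1 : K * (τ / 2 + 3 * f) / (1 - 2 * v) ≤ k := Nat.le_ceil _
  have hk2 : (k:ℝ) < K * (τ / 2 + 3 * f) / (1 - 2 * v) + 1 := Nat.ceil_lt_add_one (by positivity)
  have hk3 : (k:ℝ) < 2 * K + 1 := by
    refine hk2.trans_le ?_
    gcongr
    rw [div_le_iff₀ h12]
    have : τ / 2 + 3 * f ≤ 1 := by rw [hf]; linarith
    nlinarith
  have hk3' : k ≤ 2 * K := by
    have : k < 2 * K + 1 := by exact_mod_cast hk3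
    omega
  set q : ℝ := k / K with hq
  have hNk : N ^ k = X ^ q := by
    rw [hN, ← rpow_natCast, ← rpow_mul hX0.le, hq]; ring_nf
  have hq1 : τ / 2 + 3 * f ≤ q * (1 - 2 * v) := by
    rw [div_le_iff₀ h12] at hk1
    rw [hq, div_mul_eq_mul_div, le_div_iff₀ hK0]; linarith
  have hq3 : q ≤ 3 := by
    rw [hq, div_le_iff₀ hK0]
    linarith
  have hq2 : q * (2 * v) ≤ 3 * f + v * (τ / (1 - 2 * v) + 2 / K) := by
    have h1 : q ≤ (τ / 2 + 3 * f) / (1 - 2 * v) + 1 / K := by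
      rw [hq, div_le_iff₀ hK0, add_mul, one_div_mul_cancel hK0.ne']
      refine hk2.le.trans (le_of_eq ?_); ring
    have h2 := mul_le_mul_of_nonneg_right h1 (by linarith : 0 ≤ 2 * v)
    have h3 : 2 * v / (1 - 2 * v) ≤ 1 := by rw [div_le_one h12]; linarith
    have h4 := mul_le_mul_of_nonneg_left h3 (by positivity : 0 ≤ 3 * f)
    calc _ ≤ _ := h2
      _ = 3 * f * (2 * v / (1 - 2 * v)) + v * (τ / (1 - 2 * v) + 2 / K) := by field_simp; ring
      _ ≤ _ := by linarith
  have hq0 : 3 * f ≤ q := by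
    have : 0 ≤ q := by positivity
    nlinarith
  -- the large values estimate
  have hdp := zlam_pow_isDP hlam1 (by linarith : 0 ≤ N) k IsDP.one (by norm_num) (by norm_num) (divMono_const 1) (fun _ => zero_le_one)
  simp only [mul_one] at hdp
  have hlamk : lam ^ k ≤ exp 3 := by
    rw [hlam, ← exp_nat_mul, exp_le_exp, mul_one_div]; exact hq3
  have hY1 : (lam * N) ^ k ≤ exp 3 * X ^ q := by rw [mul_pow, hNk]; gcongr
  have hLV := IsDP.large_values hdp 1 (T := X ^ τ) (by
      rw [hNk]
      have := rpow_le_rpow_of_exponent_le hX hq0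
      linarith) (by positivity) (by
      rw [hNk, pow_one]
      refine hY1.trans ?_
      have : 2 * exp 3 ≤ kap := by
        unfold kap
        have : exp 7 = exp 3 * exp 4 := by rw [← exp_add]; norm_num
        rw [this]; nlinarith [exp_pos 3, add_one_le_exp 4]
      nlinarith [rpow_pos_of_pos hX0 q]) (by positivity) hU hUT
  have hsum : ∑ n ∈ Ioc ⌊N ^ k * (1/2)⌋₊ ⌊(lam * N) ^ k⌋₊, (omegaIn (Ioc ⌊N⌋₊ ⌊lam * N⌋₊) n ^ k) ^ 2 ≤
      C1 * (exp 3 * exp 3) * X ^ q * X ^ (f / 2) := by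
    refine (hS _ k (fun b hb => by have := mem_Ioc.1 hb; omega) (by omega) _ _ (by positivity) (by positivity)).trans ?_
    rw [mul_assoc, mul_assoc]
    refine mul_le_mul_of_nonneg_left ?_ (by linarith)
    have h1 : ((lam * N) ^ k) ^ (f / 6) ≤ exp 3 * X ^ (f / 2) := by
      calc ((lam * N) ^ k) ^ (f / 6) ≤ (exp 3 * X ^ q) ^ (f / 6) := by gcongr
        _ = exp 3 ^ (f / 6) * (X ^ q) ^ (f / 6) := mul_rpow (by positivity) (by positivity)
        _ ≤ exp 3 * X ^ (f / 2) := by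
          gcongr
          · calc exp 3 ^ (f / 6) ≤ exp 3 ^ (1:ℝ) :=
                rpow_le_rpow_of_exponent_le (one_le_exp (by norm_num)) (by rw [hf]; linarith)
              _ = _ := rpow_one _
          · rw [← rpow_mul hX0.le]
            exact rpow_le_rpow_of_exponent_le hX (by nlinarith)
    calc _ ≤ (exp 3 * X ^ q) * (exp 3 * X ^ (f / 2)) := by gcongr
      _ = _ := by ring
  set V := (volume U).toReal with hV
  have hV0 : 0 ≤ V := ENNReal.toReal_nonneg
  have hUf : volume U ≠ ⊤ := ne_top_of_le_ne_top (by simp) (measure_mono hUT)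
  have hfin : IsFiniteMeasure (volume.restrict U) := ⟨by rw [Measure.restrict_apply_univ]; exact lt_top_iff_ne_top.2 hUf⟩
  have hlow : V * X ^ (2 * q * (1 - v)) ≤ ∫ t in U, ‖zlam lam N t ^ k‖ ^ 2 := by
    have hint : Integrable (fun t => ‖zlam lam N t ^ k‖ ^ 2) (volume.restrict U) :=
      integrable_of_continuous_of_bound (((continuous_zlam lam N).pow k).norm.pow 2) (((lam * N) ^ k) ^ 2) fun t => by
        rw [norm_pow, norm_norm, norm_pow]
        gcongr
        exact norm_zlam_le (by linarith) (by linarith) t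
    have : ∫ t in U, X ^ (2 * q * (1 - v)) ≤ ∫ t in U, ‖zlam lam N t ^ k‖ ^ 2 := by
      refine setIntegral_mono_on (integrable_const _) hint hU fun t ht => ?_
      calc X ^ (2 * q * (1 - v)) = ((X ^ ((1 - v) / K)) ^ k) ^ 2 := by
            rw [← pow_mul, ← rpow_natCast, ← rpow_mul hX0.le, hq]; push_cast; ring_nf
        _ ≤ _ := by rw [norm_pow]; gcongr; exact hlev t ht
    rw [setIntegral_const, smul_eq_mul] at this
    exact this
  have hsqrt : sqrt (1 + 2 * X ^ τ) ≤ 2 * X ^ (τ / 2) := by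
    rw [sqrt_le_left (by positivity), mul_pow, ← rpow_natCast (X ^ (τ/2)), ← rpow_mul hX0.le]
    have := one_le_rpow hX hτ
    norm_num
    linarith
  have hlog' : 1 + log (1 + 2 * X ^ τ) ≤ C2 * X ^ (f / 2) := by
    refine le_trans ?_ (hlog X hX)
    have : X ^ τ ≤ X := by
      conv_rhs => rw [← rpow_one X]
      exact rpow_le_rpow_of_exponent_le hX hτ1
    gcongr
    linarith
  have hlogn : 0 ≤ log (1 + 2 * X ^ τ) := log_nonneg (by linarith [rpow_pos_of_pos hX0 τ])
  have hmain : V * X ^ (2 * q * (1 - v)) ≤ A * X ^ f * (X ^ q + 2 * V * X ^ (τ / 2)) * X ^ q := by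
    refine hlow.trans (hLV.trans ?_)
    rw [hNk, Nat.cast_one, one_mul, pow_one]
    calc _ ≤ 200 * kap ^ 2 * (C2 * X ^ (f / 2)) * (kap * (X ^ q * (1/2)) + V * (2 * X ^ (τ / 2))) *
          (C1 * (exp 3 * exp 3) * X ^ q * X ^ (f / 2)) := by rw [hNk] at hsum; gcongr
      _ ≤ 200 * kap ^ 2 * (C2 * X ^ (f / 2)) * (kap * (X ^ q + 2 * V * X ^ (τ / 2))) *
          (C1 * (exp 3 * exp 3) * X ^ q * X ^ (f / 2)) := by
          gcongr
          have h1 : 0 ≤ kap * X ^ q := by positivity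
          have h2 : V * (2 * X ^ (τ / 2)) * 1 ≤ V * (2 * X ^ (τ / 2)) * kap := by gcongr
          nlinarith
      _ = A * (X ^ (f / 2) * X ^ (f / 2)) * (X ^ q + 2 * V * X ^ (τ / 2)) * X ^ q := by rw [hA]; ring
      _ = _ := by rw [← rpow_add hX0]; ring_nf
  have h1 : A * X ^ f * (2 * V * X ^ (τ / 2)) * X ^ q ≤ V * X ^ (2 * q * (1 - v)) / 2 := by
    have e1 : X ^ f * X ^ (τ / 2) * X ^ q * X ^ (2 * f) ≤ X ^ (2 * q * (1 - v)) := by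
      rw [← rpow_add hX0, ← rpow_add hX0, ← rpow_add hX0]
      exact rpow_le_rpow_of_exponent_le hX (by linarith)
    have e2 : X ^ f * X ^ (τ / 2) * X ^ q * (4 * A) ≤ X ^ (2 * q * (1 - v)) := le_trans (by gcongr) e1
    have := mul_le_mul_of_nonneg_left e2 hV0
    linarith
  have h2 : V * X ^ (2 * q * (1 - v)) ≤ 2 * A * X ^ f * X ^ q * X ^ q := by linarith
  have e3 : X ^ (2 * q * (1 - v)) * X ^ (2 * q * v) = X ^ q * X ^ q := by
    rw [← rpow_add hX0, ← rpow_add hX0]; ring_nf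
  have h3 : V ≤ 2 * A * (X ^ f * X ^ (2 * q * v)) := by
    refine le_of_mul_le_mul_right ?_ (rpow_pos_of_pos hX0 (2 * q * (1 - v)))
    calc _ ≤ _ := h2
      _ = 2 * A * X ^ f * (X ^ q * X ^ q) := by ring
      _ = _ := by rw [← e3]; ring
  refine h3.trans ?_
  gcongr
  rw [← rpow_add hX0]
  exact rpow_le_rpow_of_exponent_le hX (by rw [hf] at *; linarith)

theorem integral_inv_one_add_abs_sq_le (hT : 0 < T) : ∫ t, (1 / (1 + |t|)) ^ 2 * cauchyWeight T t ≤ π / T := by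
  calc ∫ t, (1 / (1 + |t|)) ^ 2 * cauchyWeight T t ≤ ∫ t, 1 / T * (1 + t ^ 2)⁻¹ := by
        refine integral_mono_of_nonneg (.of_forall fun t => ?_) (integrable_inv_one_add_sq.const_mul _)
          (.of_forall fun t => ?_)
        · have := cauchyWeight_nonneg hT t
          simp only [Pi.zero_apply]; positivity
        · simp only
          rw [mul_comm]
          have h1 := cauchyWeight_le hT t
          gcongr
          rw [div_pow, one_pow, one_div]
          gcongr
          nlinarith [abs_nonneg t, sq_abs t]
    _ = _ := by rw [integral_const_mul, integral_univ_inv_one_add_sq]; ring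

set_option maxHeartbeats 1000000 in
theorem low_class (K : ℕ) (hK : 4 ≤ K) (he : 0 < e) (he1 : e ≤ 1) : ∃ C : ℝ, 0 < C ∧ ∀ X h : ℝ, 1 ≤ X → 0 ≤ h → h ≤ 7/10 →
    ∀ U : Set ℝ, MeasurableSet U → (∀ t ∈ U, ‖zlam (exp (1 / K)) (X ^ (1 / K : ℝ)) t‖ ≤ X ^ (3 / (4 * K) : ℝ)) →
    ∫ t in U, ‖zlam (exp (1 / K)) (X ^ (1 / K : ℝ)) t ^ (K - 1) * zstar (X ^ (1 / K : ℝ)) t‖ ^ 2 *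
      cauchyWeight (2 * exp 6 * X ^ (1 - h)) t ≤ C * X ^ (1 + h / 2 + 1 / K + e) := by
  obtain ⟨C1, hC1, hS⟩ := exists_sum_omegaIn_pow_le K (e := e) he
  have hk := one_lt_kap
  set A := π * (1 + 2 * (exp 1 * kap)) * (C1 * ((exp 1 * kap) * (exp 1 * kap))) with hA
  set A2 := (exp 1) ^ 2 * (16 * kap ^ 2 * π) with hA2
  refine ⟨2 * (A + A2), by positivity, fun X h hX hh hh1 U hU hlow => ?_⟩
  have hX0 : 0 < X := by linarith
  have hKr : (4:ℝ) ≤ K := by exact_mod_cast hK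
  have hK0 : (0:ℝ) < K := by linarith
  set N := X ^ (1 / K : ℝ) with hN
  have hN1 : 1 ≤ N := one_le_rpow hX (by positivity)
  have hN0 : 0 < N := by linarith
  set lam := exp (1 / K) with hlam
  have hlam1 : 1 ≤ lam := one_le_exp (by positivity)
  set T := 2 * exp 6 * X ^ (1 - h) with hT
  have hXh : 1 ≤ X ^ (1 - h) := one_le_rpow hX (by linarith)
  have hTX : X ^ (1 - h) ≤ T := by
    have : 1 ≤ exp 6 := one_le_exp (by norm_num)
    rw [hT]; nlinarith
  have hT0 : 0 < T := by linarith
  set a := ⌊h * K⌋₊ with ha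
  have ha1 : (a:ℝ) ≤ h * K := Nat.floor_le (by positivity)
  have ha2 : h * K < a + 1 := Nat.lt_floor_add_one _
  have haK : a ≤ K - 1 := by
    have : (a:ℝ) < K := by nlinarith
    have : a < K := by exact_mod_cast this
    omega
  set b := K - 1 - a with hb
  have hbr : (b:ℝ) = K - 1 - a := by rw [hb, Nat.cast_sub haK, Nat.cast_sub (by omega)]; norm_num
  have hab : a + b = K - 1 := by omega
  set r : ℝ := a / K with hr
  have hr1 : r ≤ h := by rw [hr, div_le_iff₀ hK0]; exact ha1
  have hr2 : h ≤ r + 1 / K := by rw [hr, ← add_div, le_div_iff₀ hK0]; exact ha2.le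
  have hpowN : ∀ m : ℕ, N ^ m = X ^ (m / K : ℝ) := fun m => by
    rw [hN, ← rpow_natCast, ← rpow_mul hX0.le]; ring_nf
  have hlamb : lam ^ b ≤ exp 1 := by
    rw [hlam, ← exp_nat_mul, exp_le_exp, mul_one_div, div_le_one hK0, hbr]
    grind
  -- the mean value bound for the main part
  have hdp := zlam_pow_isDP hlam1 hN0.le b (IsDP.zsum N) (by linarith) (by positivity) (divMono_const 1) (fun _ => zero_le_one)
  simp only [mul_one] at hdp
  set Y₁ := (lam * N) ^ b * (kap * N) with hY₁
  have hY1 : Y₁ ≤ exp 1 * kap * X ^ (1 - r) := by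
    calc Y₁ = lam ^ b * kap * (N ^ b * N ^ 1) := by rw [hY₁, mul_pow]; ring
      _ = lam ^ b * kap * X ^ (1 - r) := by
        rw [hpowN, hpowN, ← rpow_add hX0, hbr, hr]; congr 2; push_cast; field_simp; ring
      _ ≤ _ := by gcongr
  have hY10 : 0 ≤ Y₁ := by positivity
  have hMV := IsDP.meanValue hdp (by positivity) hY10 hT0
  have hsum := hS (Ioc ⌊N⌋₊ ⌊lam * N⌋₊) b (fun b hb => by have := mem_Ioc.1 hb; omega) (by omega) (N ^ b * N) Y₁ (by positivity) hY10
  have hek : 1 ≤ exp 1 * kap := by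
    have := one_le_exp (show (0:ℝ) ≤ 1 by norm_num)
    nlinarith
  have hYe : Y₁ ^ e ≤ exp 1 * kap * X ^ e := by
    calc Y₁ ^ e ≤ (exp 1 * kap * X ^ (1 - r)) ^ e := by gcongr
      _ = (exp 1 * kap) ^ e * (X ^ (1 - r)) ^ e := mul_rpow (by positivity) (by positivity)
      _ ≤ (exp 1 * kap) * X ^ e := by
        gcongr
        · calc _ ≤ (exp 1 * kap) ^ (1:ℝ) := rpow_le_rpow_of_exponent_le hek he1
            _ = _ := rpow_one _
        · conv_rhs => rw [← rpow_one X]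
          refine rpow_le_rpow_of_exponent_le hX ?_
          have : 0 ≤ r := by positivity
          linarith
  have hYT : 2 * Y₁ / T ≤ 2 * (exp 1 * kap) * X ^ (1 / K : ℝ) := by
    rw [div_le_iff₀ hT0]
    calc 2 * Y₁ ≤ 2 * (exp 1 * kap * X ^ (1 - r)) := by gcongr
      _ ≤ 2 * (exp 1 * kap * (X ^ (1 / K : ℝ) * X ^ (1 - h))) := by
        gcongr
        rw [← rpow_add hX0]
        exact rpow_le_rpow_of_exponent_le hX (by linarith)
      _ ≤ 2 * (exp 1 * kap * (X ^ (1 / K : ℝ) * T)) := by gcongr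
      _ = _ := by ring
  have hpart1 : ∫ t, ‖zlam lam N t ^ b * zsum N t‖ ^ 2 * cauchyWeight T t ≤ A * X ^ (1 - r + 1 / K + e) := by
    refine hMV.trans ?_
    calc _ ≤ π * (X ^ (1 / K : ℝ) + 2 * (exp 1 * kap) * X ^ (1 / K : ℝ)) *
          (C1 * ((exp 1 * kap * X ^ (1 - r)) * (exp 1 * kap * X ^ e))) := by
          gcongr
          exact hsum.trans (by gcongr)
      _ = A * (X ^ (1 - r) * X ^ (1 / K : ℝ) * X ^ e) := by rw [hA]; ring
      _ = _ := by rw [← rpow_add hX0, ← rpow_add hX0]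
  have hpart2 : ∫ t, (‖zint N t‖) ^ 2 * cauchyWeight T t ≤ 16 * kap ^ 2 * π * (N ^ 2 / T) := by
    calc ∫ t, (‖zint N t‖) ^ 2 * cauchyWeight T t ≤ ∫ t, (4 * kap * N) ^ 2 * ((1 / (1 + |t|)) ^ 2 * cauchyWeight T t) := by
          refine integral_mono_of_nonneg (.of_forall fun t => ?_) ?_ (.of_forall fun t => ?_)
          · have := cauchyWeight_nonneg hT0 t
            simp only [Pi.zero_apply]; positivity
          · refine Integrable.const_mul ?_ _
            refine Integrable.mono' (integrable_cauchyWeight hT0) ?_ (.of_forall fun t => ?_)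
            · have hc : Continuous fun v : ℝ => 1 / (1 + |v|) := Continuous.div (by fun_prop) (by fun_prop) (fun v => by positivity)
              exact ((hc.pow 2).mul (continuous_cauchyWeight hT0)).aestronglyMeasurable
            · have h0 := cauchyWeight_nonneg hT0 t
              rw [norm_of_nonneg (by positivity)]
              refine mul_le_of_le_one_left h0 (pow_le_one₀ (by positivity) ?_)
              rw [div_le_one (by positivity)]; linarith [abs_nonneg t]
          · simp only
            rw [← mul_assoc, ← mul_pow, mul_one_div]
            have h0 := cauchyWeight_nonneg hT0 t
            gcongr
            exact norm_zint_le hN0 t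
      _ ≤ (4 * kap * N) ^ 2 * (π / T) := by
          rw [integral_const_mul]
          gcongr
          exact integral_inv_one_add_abs_sq_le hT0
      _ = _ := by ring
  have hcw : ∀ t, 0 ≤ cauchyWeight T t := cauchyWeight_nonneg hT0
  have hbound : ∀ (f : ℝ → ℂ) (B : ℝ), Continuous f → (∀ t, ‖f t‖ ≤ B) → Integrable fun t => ‖f t‖ ^ 2 * cauchyWeight T t := by
    intro f B hf hB
    refine Integrable.mono' ((integrable_cauchyWeight hT0).const_mul (B ^ 2)) ((hf.norm.pow 2).mul (continuous_cauchyWeight hT0)).aestronglyMeasurable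
      (.of_forall fun t => ?_)
    have h0 := hcw t
    rw [norm_of_nonneg (by positivity)]
    gcongr
    exact hB t
  have hzl : ∀ t, ‖zlam lam N t‖ ≤ lam * N := norm_zlam_le (by linarith) hN0.le
  have i1 := hbound (fun t => zlam lam N t ^ b * zsum N t) ((lam * N) ^ b * (kap * N))
    (((continuous_zlam lam N).pow b).mul (continuous_zsum N)) fun t => by
      rw [norm_mul, norm_pow]; gcongr; exacts [hzl t, norm_zsum_le hN0 t]
  have i2 := hbound (zint N) (4 * kap * N) (continuous_zint hN0) fun t => norm_zint_le' hN0 t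
  set G : ℝ → ℝ := fun t => 2 * X ^ (3 / 2 * r) * (‖zlam lam N t ^ b * zsum N t‖ ^ 2 * cauchyWeight T t +
    (exp 1) ^ 2 * N ^ (2 * b) * (‖zint N t‖ ^ 2 * cauchyWeight T t)) with hG
  have hGint : Integrable G := (i1.add (i2.const_mul _)).const_mul _
  have hGnn : ∀ t, 0 ≤ G t := fun t => by have := hcw t; simp only [hG]; positivity
  have hpt : ∀ t ∈ U, ‖zlam lam N t ^ (K - 1) * zstar N t‖ ^ 2 * cauchyWeight T t ≤ G t := by
    intro t ht
    have h1 : ‖zlam lam N t ^ a‖ ^ 2 ≤ X ^ (3 / 2 * r) := by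
      calc ‖zlam lam N t ^ a‖ ^ 2 ≤ ((X ^ (3 / (4 * K) : ℝ)) ^ a) ^ 2 := by rw [norm_pow]; gcongr; exact hlow t ht
        _ = _ := by
          rw [← pow_mul, ← rpow_natCast, ← rpow_mul hX0.le, hr]; congr 1; push_cast; field_simp; ring
    have h2 : ‖zlam lam N t ^ b * zstar N t‖ ^ 2 ≤ 2 * (‖zlam lam N t ^ b * zsum N t‖ ^ 2 + (exp 1) ^ 2 * N ^ (2 * b) * ‖zint N t‖ ^ 2) := by
      have e1 : zlam lam N t ^ b * zstar N t = zlam lam N t ^ b * zsum N t - zlam lam N t ^ b * zint N t := by unfold zstar; ring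
      have e2 : ‖zlam lam N t ^ b * zint N t‖ ^ 2 ≤ (exp 1) ^ 2 * N ^ (2 * b) * ‖zint N t‖ ^ 2 := by
        rw [norm_mul, mul_pow, norm_pow]
        gcongr
        calc (‖zlam lam N t‖ ^ b) ^ 2 ≤ ((lam * N) ^ b) ^ 2 := by gcongr; exact hzl t
          _ = (lam ^ b) ^ 2 * N ^ (2 * b) := by rw [mul_pow, mul_pow, ← pow_mul N, mul_comm b 2]
          _ ≤ _ := by gcongr
      rw [e1]
      have e3 := norm_sub_le (zlam lam N t ^ b * zsum N t) (zlam lam N t ^ b * zint N t)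
      have e4 := add_sq_le (a := ‖zlam lam N t ^ b * zsum N t‖) (b := ‖zlam lam N t ^ b * zint N t‖)
      have e5 := pow_le_pow_left₀ (norm_nonneg _) e3 2
      linarith
    have h0 := hcw t
    have e6 : ‖zlam lam N t ^ (K - 1) * zstar N t‖ ^ 2 = ‖zlam lam N t ^ a‖ ^ 2 * ‖zlam lam N t ^ b * zstar N t‖ ^ 2 := by
      rw [← mul_pow, ← norm_mul, ← hab, pow_add, mul_assoc]
    rw [e6]
    calc _ ≤ X ^ (3 / 2 * r) * (2 * (‖zlam lam N t ^ b * zsum N t‖ ^ 2 + (exp 1) ^ 2 * N ^ (2 * b) * ‖zint N t‖ ^ 2)) * cauchyWeight T t := by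
          gcongr
      _ = G t := by simp only [hG]; ring
  have hFc : Continuous fun t => zlam lam N t ^ (K - 1) * zstar N t := ((continuous_zlam lam N).pow _).mul (continuous_zstar hN0)
  have i3 := hbound (fun t => zlam lam N t ^ (K - 1) * zstar N t) ((lam * N) ^ (K - 1) * (5 * kap * N)) hFc fun t => by
      rw [norm_mul, norm_pow]; gcongr; exacts [hzl t, norm_zstar_le hN0 t]
  have hNb : X ^ (3 / 2 * r) * (N ^ (2 * b) * (N ^ 2 / T)) ≤ X ^ (1 + h / 2 + 1 / K + e) := by
    rw [show X ^ (3 / 2 * r) * (N ^ (2 * b) * (N ^ 2 / T)) = X ^ (3 / 2 * r) * (N ^ (2 * b) * N ^ 2) / T by ring,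
      div_le_iff₀ hT0]
    calc X ^ (3 / 2 * r) * (N ^ (2 * b) * N ^ 2) = X ^ (2 - r / 2) := by
          rw [hpowN, hpowN, ← rpow_add hX0, ← rpow_add hX0, hr]; congr 1; push_cast; rw [hbr]; field_simp; ring
      _ ≤ X ^ (1 + h / 2 + 1 / K + e) * X ^ (1 - h) := by
          rw [← rpow_add hX0]
          refine rpow_le_rpow_of_exponent_le hX ?_
          grind
      _ ≤ _ := by gcongr
  calc _ ≤ ∫ t in U, G t := setIntegral_mono_on i3.integrableOn hGint.integrableOn hU hpt
    _ ≤ ∫ t, G t := setIntegral_le_integral hGint (.of_forall hGnn)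
    _ = 2 * X ^ (3 / 2 * r) * ((∫ t, ‖zlam lam N t ^ b * zsum N t‖ ^ 2 * cauchyWeight T t) +
        (exp 1) ^ 2 * N ^ (2 * b) * ∫ t, ‖zint N t‖ ^ 2 * cauchyWeight T t) := by
        simp only [hG]
        rw [integral_const_mul, integral_add i1 (i2.const_mul _), integral_const_mul]
    _ ≤ 2 * X ^ (3 / 2 * r) * (A * X ^ (1 - r + 1 / K + e) + (exp 1) ^ 2 * N ^ (2 * b) * (16 * kap ^ 2 * π * (N ^ 2 / T))) := by
        gcongr
    _ = 2 * (A * (X ^ (3 / 2 * r) * X ^ (1 - r + 1 / K + e)) + A2 * (X ^ (3 / 2 * r) * (N ^ (2 * b) * (N ^ 2 / T)))) := by rw [hA2]; ring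
    _ ≤ 2 * (A * X ^ (1 + h / 2 + 1 / K + e) + A2 * X ^ (1 + h / 2 + 1 / K + e)) := by
        gcongr
        rw [← rpow_add hX0]
        exact rpow_le_rpow_of_exponent_le hX (by linarith)
    _ = _ := by ring

theorem setIntegral_le_sum_of_subset {ι : Type*} {s : Finset ι} {S : Set ℝ} {V : ι → Set ℝ} {f : ℝ → ℝ} (hS : MeasurableSet S)
    (hV : ∀ i ∈ s, MeasurableSet (V i)) (hsub : ∀ t ∈ S, ∃ i ∈ s, t ∈ V i) (hf : ∀ t, 0 ≤ f t)
    (hfS : IntegrableOn f S) (hfi : ∀ i ∈ s, IntegrableOn f (V i)) :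
    ∫ t in S, f t ≤ ∑ i ∈ s, ∫ t in V i, f t := by
  rw [← integral_indicator hS]
  have : ∀ i ∈ s, ∫ t in V i, f t = ∫ t, (V i).indicator f t := fun i hi => (integral_indicator (hV i hi)).symm
  rw [sum_congr rfl this, ← integral_finsetSum _ fun i hi => (integrable_indicator_iff (hV i hi)).2 (hfi i hi)]
  refine integral_mono ((integrable_indicator_iff hS).2 hfS)
    (integrable_finsetSum _ fun i hi => (integrable_indicator_iff (hV i hi)).2 (hfi i hi)) fun t => ?_
  have hnn : ∀ i ∈ s, 0 ≤ (V i).indicator f t := fun i _ => Set.indicator_nonneg (fun t _ => hf t) t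
  by_cases ht : t ∈ S
  · obtain ⟨i, hi, hti⟩ := hsub t ht
    calc S.indicator f t = (V i).indicator f t := by simp_all
      _ ≤ _ := single_le_sum hnn hi
  · simp only [Set.indicator_of_notMem ht]
    exact sum_nonneg hnn

theorem chi_prod {ι : Type*} (s : Finset ι) (f : ι → ℕ) (hf : ∀ i ∈ s, f i ≠ 0) (t : ℝ) :
    chi ((∏ i ∈ s, f i : ℕ) : ℝ) t = ∏ i ∈ s, chi (f i) t := by
  induction s using Finset.induction_on with
  | empty => simp [chi_one]
  | insert a s ha ih =>
    rw [prod_insert ha, prod_insert ha, Nat.cast_mul, chi_mul, ih fun i hi => hf i (mem_insert_of_mem hi)]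
    · simp_all
    · exact_mod_cast prod_ne_zero_iff.2 fun i hi => hf i (mem_insert_of_mem hi)

theorem sum_piFinset_const {R : Type*} [CommSemiring R] (B : Finset ℕ) (k : ℕ) (f : ℕ → R) :
    ∑ i ∈ Fintype.piFinset (fun _ : Fin k => B), ∏ j, f (i j) = (∑ b ∈ B, f b) ^ k := by
  rw [← Finset.prod_univ_sum (fun _ : Fin k => B) (fun _ b => f b)]
  simp

theorem famPoly_piFinset (hB : ∀ b ∈ B, b ≠ 0) (k : ℕ) (N t : ℝ) :
    famPoly (Fintype.piFinset fun _ : Fin k => B) (fun i => ∏ j, i j) (fun _ => N) t = (∑ b ∈ B, chi b t) ^ k * zstar N t := by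
  unfold famPoly
  rw [← sum_mul, ← sum_piFinset_const B k (fun b => chi b t)]
  congr 1
  refine sum_congr rfl fun i hi => chi_prod _ _ (fun j _ => hB _ (Fintype.mem_piFinset.1 hi j)) t

theorem sum_inv_Ioc_floor_ge (hl : 1 < lam) (hN : 2 / (lam - 1) ≤ N) :
    (lam - 1) / (2 * lam) ≤ ∑ b ∈ Ioc ⌊N⌋₊ ⌊lam * N⌋₊, 1 / (b : ℝ) := by
  have h1 : 0 < lam - 1 := by linarith
  have hN0 : 0 < N := lt_of_lt_of_le (by positivity) hN
  rw [div_le_iff₀ h1] at hN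
  have h2 : ∀ b ∈ Ioc ⌊N⌋₊ ⌊lam * N⌋₊, 1 / (lam * N) ≤ 1 / (b : ℝ) := fun b hb => by
    have := (mem_Ioc_floor hN0.le (by positivity)).1 hb
    exact one_div_le_one_div_of_le (by linarith [this.1]) this.2
  have h3 := card_nsmul_le_sum _ _ _ h2
  rw [Nat.card_Ioc, nsmul_eq_mul] at h3
  refine le_trans ?_ h3
  have h4 : (⌊N⌋₊ : ℝ) ≤ N := Nat.floor_le hN0.le
  have h5 := Nat.lt_floor_add_one (lam * N)
  have h6 : ⌊N⌋₊ ≤ ⌊lam * N⌋₊ := Nat.floor_le_floor (by nlinarith)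
  rw [Nat.cast_sub h6, mul_one_div, div_le_div_iff₀ (by positivity) (by positivity)]
  nlinarith

theorem setIntegral_small_le (K : ℕ) (hK : 4 ≤ K) : ∃ C : ℝ, 0 < C ∧ ∀ lam N : ℝ, 1 ≤ lam → lam ≤ kap → 1 ≤ N →
    ∫ t in {t : ℝ | |t| ≤ N ^ (1/3:ℝ)}, ‖zlam lam N t ^ (K - 1) * zstar N t‖ ≤ C * N ^ (K - 1) := by
  have hk := one_lt_kap
  refine ⟨(200 * kap ^ 2) ^ (K - 1) * (5 * kap) * (2 * π), by positivity, fun lam N hl hlk hN => ?_⟩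
  have hN0 : 0 < N := by linarith
  have hm : MeasurableSet {t : ℝ | |t| ≤ N ^ (1/3:ℝ)} := (isClosed_le continuous_abs continuous_const).measurableSet
  calc _ ≤ ∫ t in {t : ℝ | |t| ≤ N ^ (1/3:ℝ)}, (200 * kap ^ 2) ^ (K - 1) * (5 * kap) * N ^ (K - 1) * (2 * (1 + t ^ 2)⁻¹) := by
        refine setIntegral_mono_on ?_ ?_ hm fun t ht => ?_
        · have hfc : Continuous fun t => ‖zlam lam N t ^ (K - 1) * zstar N t‖ := (((continuous_zlam lam N).pow _).mul (continuous_zstar hN0)).norm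
          have : {t : ℝ | |t| ≤ N ^ (1/3:ℝ)} = Set.Icc (-(N ^ (1/3:ℝ))) (N ^ (1/3:ℝ)) := by grind
          rw [this]
          exact hfc.integrableOn_Icc
        · exact ((integrable_inv_one_add_sq.const_mul _).const_mul _).integrableOn
        · have h1 := norm_zlam_le_div hl hlk hN ht
          have h2 := norm_zstar_le_one_add hN0 t
          have h3 : 1 ≤ 1 + |t| := by linarith [abs_nonneg t]
          have h4 : (1 + |t|) / (1 + |t|) ^ (K - 1) ≤ 2 * (1 + t ^ 2)⁻¹ := by
            rw [← div_eq_mul_inv, div_le_div_iff₀ (by positivity) (by positivity)]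
            calc (1 + |t|) * (1 + t ^ 2) ≤ 2 * (1 + |t|) ^ 3 := by
                  rw [← sq_abs]; nlinarith
              _ ≤ _ := by gcongr; omega
          rw [norm_mul, norm_pow]
          calc _ ≤ (200 * kap ^ 2 * N / (1 + |t|)) ^ (K - 1) * (5 * kap * (1 + |t|)) := by gcongr
            _ = (200 * kap ^ 2) ^ (K - 1) * (5 * kap) * N ^ (K - 1) * ((1 + |t|) / (1 + |t|) ^ (K - 1)) := by
              rw [div_pow, mul_pow]; ring
            _ ≤ _ := by gcongr
    _ ≤ ∫ t, (200 * kap ^ 2) ^ (K - 1) * (5 * kap) * N ^ (K - 1) * (2 * (1 + t ^ 2)⁻¹) :=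
        setIntegral_le_integral ((integrable_inv_one_add_sq.const_mul _).const_mul _) (.of_forall fun t => by
          simp only [Pi.zero_apply]; positivity)
    _ = _ := by rw [integral_const_mul, integral_const_mul, integral_univ_inv_one_add_sq]; ring

theorem level_exponent_off (hK : 0 < K) {h : ℝ} (he : 0 < e) (heK : 4 * e ≤ 1 / K) (heη : e + η ≤ 4 * δ / K) (hη : 0 ≤ η)
    (hδ : δ / 2 ≤ v) (hv0 : 0 ≤ v) (hv : v ≤ 1/4) (hvh : 2 * v ≤ h - 20 / K) :
    e + v * ((1 - h + 2 * e) / (1 - 2 * v) + 2 / K) + (1 - (v - η) * (1 - 1 / K)) ≤ 1 - 4 * δ / K := by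
  have hK1 : 0 ≤ 1 / K := by positivity
  have h1 : (1 - h + 2 * e) / (1 - 2 * v) ≤ 1 - 20 * (1 / K) + 4 * e := by
    rw [div_le_iff₀ (by linarith)]
    have : 20 / K = 20 * (1 / K) := by ring
    nlinarith
  have e2 : 2 / K = 2 * (1 / K) := by ring
  have e3 : 4 * δ / K = 4 * δ * (1 / K) := by ring
  rw [e3] at heη ⊢
  rw [e2]
  have h2 := mul_le_mul_of_nonneg_left h1 hv0
  have h3 := mul_le_mul_of_nonneg_left heK hv0
  have h4 := mul_le_mul_of_nonneg_right hδ hK1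
  nlinarith [mul_nonneg hη hK1]

theorem level_exponent_on (hK : 0 < K) {h : ℝ} (he : 0 < e) (heη : 2 * e + 2 * η ≤ 1 / K) (hη : 0 ≤ η)
    (hv0 : 0 ≤ v) (hv : v ≤ 1/4) (hvh : h - 20 / K ≤ 2 * v) :
    e + v * ((1 - h + 2 * e) / (1 - 2 * v) + 2 / K) - (1 - h) + 2 * (1 - (v - η) * (1 - 1 / K)) ≤ 1 + h / 2 + 12 / K := by
  have hK1 : 0 ≤ 1 / K := by positivity
  have e2 : 2 / K = 2 * (1 / K) := by ring
  have e3 : 12 / K = 12 * (1 / K) := by ring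
  have e4 : 20 / K = 20 * (1 / K) := by ring
  rw [e2, e3]; rw [e4] at hvh
  have h1 : v * ((1 - h + 2 * e) / (1 - 2 * v)) ≤ 2 * v - h / 2 + 10 * (1 / K) + e := by
    rw [← mul_div_assoc, div_le_iff₀ (by linarith)]
    have : (4 * v - 1) * (v - h / 2) ≤ (1 - 4 * v) * (10 * (1 / K)) := by nlinarith
    nlinarith [mul_nonneg hv0 he.le, mul_nonneg hv0 hK1]
  nlinarith [mul_nonneg hη hK1, mul_nonneg hv0 hK1]

set_option maxHeartbeats 4000000 in
theorem exists_level_splitting (K : ℕ) (hK : 4 ≤ K) (hε : 0 < ε) : ∃ e C : ℝ, 0 < e ∧ 0 < C ∧ ∀ c : ℝ, 0 < c →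
    ∀ᶠ X : ℝ in atTop, ∀ h : ℝ, ε ≤ h → h ≤ 7/10 → ∃ U : Set ℝ, MeasurableSet U ∧
    ∫ t in Uᶜ ∩ Set.Icc (-(2 * exp 6 * X ^ (1 - h) * X ^ e)) (2 * exp 6 * X ^ (1 - h) * X ^ e),
      ‖zlam (exp (1 / K)) (X ^ (1 / K : ℝ)) t ^ (K - 1) * zstar (X ^ (1 / K : ℝ)) t‖ ≤ c * X ∧
    ∫ t in U, ‖zlam (exp (1 / K)) (X ^ (1 / K : ℝ)) t ^ (K - 1) * zstar (X ^ (1 / K : ℝ)) t‖ ^ 2 *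
      cauchyWeight (2 * exp 6 * X ^ (1 - h)) t ≤ C * X ^ (1 + h / 2 + 12 / K) := by
  have hk := one_lt_kap
  have hKr : (4:ℝ) ≤ K := by exact_mod_cast hK
  have hK0 : (0:ℝ) < K := by linarith
  have hKi : 0 < 1 / (K:ℝ) := by positivity
  obtain ⟨δ, C0, hδ, hδ1, hC0, hZ⟩ := exists_norm_zlam_le K hK0.le
  set M : ℕ := ⌈2 * K / δ⌉₊ with hM
  have hMr : 2 * K / δ ≤ M := Nat.le_ceil _
  have hM0 : (0:ℝ) < M := by positivity
  set η : ℝ := 1 / (4 * M) with hη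
  have hη0 : 0 < η := by positivity
  have hηδ : η ≤ δ / (8 * K) := by
    rw [hη, div_le_div_iff₀ (by positivity) (by positivity)]
    rw [div_le_iff₀ hδ] at hMr
    linarith
  have hMη : M * η = 1 / 4 := by rw [hη]; field_simp
  set e : ℝ := min (ε / 2) (δ / (8 * K)) with he
  have he0 : 0 < e := by positivity
  have heε : 2 * e ≤ ε := by grind
  have heδ : e ≤ δ / (8 * K) := min_le_right _ _
  have hδK : δ / (8 * K) = δ * (1 / K) / 8 := by field_simp
  have hδK' : 4 * δ / K = 4 * (δ * (1 / K)) := by ring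
  have hδK2 : δ * (1 / K) ≤ 1 / 4 * (1 / K) := by gcongr
  have hK4 : 1 / (K:ℝ) ≤ 1 / 4 := by gcongr
  rw [hδK] at hηδ heδ
  obtain ⟨C1, hC1, hlev⟩ := level_volume K (by omega) he0 (by linarith)
  obtain ⟨C2, hC2, hsmall⟩ := setIntegral_small_le K hK
  obtain ⟨C3, hC3, hlow⟩ := low_class K hK he0 (by linarith)
  refine ⟨e, C3 + (M + 1) * ((5 * kap) ^ 2 * C1), he0, by positivity, fun c hc => ?_⟩
  have ev1 : ∀ᶠ X : ℝ in atTop, 2 * exp 6 ≤ X ^ e := (tendsto_rpow_atTop he0).eventually_ge_atTop _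
  have ev2 : ∀ᶠ X : ℝ in atTop, C0 ≤ X ^ (1 / K * (δ / 2) : ℝ) := (tendsto_rpow_atTop (by positivity)).eventually_ge_atTop _
  have ev3 : ∀ᶠ X : ℝ in atTop, (C2 + (M + 1) * ((5 * kap) * C1)) / c ≤ X ^ (4 * δ / K : ℝ) :=
    (tendsto_rpow_atTop (by positivity)).eventually_ge_atTop _
  filter_upwards [ev1, ev2, ev3, hlev, eventually_ge_atTop 1] with X hX1 hX2 hX3 hlevX hX h hh hh1
  have hX0 : 0 < X := by linarith
  set N := X ^ (1 / K : ℝ) with hN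
  have hN1 : 1 ≤ N := one_le_rpow hX (by positivity)
  have hN0 : 0 < N := by linarith
  set lam := exp (1 / K) with hlam
  have hlam1 : 1 ≤ lam := one_le_exp (by positivity)
  have hlamk : lam ≤ kap := by
    unfold kap; rw [hlam]; exact exp_le_exp.2 (by linarith)
  set T := 2 * exp 6 * X ^ (1 - h) with hT
  have hXh : 1 ≤ X ^ (1 - h) := one_le_rpow hX (by linarith)
  have hTX : X ^ (1 - h) ≤ T := by
    have : 1 ≤ exp 6 := one_le_exp (by norm_num)
    nlinarith
  have hT0 : 0 < T := by linarith
  set τ := 1 - h + 2 * e with hτ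
  have hT1 : T * X ^ e ≤ X ^ τ := by
    calc T * X ^ e = 2 * exp 6 * (X ^ (1 - h) * X ^ e) := by rw [hT]; ring
      _ ≤ X ^ e * (X ^ (1 - h) * X ^ e) := by gcongr
      _ = X ^ τ := by rw [← rpow_add hX0, ← rpow_add hX0]; congr 1; rw [hτ]; ring
  have hτ0 : 0 ≤ τ := by linarith
  have hτ1 : τ ≤ 1 := by linarith
  set T1 := T * X ^ e with hT1d
  set F : ℝ → ℂ := fun t => zlam lam N t ^ (K - 1) * zstar N t with hF
  have hFc : Continuous F := ((continuous_zlam lam N).pow _).mul (continuous_zstar hN0)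
  have hzc : Continuous fun t => ‖zlam lam N t‖ := (continuous_zlam lam N).norm
  set V : ℕ → Set ℝ := fun i => {t | t ∈ Set.Icc (-T1) T1 ∧ N ^ (1/3:ℝ) ≤ |t| ∧ X ^ ((1 - i * η) / K) ≤ ‖zlam lam N t‖ ∧
    ‖zlam lam N t‖ ≤ X ^ ((1 - (i * η - η)) / K)} with hV
  have hVm : ∀ i, MeasurableSet (V i) := fun i => by
    refine IsClosed.measurableSet ?_
    exact isClosed_Icc.inter ((isClosed_le continuous_const continuous_abs).inter
      ((isClosed_le continuous_const hzc).inter (isClosed_le hzc continuous_const)))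
  have hVsub : ∀ i, V i ⊆ Set.Icc (-(X ^ τ)) (X ^ τ) := fun i t ht => ⟨by linarith [ht.1.1], by linarith [ht.1.2]⟩
  have hVIcc : ∀ i, V i ⊆ Set.Icc (-T1) T1 := fun i t ht => ht.1
  have hvol : ∀ i ≤ M, (volume (V i)).toReal ≤ C1 * X ^ (e + (i * η) * (τ / (1 - 2 * (i * η)) + 2 / K)) := by
    intro i hi
    refine hlevX τ (i * η) hτ0 hτ1 (by positivity) ?_ (V i) (hVm i) (hVsub i) fun t ht => ht.2.2.1
    rw [← hMη]; gcongr
  have hVfin : ∀ i, volume (V i) < ⊤ := fun i => lt_of_le_of_lt (measure_mono (hVIcc i)) (by simp)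
  have hVF : ∀ i, ∀ t ∈ V i, ‖F t‖ ≤ 5 * kap * X ^ (1 - (i * η - η) * (1 - 1 / K)) := by
    intro i t ht
    calc ‖F t‖ = ‖zlam lam N t‖ ^ (K - 1) * ‖zstar N t‖ := by simp only [hF]; rw [norm_mul, norm_pow]
      _ ≤ (X ^ ((1 - (i * η - η)) / K)) ^ (K - 1) * (5 * kap * N) := by
        gcongr
        · exact ht.2.2.2
        · exact norm_zstar_le hN0 t
      _ = 5 * kap * ((X ^ ((1 - (i * η - η)) / K)) ^ (K - 1) * N) := by ring
      _ = _ := by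
        rw [hN, ← rpow_natCast, ← rpow_mul hX0.le, ← rpow_add hX0]
        congr 2
        rw [Nat.cast_sub (by omega)]; push_cast; field_simp; ring
  have hcover : ∀ t, t ∈ Set.Icc (-T1) T1 → N ^ (1/3:ℝ) ≤ |t| → X ^ (3 / (4 * K) : ℝ) < ‖zlam lam N t‖ →
      ∃ i ≤ M, t ∈ V i ∧ δ / 2 ≤ i * η := by
    intro t ht htN htZ
    have htX : |t| ≤ N ^ (K:ℝ) := by
      rw [hN, ← rpow_mul hX0.le, one_div, inv_mul_cancel₀ hK0.ne', rpow_one]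
      calc |t| ≤ T1 := abs_le.2 ht
        _ ≤ X ^ τ := hT1
        _ ≤ X ^ (1:ℝ) := by gcongr
        _ = X := rpow_one X
    have h1 := hZ lam N t hlam1 hlamk hN1 htN htX
    have h2 : ‖zlam lam N t‖ ≤ X ^ ((1 - δ / 2) / K) := by
      refine h1.trans ?_
      calc C0 * N ^ (1 - δ) ≤ X ^ (1 / K * (δ / 2) : ℝ) * N ^ (1 - δ) := by gcongr
        _ = _ := by
          rw [hN, ← rpow_mul hX0.le, ← rpow_add hX0]; congr 1; field_simp; ring
    have hZ0 : 0 < ‖zlam lam N t‖ := lt_trans (by positivity) htZ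
    have hXne : 1 < X := by
      by_contra hcon
      have : X = 1 := by linarith
      rw [this] at htZ h2
      simp at htZ h2
      linarith
    have hlog : 0 < log X := log_pos hXne
    set s := log ‖zlam lam N t‖ / log X with hs
    have hZs : ‖zlam lam N t‖ = X ^ s := by
      rw [rpow_def_of_pos hX0, hs, mul_div_cancel₀ _ hlog.ne', exp_log hZ0]
    rw [hZs] at htZ h2
    have h3 := (rpow_lt_rpow_left_iff hXne).1 htZ
    have h4 := (rpow_le_rpow_left_iff hXne).1 h2
    set u := 1 - s * K with hu
    have hu1 : u ≤ 1 / 4 := by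
      rw [div_lt_iff₀ (by positivity)] at h3
      rw [hu]; linarith
    have hu2 : δ / 2 ≤ u := by
      rw [le_div_iff₀ hK0] at h4
      rw [hu]; linarith
    have hu0 : 0 ≤ u / η := by
      have : 0 ≤ u := by linarith
      positivity
    have hc1 := Nat.le_ceil (u / η)
    have hc2 := Nat.ceil_lt_add_one hu0
    rw [div_le_iff₀ hη0] at hc1
    have hc3 : (⌈u / η⌉₊ : ℝ) * η ≤ u + η := by
      calc _ ≤ (u / η + 1) * η := by gcongr
        _ = u + η := by field_simp
    have hsK : s = (1 - u) / K := by rw [hu]; field_simp; ring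
    refine ⟨⌈u / η⌉₊, Nat.ceil_le.2 ?_, ⟨ht, htN, ?_, ?_⟩, by linarith⟩
    · rw [div_le_iff₀ hη0, hMη]; exact hu1
    · rw [hZs, hsK]
      gcongr
    · rw [hZs, hsK]
      refine rpow_le_rpow_of_exponent_le hX ?_
      gcongr
      linarith
  set J1 := (range (M + 1)).filter fun i : ℕ => 2 * (i * η) ≤ h - 20 / K ∧ δ / 2 ≤ i * η with hJ1
  set J2 := (range (M + 1)).filter fun i : ℕ => h - 20 / K ≤ 2 * (i * η) with hJ2
  set W : Set ℝ := {t | t ∈ Set.Icc (-T1) T1 ∧ N ^ (1/3:ℝ) ≤ |t| ∧ ‖zlam lam N t‖ ≤ X ^ (3 / (4 * K) : ℝ)} with hW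
  have hWm : MeasurableSet W := (isClosed_Icc.inter ((isClosed_le continuous_const continuous_abs).inter
      (isClosed_le hzc continuous_const))).measurableSet
  set S : Set ℝ := {t : ℝ | |t| ≤ N ^ (1/3:ℝ)} with hS
  have hSm : MeasurableSet S := (isClosed_le continuous_abs continuous_const).measurableSet
  have hUm : MeasurableSet (W ∪ ⋃ i ∈ J2, V i) := hWm.union (Finset.measurableSet_biUnion _ fun i _ => hVm i)
  have hq0 : ∀ i : ℕ, 0 ≤ i * η := fun i => by positivity
  have hq1 : ∀ i : ℕ, i ≤ M → i * η ≤ 1 / 4 := fun i hi => by rw [← hMη]; gcongr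
  refine ⟨W ∪ ⋃ i ∈ J2, V i, hUm, ?_, ?_⟩
  · have hint : ∀ s : Set ℝ, s ⊆ Set.Icc (-T1) T1 → IntegrableOn (fun t => ‖F t‖) s := fun s hs =>
      (hFc.norm.integrableOn_Icc).mono_set hs
    have hSint : IntegrableOn (fun t => ‖F t‖) S := by
      refine (hFc.norm.integrableOn_Icc (a := -(N ^ (1/3:ℝ))) (b := N ^ (1/3:ℝ))).mono_set fun t ht => abs_le.1 ht
    have key := setIntegral_le_sum_of_subset (s := insertNone J1) (S := (W ∪ ⋃ i ∈ J2, V i)ᶜ ∩ Set.Icc (-T1) T1)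
      (V := fun o => Option.elim o S V) (f := fun t => ‖F t‖) (hUm.compl.inter measurableSet_Icc)
      (fun o _ => by cases o; exacts [hSm, hVm _]) ?_ (fun t => norm_nonneg _) (hint _ Set.inter_subset_right)
      (fun o _ => by cases o; exacts [hSint, hint _ (hVIcc _)])
    · rw [sum_insertNone] at key
      refine key.trans ?_
      have hb : ∀ i ∈ J1, ∫ t in V i, ‖F t‖ ≤ (5 * kap) * C1 * X ^ (1 - 4 * δ / K) := by
        intro i hi
        obtain ⟨hi1, hi2, hi3⟩ := mem_filter.1 hi
        have hiM : i ≤ M := by have := mem_range.1 hi1; omega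
        have h1 := norm_setIntegral_le_of_norm_le_const (f := fun t => ‖F t‖) (hVfin i) fun t ht => by
          rw [norm_norm]; exact hVF i t ht
        have h2 := level_exponent_off hK0 he0 (by linarith) (by linarith) hη0.le hi3 (hq0 i) (hq1 i hiM) hi2
        calc _ ≤ _ := (le_abs_self _).trans h1
          _ ≤ 5 * kap * X ^ (1 - (i * η - η) * (1 - 1 / K)) * (C1 * X ^ (e + (i * η) * (τ / (1 - 2 * (i * η)) + 2 / K))) := by
            gcongr
            exact hvol i hiM
          _ = (5 * kap) * C1 * X ^ (e + (i * η) * (τ / (1 - 2 * (i * η)) + 2 / K) + (1 - (i * η - η) * (1 - 1 / K))) := by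
            rw [rpow_add hX0 (e + _)]; ring
          _ ≤ _ := by gcongr
      have hs := hsmall lam N hlam1 hlamk hN1
      have hNK : N ^ (K - 1) = X ^ (1 - 1 / K : ℝ) := by
        rw [hN, ← rpow_natCast, ← rpow_mul hX0.le, Nat.cast_sub (by omega)]; congr 1; push_cast; field_simp
      have hcard : (#J1 : ℝ) ≤ M + 1 := by
        have := card_filter_le (range (M + 1)) fun i : ℕ => 2 * (i * η) ≤ h - 20 / K ∧ δ / 2 ≤ i * η
        rw [card_range] at this
        exact_mod_cast this
      calc _ ≤ C2 * X ^ (1 - 1 / K : ℝ) + ∑ i ∈ J1, (5 * kap) * C1 * X ^ (1 - 4 * δ / K) := by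
            rw [← hNK]
            exact add_le_add hs (sum_le_sum hb)
        _ ≤ C2 * X ^ (1 - 4 * δ / K) + (M + 1) * ((5 * kap) * C1 * X ^ (1 - 4 * δ / K)) := by
            rw [sum_const, nsmul_eq_mul]
            have : X ^ (1 - 1 / K : ℝ) ≤ X ^ (1 - 4 * δ / K) := rpow_le_rpow_of_exponent_le hX (by rw [hδK']; linarith)
            gcongr
        _ = (C2 + (M + 1) * ((5 * kap) * C1)) * X ^ (1 - 4 * δ / K) := by ring
        _ ≤ (c * X ^ (4 * δ / K : ℝ)) * X ^ (1 - 4 * δ / K) := by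
            gcongr
            rw [div_le_iff₀ hc] at hX3; linarith
        _ = c * X := by
            rw [mul_assoc, ← rpow_add hX0]; simp
    · rintro t ⟨htU, htI⟩
      by_cases htS : |t| ≤ N ^ (1/3:ℝ)
      · exact ⟨none, by simp, htS⟩
      · push Not at htS
        have hnW : ¬ ‖zlam lam N t‖ ≤ X ^ (3 / (4 * K) : ℝ) := fun hcon => htU (Or.inl ⟨htI, htS.le, hcon⟩)
        push Not at hnW
        obtain ⟨i, hi, hiV, hiδ⟩ := hcover t htI htS.le hnW
        refine ⟨some i, ?_, hiV⟩
        rw [some_mem_insertNone, hJ1, mem_filter, mem_range]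
        refine ⟨by omega, ?_, hiδ⟩
        by_contra hcon
        push Not at hcon
        refine htU (Or.inr ?_)
        simp only [Set.mem_iUnion]
        exact ⟨i, mem_filter.2 ⟨mem_range.2 (by omega), hcon.le⟩, hiV⟩
  · have hcw := cauchyWeight_nonneg hT0
    have hgc : Continuous fun t => ‖F t‖ ^ 2 * cauchyWeight T t := (hFc.norm.pow 2).mul (continuous_cauchyWeight hT0)
    have hcomb : ∀ a b d : ℝ, (5 * kap * X ^ a) ^ 2 * (X ^ d)⁻¹ * (C1 * X ^ b) = (5 * kap) ^ 2 * C1 * X ^ (b - d + 2 * a) := by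
      intro a b d
      rw [rpow_add hX0, rpow_sub hX0, mul_comm (2:ℝ) a, rpow_mul hX0.le, rpow_two]; ring
    have hint : ∀ s : Set ℝ, s ⊆ Set.Icc (-T1) T1 → IntegrableOn (fun t => ‖F t‖ ^ 2 * cauchyWeight T t) s := fun s hs =>
      (hgc.integrableOn_Icc).mono_set hs
    have hWI : W ⊆ Set.Icc (-T1) T1 := fun t ht => ht.1
    have hUI : (W ∪ ⋃ i ∈ J2, V i) ⊆ Set.Icc (-T1) T1 := Set.union_subset hWI (Set.iUnion₂_subset fun i _ => hVIcc i)
    have key := setIntegral_le_sum_of_subset (s := insertNone J2) (S := (W ∪ ⋃ i ∈ J2, V i))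
      (V := fun o => Option.elim o W V) (f := fun t => ‖F t‖ ^ 2 * cauchyWeight T t) hUm
      (fun o _ => by cases o; exacts [hWm, hVm _]) ?_ (fun t => mul_nonneg (by positivity) (hcw t)) (hint _ hUI)
      (fun o _ => by cases o; exacts [hint _ hWI, hint _ (hVIcc _)])
    · rw [sum_insertNone] at key
      refine key.trans ?_
      have hb : ∀ i ∈ J2, ∫ t in V i, ‖F t‖ ^ 2 * cauchyWeight T t ≤ (5 * kap) ^ 2 * C1 * X ^ (1 + h / 2 + 12 / K) := by
        intro i hi
        obtain ⟨hi1, hi2⟩ := mem_filter.1 hi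
        have hiM : i ≤ M := by have := mem_range.1 hi1; omega
        have h1 := norm_setIntegral_le_of_norm_le_const (f := fun t => ‖F t‖ ^ 2 * cauchyWeight T t)
          (C := (5 * kap * X ^ (1 - (i * η - η) * (1 - 1 / K))) ^ 2 * (X ^ (1 - h))⁻¹) (hVfin i) fun t ht => by
            have h0 := hcw t
            rw [norm_of_nonneg (by positivity)]
            gcongr
            · exact hVF i t ht
            · refine (cauchyWeight_le hT0 t).trans ?_
              rw [one_div]; gcongr
        have h2 := level_exponent_on hK0 he0 (by linarith) hη0.le (hq0 i) (hq1 i hiM) hi2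
        calc _ ≤ _ := (le_abs_self _).trans h1
          _ ≤ (5 * kap * X ^ (1 - (i * η - η) * (1 - 1 / K))) ^ 2 * (X ^ (1 - h))⁻¹ *
              (C1 * X ^ (e + (i * η) * (τ / (1 - 2 * (i * η)) + 2 / K))) := by
            gcongr
            exact hvol i hiM
          _ = (5 * kap) ^ 2 * C1 * X ^ (e + (i * η) * (τ / (1 - 2 * (i * η)) + 2 / K) - (1 - h) + 2 * (1 - (i * η - η) * (1 - 1 / K))) := by
            exact hcomb _ _ _
          _ ≤ _ := by gcongr
      have hs := hlow X h hX (by linarith) hh1 W hWm fun t ht => ht.2.2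
      have hcard : (#J2 : ℝ) ≤ M + 1 := by
        have := card_filter_le (range (M + 1)) fun i : ℕ => h - 20 / K ≤ 2 * (i * η)
        rw [card_range] at this
        exact_mod_cast this
      calc _ ≤ C3 * X ^ (1 + h / 2 + 1 / K + e) + ∑ i ∈ J2, (5 * kap) ^ 2 * C1 * X ^ (1 + h / 2 + 12 / K) := add_le_add hs (sum_le_sum hb)
        _ ≤ C3 * X ^ (1 + h / 2 + 12 / K) + (M + 1) * ((5 * kap) ^ 2 * C1 * X ^ (1 + h / 2 + 12 / K)) := by
            rw [sum_const, nsmul_eq_mul]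
            have h12 : 12 / (K:ℝ) = 12 * (1 / K) := by ring
            have : X ^ (1 + h / 2 + 1 / K + e) ≤ X ^ (1 + h / 2 + 12 / K) :=
              rpow_le_rpow_of_exponent_le hX (by rw [h12]; linarith)
            gcongr
        _ = _ := by ring
    · rintro t (ht | ht)
      · exact ⟨none, by simp, ht⟩
      · simp only [Set.mem_iUnion] at ht
        obtain ⟨i, hi, hiV⟩ := ht
        exact ⟨some i, by rwa [some_mem_insertNone], hiV⟩

/-- The positive integers `n` all of whose prime factors are at most `n ^ θ`. -/
def IsSmoothNat (θ : ℝ) (n : ℕ) : Prop := 1 ≤ n ∧ ∀ p : ℕ, p.Prime → p ∣ n → (p : ℝ) ≤ (n : ℝ) ^ θ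

set_option maxHeartbeats 1000000 in
theorem volume_far_from_smooth_le_of_large (hθ : 0 < θ) (hβ : β < 1/2) (hε : 0 < ε) : ∃ C : ℝ, 0 < C ∧
    ∀ᶠ X : ℝ in atTop, ∀ h : ℝ, ε ≤ h → h ≤ 7/10 →
    volume {x : ℝ | exp 4 * X ≤ x ∧ x ≤ exp 6 * X ∧ ∀ n : ℕ, IsSmoothNat θ n → X ^ h < |(n : ℝ) - x|} ≤
      ENNReal.ofReal (C * X ^ (1 - β * h)) := by
  have hβε : 0 < (1/2 - β) * ε := mul_pos (by linarith) hε
  set K : ℕ := ⌈4 + 2 / θ + 12 / ((1/2 - β) * ε)⌉₊ with hKd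
  have hKc : 4 + 2 / θ + 12 / ((1/2 - β) * ε) ≤ K := Nat.le_ceil _
  have hθ2 : 0 < 2 / θ := by positivity
  have hb12 : 0 < 12 / ((1/2 - β) * ε) := by positivity
  have hKr : (4:ℝ) ≤ K := by linarith
  have hK : 4 ≤ K := by exact_mod_cast hKr
  have hK0 : (0:ℝ) < K := by linarith
  have hKi : 0 < 1 / (K:ℝ) := by positivity
  have hKθ : 1 / (K:ℝ) ≤ θ / 2 := by
    rw [div_le_div_iff₀ hK0 (by norm_num)]
    have : 2 / θ ≤ K := by linarith
    rw [div_le_iff₀ hθ] at this; linarith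
  have hKβ : 12 / (K:ℝ) ≤ (1/2 - β) * ε := by
    rw [div_le_iff₀ hK0]
    have : 12 / ((1/2 - β) * ε) ≤ K := by linarith
    rw [div_le_iff₀ hβε] at this; linarith
  obtain ⟨e, C1, he, hC1, hsplit⟩ := exists_level_splitting K hK hε
  obtain ⟨c, C2, X₀, hc, hC2, hX₀, htr⟩ := transfer_trunc he
  set lam := exp (1 / K) with hlam
  have hlam1 : 1 < lam := one_lt_exp_iff.2 hKi
  set ℓ := ((lam - 1) / (2 * lam)) ^ (K - 1) with hℓ
  have hlm : 0 < (lam - 1) / (2 * lam) := by positivity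
  have hℓ0 : 0 < ℓ := by positivity
  refine ⟨C2 * (2 * exp 6) / ℓ ^ 2 * C1, by positivity, ?_⟩
  have ev1 : ∀ᶠ X : ℝ in atTop, kap ≤ X ^ (θ / 2) := (tendsto_rpow_atTop (by positivity)).eventually_ge_atTop _
  have ev2 : ∀ᶠ X : ℝ in atTop, 2 / (lam - 1) ≤ X ^ (1 / K : ℝ) := (tendsto_rpow_atTop hKi).eventually_ge_atTop _
  have ev3 : ∀ᶠ X : ℝ in atTop, 2 * exp 6 ≤ X ^ ε := (tendsto_rpow_atTop hε).eventually_ge_atTop _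
  filter_upwards [ev1, ev2, ev3, hsplit (c * ℓ) (by positivity), eventually_ge_atTop X₀] with X hX1 hX2 hX3 hsp hXX h hh hh1
  obtain ⟨U, hU, hU1, hU2⟩ := hsp h hh hh1
  have hX : 1 ≤ X := by linarith
  have hX0 : 0 < X := by linarith
  set N := X ^ (1 / K : ℝ) with hN
  have hN1 : 1 ≤ N := one_le_rpow hX (by positivity)
  have hN0 : 0 < N := by linarith
  set T := 2 * exp 6 * X ^ (1 - h) with hT
  have hXh : 1 ≤ X ^ (1 - h) := one_le_rpow hX (by linarith)
  have hT1 : 1 ≤ T := by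
    have : 1 ≤ exp 6 := one_le_exp (by norm_num)
    nlinarith
  have hTX : T ≤ X := by
    calc T ≤ X ^ ε * X ^ (1 - h) := by rw [hT]; gcongr
      _ = X ^ (ε + (1 - h)) := (rpow_add hX0 _ _).symm
      _ ≤ X ^ (1:ℝ) := rpow_le_rpow_of_exponent_le hX (by linarith)
      _ = X := rpow_one X
  set B := Ioc ⌊N⌋₊ ⌊lam * N⌋₊ with hB
  have hBmem : ∀ b ∈ B, N < b ∧ (b : ℝ) ≤ lam * N := fun b hb => (mem_Ioc_floor hN0.le (by positivity)).1 hb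
  have hB0 : ∀ b ∈ B, b ≠ 0 := fun b hb => by have := mem_Ioc.1 hb; omega
  set I := Fintype.piFinset fun _ : Fin (K - 1) => B with hI
  set d : (Fin (K - 1) → ℕ) → ℕ := fun i => ∏ j, i j with hd
  have hNK : N ^ (K - 1) * N = X := by
    rw [← pow_succ, Nat.sub_add_cancel (by omega), hN, ← rpow_natCast, ← rpow_mul hX0.le, one_div,
      inv_mul_cancel₀ hK0.ne', rpow_one]
  have hlamK : lam ^ (K - 1) ≤ exp 3 := by
    rw [hlam, ← exp_nat_mul]
    refine exp_le_exp.2 ?_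
    rw [Nat.cast_sub (by omega)]; push_cast
    rw [mul_one_div, div_le_iff₀ hK0]; linarith
  have hdlow : ∀ i ∈ I, N ^ (K - 1) ≤ d i := fun i hi => by
    simp only [hd]; push_cast
    calc N ^ (K - 1) = ∏ j : Fin (K - 1), N := by simp
      _ ≤ _ := prod_le_prod (fun _ _ => hN0.le) fun j _ => (hBmem _ (Fintype.mem_piFinset.1 hi j)).1.le
  have hdup : ∀ i ∈ I, (d i : ℝ) ≤ (lam * N) ^ (K - 1) := fun i hi => by
    simp only [hd]; push_cast
    calc _ ≤ ∏ j : Fin (K - 1), lam * N := prod_le_prod (fun _ _ => by positivity) fun j _ => (hBmem _ (Fintype.mem_piFinset.1 hi j)).2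
      _ = _ := by simp
  have hL : ∑ i ∈ I, 1 / (d i : ℝ) = (∑ b ∈ B, 1 / (b : ℝ)) ^ (K - 1) := by
    rw [← sum_piFinset_const B (K - 1) fun b : ℕ => 1 / (b : ℝ)]
    refine sum_congr rfl fun i _ => ?_
    simp [hd]
  have hLl : ℓ ≤ ∑ i ∈ I, 1 / (d i : ℝ) := by
    rw [hL]
    exact pow_le_pow_left₀ hlm.le (sum_inv_Ioc_floor_ge hlam1 hX2) _
  have hF : ∀ t, famPoly I d (fun _ => N) t = zlam lam N t ^ (K - 1) * zstar N t := fun t => famPoly_piFinset hB0 (K - 1) N t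
  have key := htr X T hXX hT1 hTX I d (fun _ => N) _ (fun i hi => ?_) (fun _ _ => hN0) (fun i hi => ⟨?_, ?_⟩)
    (lt_of_lt_of_le hℓ0 hLl) rfl U hU ?_ (X ^ h) ?_
  · refine (measure_mono ?_).trans (key.trans (ENNReal.ofReal_le_ofReal ?_))
    · rintro x ⟨hx1, hx2, hx3⟩
      refine ⟨hx1, hx2, fun i hi m hm1 hm2 => ?_⟩
      have := hx3 (d i * m) ⟨?_, fun p hp hpd => ?_⟩
      · push_cast at this; exact this
      · have h1 : 0 < d i := prod_pos fun j _ => Nat.pos_of_ne_zero (hB0 _ (Fintype.mem_piFinset.1 hi j))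
        have h2 : 0 < m := by
          have : (0:ℝ) < m := by linarith
          exact_mod_cast this
        exact Nat.mul_pos h1 h2
      · have h1 : (p:ℝ) ≤ kap * N := by
          rcases (Nat.Prime.dvd_mul hp).1 hpd with h | h
          · obtain ⟨j, _, hj⟩ := (Prime.dvd_finsetProd_iff hp.prime _).1 h
            have hm := Fintype.mem_piFinset.1 hi j
            have h2 : p ≤ i j := Nat.le_of_dvd (Nat.pos_of_ne_zero (hB0 _ hm)) hj
            have h3 : (p:ℝ) ≤ i j := by exact_mod_cast h2
            refine h3.trans ((hBmem _ hm).2.trans ?_)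
            have : lam ≤ kap := exp_le_exp.2 (by
              rw [div_le_iff₀ hK0]; linarith)
            gcongr
          · have h2 : 0 < m := by
              have : (0:ℝ) < m := by linarith
              exact_mod_cast this
            have h3 : (p:ℝ) ≤ m := by exact_mod_cast Nat.le_of_dvd h2 h
            linarith
        have h4 : X ≤ ((d i * m : ℕ) : ℝ) := by
          push_cast
          calc X = N ^ (K - 1) * N := hNK.symm
            _ ≤ _ := by gcongr; exact hdlow i hi
        calc (p:ℝ) ≤ kap * N := h1
          _ ≤ X ^ (θ / 2) * X ^ (θ / 2) := by
            have : N ≤ X ^ (θ / 2) := rpow_le_rpow_of_exponent_le hX hKθ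
            gcongr
          _ = X ^ θ := by rw [← rpow_add hX0]; congr 1; ring
          _ ≤ _ := by gcongr
    · simp only [hF]
      have hX22 : 0 ≤ ∫ t in U, ‖zlam lam N t ^ (K - 1) * zstar N t‖ ^ 2 * cauchyWeight T t :=
        integral_nonneg fun t => mul_nonneg (by positivity) (cauchyWeight_nonneg (by linarith) t)
      calc _ ≤ C2 * T / (X * ℓ ^ 2) * (C1 * X ^ (1 + h / 2 + 12 / K)) := by gcongr
        _ = C2 * (2 * exp 6) / ℓ ^ 2 * C1 * (X ^ (1 - h) / X * X ^ (1 + h / 2 + 12 / K)) := by rw [hT]; field_simp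
        _ = C2 * (2 * exp 6) / ℓ ^ 2 * C1 * X ^ (1 - h / 2 + 12 / K) := by
          nth_rewrite 2 [← rpow_one X]
          rw [← rpow_sub hX0, ← rpow_add hX0]; congr 2; ring
        _ ≤ _ := by
          refine mul_le_mul_of_nonneg_left (rpow_le_rpow_of_exponent_le hX ?_) (by positivity)
          have : (1/2 - β) * ε ≤ (1/2 - β) * h := by gcongr
          linarith
  · exact prod_pos fun j _ => Nat.pos_of_ne_zero (hB0 _ (Fintype.mem_piFinset.1 hi j))
  · calc X = N ^ (K - 1) * N := hNK.symm
      _ ≤ _ := by gcongr; exact hdlow i hi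
  · calc _ ≤ (lam * N) ^ (K - 1) * N := by gcongr; exact hdup i hi
      _ = lam ^ (K - 1) * (N ^ (K - 1) * N) := by rw [mul_pow]; ring
      _ ≤ _ := by rw [hNK]; gcongr
  · simp only [hF]
    calc _ ≤ c * ℓ * X := hU1
      _ = c * X * ℓ := by ring
      _ ≤ _ := by gcongr
  · rw [hT, div_le_iff₀ (by linarith)]
    calc 2 * exp 6 * X = 2 * exp 6 * (X ^ h * X ^ (1 - h)) := by
          rw [← rpow_add hX0, add_sub_cancel, rpow_one]
      _ ≤ _ := by linarith

/-- The primes `p` with `a ≤ log p < b`. -/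
noncomputable def primesIn (a b : ℝ) : Finset ℕ :=
  (range (⌊exp b⌋₊ + 1)).filter fun p => p.Prime ∧ a ≤ log p ∧ log p < b

theorem mem_primesIn : p ∈ primesIn a b ↔ p.Prime ∧ a ≤ log p ∧ log p < b := by
  unfold primesIn
  rw [mem_filter, mem_range, and_iff_right_iff_imp]
  rintro ⟨hp, -, h⟩
  have hp0 : (0:ℝ) < p := by exact_mod_cast hp.pos
  exact Nat.lt_succ_of_le (Nat.le_floor ((log_lt_iff_lt_exp hp0).1 h).le)

/-- The sum of reciprocals of a finite set of integers. -/
noncomputable def recipSum (B : Finset ℕ) : ℝ := ∑ p ∈ B, 1 / (p : ℝ)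

theorem recipSum_nonneg (B : Finset ℕ) : 0 ≤ recipSum B := sum_nonneg fun _ _ => by positivity

theorem exists_theta_sub_ge : ∃ x₀ : ℝ, ∀ x, x₀ ≤ x → x / 10 ≤ Chebyshev.theta (exp (9/10) * x) - Chebyshev.theta x := by
  obtain ⟨C, hC⟩ := Chebyshev.psi_sub_theta_le_mul_sqrt
  refine ⟨(100 * (|C| + 8)) ^ 2, fun x hx => ?_⟩
  have h9 : 2.44 ≤ exp (9/10) := by
    rw [show (9/10:ℝ) = 1 + -(1/10) by norm_num, exp_add]
    nlinarith [exp_one_gt_d9, add_one_le_exp (-(1/10):ℝ)]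
  set y := exp (9/10) * x
  have hx0 : 0 ≤ x := (sq_nonneg _).trans hx
  have hy : 2.44 * x ≤ y := mul_le_mul_of_nonneg_right h9 hx0
  have hs := sq_sqrt (show 0 ≤ y by linarith)
  have h1 : 100 * (|C| + 8) ≤ √y := le_sqrt_of_sq_le (by linarith)
  have h2 := Chebyshev.psi_ge' (x := y) (by linarith)
  have h3 := log_le_sub_one_of_pos (show 0 < √(y + 2) by positivity)
  rw [log_sqrt (by linarith)] at h3
  have h4 : √(y + 2) ≤ √y + 2 := sqrt_le_iff.2 (by constructor <;> nlinarith [abs_nonneg C])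
  have hup := Chebyshev.theta_le_log4_mul_x hx0
  rw [show (4:ℝ) = 2 ^ 2 by norm_num, log_pow] at hup
  push_cast at hup
  nlinarith [hC y, le_abs_self C, abs_nonneg C, log_two_gt_d9, log_two_lt_d9]

theorem exists_recipSum_unit_ge : ∃ c : ℝ, 0 < c ∧ ∃ j₀ : ℕ, 1 ≤ j₀ ∧ ∀ j : ℕ, j₀ ≤ j → c / j ≤ recipSum (primesIn j (j + 1)) := by
  obtain ⟨x₀, hx₀⟩ := exists_theta_sub_ge
  refine ⟨1 / 60, by norm_num, ⌈max x₀ 1⌉₊, Nat.one_le_iff_ne_zero.2 (Nat.ceil_pos.2 (by positivity)).ne', fun j hj => ?_⟩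
  have hj1 : max x₀ 1 ≤ j := Nat.ceil_le.1 hj
  have hj1' : (1:ℝ) ≤ j := (le_max_right _ _).trans hj1
  have hx : x₀ ≤ exp j := ((le_max_left _ _).trans hj1).trans ((by linarith : (j:ℝ) ≤ j + 1).trans (add_one_le_exp _))
  have h := hx₀ _ hx
  rw [← exp_add] at h
  have hE := exp_pos (j:ℝ)
  have hle : (⌊exp (j:ℝ)⌋₊) ≤ ⌊exp (9/10 + j)⌋₊ := Nat.floor_le_floor (exp_le_exp.2 (by linarith))
  have hdiff : Chebyshev.theta (exp (9/10 + j)) - Chebyshev.theta (exp j)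
      ≤ ∑ p ∈ primesIn j (j + 1), log p := by
    have hsub : (Ioc 0 ⌊exp (j:ℝ)⌋₊).filter Nat.Prime ⊆ (Ioc 0 ⌊exp (9/10 + j)⌋₊).filter Nat.Prime :=
      by gcongr
    unfold Chebyshev.theta
    rw [← sum_sdiff hsub, add_sub_cancel_right]
    refine sum_le_sum_of_subset_of_nonneg (fun p hp => ?_) fun p hp _ => log_nonneg ?_
    · rw [Finset.mem_sdiff, mem_filter, mem_filter, mem_Ioc, mem_Ioc] at hp
      obtain ⟨⟨⟨h0, h1⟩, hpp⟩, h2⟩ := hp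
      have hp0 : (0:ℝ) < p := by exact_mod_cast h0
      have h3 : ⌊exp (j:ℝ)⌋₊ < p := by
        grind
      have h4 : exp j < p := (Nat.floor_lt (exp_pos _).le).1 h3
      have h5 : (p:ℝ) ≤ exp (9/10 + j) := (Nat.le_floor_iff (exp_pos _).le).1 h1
      refine mem_primesIn.2 ⟨hpp, (le_log_iff_exp_le hp0).2 h4.le, ?_⟩
      have := (log_le_iff_le_exp hp0).2 h5
      linarith
    · exact_mod_cast (mem_primesIn.1 hp).1.one_le
  have hcmp : ∑ p ∈ primesIn j (j + 1), log p ≤ ((j + 1) * exp (j + 1)) * recipSum (primesIn j (j + 1)) := by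
    unfold recipSum
    rw [mul_sum]
    refine sum_le_sum fun p hp => ?_
    obtain ⟨hpp, h1, h2⟩ := mem_primesIn.1 hp
    have hp0 : (0:ℝ) < p := by exact_mod_cast hpp.pos
    have h3 := (log_lt_iff_lt_exp hp0).1 h2
    rw [mul_one_div, le_div_iff₀ hp0]
    gcongr
  have he1 := exp_one_lt_d9
  rw [exp_add] at hcmp
  have hS := recipSum_nonneg (primesIn j (j + 1))
  rw [div_le_iff₀ (by linarith)]
  have h6 : exp j / 10 ≤ (2 * j * (exp j * 3)) * recipSum (primesIn j (j + 1)) := by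
    refine (h.trans hdiff).trans (hcmp.trans ?_)
    gcongr <;> linarith
  have h7 : exp j * (1 / 60) ≤ exp j * (recipSum (primesIn j (j + 1)) * j) := by nlinarith
  exact le_of_mul_le_mul_left h7 hE

theorem log_div_le_sum_inv (hm : 1 ≤ m) (hmn : m ≤ n) : log (n / m) ≤ ∑ j ∈ Ico m n, 1 / (j : ℝ) := by
  have hm0 : (0:ℝ) < m := by exact_mod_cast hm
  induction n, hmn using Nat.le_induction with
  | base => simp [hm0.ne']
  | succ n hn ih =>
    have hn0 : (0:ℝ) < n := by exact_mod_cast hm.trans hn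
    rw [sum_Ico_succ_top hn]
    have h1 : log ((n + 1 : ℕ) / m) = log (n / m) + log (1 + 1 / n) := by
      rw [← log_mul (by positivity) (by positivity)]
      grind
    have h2 := log_le_sub_one_of_pos (show (0:ℝ) < 1 + 1 / n by positivity)
    linarith

/-- A Mertens type lower bound. -/
theorem exists_recipSum_ge : ∃ c : ℝ, 0 < c ∧ ∃ j₀ : ℕ, 1 ≤ j₀ ∧
    (∀ j : ℕ, j₀ ≤ j → c / j ≤ recipSum (primesIn j (j + 1))) ∧
    ∀ m n : ℕ, j₀ ≤ m → m ≤ n → c * log (n / m) ≤ recipSum (primesIn m n) := by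
  obtain ⟨c, hc, j₀, hj₀, h⟩ := exists_recipSum_unit_ge
  refine ⟨c, hc, j₀, hj₀, h, fun m n hm hmn => ?_⟩
  refine (mul_le_mul_of_nonneg_left (log_div_le_sum_inv (hj₀.trans hm) hmn) hc.le).trans ?_
  induction n, hmn using Nat.le_induction with
  | base => simp [recipSum_nonneg]
  | succ n hn ih =>
    rw [sum_Ico_succ_top hn, mul_add]
    have h1 : recipSum (primesIn m n) + recipSum (primesIn n (n + 1)) ≤ recipSum (primesIn m (n + 1 : ℕ)) := by
      unfold recipSum
      rw [← sum_union]
      · refine sum_le_sum_of_subset_of_nonneg (fun p hp => ?_) fun _ _ _ => by positivity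
        have hmn' : (m:ℝ) ≤ n := by exact_mod_cast hn
        push_cast
        rcases mem_union.1 hp with hp | hp <;> obtain ⟨h1, h2, h3⟩ := mem_primesIn.1 hp <;>
          exact mem_primesIn.2 ⟨h1, by linarith, by linarith⟩
      · refine disjoint_left.2 fun p hp hp' => ?_
        have h1 := (mem_primesIn.1 hp).2.2
        have h2 := (mem_primesIn.1 hp').2.1
        linarith
    grind

/-- Reciprocals over a logarithmic unit interval. -/
theorem recipSum_le_of_block (hB : ∀ p ∈ B, p.Prime ∧ y ≤ log p ∧ log p ≤ y + 1) :
    (#B : ℝ) ≤ exp (y + 1) ∧ recipSum B ≤ exp 1 := by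
  have hcard : (#B : ℝ) ≤ exp (y + 1) := by
    have hsub : B ⊆ Ioc 0 ⌊exp (y + 1)⌋₊ := fun p hp => by
      have h := hB p hp
      have hp0 : (0:ℝ) < p := by exact_mod_cast h.1.pos
      exact mem_Ioc.2 ⟨h.1.pos, Nat.le_floor ((log_le_iff_le_exp hp0).1 h.2.2)⟩
    calc (#B : ℝ) ≤ #(Ioc 0 ⌊exp (y + 1)⌋₊) := by exact_mod_cast card_le_card hsub
      _ ≤ exp (y + 1) := by
        rw [Nat.card_Ioc, Nat.sub_zero]
        exact Nat.floor_le (exp_pos _).le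
  refine ⟨hcard, ?_⟩
  calc recipSum B ≤ ∑ _p ∈ B, exp (-y) := by
        refine sum_le_sum fun p hp => ?_
        have h := hB p hp
        have hp0 : (0:ℝ) < p := by exact_mod_cast h.1.pos
        rw [exp_neg, one_div]
        exact inv_anti₀ (exp_pos y) ((le_log_iff_exp_le hp0).1 h.2.1)
    _ = #B * exp (-y) := by rw [sum_const, nsmul_eq_mul]
    _ ≤ exp (y + 1) * exp (-y) := by gcongr
    _ = exp 1 := by rw [← exp_add]; ring_nf

/-- The nonnegative function `f` has mean value at most `M` along the multiples of every integer
coprime to all elements of `S`. -/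
def MomentBound (S : Finset ℕ) (f : ℕ → ℝ) (M : ℝ) : Prop :=
  (∀ k, 0 ≤ f k) ∧ ∀ D : ℕ, 1 ≤ D → (∀ p ∈ S, D.Coprime p) → ∀ Y : ℝ, 0 ≤ Y →
    ∑ k ∈ (Ioc 0 ⌊Y⌋₊).filter (D ∣ ·), f k ≤ M * Y / D

theorem MomentBound.one : MomentBound ∅ (fun _ => 1) 1 := by
  refine ⟨fun _ => zero_le_one, fun D hD _ Y hY => ?_⟩
  have hD0 : (0:ℝ) < D := by exact_mod_cast hD
  rw [sum_const, nsmul_eq_mul, mul_one, one_mul, Nat.Ioc_filter_dvd_card_eq_div]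
  exact Nat.cast_div_le.trans (div_le_div_of_nonneg_right (Nat.floor_le hY) hD0.le)

theorem MomentBound.mul_sum {S S' : Finset ℕ} {f : ℕ → ℝ} {M' : ℝ} (h : MomentBound S f M) (hM : 0 ≤ M)
    (hS : S ⊆ S') {ι : Type*} {A : Finset ι} {w : ι → ℝ} {d : ι → ℕ} (hw : ∀ i ∈ A, 0 ≤ w i) (hd : ∀ i ∈ A, 1 ≤ d i)
    (hdS : ∀ i ∈ A, ∀ p ∈ S, (d i).Coprime p) (hdS' : ∀ i ∈ A, ∀ D : ℕ, (∀ p ∈ S', D.Coprime p) → D.Coprime (d i))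
    (hM' : ∑ i ∈ A, w i / d i ≤ M') :
    MomentBound S' (fun k => (∑ i ∈ A, if d i ∣ k then w i else 0) * f k) (M' * M) := by
  refine ⟨fun k => mul_nonneg (sum_nonneg fun i hi => ?_) (h.1 k), fun D hD hDS Y hY => ?_⟩
  · grind
  have hD0 : (0:ℝ) < D := by exact_mod_cast hD
  calc ∑ k ∈ (Ioc 0 ⌊Y⌋₊).filter (D ∣ ·), (∑ i ∈ A, if d i ∣ k then w i else 0) * f k
      = ∑ i ∈ A, w i * ∑ k ∈ (Ioc 0 ⌊Y⌋₊).filter (D * d i ∣ ·), f k := by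
        simp_rw [Finset.sum_mul, Finset.mul_sum]
        rw [sum_comm]
        refine sum_congr rfl fun i hi => ?_
        have hco := hdS' i hi D hDS
        have e1 : (Ioc 0 ⌊Y⌋₊).filter (D * d i ∣ ·) = ((Ioc 0 ⌊Y⌋₊).filter (D ∣ ·)).filter (d i ∣ ·) := by
          rw [filter_filter]
          exact filter_congr fun k _ => ⟨fun hk => ⟨dvd_trans (dvd_mul_right _ _) hk, dvd_trans (dvd_mul_left _ _) hk⟩,
            fun hk => hco.mul_dvd_of_dvd_of_dvd hk.1 hk.2⟩
        rw [e1, sum_filter (fun k => d i ∣ k)]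
        simp
    _ ≤ ∑ i ∈ A, w i * (M * Y / (D * d i : ℕ)) := by
        refine sum_le_sum fun i hi => mul_le_mul_of_nonneg_left ?_ (hw i hi)
        refine h.2 _ (Nat.mul_pos hD (hd i hi)) (fun p hp => ?_) Y hY
        exact Nat.Coprime.mul_left (hDS p (hS hp)) (hdS i hi p hp)
    _ = (∑ i ∈ A, w i / d i) * (M * Y / D) := by
        rw [Finset.sum_mul]
        grind
    _ ≤ M' * (M * Y / D) := by gcongr
    _ = M' * M * Y / D := by ring

theorem omegaIn_eq_sum (B : Finset ℕ) (k : ℕ) : omegaIn B k = ∑ p ∈ B, if p ∣ k then (1:ℝ) else 0 := by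
  rw [← sum_filter, omegaIn, sum_const, nsmul_eq_mul, mul_one]

theorem MomentBound.omega_sq {S : Finset ℕ} {f : ℕ → ℝ} (h : MomentBound S f M) (hM : 0 ≤ M)
    (hB : ∀ p ∈ B, p.Prime) (hSB : ∀ p ∈ B, ∀ q ∈ S, p.Coprime q) :
    MomentBound (B ∪ S) (fun k => omegaIn B k ^ 2 * f k) ((1 + recipSum B) ^ 2 * M) := by
  have key := h.mul_sum hM (subset_union_right : S ⊆ B ∪ S) (A := B ×ˢ B) (w := fun _ => 1) (d := fun x => Nat.lcm x.1 x.2)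
    (fun _ _ => zero_le_one) (fun x hx => ?_) (fun x hx q hq => ?_) (fun x hx D hD => ?_) (M' := (1 + recipSum B) ^ 2) ?_
  · convert key using 3 with k
    rw [omegaIn_eq_sum, sq, sum_mul_sum, sum_product]
    refine sum_congr rfl fun p _ => sum_congr rfl fun q _ => ?_
    by_cases h1 : p ∣ k <;> by_cases h2 : q ∣ k <;> simp [h1, h2, Nat.lcm_dvd_iff]
  · rw [mem_product] at hx
    exact Nat.lcm_pos (hB _ hx.1).pos (hB _ hx.2).pos
  · rw [mem_product] at hx
    exact Nat.Coprime.coprime_dvd_left (Nat.lcm_dvd_mul _ _) (Nat.Coprime.mul_left (hSB _ hx.1 q hq) (hSB _ hx.2 q hq))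
  · rw [mem_product] at hx
    exact Nat.Coprime.coprime_dvd_right (Nat.lcm_dvd_mul _ _)
      (Nat.Coprime.mul_right (hD _ (mem_union_left _ hx.1)) (hD _ (mem_union_left _ hx.2)))
  · have h1 : ∑ x ∈ B ×ˢ B, 1 / (Nat.lcm x.1 x.2 : ℝ) ≤ ∑ p ∈ B, ∑ q ∈ B, (1 / (p:ℝ) * (1 / q) + if p = q then 1 / (p:ℝ) else 0) := by
      rw [sum_product]
      refine sum_le_sum fun p hp => sum_le_sum fun q hq => ?_
      split_ifs with hpq
      · subst hpq
        rw [Nat.lcm_self]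
        nlinarith
      · rw [((Nat.coprime_primes (hB p hp) (hB q hq)).2 hpq).lcm_eq_mul]
        push_cast
        rw [add_zero, one_div_mul_one_div]
    have h2 : ∑ p ∈ B, ∑ q ∈ B, (1 / (p:ℝ) * (1 / q) + if p = q then 1 / (p:ℝ) else 0) = recipSum B ^ 2 + recipSum B := by
      simp_rw [sum_add_distrib]
      rw [← sum_mul_sum, sq]
      simp [recipSum]
    have := recipSum_nonneg B
    nlinarith

theorem MomentBound.exp_omega {S : Finset ℕ} {f : ℕ → ℝ} (h : MomentBound S f M) (hM : 0 ≤ M) (B : Finset ℕ)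
    (hB : ∀ p ∈ B, p.Prime) (hSB : ∀ p ∈ B, ∀ q ∈ S, p.Coprime q) :
    MomentBound (B ∪ S) (fun k => exp (omegaIn B k) * f k) (exp (2 * recipSum B) * M) := by
  induction B using Finset.induction_on with
  | empty => simpa [omegaIn, recipSum] using h
  | insert p B hp ih =>
    have hpp := hB p (mem_insert_self _ _)
    have hp0 : (0:ℝ) < p := by exact_mod_cast hpp.pos
    have ih' := ih (fun q hq => hB q (mem_insert_of_mem hq)) fun q hq => hSB q (mem_insert_of_mem hq)
    have he := exp_one_lt_d9
    have key := ih'.mul_sum (by positivity) (S' := insert p B ∪ S) (union_subset_union_left (subset_insert _ _)) (A := (univ : Finset Bool))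
      (w := fun b => if b then exp 1 - 1 else 1) (d := fun b => if b then p else 1)
      (fun b _ => ?_) (fun b _ => ?_) (fun b _ q hq => ?_) (fun b _ D hD => ?_) (M' := exp (2 * (1 / p))) ?_
    · convert key using 1
      · funext k
        have h1 : omegaIn (insert p B) k = (if p ∣ k then 1 else 0) + omegaIn B k := by
          rw [omegaIn_eq_sum, omegaIn_eq_sum, sum_insert hp]
        rw [h1, exp_add]
        by_cases hk : p ∣ k <;> simp [hk]; ring
      · unfold recipSum
        rw [sum_insert hp, mul_add, exp_add]
        ring
    · cases b <;> simp
    · cases b <;> simp [hpp.one_le]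
    · cases b
      · simp
      · simp only [if_true]
        rcases mem_union.1 hq with hq | hq
        · exact (Nat.coprime_primes hpp (hB q (mem_insert_of_mem hq))).2 fun h => hp (h ▸ hq)
        grind
    · grind
    · simp only [Fintype.univ_bool, mem_singleton, Bool.true_eq_false, not_false_eq_true, sum_insert, if_true, sum_singleton,
        Bool.false_eq_true, if_false, Nat.cast_one, div_one]
      have h1 := add_one_le_exp (2 * (1 / (p:ℝ)))
      have h2 : (exp 1 - 1) / p ≤ 2 * (1 / p) := by
        rw [mul_one_div]
        gcongr
        linarith
      linarith

/-- A finite family of sets of primes, each with a rounding parameter. -/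
abbrev ScaleList := List (ℕ × Finset ℕ)

variable {l : ScaleList}

namespace ScaleList

/-- All primes occurring in the family. -/
noncomputable def support : ScaleList → Finset ℕ
  | [] => ∅
  | (_, B) :: l => B ∪ support l

/-- The product over the family of the numbers of prime divisors. -/
noncomputable def omega : ScaleList → ℕ → ℝ
  | [], _ => 1
  | (_, B) :: l, n => omegaIn B n * omega l n

/-- The product of the sums of reciprocals. -/
noncomputable def mass : ScaleList → ℝ
  | [] => 1
  | (_, B) :: l => recipSum B * mass l

/-- An upper bound for the root mean square of `omega`. -/
noncomputable def bigMass : ScaleList → ℝ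
  | [] => 1
  | (_, B) :: l => (1 + recipSum B) * bigMass l

/-- The sum of the inverse rounding parameters. -/
noncomputable def slack : ScaleList → ℝ
  | [] => 0
  | (r, _) :: l => 1 / (r:ℝ) + slack l

/-- The sets consist of primes and the rounding parameters are positive. -/
def IsPrimeList : ScaleList → Prop
  | [] => True
  | (r, B) :: l => 1 ≤ r ∧ (∀ p ∈ B, p.Prime) ∧ IsPrimeList l

/-- The sets are pairwise disjoint. -/
def IsDisjoint : ScaleList → Prop
  | [] => True
  | (_, B) :: l => (∀ p ∈ B, p ∉ support l) ∧ IsDisjoint l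

theorem omega_nonneg (l : ScaleList) (n : ℕ) : 0 ≤ omega l n := by
  induction l with
  | nil => exact zero_le_one
  | cons a l ih => exact mul_nonneg (omegaIn_nonneg _ _) ih

theorem mass_nonneg (l : ScaleList) : 0 ≤ mass l := by
  induction l with
  | nil => exact zero_le_one
  | cons a l ih => exact mul_nonneg (recipSum_nonneg _) ih

theorem bigMass_nonneg (l : ScaleList) : 0 ≤ bigMass l := by
  induction l with
  | nil => exact zero_le_one
  | cons a l ih => exact mul_nonneg (add_nonneg zero_le_one (recipSum_nonneg _)) ih

theorem mass_le_bigMass (l : ScaleList) : mass l ≤ bigMass l := by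
  induction l with
  | nil => exact le_rfl
  | cons a l ih => exact mul_le_mul (by linarith) ih (mass_nonneg l) (by linarith [recipSum_nonneg a.2])

theorem divMono_omega (l : ScaleList) : DivMono (omega l) := by
  induction l with
  | nil => exact divMono_const 1
  | cons a l ih => exact (divMono_omegaIn a.2).mul ih (omegaIn_nonneg _) (omega_nonneg l)

theorem IsPrimeList.prime_of_mem (h : IsPrimeList l) (hp : p ∈ support l) : p.Prime := by
  induction l with
  | nil => simp [support] at hp
  | cons a l ih =>
    rcases mem_union.1 hp with hp | hp
    exacts [h.2.1 p hp, ih h.2.2 hp]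

theorem momentBound_omega (h : IsPrimeList l) (h' : IsDisjoint l) :
    MomentBound (support l) (fun k => omega l k ^ 2) (bigMass l ^ 2) := by
  induction l with
  | nil => simpa [support, omega, bigMass] using MomentBound.one
  | cons a l ih =>
    have key := (ih h.2.2 h'.2).omega_sq (by positivity) h.2.1 fun p hp q hq =>
      (Nat.coprime_primes (h.2.1 p hp) (h.2.2.prime_of_mem hq)).2 fun hpq => h'.1 p hp (hpq ▸ hq)
    convert key using 1
    · rfl
    · funext k
      simp only [omega]
      ring
    · simp only [bigMass]
      ring

theorem sum_omega_sq_le (h : IsPrimeList l) (h' : IsDisjoint l) (hB : ∀ p ∈ B, p.Prime)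
    (hBl : ∀ p ∈ B, p ∉ support l) (k : ℕ) (h1 : 0 ≤ Y₁) :
    ∑ n ∈ Ioc ⌊Y₀⌋₊ ⌊Y₁⌋₊, (omegaIn B n ^ k * omega l n) ^ 2
      ≤ (2 * k).factorial * (exp (2 * recipSum B) * bigMass l ^ 2) * Y₁ := by
  have key := ((momentBound_omega h h').exp_omega (by positivity) B hB fun p hp q hq =>
      (Nat.coprime_primes (hB p hp) (h.prime_of_mem hq)).2 fun hpq => hBl p hp (hpq ▸ hq))
  have key2 := key.2 1 le_rfl (fun p _ => Nat.coprime_one_left p) Y₁ h1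
  rw [filter_true_of_mem fun k _ => one_dvd k, Nat.cast_one, div_one] at key2
  calc ∑ n ∈ Ioc ⌊Y₀⌋₊ ⌊Y₁⌋₊, (omegaIn B n ^ k * omega l n) ^ 2
      ≤ ∑ n ∈ Ioc 0 ⌊Y₁⌋₊, (omegaIn B n ^ k * omega l n) ^ 2 :=
        sum_le_sum_of_subset_of_nonneg (Ioc_subset_Ioc (Nat.zero_le _) le_rfl) fun _ _ _ => by positivity
    _ ≤ ∑ n ∈ Ioc 0 ⌊Y₁⌋₊, (2 * k).factorial * (exp (omegaIn B n) * omega l n ^ 2) := by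
        refine sum_le_sum fun n _ => ?_
        have h2 := pow_div_factorial_le_exp _ (omegaIn_nonneg B n) (2 * k)
        rw [div_le_iff₀ (by positivity)] at h2
        calc (omegaIn B n ^ k * omega l n) ^ 2 = omegaIn B n ^ (2 * k) * omega l n ^ 2 := by ring
          _ ≤ (exp (omegaIn B n) * (2 * k).factorial) * omega l n ^ 2 := by gcongr
          _ = _ := by ring
    _ ≤ _ := by
        rw [← Finset.mul_sum, mul_assoc]
        gcongr

end ScaleList

/-- The logarithm of `p` rounded down to a multiple of `1 / r`. -/
noncomputable def rnd (r p : ℕ) : ℝ := (⌊(r:ℝ) * log p⌋₊ : ℝ) / r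

theorem rnd_nonneg (r p : ℕ) : 0 ≤ rnd r p := by unfold rnd; positivity

theorem rnd_le_log (hr : 1 ≤ r) (hp : 1 ≤ p) : rnd r p ≤ log p := by
  have hr0 : (0:ℝ) < r := by exact_mod_cast hr
  rw [rnd, div_le_iff₀ hr0, mul_comm]
  exact Nat.floor_le (by positivity)

theorem log_le_rnd_add (hr : 1 ≤ r) : log p ≤ rnd r p + 1 / r := by
  have hr0 : (0:ℝ) < r := by exact_mod_cast hr
  rw [rnd, ← add_div, le_div_iff₀ hr0, mul_comm]
  exact (Nat.lt_floor_add_one _).le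

theorem exp_rnd_le (hr : 1 ≤ r) (hp : 1 ≤ p) : exp (rnd r p) ≤ p :=
  (le_log_iff_exp_le (by exact_mod_cast hp)).1 (rnd_le_log hr hp)

theorem le_exp_rnd (hr : 1 ≤ r) (hp : 1 ≤ p) : (p:ℝ) ≤ exp (rnd r p + 1 / r) :=
  (log_le_iff_le_exp (by exact_mod_cast hp)).1 (log_le_rnd_add hr)

/-- The iterated sum attached to a family of sets of primes and a kernel `W`, which is evaluated at
`σ` increased by the rounded logarithms of the primes. -/
noncomputable def nested : ScaleList → (ℝ → ℝ → ℂ) → ℝ → ℝ → ℂ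
  | [], W, σ, t => W σ t
  | (r, B) :: l, W, σ, t => ∑ p ∈ B, chi p t * nested l W (σ + rnd r p) t

theorem nested_append (l l' : ScaleList) (W : ℝ → ℝ → ℂ) (σ t : ℝ) :
    nested (l ++ l') W σ t = nested l (nested l' W) σ t := by
  induction l generalizing σ with
  | nil => rfl
  | cons a l ih =>
    change ∑ p ∈ a.2, chi p t * nested (l ++ l') W (σ + rnd a.1 p) t = ∑ p ∈ a.2, chi p t * nested l (nested l' W) (σ + rnd a.1 p) t
    grind

theorem IsDP.nested (hl : l.IsPrimeList) {W : ℝ → ℝ → ℂ} (ha : 0 ≤ a) (hb : 0 ≤ b)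
    (hg : DivMono g) (hg0 : ∀ n, 0 ≤ g n) (hW : ∀ σ, 0 ≤ σ → IsDP (W σ) g (a * exp (-σ)) (b * exp (-σ))) (hσ : 0 ≤ σ) :
    IsDP (nested l W σ) (fun n => l.omega n * g n) (a * exp (-σ)) (b * exp l.slack * exp (-σ)) := by
  induction l generalizing σ with
  | nil => simpa [SmoothGaps.nested, ScaleList.omega, ScaleList.slack] using hW σ hσ
  | cons x l ih =>
    obtain ⟨hr, hp, hl'⟩ := hl
    have hp1 : ∀ p ∈ x.2, 1 ≤ p := fun p h => (hp p h).one_le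
    have key := IsDP.sum (g' := fun n => ScaleList.omega (x :: l) n * g n) (Y₀ := a * exp (-σ))
      (Y₁ := b * exp (ScaleList.slack (x :: l)) * exp (-σ)) hp1 (fun p h => ih hl' (σ := σ + rnd x.1 p) (add_nonneg hσ (rnd_nonneg _ _)))
      (fun p _ => by positivity) (fun p _ => by positivity) (by positivity) (by positivity) (fun p h => ?_) (fun p h => ?_)
      (fun p _ m hm => ?_) (fun n => ?_)
    · exact key
    · have h1 := exp_rnd_le hr (hp1 p h)
      have h2 : exp (-σ) = exp (rnd x.1 p) * exp (-(σ + rnd x.1 p)) := by rw [← exp_add]; ring_nf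
      calc a * exp (-σ) = exp (rnd x.1 p) * (a * exp (-(σ + rnd x.1 p))) := by rw [h2]; ring
        _ ≤ p * (a * exp (-(σ + rnd x.1 p))) := by gcongr
    · have h1 := le_exp_rnd hr (hp1 p h)
      calc p * (b * exp (ScaleList.slack l) * exp (-(σ + rnd x.1 p)))
          ≤ exp (rnd x.1 p + 1 / x.1) * (b * exp (ScaleList.slack l) * exp (-(σ + rnd x.1 p))) := by gcongr
        _ = b * (exp (rnd x.1 p + 1 / x.1) * exp (ScaleList.slack l) * exp (-(σ + rnd x.1 p))) := by ring
        _ = b * (exp (1 / x.1 + ScaleList.slack l) * exp (-σ)) := by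
          rw [← exp_add, ← exp_add, ← exp_add]; ring_nf
        _ = _ := by rw [ScaleList.slack]; ring
    · exact ((ScaleList.divMono_omega l).mul hg (ScaleList.omega_nonneg l) hg0) (Nat.div_dvd_of_dvd hm)
    · exact le_of_eq (by simp only [ScaleList.omega]; ring)

theorem exists_nested_eq_sum (hl : l.IsPrimeList) :
    ∃ (ι : Type) (I : Finset ι) (d : ι → ℕ) (y : ι → ℝ),
      (∀ i ∈ I, 1 ≤ d i ∧ 0 ≤ y i ∧ exp (y i) ≤ d i ∧ (d i : ℝ) ≤ exp (y i + l.slack) ∧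
        (∀ p : ℕ, p.Prime → p ∣ d i → p ∈ l.support)) ∧
      (∀ i ∈ I, ∀ u : ℕ × Finset ℕ → ℝ, (∀ a ∈ l, ∀ p ∈ a.2, u a ≤ rnd a.1 p) → (l.map u).sum ≤ y i) ∧
      (∀ i ∈ I, ∀ u : ℕ × Finset ℕ → ℝ, (∀ a ∈ l, ∀ p ∈ a.2, rnd a.1 p ≤ u a) → y i ≤ (l.map u).sum) ∧
      (∀ i ∈ I, ∀ r : ℕ, (∀ a ∈ l, a.1 = r) → ∃ v : ℕ, y i = v / r) ∧
      ∑ i ∈ I, 1 / (d i : ℝ) = l.mass ∧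
      ∀ (W : ℝ → ℝ → ℂ) (σ t : ℝ), nested l W σ t = ∑ i ∈ I, chi (d i) t * W (σ + y i) t := by
  induction l with
  | nil =>
    refine ⟨Unit, univ, fun _ => 1, fun _ => 0, ?_, ?_, ?_, ?_, ?_, ?_⟩
    · simp [ScaleList.slack, ScaleList.support]
      exact fun p hp h => hp.ne_one h
    · simp
    · simp
    · exact fun _ _ r _ => ⟨0, by simp⟩
    · simp [ScaleList.mass]
    · intro W σ t
      simp [nested, chi_one]
  | cons x l ih =>
    obtain ⟨hr, hp, hl'⟩ := hl
    obtain ⟨ι, I, d, y, h1, h2, h3, h4, h5, h6⟩ := ih hl'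
    refine ⟨ℕ × ι, x.2 ×ˢ I, fun i => i.1 * d i.2, fun i => rnd x.1 i.1 + y i.2, ?_, ?_, ?_, ?_, ?_, ?_⟩
    · rintro ⟨p, i⟩ hi
      obtain ⟨hpx, hi⟩ := mem_product.1 hi
      obtain ⟨ha, hb, hc, hd, he⟩ := h1 i hi
      have hpp := (hp p hpx)
      refine ⟨Nat.mul_pos hpp.pos ha, add_nonneg (rnd_nonneg _ _) hb, ?_, ?_, fun q hq hqd => ?_⟩
      · rw [exp_add]
        push_cast
        exact mul_le_mul (exp_rnd_le hr hpp.one_le) hc (by positivity) (by positivity)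
      · rw [ScaleList.slack, show rnd x.1 p + y i + (1 / (x.1:ℝ) + ScaleList.slack l) = (rnd x.1 p + 1 / x.1) + (y i + ScaleList.slack l) by ring,
          exp_add]
        push_cast
        exact mul_le_mul (le_exp_rnd hr hpp.one_le) hd (by positivity) (by positivity)
      · rcases hq.dvd_mul.1 hqd with h | h
        · exact mem_union_left _ ((Nat.prime_dvd_prime_iff_eq hq hpp).1 h ▸ hpx)
        · exact mem_union_right _ (he q hq h)
    · rintro ⟨p, i⟩ hi u hu
      obtain ⟨hpx, hi⟩ := mem_product.1 hi
      rw [List.map_cons, List.sum_cons]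
      exact add_le_add (hu x List.mem_cons_self p hpx) (h2 i hi u fun a ha => hu a (List.mem_cons_of_mem _ ha))
    · rintro ⟨p, i⟩ hi u hu
      obtain ⟨hpx, hi⟩ := mem_product.1 hi
      rw [List.map_cons, List.sum_cons]
      exact add_le_add (hu x List.mem_cons_self p hpx) (h3 i hi u fun a ha => hu a (List.mem_cons_of_mem _ ha))
    · rintro ⟨p, i⟩ hi r hr'
      obtain ⟨hpx, hi⟩ := mem_product.1 hi
      obtain ⟨v, hv⟩ := h4 i hi r fun a ha => hr' a (List.mem_cons_of_mem _ ha)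
      refine ⟨⌊(x.1:ℝ) * log p⌋₊ + v, ?_⟩
      change rnd x.1 p + y i = _
      rw [hv, rnd, hr' x List.mem_cons_self]
      push_cast
      ring
    · rw [ScaleList.mass, ← h5, recipSum, sum_mul_sum, sum_product]
      refine sum_congr rfl fun p _ => sum_congr rfl fun i _ => ?_
      push_cast
      rw [one_div_mul_one_div]
    · intro W σ t
      rw [nested, sum_product]
      refine sum_congr rfl fun p hpx => ?_
      rw [h6, Finset.mul_sum]
      refine sum_congr rfl fun i hi => ?_
      push_cast
      rw [chi_mul (by exact_mod_cast (hp p hpx).pos.ne') (by have := (h1 i hi).1; positivity), add_assoc]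
      ring

theorem nested_sub (hl : l.IsPrimeList) (W W' : ℝ → ℝ → ℂ) (σ t : ℝ) :
    nested l (fun σ t => W σ t - W' σ t) σ t = nested l W σ t - nested l W' σ t := by
  obtain ⟨ι, I, d, y, -, -, -, -, -, h⟩ := exists_nested_eq_sum hl
  rw [h, h, h, ← sum_sub_distrib]
  grind

theorem continuous_nested (hl : l.IsPrimeList) {W : ℝ → ℝ → ℂ} (hW : ∀ σ, Continuous (W σ)) (σ : ℝ) :
    Continuous (nested l W σ) := by
  obtain ⟨ι, I, d, y, -, -, -, -, -, h⟩ := exists_nested_eq_sum hl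
  rw [show nested l W σ = _ from funext fun t => h W σ t]
  exact continuous_finsetSum _ fun i _ => (continuous_chi _).mul (hW _)

theorem norm_nested_le (hl : l.IsPrimeList) {W : ℝ → ℝ → ℂ} (hM : 0 ≤ M) (hσ : 0 ≤ σ)
    (hW : ∀ σ, 0 ≤ σ → ‖W σ t‖ ≤ M * exp (-σ)) : ‖nested l W σ t‖ ≤ M * exp (-σ) * exp l.slack * l.mass := by
  obtain ⟨ι, I, d, y, h1, -, -, -, h5, h6⟩ := exists_nested_eq_sum hl
  rw [h6, ← h5, Finset.mul_sum]
  refine (norm_sum_le _ _).trans (sum_le_sum fun i hi => ?_)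
  obtain ⟨ha, hb, hc, hd, -⟩ := h1 i hi
  have hd0 : (0:ℝ) < d i := by exact_mod_cast ha
  rw [norm_mul, norm_chi, one_mul, mul_one_div, le_div_iff₀ hd0]
  calc ‖W (σ + y i) t‖ * d i ≤ (M * exp (-(σ + y i))) * exp (y i + l.slack) := by
        gcongr
        exact hW _ (by positivity)
    _ = M * (exp (-(σ + y i)) * exp (y i + l.slack)) := by ring
    _ = M * (exp (-σ) * exp l.slack) := by rw [← exp_add, ← exp_add]; ring_nf
    _ = _ := by ring

/-- Splitting the outermost sum according to the rounded logarithm. -/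
theorem nested_cons_eq_sum (r : ℕ) (B : Finset ℕ) (l : ScaleList) (W : ℝ → ℝ → ℂ) (σ t : ℝ) :
    nested ((r, B) :: l) W σ t = ∑ v ∈ B.image (fun p : ℕ => ⌊(r:ℝ) * log p⌋₊),
      (∑ p ∈ B.filter (fun p : ℕ => ⌊(r:ℝ) * log p⌋₊ = v), chi p t) * nested l W (σ + v / r) t := by
  rw [nested, ← sum_fiberwise_of_maps_to (g := fun p : ℕ => ⌊(r:ℝ) * log p⌋₊) (t := B.image fun p : ℕ => ⌊(r:ℝ) * log p⌋₊)
    fun p hp => mem_image_of_mem _ hp]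
  refine sum_congr rfl fun v _ => ?_
  rw [Finset.sum_mul]
  refine sum_congr rfl fun p hp => ?_
  rw [rnd, (mem_filter.1 hp).2]

/-- The kernel which is `1` at `s` and `0` elsewhere. -/
noncomputable def deltaKernel (s : ℝ) : ℝ → ℝ → ℂ := fun σ _ => if σ = s then 1 else 0

theorem IsDP.deltaKernel (s σ : ℝ) :
    IsDP (deltaKernel s σ) (fun _ => 1) (exp s / 2 * exp (-σ)) (exp s * exp (-σ)) := by
  unfold SmoothGaps.deltaKernel
  by_cases h : σ = s
  · have h1 : exp s * exp (-σ) = 1 := by rw [h, ← exp_add]; simp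
    rw [show exp s / 2 * exp (-σ) = exp s * exp (-σ) / 2 by ring, h1]
    simpa [h] using IsDP.one
  · refine ⟨fun _ => 0, fun _ => ⟨le_rfl, zero_le_one⟩, fun t => ?_⟩
    simp [h]

/-- Factoring the kernel out of an iterated sum with a common rounding parameter. -/
theorem exists_nested_eq_sum_deltaKernel (hl : l.IsPrimeList) (hr : 1 ≤ r) (hlr : ∀ a ∈ l, a.1 = r) {u₀ u₁ : ℝ} (hu₁ : 0 ≤ u₁)
    (hl0 : ∀ a ∈ l, ∀ p ∈ a.2, u₀ ≤ rnd a.1 p) (hl1 : ∀ a ∈ l, ∀ p ∈ a.2, rnd a.1 p ≤ u₁) (σ : ℝ) :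
    ∃ S : Finset ℝ, (#S : ℝ) ≤ r * (l.length * u₁) + 1 ∧ (∀ s ∈ S, σ + l.length * u₀ ≤ s ∧ s ≤ σ + l.length * u₁) ∧
      ∀ (W : ℝ → ℝ → ℂ) (t : ℝ), nested l W σ t = ∑ s ∈ S, nested l (deltaKernel s) σ t * W s t := by
  obtain ⟨ι, I, d, y, -, h2, h3, h4, -, h6⟩ := exists_nested_eq_sum hl
  have hr0 : (0:ℝ) < r := by exact_mod_cast hr
  have hc : ∀ u : ℝ, (l.map fun _ => u).sum = l.length * u := by simp
  have hy0 : ∀ i ∈ I, l.length * u₀ ≤ y i := fun i hi => by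
    rw [← hc]; exact h2 i hi _ hl0
  have hy1 : ∀ i ∈ I, y i ≤ l.length * u₁ := fun i hi => by
    rw [← hc]; exact h3 i hi _ hl1
  refine ⟨I.image fun i => σ + y i, ?_, fun s hs => ?_, fun W t => ?_⟩
  · have hsub : (I.image fun i => σ + y i) ⊆ (range (⌊r * (l.length * u₁)⌋₊ + 1)).image fun v : ℕ => σ + (v:ℝ) / r := by
      intro s hs
      obtain ⟨i, hi, rfl⟩ := mem_image.1 hs
      obtain ⟨v, hv⟩ := h4 i hi r hlr
      refine mem_image.2 ⟨v, ?_, by rw [hv]⟩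
      have := hy1 i hi
      rw [hv, div_le_iff₀ hr0, mul_comm] at this
      exact mem_range.2 (Nat.lt_succ_of_le (Nat.le_floor this))
    calc (#(I.image fun i => σ + y i) : ℝ) ≤ (⌊r * (l.length * u₁)⌋₊ + 1 : ℕ) := by
          exact_mod_cast (card_le_card hsub).trans (card_image_le.trans (card_range _).le)
      _ ≤ _ := by
        push_cast
        gcongr
        exact Nat.floor_le (by positivity)
  · grind
  · rw [h6]
    simp_rw [h6, Finset.sum_mul]
    rw [sum_comm]
    refine sum_congr rfl fun i hi => ?_
    rw [sum_eq_single (σ + y i)]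
    · simp [deltaKernel]
    · intro s _ hs
      simp [deltaKernel, Ne.symm hs]
    grind

theorem IsDP.exists_bound (h : IsDP F g Y₀ Y₁) : ∃ C : ℝ, ∀ t, ‖F t‖ ≤ C := by
  obtain ⟨a, -, h⟩ := h
  refine ⟨∑ n ∈ Ioc ⌊Y₀⌋₊ ⌊Y₁⌋₊, ‖(a n : ℂ)‖, fun t => ?_⟩
  rw [h]
  exact (norm_sum_le _ _).trans (sum_le_sum fun n _ => by rw [norm_mul, norm_chi, mul_one])

theorem integrable_norm_sq_mul_cauchyWeight {f : ℝ → ℂ} (hT : 0 < T) (hf : Continuous f) (hC : ∀ t, ‖f t‖ ≤ C) :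
    Integrable fun t => ‖f t‖ ^ 2 * cauchyWeight T t := by
  refine (integrable_cauchyWeight hT).bdd_mul (c := C ^ 2) (hf.norm.pow 2).aestronglyMeasurable (.of_forall fun t => ?_)
  rw [norm_pow, norm_norm]
  exact pow_le_pow_left₀ (norm_nonneg _) (hC t) 2

/-- The kernel `W` is at every `σ` a Dirichlet polynomial of length about `X e ^ (-σ)` with
coefficients in `[0, K]`, minus a smooth main term. -/
structure KernelBound (X K : ℝ) (W Ws Wi : ℝ → ℝ → ℂ) : Prop where
  nonneg : 0 ≤ K
  eq_sub : ∀ σ t, W σ t = Ws σ t - Wi σ t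
  isDP : ∀ σ, 0 ≤ σ → IsDP (Ws σ) (fun _ => K) (X * exp (-σ)) (exp 8 * X * exp (-σ))
  norm_le : ∀ σ, 0 ≤ σ → ∀ t, ‖Wi σ t‖ ≤ 4 * exp 8 * K * X * exp (-σ) / (1 + |t|)
  continuous_main : ∀ σ, Continuous (Wi σ)
  continuous_sum : ∀ σ, Continuous (Ws σ)

namespace KernelBound

variable {X K : ℝ} {W Ws Wi : ℝ → ℝ → ℂ}

theorem continuous_nested (h : KernelBound X K W Ws Wi) (hl : l.IsPrimeList) (σ : ℝ) : Continuous (nested l W σ) :=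
  SmoothGaps.continuous_nested hl (fun σ => by
    rw [show W σ = fun t => Ws σ t - Wi σ t from funext (h.eq_sub σ)]
    exact (h.continuous_sum σ).sub (h.continuous_main σ)) σ

theorem nested_isDP (h : KernelBound X K W Ws Wi) (hX : 0 ≤ X) (hl : l.IsPrimeList) (hσ : 0 ≤ σ) :
    IsDP (nested l Ws σ) (fun n => l.omega n * K) (X * exp (-σ)) (exp 8 * X * exp l.slack * exp (-σ)) :=
  IsDP.nested hl hX (by positivity) (divMono_const K) (fun _ => h.nonneg) h.isDP hσ

theorem norm_nested_main_le (h : KernelBound X K W Ws Wi) (hX : 0 ≤ X) (hl : l.IsPrimeList) (hσ : 0 ≤ σ) (t : ℝ) :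
    ‖nested l Wi σ t‖ ≤ 4 * exp 8 * K * X / (1 + |t|) * exp (-σ) * exp l.slack * l.mass := by
  have hK := h.nonneg
  exact norm_nested_le hl (by positivity) hσ fun σ hσ => (h.norm_le σ hσ t).trans (le_of_eq (by ring))

theorem exists_bound_nested (h : KernelBound X K W Ws Wi) (hX : 0 ≤ X) (hl : l.IsPrimeList) (hσ : 0 ≤ σ) :
    ∃ C : ℝ, ∀ t, ‖nested l W σ t‖ ≤ C := by
  obtain ⟨C, hC⟩ := (h.nested_isDP hX hl hσ).exists_bound
  have hK := h.nonneg
  refine ⟨C + 4 * exp 8 * K * X * exp (-σ) * exp l.slack * l.mass, fun t => ?_⟩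
  rw [show W = fun σ t => Ws σ t - Wi σ t from funext fun σ => funext (h.eq_sub σ), nested_sub hl]
  refine (norm_sub_le _ _).trans (add_le_add (hC t) ((h.norm_nested_main_le hX hl hσ t).trans ?_))
  have := l.mass_nonneg
  have : 4 * exp 8 * K * X / (1 + |t|) ≤ 4 * exp 8 * K * X := div_le_self (by positivity) (by linarith [abs_nonneg t])
  gcongr

theorem integrable_nested (h : KernelBound X K W Ws Wi) (hX : 0 ≤ X) (hT : 0 < T) (hl : l.IsPrimeList) (hσ : 0 ≤ σ) :
    Integrable fun t => ‖nested l W σ t‖ ^ 2 * cauchyWeight T t := by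
  obtain ⟨C, hC⟩ := h.exists_bound_nested hX hl hσ
  exact integrable_norm_sq_mul_cauchyWeight hT (h.continuous_nested hl σ) hC

end KernelBound

theorem continuous_sum_chi (B : Finset ℕ) : Continuous fun t => ∑ p ∈ B, chi p t :=
  continuous_finsetSum _ fun _ _ => continuous_chi _

theorem norm_sum_chi_le (B : Finset ℕ) (t : ℝ) : ‖∑ p ∈ B, chi p t‖ ≤ #B := by
  refine (norm_sum_le _ _).trans (le_of_eq ?_)
  simp [norm_chi]

/-- `B` consists of primes in a logarithmic unit interval to the right of `y`. -/
def IsBlock (B : Finset ℕ) (y : ℝ) : Prop := 0 ≤ y ∧ ∀ p ∈ B, p.Prime ∧ y ≤ log p ∧ log p ≤ y + 1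

theorem IsBlock.bounds (h : IsBlock B y) : ∀ p ∈ B, 1 ≤ p ∧ exp y ≤ p ∧ (p:ℝ) ≤ exp (y + 1) := fun p hp => by
  obtain ⟨hpp, h1, h2⟩ := h.2 p hp
  have hp0 : (0:ℝ) < p := by exact_mod_cast hpp.pos
  exact ⟨hpp.one_le, (le_log_iff_exp_le hp0).1 h1, (log_le_iff_le_exp hp0).1 h2⟩

theorem exp_two_mul_recipSum_le (h : IsBlock B y) : exp (2 * recipSum B) ≤ exp 6 := by
  have := (recipSum_le_of_block h.2).2
  have := exp_one_lt_d9
  exact exp_le_exp.2 (by linarith)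

theorem IsBlock.norm_pow_le (h : IsBlock B y) (k : ℕ) (t : ℝ) :
    (‖∑ p ∈ B, chi p t‖ * exp (-y)) ^ k ≤ exp k := by
  calc (‖∑ p ∈ B, chi p t‖ * exp (-y)) ^ k ≤ (exp (y + 1) * exp (-y)) ^ k := by
        gcongr
        exact (norm_sum_chi_le B t).trans (recipSum_le_of_block h.2).1
    _ = exp k := by rw [← exp_add, ← exp_nat_mul]; ring_nf

set_option maxHeartbeats 1000000 in
/-- Mean values of an iterated sum multiplied by a high power of a prime block. -/
theorem integral_block_pow_mul_nested_le : ∃ C : ℝ, 0 < C ∧ ∀ {X T K : ℝ} {W Ws Wi : ℝ → ℝ → ℂ}, 0 < X → 0 < T → KernelBound X K W Ws Wi →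
    ∀ {l : ScaleList}, l.IsPrimeList → l.IsDisjoint → l.slack ≤ 1 → ∀ {B : Finset ℕ} {y : ℝ}, IsBlock B y → (∀ p ∈ B, p ∉ l.support) →
    ∀ (k : ℕ) {σ : ℝ}, 0 ≤ σ → T ≤ exp 7 * X * exp (k * y - σ) →
    ∫ t, ((‖∑ p ∈ B, chi p t‖ * exp (-y)) ^ k * (exp σ * ‖nested l W σ t‖)) ^ 2 * cauchyWeight T t
      ≤ C * exp (2 * k) * (2 * k).factorial * (K ^ 2 * l.bigMass ^ 2) * X ^ 2 / T := by
  refine ⟨6 * π * exp 24 + 32 * π * exp 18, by positivity, ?_⟩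
  intro X T K W Ws Wi hX hT h l hl hl' hsl B y hB hBl k σ hσ hTX
  have hK := h.nonneg
  set D : ℝ → ℂ := fun t => ∑ p ∈ B, chi p t with hD
  set Λ := l.bigMass
  have hΛ : 0 ≤ Λ := l.bigMass_nonneg
  have hmΛ : l.mass ≤ Λ := l.mass_le_bigMass
  have hm0 := l.mass_nonneg
  -- the Dirichlet polynomial part
  set F : ℝ → ℂ := fun t => D t ^ k * nested l Ws σ t with hF
  have hFdp := IsDP.pow_mul (fun p hp => hB.bounds p hp) (exp_pos y).le (exp_pos (y + 1)).le (h.nested_isDP hX.le hl hσ)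
    (by positivity) (by positivity) ((ScaleList.divMono_omega l).mul (divMono_const K) l.omega_nonneg fun _ => hK)
    (fun n => mul_nonneg (l.omega_nonneg n) hK) k
  set Y₁ := exp (y + 1) ^ k * (exp 8 * X * exp l.slack * exp (-σ)) with hY₁
  have hY₁0 : 0 ≤ Y₁ := by positivity
  set Z := X * exp (k * y - σ) with hZ
  have hZ0 : 0 < Z := by positivity
  have hY₁Z : Y₁ ≤ exp (k + 9) * Z := by
    calc Y₁ ≤ exp (y + 1) ^ k * (exp 8 * X * exp 1 * exp (-σ)) := by rw [hY₁]; gcongr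
      _ = exp (k * (y + 1)) * exp 8 * exp 1 * exp (-σ) * X := by rw [← exp_nat_mul]; ring
      _ = exp (k + 9) * exp (k * y - σ) * X := by
        rw [← exp_add, ← exp_add, ← exp_add, ← exp_add]; ring_nf
      _ = _ := by rw [hZ]; ring
  have hmv := hFdp.meanValue (by positivity) hY₁0 hT
  have hsum := ScaleList.sum_omega_sq_le (Y₀ := exp y ^ k * (X * exp (-σ))) hl hl' (fun p hp => (hB.2 p hp).1) hBl k hY₁0
  have hS : ∑ n ∈ Ioc ⌊exp y ^ k * (X * exp (-σ))⌋₊ ⌊Y₁⌋₊, (omegaIn B n ^ k * (l.omega n * K)) ^ 2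
      ≤ (2 * k).factorial * (exp 6 * Λ ^ 2) * (exp (k + 9) * Z) * K ^ 2 := by
    calc _ = (∑ n ∈ Ioc ⌊exp y ^ k * (X * exp (-σ))⌋₊ ⌊Y₁⌋₊, (omegaIn B n ^ k * l.omega n) ^ 2) * K ^ 2 := by
          rw [Finset.sum_mul]; grind
      _ ≤ ((2 * k).factorial * (exp (2 * recipSum B) * Λ ^ 2) * Y₁) * K ^ 2 := by gcongr
      _ ≤ _ := by
        have := exp_two_mul_recipSum_le hB
        gcongr
  have hone : 1 + 2 * Y₁ / T ≤ 3 * (exp (k + 9) * Z) / T := by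
    have h1 : T ≤ exp (k + 9) * Z := by
      refine hTX.trans ?_
      rw [mul_assoc, ← hZ]
      exact mul_le_mul_of_nonneg_right (exp_le_exp.2 (by linarith)) hZ0.le
    rw [le_div_iff₀ hT, add_mul, div_mul_cancel₀ _ hT.ne']
    linarith
  have hFint : ∫ t, ‖F t‖ ^ 2 * cauchyWeight T t ≤ π * (3 * (exp (k + 9) * Z) / T)
      * ((2 * k).factorial * (exp 6 * Λ ^ 2) * (exp (k + 9) * Z) * K ^ 2) := by
    refine hmv.trans ?_
    gcongr
  -- the main term part
  have hpt : ∀ t, ((‖D t‖ * exp (-y)) ^ k * (exp σ * ‖nested l W σ t‖)) ^ 2 * cauchyWeight T t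
      ≤ 2 * exp (-(2 * (k * y)) + 2 * σ) * (‖F t‖ ^ 2 * cauchyWeight T t)
        + 2 * exp (2 * k) * (4 * exp 9 * K * X * Λ) ^ 2 * ((1 / (1 + |t|)) ^ 2 * cauchyWeight T t) := fun t => by
    have hcw := cauchyWeight_nonneg hT t
    have h1 : nested l W σ t = nested l Ws σ t - nested l Wi σ t := by
      rw [show W = fun σ t => Ws σ t - Wi σ t from funext fun σ => funext (h.eq_sub σ), nested_sub hl]
    have h2 := norm_sub_le (nested l Ws σ t) (nested l Wi σ t)
    rw [← h1] at h2
    have h3 : ‖nested l Wi σ t‖ ≤ 4 * exp 9 * K * X * Λ * (1 / (1 + |t|)) * exp (-σ) := by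
      refine (h.norm_nested_main_le hX.le hl hσ t).trans ?_
      calc 4 * exp 8 * K * X / (1 + |t|) * exp (-σ) * exp l.slack * l.mass
          ≤ 4 * exp 8 * K * X / (1 + |t|) * exp (-σ) * exp 1 * Λ := by gcongr
        _ = 4 * (exp 8 * exp 1) * K * X * Λ * (1 / (1 + |t|)) * exp (-σ) := by ring
        _ = _ := by rw [← exp_add]; norm_num
    have h4 := hB.norm_pow_le k t
    set d := (‖D t‖ * exp (-y)) ^ k with hd
    have h5 : d * (exp σ * ‖nested l W σ t‖) ≤ d * (exp σ * ‖nested l Ws σ t‖) + exp k * (4 * exp 9 * K * X * Λ * (1 / (1 + |t|))) := by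
      calc d * (exp σ * ‖nested l W σ t‖) ≤ d * (exp σ * (‖nested l Ws σ t‖ + 4 * exp 9 * K * X * Λ * (1 / (1 + |t|)) * exp (-σ))) := by
            gcongr; exact h2.trans (by linarith)
        _ = d * (exp σ * ‖nested l Ws σ t‖) + d * (4 * exp 9 * K * X * Λ * (1 / (1 + |t|))) * (exp σ * exp (-σ)) := by ring
        _ ≤ _ := by
          rw [← exp_add, add_neg_cancel, exp_zero, mul_one]
          gcongr
    have h6 : (d * (exp σ * ‖nested l Ws σ t‖)) ^ 2 = exp (-(2 * (k * y)) + 2 * σ) * ‖F t‖ ^ 2 := by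
      rw [hF, norm_mul, norm_pow, hd, mul_pow, mul_pow, mul_pow, mul_pow (‖D t‖ ^ k), mul_pow (exp σ), ← exp_nat_mul, ← exp_nat_mul,
        ← exp_nat_mul, exp_add]
      grind
    have h7 : (exp k * (4 * exp 9 * K * X * Λ * (1 / (1 + |t|)))) ^ 2
        = exp (2 * k) * (4 * exp 9 * K * X * Λ) ^ 2 * (1 / (1 + |t|)) ^ 2 := by
      rw [show exp (2 * (k:ℝ)) = exp k ^ 2 by rw [← exp_nat_mul]; norm_num]
      ring
    have h8 : (d * (exp σ * ‖nested l W σ t‖)) ^ 2 ≤ 2 * (exp (-(2 * (k * y)) + 2 * σ) * ‖F t‖ ^ 2)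
        + 2 * (exp (2 * k) * (4 * exp 9 * K * X * Λ) ^ 2 * (1 / (1 + |t|)) ^ 2) := by
      rw [← h6, ← h7]
      have h9 : 0 ≤ d * (exp σ * ‖nested l W σ t‖) := by positivity
      refine (pow_le_pow_left₀ h9 h5 2).trans ?_
      nlinarith [sq_nonneg (d * (exp σ * ‖nested l Ws σ t‖) - exp k * (4 * exp 9 * K * X * Λ * (1 / (1 + |t|))))]
    calc _ ≤ (2 * (exp (-(2 * (k * y)) + 2 * σ) * ‖F t‖ ^ 2)
        + 2 * (exp (2 * k) * (4 * exp 9 * K * X * Λ) ^ 2 * (1 / (1 + |t|)) ^ 2)) * cauchyWeight T t := by gcongr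
      _ = _ := by ring
  obtain ⟨CF, hCF⟩ := hFdp.exists_bound
  have hFi : Integrable fun t => ‖F t‖ ^ 2 * cauchyWeight T t := integrable_norm_sq_mul_cauchyWeight hT hFdp.continuous hCF
  have hMi : Integrable fun t : ℝ => (1 / (1 + |t|)) ^ 2 * cauchyWeight T t := by
    refine (integrable_cauchyWeight hT).bdd_mul (c := 1) (Continuous.aestronglyMeasurable ?_) (.of_forall fun t => ?_)
    · exact (continuous_const.div (continuous_const.add continuous_abs) fun t : ℝ => (by positivity : (1 + |t| : ℝ) ≠ 0)).pow 2
    · rw [norm_pow, norm_of_nonneg (by positivity)]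
      exact pow_le_one₀ (by positivity) ((div_le_one (by positivity)).2 (by linarith [abs_nonneg t]))
  calc _ ≤ ∫ t, (2 * exp (-(2 * (k * y)) + 2 * σ) * (‖F t‖ ^ 2 * cauchyWeight T t)
        + 2 * exp (2 * k) * (4 * exp 9 * K * X * Λ) ^ 2 * ((1 / (1 + |t|)) ^ 2 * cauchyWeight T t)) :=
        integral_mono_of_nonneg (.of_forall fun t => mul_nonneg (sq_nonneg _) (cauchyWeight_nonneg hT t))
          ((hFi.const_mul _).add (hMi.const_mul _)) (.of_forall hpt)
    _ = 2 * exp (-(2 * (k * y)) + 2 * σ) * (∫ t, ‖F t‖ ^ 2 * cauchyWeight T t)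
        + 2 * exp (2 * k) * (4 * exp 9 * K * X * Λ) ^ 2 * (∫ t, (1 / (1 + |t|)) ^ 2 * cauchyWeight T t) := by
        rw [integral_add (hFi.const_mul _) (hMi.const_mul _), integral_const_mul, integral_const_mul]
    _ ≤ 2 * exp (-(2 * (k * y)) + 2 * σ) * (π * (3 * (exp (k + 9) * Z) / T)
          * ((2 * k).factorial * (exp 6 * Λ ^ 2) * (exp (k + 9) * Z) * K ^ 2))
        + 2 * exp (2 * k) * (4 * exp 9 * K * X * Λ) ^ 2 * (π / T) := by
        exact add_le_add (mul_le_mul_of_nonneg_left hFint (by positivity))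
          (mul_le_mul_of_nonneg_left (integral_inv_one_add_abs_sq_le hT) (by positivity))
    _ = 6 * π * (exp (-(2 * (k * y)) + 2 * σ) * exp (k + 9) * exp (k + 9) * exp 6
          * exp (k * y - σ) * exp (k * y - σ)) * (2 * k).factorial * (K ^ 2 * Λ ^ 2) * X ^ 2 / T
        + 32 * π * (exp 9 * exp 9) * exp (2 * k) * (K ^ 2 * Λ ^ 2) * X ^ 2 / T := by rw [hZ]; ring
    _ = 6 * π * exp 24 * exp (2 * k) * (2 * k).factorial * (K ^ 2 * Λ ^ 2) * X ^ 2 / T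
        + 32 * π * exp 18 * exp (2 * k) * 1 * (K ^ 2 * Λ ^ 2) * X ^ 2 / T := by
        rw [← exp_add, ← exp_add, ← exp_add, ← exp_add, ← exp_add, ← exp_add,
          mul_assoc (6 * π) (exp 24), ← exp_add, mul_one]
        ring_nf
    _ ≤ 6 * π * exp 24 * exp (2 * k) * (2 * k).factorial * (K ^ 2 * Λ ^ 2) * X ^ 2 / T
        + 32 * π * exp 18 * exp (2 * k) * (2 * k).factorial * (K ^ 2 * Λ ^ 2) * X ^ 2 / T := by
        gcongr
        exact_mod_cast Nat.one_le_iff_ne_zero.2 (Nat.factorial_ne_zero _)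
    _ = _ := by ring

/-- The scales `r, r ^ 2, r ^ 4, …` with the primes `p` satisfying `r ^ 4 ≤ log p < r ^ 6`. -/
noncomputable def scales : ℕ → ℕ → ScaleList
  | 0, _ => []
  | n + 1, r => (r, primesIn ((r:ℝ) ^ 4) ((r:ℝ) ^ 6)) :: scales n (r ^ 2)

theorem le_log_of_mem_support_scales (hr : 1 ≤ r) (hp : p ∈ (scales n r).support) : (r:ℝ) ^ 4 ≤ log p := by
  induction n generalizing r with
  | zero => simp [scales, ScaleList.support] at hp
  | succ n ih =>
    rcases mem_union.1 hp with hp | hp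
    · exact (mem_primesIn.1 hp).2.1
    · have h := ih (Nat.one_le_pow _ _ hr) hp
      have hr1 : (1:ℝ) ≤ r := by exact_mod_cast hr
      refine le_trans ?_ h
      push_cast
      rw [← pow_mul]
      exact pow_le_pow_right₀ hr1 (by norm_num)

theorem log_lt_of_mem_support_scales (hr : 1 ≤ r) (hp : p ∈ (scales n r).support) :
    log p < ((r:ℝ) ^ 2 ^ n) ^ 3 := by
  induction n generalizing r with
  | zero => simp [scales, ScaleList.support] at hp
  | succ n ih =>
    have hr1 : (1:ℝ) ≤ r := by exact_mod_cast hr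
    rcases mem_union.1 hp with hp | hp
    · refine (mem_primesIn.1 hp).2.2.trans_le ?_
      rw [← pow_mul]
      refine pow_le_pow_right₀ hr1 ?_
      grind
    · refine (ih (Nat.one_le_pow _ _ hr) hp).trans_le (le_of_eq ?_)
      push_cast
      rw [← pow_mul (r:ℝ) 2, pow_succ' 2 n]

theorem isPrimeList_scales (hr : 1 ≤ r) : (scales n r).IsPrimeList := by
  induction n generalizing r with
  | zero => trivial
  | succ n ih => exact ⟨hr, fun p hp => (mem_primesIn.1 hp).1, ih (Nat.one_le_pow _ _ hr)⟩

theorem isDisjoint_scales (hr : 1 ≤ r) : (scales n r).IsDisjoint := by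
  induction n generalizing r with
  | zero => trivial
  | succ n ih =>
    refine ⟨fun p hp hp' => ?_, ih (Nat.one_le_pow _ _ hr)⟩
    have hr1 : (1:ℝ) ≤ r := by exact_mod_cast hr
    have h1 := le_log_of_mem_support_scales (Nat.one_le_pow _ _ hr) hp'
    have h2 := (mem_primesIn.1 hp).2.2
    have h3 : (r:ℝ) ^ 6 ≤ ((r ^ 2 : ℕ) : ℝ) ^ 4 := by
      push_cast
      rw [← pow_mul]
      exact pow_le_pow_right₀ hr1 (by norm_num)
    linarith

theorem slack_scales_le (hr : 2 ≤ r) : (scales n r).slack ≤ 2 / r := by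
  have hr0 : (2:ℝ) ≤ r := by exact_mod_cast hr
  induction n generalizing r with
  | zero => positivity
  | succ n ih =>
    have h2 : 2 ≤ r ^ 2 := by nlinarith
    have h := ih h2 (by exact_mod_cast h2)
    simp only [scales, ScaleList.slack]
    push_cast at h
    have h3 : 2 / (r:ℝ) ^ 2 ≤ 1 / r := by
      rw [div_le_div_iff₀ (by positivity) (by positivity)]
      nlinarith
    grind

/-- The points at which one of the blocks in `P` is exceptionally large. -/
def badSet (P : Finset (Finset ℕ × ℝ)) (A T₁ : ℝ) : Set ℝ :=
  {t | t ∈ Set.Icc (-T₁) T₁ ∧ ∃ b ∈ P, exp (-(A * b.2)) < ‖∑ p ∈ b.1, chi p t‖ * exp (-b.2)}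

theorem measurableSet_badSet (P : Finset (Finset ℕ × ℝ)) (A T₁ : ℝ) : MeasurableSet (badSet P A T₁) := by
  have : badSet P A T₁ = Set.Icc (-T₁) T₁ ∩ ⋃ b ∈ P, {t | exp (-(A * b.2)) < ‖∑ p ∈ b.1, chi p t‖ * exp (-b.2)} := by
    ext t
    simp [badSet]
  rw [this]
  refine measurableSet_Icc.inter (Finset.measurableSet_biUnion _ fun b _ => ?_)
  exact (isOpen_lt continuous_const ((continuous_sum_chi b.1).norm.mul continuous_const)).measurableSet

theorem badSet_subset {P : Finset (Finset ℕ × ℝ)} {A' : ℝ} (h : A ≤ A') (hP : ∀ b ∈ P, 0 ≤ b.2) : badSet P A T₁ ⊆ badSet P A' T₁ := by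
  rintro t ⟨ht, b, hb, h'⟩
  refine ⟨ht, b, hb, lt_of_le_of_lt (exp_le_exp.2 ?_) h'⟩
  have := mul_le_mul_of_nonneg_right h (hP b hb)
  linarith

theorem exists_scale_numerics (C : ℝ) : ∃ r₀ : ℕ, 32 ≤ r₀ ∧ ∀ r : ℕ, r₀ ≤ r →
    4 / (r:ℝ) * (1 + log (4 * (r:ℝ) ^ 4)) ≤ 1 ∧
    (r:ℝ) ^ 18 * (C * exp (-(5 * (r:ℝ) ^ 3))) ≤ exp (-(2 * (r:ℝ) ^ 2)) / 2 ∧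
    (r:ℝ) ^ 14 * (exp 2 * exp (-(2 * (r:ℝ) ^ 4))) ≤ exp (-(2 * (r:ℝ) ^ 2)) / 2 := by
  have h1 : Tendsto (fun r : ℝ => 4 / r * (1 + log (4 * r ^ 4))) atTop (𝓝 0) := by
    have h2 : Tendsto (fun r : ℝ => 4 * (1 + log 4) * r⁻¹ + 16 * (log r / r)) atTop (𝓝 (4 * (1 + log 4) * 0 + 16 * 0)) :=
      (tendsto_inv_atTop_zero.const_mul _).add (Tendsto.const_mul _ (isLittleO_log_id_atTop.tendsto_div_nhds_zero))
    rw [mul_zero, mul_zero, add_zero] at h2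
    refine h2.congr' ?_
    filter_upwards [eventually_gt_atTop 0] with r hr
    rw [log_mul (by norm_num) (by positivity), log_pow]
    push_cast
    field_simp
    ring
  have h3 := h1.eventually_le_const (show (0:ℝ) < 1 by norm_num)
  have h4 : ∀ (M : ℝ) (k : ℕ), ∀ᶠ r : ℝ in atTop, M * r ^ k ≤ exp r := fun M k => by
    have := (isLittleO_pow_exp_atTop (n := k)).bound (c := 1 / (|M| + 1)) (by positivity)
    filter_upwards [this, eventually_gt_atTop 0] with r hr hr0
    rw [norm_of_nonneg (by positivity), norm_of_nonneg (exp_pos r).le, div_mul_eq_mul_div, one_mul, le_div_iff₀ (by positivity)] at hr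
    have : M * r ^ k ≤ |M| * r ^ k := by gcongr; exact le_abs_self M
    nlinarith [pow_pos hr0 k]
  have h5 := tendsto_natCast_atTop_atTop.eventually (h3.and ((h4 (2 * C) 18).and (h4 (2 * exp 2) 14)))
  obtain ⟨r₁, hr₁⟩ := eventually_atTop.1 h5
  refine ⟨max r₁ 32, le_max_right _ _, fun r hr => ?_⟩
  obtain ⟨ha, hb, hc⟩ := hr₁ r ((le_max_left _ _).trans hr)
  have hr1 : (1:ℝ) ≤ r := by exact_mod_cast (by norm_num : 1 ≤ 32).trans ((le_max_right _ _).trans hr)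
  have h23 : (r:ℝ) ^ 2 ≤ r ^ 3 := by nlinarith
  have h12 : (r:ℝ) ≤ r ^ 2 := le_self_pow₀ hr1 (by norm_num)
  have h34 : (r:ℝ) ^ 3 ≤ r ^ 4 := by nlinarith
  have h32 : (32:ℝ) ≤ r := by exact_mod_cast (le_max_right _ _).trans hr
  refine ⟨ha, ?_, ?_⟩
  · calc (r:ℝ) ^ 18 * (C * exp (-(5 * (r:ℝ) ^ 3))) = (2 * C * (r:ℝ) ^ 18) * exp (-(5 * (r:ℝ) ^ 3)) / 2 := by ring
      _ ≤ exp r * exp (-(5 * (r:ℝ) ^ 3)) / 2 := by gcongr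
      _ = exp (r - 5 * (r:ℝ) ^ 3) / 2 := by rw [← exp_add]; ring_nf
      _ ≤ _ := by gcongr; linarith
  · calc (r:ℝ) ^ 14 * (exp 2 * exp (-(2 * (r:ℝ) ^ 4))) = (2 * exp 2 * (r:ℝ) ^ 14) * exp (-(2 * (r:ℝ) ^ 4)) / 2 := by ring
      _ ≤ exp r * exp (-(2 * (r:ℝ) ^ 4)) / 2 := by gcongr
      _ = exp (r - 2 * (r:ℝ) ^ 4) / 2 := by rw [← exp_add]; ring_nf
      _ ≤ _ := by gcongr; nlinarith

/-- The gain when passing from one scale to the next. -/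
theorem scale_gain (hα0 : 1 / 8 ≤ α) (hα : α ≤ 1 / 4) (hr : 32 ≤ r)
    (hlog : 4 / (r:ℝ) * (1 + log (4 * (r:ℝ) ^ 4)) ≤ 1) {z : ℝ} (hσ0 : 0 ≤ σ) (hσ : σ ≤ 2 * (r:ℝ) ^ 3)
    (hy : (r:ℝ) ^ 4 ≤ y) (hy' : y ≤ (r:ℝ) ^ 6) (hz : (r:ℝ) ^ 2 ≤ z) (hz' : z ≤ (r:ℝ) ^ 3) :
    exp (-(α - 4 / ((r ^ 2 : ℕ) : ℝ)) * y) ^ 2 * (exp ((α - 4 / r) * z) ^ ⌈(σ + y) / z⌉₊) ^ 2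
      * (exp (2 * ⌈(σ + y) / z⌉₊) * (2 * ⌈(σ + y) / z⌉₊).factorial) ≤ exp (-(5 * (r:ℝ) ^ 3)) := by
  have hr0 : (32:ℝ) ≤ r := by exact_mod_cast hr
  have hz0 : 0 < z := lt_of_lt_of_le (by positivity) hz
  have hy0 : 0 < y := lt_of_lt_of_le (by positivity) hy
  set k := ⌈(σ + y) / z⌉₊ with hk
  have hk1 : (k:ℝ) ≤ (σ + y) / z + 1 := (Nat.ceil_lt_add_one (by positivity)).le
  have hkz : k * z ≤ σ + y + z := by
    have := mul_le_mul_of_nonneg_right hk1 hz0.le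
    rwa [add_mul, div_mul_cancel₀ _ hz0.ne', one_mul] at this
  have h3 : 3 * (r:ℝ) ^ 3 ≤ 3 / r * y := by
    rw [div_mul_eq_mul_div, le_div_iff₀ (by linarith)]
    linarith
  have hk2 : 2 * (k:ℝ) ≤ 4 * y / (r:ℝ) ^ 2 := by
    rw [le_div_iff₀ (by positivity)]
    have h1 : (k:ℝ) * (r:ℝ) ^ 2 ≤ (σ + y) + (r:ℝ) ^ 2 := by
      calc (k:ℝ) * (r:ℝ) ^ 2 ≤ ((σ + y) / z + 1) * (r:ℝ) ^ 2 := by gcongr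
        _ = (σ + y) / z * (r:ℝ) ^ 2 + (r:ℝ) ^ 2 := by ring
        _ ≤ (σ + y) / z * z + (r:ℝ) ^ 2 := by gcongr
        _ = _ := by rw [div_mul_cancel₀ _ hz0.ne']
    have h4 : 2 * (r:ℝ) ^ 3 + (r:ℝ) ^ 2 ≤ (r:ℝ) ^ 4 := by nlinarith [pow_pos (by linarith : (0:ℝ) < r) 2, pow_pos (by linarith : (0:ℝ) < r) 3]
    linarith
  have hk3 : 2 * (k:ℝ) ≤ 4 * (r:ℝ) ^ 4 := by
    refine hk2.trans ?_
    rw [div_le_iff₀ (by positivity)]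
    nlinarith
  have hfac : ((2 * k).factorial : ℝ) ≤ exp (2 * k * log (4 * (r:ℝ) ^ 4)) := by
    calc ((2 * k).factorial : ℝ) ≤ ((2 * k : ℕ) : ℝ) ^ (2 * k) := by exact_mod_cast Nat.factorial_le_pow _
      _ ≤ (4 * (r:ℝ) ^ 4) ^ (2 * k) := by gcongr; push_cast; exact hk3
      _ = exp (2 * k * log (4 * (r:ℝ) ^ 4)) := by
        rw [show 2 * (k:ℝ) = ((2 * k : ℕ) : ℝ) by push_cast; ring, exp_nat_mul, exp_log (by positivity)]
  have hL0 : 0 ≤ 1 + log (4 * (r:ℝ) ^ 4) := by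
    have : 0 ≤ log (4 * (r:ℝ) ^ 4) := log_nonneg (by have := one_le_pow₀ (by linarith : (1:ℝ) ≤ r) (n := 4); linarith)
    linarith
  have hsmall : 2 * k * (1 + log (4 * (r:ℝ) ^ 4)) ≤ y / r := by
    calc 2 * k * (1 + log (4 * (r:ℝ) ^ 4)) ≤ 4 * y / (r:ℝ) ^ 2 * (1 + log (4 * (r:ℝ) ^ 4)) := by gcongr
      _ = y / r * (4 / r * (1 + log (4 * (r:ℝ) ^ 4))) := by ring
      _ ≤ y / r * 1 := by gcongr
      _ = y / r := mul_one _
  have hA : 0 ≤ α - 4 / r := by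
    have : 4 / (r:ℝ) ≤ 1 / 8 := by rw [div_le_div_iff₀ (by linarith) (by norm_num)]; linarith
    linarith
  have hmain : -(2 * (α - 4 / ((r ^ 2 : ℕ) : ℝ)) * y) + 2 * ((α - 4 / r) * (k * z)) ≤ -(6 * (y / r)) := by
    have h1 : (α - 4 / r) * (k * z) ≤ (α - 4 / r) * (y + 3 / r * y) := by gcongr; linarith
    have h2 : -(2 * (α - 4 / ((r ^ 2 : ℕ) : ℝ)) * y) + 2 * ((α - 4 / r) * (y + 3 / r * y)) = (6 * α - 8) * (y / r) - 16 * (y / r ^ 2) := by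
      push_cast
      field_simp
      ring
    have h4 : 0 ≤ y / (r:ℝ) ^ 2 := by positivity
    have h5 : 0 ≤ y / (r:ℝ) := by positivity
    nlinarith
  have h5 : 5 * (r:ℝ) ^ 3 ≤ 5 * (y / r) := by
    grind
  calc _ ≤ exp (-(α - 4 / ((r ^ 2 : ℕ) : ℝ)) * y) ^ 2 * (exp ((α - 4 / r) * z) ^ k) ^ 2
      * (exp (2 * k) * exp (2 * k * log (4 * (r:ℝ) ^ 4))) := by gcongr
    _ = exp (-(2 * (α - 4 / ((r ^ 2 : ℕ) : ℝ)) * y) + 2 * ((α - 4 / r) * (k * z)) + 2 * k * (1 + log (4 * (r:ℝ) ^ 4))) := by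
      rw [← exp_nat_mul, ← exp_nat_mul, ← exp_nat_mul, ← exp_add, ← exp_add, ← exp_add]
      congr 1
      push_cast
      ring
    _ ≤ _ := exp_le_exp.2 (by linarith)

/-- The blocks of primes obtained by splitting `B` according to the value of `⌊r log p⌋`. -/
noncomputable def splitBlocks (r : ℕ) (B : Finset ℕ) : Finset (Finset ℕ × ℝ) :=
  (B.image fun p : ℕ => ⌊(r:ℝ) * log p⌋₊).image fun v => (B.filter fun p : ℕ => ⌊(r:ℝ) * log p⌋₊ = v, (v:ℝ) / r)

theorem isBlock_filter_floor (hr : 1 ≤ r) (hB : ∀ p ∈ B, p.Prime) (v : ℕ) :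
    IsBlock (B.filter fun p : ℕ => ⌊(r:ℝ) * log p⌋₊ = v) ((v:ℝ) / r) := by
  have hr0 : (1:ℝ) ≤ r := by exact_mod_cast hr
  refine ⟨by positivity, fun p hp => ?_⟩
  obtain ⟨hpB, hv⟩ := mem_filter.1 hp
  have h1 := rnd_le_log hr (hB p hpB).one_le
  have h2 := log_le_rnd_add (p := p) hr
  rw [rnd, hv] at h1 h2
  refine ⟨hB p hpB, h1, h2.trans ?_⟩
  have : 1 / (r:ℝ) ≤ 1 := (div_le_one (by linarith)).2 hr0
  linarith

set_option maxHeartbeats 2000000 in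
/-- The contribution of the points at which some block of small primes is large is negligible,
given the corresponding statement at the end of the recursion. -/
theorem exists_integral_badSet_nested_le (hα0 : 1 / 8 ≤ α) (hα : α ≤ 1 / 4) : ∃ r₀ : ℕ, 32 ≤ r₀ ∧
    ∀ {X T K T₁ M : ℝ} {W Ws Wi : ℝ → ℝ → ℂ}, 0 < X → 0 < T → T ≤ X → KernelBound X K W Ws Wi → ∀ n r : ℕ, r₀ ≤ r →
    (∀ P : Finset (Finset ℕ × ℝ), (#P : ℝ) ≤ ((r:ℝ) ^ 2 ^ n) ^ 4 → (∀ b ∈ P, IsBlock b.1 b.2 ∧ ((r:ℝ) ^ 2 ^ n) ^ 2 ≤ b.2 ∧ b.2 ≤ M) →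
      ∀ σ, 0 ≤ σ → σ ≤ M → ∫ t in badSet P α T₁, (exp σ * ‖W σ t‖) ^ 2 * cauchyWeight T t
        ≤ exp (-(2 * ((r:ℝ) ^ 2 ^ n) ^ 2)) * (K ^ 2 * X ^ 2 / T)) →
    (n ≠ 0 → 2 * ((r:ℝ) ^ 2 ^ n) ^ 3 ≤ M) →
    ∀ P : Finset (Finset ℕ × ℝ), (#P : ℝ) ≤ (r:ℝ) ^ 4 →
      (∀ b ∈ P, IsBlock b.1 b.2 ∧ (r:ℝ) ^ 2 ≤ b.2 ∧ b.2 ≤ (r:ℝ) ^ 3 ∧ b.2 ≤ M) →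
      ∀ σ, 0 ≤ σ → σ ≤ 2 * (r:ℝ) ^ 3 → σ ≤ M →
      ∫ t in badSet P (α - 4 / r) T₁, (exp σ * ‖nested (scales n r) W σ t‖) ^ 2 * cauchyWeight T t
        ≤ exp (-(2 * (r:ℝ) ^ 2)) * (K ^ 2 * (scales n r).bigMass ^ 2 * X ^ 2 / T) := by
  obtain ⟨C, hC, hblock⟩ := integral_block_pow_mul_nested_le
  obtain ⟨r₀, hr₀, hnum⟩ := exists_scale_numerics C
  refine ⟨r₀, hr₀, ?_⟩
  intro X T K T₁ M W Ws Wi hX hT hTX h n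
  have hcw := fun t => cauchyWeight_nonneg hT t
  have hK := h.nonneg
  -- integrability of the summands
  have hint : ∀ {l : ScaleList}, l.IsPrimeList → ∀ {σ : ℝ}, 0 ≤ σ →
      Integrable fun t => (exp σ * ‖nested l W σ t‖) ^ 2 * cauchyWeight T t := fun {l} hl {σ} hσ => by
    refine ((h.integrable_nested hX.le hT hl hσ).const_mul (exp σ ^ 2)).congr (.of_forall fun t => ?_)
    simp only
    ring
  induction n with
  | zero =>
    intro r hr hbot _ P hP hPb σ hσ0 _ hσ
    simp only [pow_zero, pow_one] at hbot
    have h1 := hbot P hP (fun b hb => ⟨(hPb b hb).1, (hPb b hb).2.1, (hPb b hb).2.2.2⟩) σ hσ0 hσ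
    have hr1 : 0 ≤ 4 / (r:ℝ) := by positivity
    have h2 : scales 0 r = [] := rfl
    rw [h2]
    have h3 : ScaleList.bigMass [] = 1 := rfl
    rw [h3]
    simp only [nested, one_pow, mul_one] at *
    refine le_trans (setIntegral_mono_set ?_ ?_ ?_) h1
    · exact (hint (l := []) trivial hσ0).integrableOn
    · exact .of_forall fun t => mul_nonneg (sq_nonneg _) (hcw t)
    · exact (badSet_subset (by linarith) fun b hb => (hPb b hb).1.1).eventuallyLE
  | succ n ih =>
    intro r hr hbot hM P hP hPb σ hσ0 hσr hσM
    have hr32 : 32 ≤ r := hr₀.trans hr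
    have hr0 : (32:ℝ) ≤ r := by exact_mod_cast hr32
    have hr1 : (1:ℝ) ≤ r := by linarith
    have hrn : 1 ≤ r := by lia
    have hr2 : 1 ≤ r ^ 2 := Nat.one_le_pow _ _ hrn
    have hpow : ((r ^ 2 : ℕ) : ℝ) ^ 2 ^ n = (r:ℝ) ^ 2 ^ (n + 1) := by
      push_cast
      rw [← pow_mul (r:ℝ) 2, pow_succ' 2 n]
    have hrM : 2 * (r:ℝ) ^ 6 ≤ M := by
      refine le_trans ?_ (hM (by simp))
      rw [← pow_mul]
      have : 2 ≤ 2 ^ (n + 1) := by rw [pow_succ]; have := Nat.one_le_two_pow (n := n); lia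
      gcongr
      lia
    set B := primesIn ((r:ℝ) ^ 4) ((r:ℝ) ^ 6) with hBdef
    set l := scales n (r ^ 2) with hldef
    have hlP : l.IsPrimeList := isPrimeList_scales hr2
    have hlD : l.IsDisjoint := isDisjoint_scales hr2
    have hlS : l.slack ≤ 1 := by
      refine (slack_scales_le (by nlinarith)).trans ?_
      rw [div_le_one (by positivity)]
      push_cast
      nlinarith
    have hBp : ∀ p ∈ B, p.Prime := fun p hp => (mem_primesIn.1 hp).1
    set V := B.image fun p : ℕ => ⌊(r:ℝ) * log p⌋₊ with hV
    have hVmem : ∀ v ∈ V, (r:ℝ) ^ 4 ≤ (v:ℝ) / r ∧ (v:ℝ) / r ≤ (r:ℝ) ^ 6 ∧ v < r ^ 7 := fun v hv => by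
      obtain ⟨p, hp, rfl⟩ := mem_image.1 hv
      obtain ⟨hpp, h1, h2⟩ := mem_primesIn.1 hp
      have hl0 : 0 ≤ log p := le_trans (by positivity) h1
      have h3 : r ^ 5 ≤ ⌊(r:ℝ) * log p⌋₊ := Nat.le_floor (by
        push_cast
        calc (r:ℝ) ^ 5 = r * (r:ℝ) ^ 4 := by ring
          _ ≤ _ := by gcongr)
      have h4 : ((⌊(r:ℝ) * log p⌋₊ : ℕ) : ℝ) ≤ r * log p := Nat.floor_le (by positivity)
      refine ⟨?_, ?_, ?_⟩
      · rw [le_div_iff₀ (by linarith)]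
        calc (r:ℝ) ^ 4 * r = ((r ^ 5 : ℕ) : ℝ) := by push_cast; ring
          _ ≤ _ := by exact_mod_cast h3
      · rw [div_le_iff₀ (by linarith)]
        nlinarith
      · have : ((⌊(r:ℝ) * log p⌋₊ : ℕ) : ℝ) < ((r ^ 7 : ℕ) : ℝ) := by
          push_cast
          calc _ ≤ _ := h4
            _ < r * (r:ℝ) ^ 6 := by gcongr
            _ = _ := by ring
        exact_mod_cast this
    have hVcard : #V ≤ r ^ 7 := by
      refine (card_le_card (t := range (r ^ 7)) fun v hv => mem_range.2 (hVmem v hv).2.2).trans ?_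
      simp
    set P' := splitBlocks r B with hP'
    set A := α - 4 / (r:ℝ) with hA
    set A' := α - 4 / ((r ^ 2 : ℕ) : ℝ) with hA'
    set D : ℕ → ℝ → ℂ := fun v t => ∑ p ∈ B.filter (fun p : ℕ => ⌊(r:ℝ) * log p⌋₊ = v), chi p t with hD
    set d : ℕ → ℝ → ℝ := fun v t => ‖D v t‖ * exp (-((v:ℝ) / r)) with hd
    set G : ℕ → ℝ → ℝ := fun v t => exp (σ + v / r) * ‖nested l W (σ + v / r) t‖ with hG
    set E := K ^ 2 * l.bigMass ^ 2 * X ^ 2 / T with hE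
    have hE0 : 0 ≤ E := by positivity
    have hd0 : ∀ v t, 0 ≤ d v t := fun v t => by positivity
    have hG0 : ∀ v t, 0 ≤ G v t := fun v t => by positivity
    have hσv : ∀ v : ℕ, 0 ≤ σ + (v:ℝ) / r := fun v => by positivity
    have hdle : ∀ v t, d v t ≤ exp 1 := fun v t => by
      have := (isBlock_filter_floor hrn hBp v).norm_pow_le 1 t
      rwa [pow_one, Nat.cast_one] at this
    -- the induction hypothesis
    have hIH : ∀ v ∈ V, ∫ t in badSet P' A' T₁, (G v t) ^ 2 * cauchyWeight T t ≤ exp (-(2 * (r:ℝ) ^ 4)) * E := fun v hv => by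
      obtain ⟨hv1, hv2, hv3⟩ := hVmem v hv
      have := ih (r ^ 2) (hr.trans (by nlinarith)) (by rw [hpow]; exact hbot) (by rw [hpow]; exact fun _ => hM (by simp)) P' ?_ ?_
        (σ + v / r) (hσv v) ?_ ?_
      · rwa [show ((r ^ 2 : ℕ) : ℝ) ^ 2 = (r:ℝ) ^ 4 by push_cast; ring] at this
      · have h1 : #P' ≤ r ^ 7 := card_image_le.trans hVcard
        calc (#P' : ℝ) ≤ ((r ^ 7 : ℕ) : ℝ) := by exact_mod_cast h1
          _ = (r:ℝ) ^ 7 := by push_cast; ring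
          _ ≤ (r:ℝ) ^ 8 := pow_le_pow_right₀ hr1 (by norm_num)
          _ = _ := by push_cast; ring
      · intro b hb
        obtain ⟨w, hw, rfl⟩ := mem_image.1 hb
        obtain ⟨hw1, hw2, hw3⟩ := hVmem w hw
        refine ⟨isBlock_filter_floor hrn hBp w, ?_, ?_, ?_⟩
        · push_cast; rw [← pow_mul]; exact hw1
        · push_cast; rw [← pow_mul]; exact hw2
        · have : 0 ≤ (r:ℝ) ^ 6 := by positivity
          simp only
          linarith
      · push_cast
        rw [← pow_mul]
        have : 2 * (r:ℝ) ^ 3 ≤ (r:ℝ) ^ (2 * 3) := by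
          have : (2:ℝ) ≤ r ^ 3 := by nlinarith [pow_pos (by linarith : (0:ℝ) < r) 2]
          calc 2 * (r:ℝ) ^ 3 ≤ (r:ℝ) ^ 3 * (r:ℝ) ^ 3 := by gcongr
            _ = _ := by ring
        norm_num at this ⊢
        linarith
      · have : 2 * (r:ℝ) ^ 3 ≤ (r:ℝ) ^ 6 := by
          have : (2:ℝ) ≤ r ^ 3 := by nlinarith [pow_pos (by linarith : (0:ℝ) < r) 2]
          calc 2 * (r:ℝ) ^ 3 ≤ (r:ℝ) ^ 3 * (r:ℝ) ^ 3 := by gcongr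
            _ = _ := by ring
        linarith
    -- the points outside the new bad set
    set k : ℕ → Finset ℕ × ℝ → ℕ := fun v b => ⌈(σ + v / r) / b.2⌉₊ with hk
    set Γ : ℕ → Finset ℕ × ℝ → ℝ := fun v b => exp (-A' * (v / r)) ^ 2 * (exp (A * b.2) ^ k v b) ^ 2 with hΓ
    set f : ℕ → Finset ℕ × ℝ → ℝ → ℝ := fun v b t => ((‖∑ p ∈ b.1, chi p t‖ * exp (-b.2)) ^ k v b * G v t) ^ 2 * cauchyWeight T t with hf
    have hf0 : ∀ v b t, 0 ≤ f v b t := fun v b t => mul_nonneg (sq_nonneg _) (hcw t)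
    have hΓ0 : ∀ v b, 0 ≤ Γ v b := fun v b => by positivity
    have hgood : ∀ v ∈ V, ∀ b ∈ P, Γ v b * ∫ t, f v b t ≤ exp (-(5 * (r:ℝ) ^ 3)) * (C * E) := fun v hv b hb => by
      obtain ⟨hb1, hb2, hb3, hb4⟩ := hPb b hb
      obtain ⟨hv1, hv2, hv3⟩ := hVmem v hv
      have hb0 : 0 < b.2 := lt_of_lt_of_le (by positivity) hb2
      have h1 := hblock hX hT h hlP hlD hlS hb1 (fun p hp hpl => ?_) (k v b) (hσv v) ?_
      · have h2 := scale_gain hα0 hα hr32 (hnum r hr).1 hσ0 hσr hv1 hv2 hb2 hb3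
        calc Γ v b * ∫ t, f v b t ≤ Γ v b * (C * exp (2 * k v b) * (2 * k v b).factorial * (K ^ 2 * l.bigMass ^ 2) * X ^ 2 / T) :=
              mul_le_mul_of_nonneg_left h1 (hΓ0 v b)
          _ = (Γ v b * (exp (2 * k v b) * (2 * k v b).factorial)) * (C * E) := by rw [hE]; ring
          _ ≤ _ := mul_le_mul_of_nonneg_right h2 (by positivity)
      · have h3 := le_log_of_mem_support_scales hr2 hpl
        have h4 := (hb1.2 p hp).2.2
        push_cast at h3
        rw [← pow_mul] at h3
        have h5 : (r:ℝ) ^ 3 + 1 < (r:ℝ) ^ (2 * 4) := by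
          have : (r:ℝ) ^ 4 ≤ (r:ℝ) ^ (2 * 4) := pow_le_pow_right₀ hr1 (by norm_num)
          have : (1:ℝ) ≤ (r:ℝ) ^ 3 := one_le_pow₀ hr1
          have : (r:ℝ) ^ 4 = r * (r:ℝ) ^ 3 := by ring
          nlinarith
        linarith
      · have h6 : σ + v / r ≤ k v b * b.2 := by
          have := Nat.le_ceil ((σ + v / r) / b.2)
          rwa [div_le_iff₀ hb0] at this
        have h7 : 1 ≤ exp (k v b * b.2 - (σ + v / r)) := one_le_exp (by linarith)
        have h8 : 1 ≤ exp 7 := one_le_exp (by norm_num)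
        calc T ≤ X := hTX
          _ = 1 * X * 1 := by ring
          _ ≤ _ := by gcongr
    have hfint : ∀ v b, 0 ≤ b.2 → IsBlock b.1 b.2 → Integrable (f v b) := fun v b hb hbB => by
      refine ((hint hlP (hσv v)).bdd_mul (c := exp (k v b) ^ 2) (f := fun t => ((‖∑ p ∈ b.1, chi p t‖ * exp (-b.2)) ^ k v b) ^ 2)
        (Continuous.aestronglyMeasurable ?_) (.of_forall fun t => ?_)).congr (.of_forall fun t => ?_)
      · exact (((continuous_sum_chi b.1).norm.mul continuous_const).pow _).pow 2
      · rw [norm_of_nonneg (by positivity)]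
        exact pow_le_pow_left₀ (by positivity) (hbB.norm_pow_le _ t) 2
      · simp only [hf, hG]
        ring
    -- the pointwise bound
    have hpt : ∀ t ∈ badSet P A T₁, (exp σ * ‖nested (scales (n + 1) r) W σ t‖) ^ 2 * cauchyWeight T t
        ≤ (r:ℝ) ^ 7 * ∑ v ∈ V, ((badSet P' A' T₁).indicator (fun t => exp 2 * ((G v t) ^ 2 * cauchyWeight T t)) t + ∑ b ∈ P, Γ v b * f v b t) := by
      rintro t ⟨htT, b₀, hb₀, hbt⟩
      have h1 : exp σ * ‖nested (scales (n + 1) r) W σ t‖ ≤ ∑ v ∈ V, d v t * G v t := by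
        rw [scales, nested_cons_eq_sum]
        refine (mul_le_mul_of_nonneg_left (norm_sum_le _ _) (exp_pos σ).le).trans (le_of_eq ?_)
        rw [mul_sum]
        refine sum_congr rfl fun v _ => ?_
        simp only [hd, hG]
        rw [norm_mul, exp_add, exp_neg]
        field_simp
        rfl
      have h2 : ∀ v ∈ V, (d v t * G v t) ^ 2 * cauchyWeight T t
          ≤ (badSet P' A' T₁).indicator (fun t => exp 2 * ((G v t) ^ 2 * cauchyWeight T t)) t + ∑ b ∈ P, Γ v b * f v b t := fun v hv => by
        have hsum0 : 0 ≤ ∑ b ∈ P, Γ v b * f v b t := sum_nonneg fun b _ => mul_nonneg (hΓ0 v b) (hf0 v b t)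
        by_cases ht' : t ∈ badSet P' A' T₁
        · rw [Set.indicator_of_mem ht']
          have : (d v t * G v t) ^ 2 * cauchyWeight T t ≤ exp 2 * ((G v t) ^ 2 * cauchyWeight T t) := by
            rw [mul_pow, mul_assoc]
            refine mul_le_mul_of_nonneg_right ?_ (mul_nonneg (sq_nonneg _) (hcw t))
            calc d v t ^ 2 ≤ exp 1 ^ 2 := pow_le_pow_left₀ (hd0 v t) (hdle v t) 2
              _ = exp 2 := by rw [← exp_nat_mul]; norm_num
          linarith
        · rw [Set.indicator_of_notMem ht', zero_add]
          have h3 : d v t ≤ exp (-A' * (v / r)) := by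
            by_contra! hlt
            refine ht' ⟨htT, _, mem_image.2 ⟨v, hv, rfl⟩, ?_⟩
            rw [← neg_mul]
            exact hlt
          have h4 : 1 ≤ exp (A * b₀.2) ^ k v b₀ * (‖∑ p ∈ b₀.1, chi p t‖ * exp (-b₀.2)) ^ k v b₀ := by
            rw [← mul_pow]
            refine one_le_pow₀ ?_
            calc (1:ℝ) = exp (A * b₀.2) * exp (-(A * b₀.2)) := by rw [← exp_add, add_neg_cancel, exp_zero]
              _ ≤ _ := mul_le_mul_of_nonneg_left hbt.le (exp_pos _).le
          refine le_trans ?_ (single_le_sum (f := fun b => Γ v b * f v b t) (fun b _ => mul_nonneg (hΓ0 v b) (hf0 v b t)) hb₀)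
          have h5 : Γ v b₀ * f v b₀ t = (exp (-A' * (v / r)) * exp (A * b₀.2) ^ k v b₀
              * ((‖∑ p ∈ b₀.1, chi p t‖ * exp (-b₀.2)) ^ k v b₀ * G v t)) ^ 2 * cauchyWeight T t := by
            simp only [hΓ, hf]
            ring
          simp only [h5]
          refine mul_le_mul_of_nonneg_right ?_ (hcw t)
          refine pow_le_pow_left₀ (mul_nonneg (hd0 v t) (hG0 v t)) ?_ 2
          calc d v t * G v t ≤ exp (-A' * (v / r)) * G v t * 1 := by
                rw [mul_one]; exact mul_le_mul_of_nonneg_right h3 (hG0 v t)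
            _ ≤ exp (-A' * (v / r)) * G v t * (exp (A * b₀.2) ^ k v b₀ * (‖∑ p ∈ b₀.1, chi p t‖ * exp (-b₀.2)) ^ k v b₀) :=
                mul_le_mul_of_nonneg_left h4 (mul_nonneg (exp_pos _).le (hG0 v t))
            _ = _ := by ring
      calc (exp σ * ‖nested (scales (n + 1) r) W σ t‖) ^ 2 * cauchyWeight T t
          ≤ (∑ v ∈ V, d v t * G v t) ^ 2 * cauchyWeight T t := by
            refine mul_le_mul_of_nonneg_right (pow_le_pow_left₀ (by positivity) h1 2) (hcw t)
        _ ≤ (#V * ∑ v ∈ V, (d v t * G v t) ^ 2) * cauchyWeight T t := mul_le_mul_of_nonneg_right sq_sum_le_card_mul_sum_sq (hcw t)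
        _ = #V * ∑ v ∈ V, (d v t * G v t) ^ 2 * cauchyWeight T t := by rw [mul_assoc, Finset.sum_mul]
        _ ≤ (r:ℝ) ^ 7 * ∑ v ∈ V, ((badSet P' A' T₁).indicator (fun t => exp 2 * ((G v t) ^ 2 * cauchyWeight T t)) t + ∑ b ∈ P, Γ v b * f v b t) := by
          refine mul_le_mul (by exact_mod_cast hVcard) (sum_le_sum h2) ?_ (by positivity)
          exact sum_nonneg fun v _ => mul_nonneg (sq_nonneg _) (hcw t)
    have hI1 : ∀ v, Integrable ((badSet P' A' T₁).indicator fun t => exp 2 * ((G v t) ^ 2 * cauchyWeight T t)) := fun v =>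
      ((hint hlP (hσv v)).const_mul _).indicator (measurableSet_badSet _ _ _)
    have hI2 : ∀ v, Integrable fun t => ∑ b ∈ P, Γ v b * f v b t := fun v =>
      integrable_finsetSum _ fun b hb => (hfint v b (hPb b hb).1.1 (hPb b hb).1).const_mul _
    have hcalc : ∀ v ∈ V, (∫ t, ((badSet P' A' T₁).indicator (fun t => exp 2 * ((G v t) ^ 2 * cauchyWeight T t)) t + ∑ b ∈ P, Γ v b * f v b t))
        ≤ exp 2 * (exp (-(2 * (r:ℝ) ^ 4)) * E) + (r:ℝ) ^ 4 * (exp (-(5 * (r:ℝ) ^ 3)) * (C * E)) := fun v hv => by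
      rw [integral_add (hI1 v) (hI2 v), integral_indicator (measurableSet_badSet _ _ _), integral_const_mul,
        integral_finsetSum _ fun b hb => (hfint v b (hPb b hb).1.1 (hPb b hb).1).const_mul _]
      refine add_le_add (mul_le_mul_of_nonneg_left (hIH v hv) (exp_pos _).le) ?_
      calc _ ≤ ∑ b ∈ P, exp (-(5 * (r:ℝ) ^ 3)) * (C * E) := sum_le_sum fun b hb => by
            rw [integral_const_mul]; exact hgood v hv b hb
        _ = #P * (exp (-(5 * (r:ℝ) ^ 3)) * (C * E)) := by rw [sum_const, nsmul_eq_mul]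
        _ ≤ _ := by gcongr
    have hEE : E ≤ K ^ 2 * (scales (n + 1) r).bigMass ^ 2 * X ^ 2 / T := by
      have h1 : l.bigMass ≤ (scales (n + 1) r).bigMass := by
        rw [scales, ScaleList.bigMass]
        exact le_mul_of_one_le_left l.bigMass_nonneg (by linarith [recipSum_nonneg B])
      have := l.bigMass_nonneg
      rw [hE]
      gcongr
    calc ∫ t in badSet P A T₁, (exp σ * ‖nested (scales (n + 1) r) W σ t‖) ^ 2 * cauchyWeight T t
        = ∫ t, (badSet P A T₁).indicator (fun t => (exp σ * ‖nested (scales (n + 1) r) W σ t‖) ^ 2 * cauchyWeight T t) t :=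
          (integral_indicator (measurableSet_badSet _ _ _)).symm
      _ ≤ ∫ t, (r:ℝ) ^ 7 * ∑ v ∈ V, ((badSet P' A' T₁).indicator (fun t => exp 2 * ((G v t) ^ 2 * cauchyWeight T t)) t + ∑ b ∈ P, Γ v b * f v b t) := by
        refine integral_mono_of_nonneg (.of_forall fun t => Set.indicator_nonneg (fun t _ => mul_nonneg (sq_nonneg _) (hcw t)) t)
          ((integrable_finsetSum _ fun v _ => (hI1 v).add (hI2 v)).const_mul _) (.of_forall fun t => ?_)
        refine Set.indicator_le' (hpt) (fun t _ => ?_) t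
        refine mul_nonneg (by positivity) (sum_nonneg fun v _ => add_nonneg (Set.indicator_nonneg (fun t _ => ?_) t) (sum_nonneg fun b _ => mul_nonneg (hΓ0 v b) (hf0 v b t)))
        exact mul_nonneg (exp_pos _).le (mul_nonneg (sq_nonneg _) (hcw t))
      _ = (r:ℝ) ^ 7 * ∑ v ∈ V, ∫ t, ((badSet P' A' T₁).indicator (fun t => exp 2 * ((G v t) ^ 2 * cauchyWeight T t)) t + ∑ b ∈ P, Γ v b * f v b t) := by
        rw [integral_const_mul]
        congr 1
        exact integral_finsetSum _ fun v _ => (hI1 v).add (hI2 v)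
      _ ≤ (r:ℝ) ^ 7 * ∑ v ∈ V, (exp 2 * (exp (-(2 * (r:ℝ) ^ 4)) * E) + (r:ℝ) ^ 4 * (exp (-(5 * (r:ℝ) ^ 3)) * (C * E))) := by
        gcongr with v hv
        exact hcalc v hv
      _ = (r:ℝ) ^ 7 * (#V * (exp 2 * (exp (-(2 * (r:ℝ) ^ 4)) * E) + (r:ℝ) ^ 4 * (exp (-(5 * (r:ℝ) ^ 3)) * (C * E)))) := by
        rw [sum_const, nsmul_eq_mul]
      _ ≤ (r:ℝ) ^ 7 * ((r:ℝ) ^ 7 * (exp 2 * (exp (-(2 * (r:ℝ) ^ 4)) * E) + (r:ℝ) ^ 4 * (exp (-(5 * (r:ℝ) ^ 3)) * (C * E)))) := by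
        gcongr
        exact_mod_cast hVcard
      _ = ((r:ℝ) ^ 18 * (C * exp (-(5 * (r:ℝ) ^ 3))) + (r:ℝ) ^ 14 * (exp 2 * exp (-(2 * (r:ℝ) ^ 4)))) * E := by ring
      _ ≤ exp (-(2 * (r:ℝ) ^ 2)) * E := by
        refine mul_le_mul_of_nonneg_right ?_ hE0
        linarith [(hnum r hr).2.1, (hnum r hr).2.2]
      _ ≤ _ := mul_le_mul_of_nonneg_left hEE (exp_pos _).le

theorem IsDP.mono_on {g' : ℕ → ℝ} (h : IsDP F g Y₀ Y₁) (hg : ∀ n ∈ Ioc ⌊Y₀⌋₊ ⌊Y₁⌋₊, g n ≤ g' n) (hg' : ∀ n, 0 ≤ g' n) :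
    IsDP F g' Y₀ Y₁ := by
  obtain ⟨a, ha, hF⟩ := h
  refine ⟨fun n => if n ∈ Ioc ⌊Y₀⌋₊ ⌊Y₁⌋₊ then a n else 0, fun n => ?_, fun t => ?_⟩
  · grind
  simp_all

theorem omegaIn_mul_le_log (hB : ∀ p ∈ B, p.Prime ∧ y ≤ log p) (hn : 1 ≤ n) :
    omegaIn B n * y ≤ log n := by
  have h1 : ∏ p ∈ B.filter (· ∣ n), p ∣ n := by
    refine Finset.prod_primes_dvd n (fun p hp => (hB p (mem_filter.1 hp).1).1.prime) fun p hp => (mem_filter.1 hp).2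
  have h2 : ((∏ p ∈ B.filter (· ∣ n), p : ℕ) : ℝ) ≤ n := by exact_mod_cast Nat.le_of_dvd hn h1
  have h3 : log ((∏ p ∈ B.filter (· ∣ n), p : ℕ) : ℝ) ≤ log n := by
    refine log_le_log ?_ h2
    exact_mod_cast Finset.prod_pos fun p hp => (hB p (mem_filter.1 hp).1).1.pos
  refine le_trans ?_ h3
  push_cast
  rw [log_prod fun p hp => by exact_mod_cast (hB p (mem_filter.1 hp).1).1.ne_zero]
  rw [omegaIn, ← nsmul_eq_mul]
  exact card_nsmul_le_sum _ _ _ fun p hp => (hB p (mem_filter.1 hp).1).2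

/-- Chebyshev's inequality for a high power of a prime block. -/
theorem volume_badSet_le_of_block (hB : IsBlock B y) (hT : 0 < T₁) (hk : T₁ ≤ exp (k * y)) :
    (volume (badSet {(B, y)} α T₁)).toReal
      ≤ 6 * π * exp 6 * (exp (2 * α * (k * y)) * (exp (2 * k) * (2 * k).factorial)) := by
  set D : ℝ → ℂ := fun t => ∑ p ∈ B, chi p t with hD
  have hdp : IsDP (fun t => D t ^ k) (fun n => omegaIn B n ^ k) (exp y ^ k * (1 / 2)) (exp (y + 1) ^ k * 1) := by
    have := IsDP.pow_mul (fun p hp => hB.bounds p hp) (exp_pos y).le (exp_pos (y + 1)).le IsDP.one (by norm_num) (by norm_num)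
      (divMono_const 1) (fun _ => zero_le_one) k
    simpa only [mul_one] using this
  set Y₁ := exp (y + 1) ^ k * 1 with hY₁
  have hY0 : 0 < Y₁ := by positivity
  have hY : Y₁ = exp (k * y) * exp k := by
    rw [hY₁, mul_one, ← exp_nat_mul, ← exp_add]
    ring_nf
  have hTY : T₁ ≤ Y₁ := by
    rw [hY]
    have : 1 ≤ exp (k:ℝ) := one_le_exp (by positivity)
    nlinarith [exp_pos (k * y)]
  have hmv := hdp.meanValue (by positivity) hY0.le hT
  have hsum := ScaleList.sum_omega_sq_le (l := []) (Y₀ := exp y ^ k * (1 / 2)) trivial trivial (fun p hp => (hB.2 p hp).1)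
    (by simp [ScaleList.support]) k hY0.le
  simp only [ScaleList.omega, ScaleList.bigMass, mul_one, one_pow] at hsum
  have hS : ∫ t, ‖D t ^ k‖ ^ 2 * cauchyWeight T₁ t ≤ π * (3 * Y₁ / T₁) * ((2 * k).factorial * exp 6 * Y₁) := by
    refine hmv.trans ?_
    have h1 : 1 + 2 * Y₁ / T₁ ≤ 3 * Y₁ / T₁ := by
      rw [le_div_iff₀ hT, add_mul, div_mul_cancel₀ _ hT.ne']
      linarith
    have h2 := exp_two_mul_recipSum_le hB
    have h3 : ∑ n ∈ Ioc ⌊exp y ^ k * (1 / 2)⌋₊ ⌊Y₁⌋₊, (omegaIn B n ^ k) ^ 2 ≤ (2 * k).factorial * exp 6 * Y₁ := by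
      refine hsum.trans ?_
      gcongr
    gcongr
  obtain ⟨C, hC⟩ := hdp.exists_bound
  have hint := integrable_norm_sq_mul_cauchyWeight hT hdp.continuous hC
  set c := exp ((1 - α) * y) ^ (2 * k) * (1 / (2 * T₁)) with hc
  have hpt : ∀ t ∈ badSet {(B, y)} α T₁, c ≤ ‖D t ^ k‖ ^ 2 * cauchyWeight T₁ t := by
    rintro t ⟨htT, b, hb, hbt⟩
    obtain rfl := mem_singleton.1 hb
    simp only at hbt
    have h1 : exp ((1 - α) * y) ≤ ‖D t‖ := by
      have := mul_le_mul_of_nonneg_right hbt.le (exp_pos y).le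
      rw [mul_assoc, ← exp_add, ← exp_add, neg_add_cancel, exp_zero, mul_one] at this
      grind
    have h2 : 1 / (2 * T₁) ≤ cauchyWeight T₁ t := by
      rw [cauchyWeight, div_le_div_iff₀ (by positivity) (by positivity)]
      have : t ^ 2 ≤ T₁ ^ 2 := sq_le_sq' htT.1 htT.2
      nlinarith
    rw [norm_pow, ← pow_mul, mul_comm k 2]
    exact mul_le_mul (pow_le_pow_left₀ (exp_pos _).le h1 _) h2 (by positivity) (by positivity)
  have hfin : volume (badSet {(B, y)} α T₁) ≠ ⊤ :=
    measure_ne_top_of_subset (fun t ht => ht.1) (by simp)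
  have h5 : c * (volume (badSet {(B, y)} α T₁)).toReal ≤ ∫ t, ‖D t ^ k‖ ^ 2 * cauchyWeight T₁ t := by
    calc c * (volume (badSet {(B, y)} α T₁)).toReal = ∫ _ in badSet {(B, y)} α T₁, c := by
          rw [setIntegral_const, smul_eq_mul, mul_comm]; rfl
      _ ≤ ∫ t in badSet {(B, y)} α T₁, ‖D t ^ k‖ ^ 2 * cauchyWeight T₁ t :=
          setIntegral_mono_on (integrableOn_const hfin) hint.integrableOn (measurableSet_badSet _ _ _) hpt
      _ ≤ _ := setIntegral_le_integral hint (.of_forall fun t => mul_nonneg (sq_nonneg _) (cauchyWeight_nonneg hT t))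
  have hc0 : 0 < c := by positivity
  rw [← le_div_iff₀' hc0] at h5
  refine h5.trans ?_
  rw [div_le_iff₀ hc0]
  refine hS.trans (le_of_eq ?_)
  have h6 : Y₁ * Y₁ = exp (2 * α * (k * y)) * exp (2 * k) * exp ((1 - α) * y) ^ (2 * k) := by
    rw [hY, ← exp_nat_mul, ← exp_add, ← exp_add, ← exp_add, ← exp_add]
    congr 1
    push_cast
    ring
  grind

/-- Blocks of primes which are larger than a power of `log X` are rarely large. -/
theorem exists_volume_badSet_le (hα0 : 0 ≤ α) (hα : α ≤ 1) (hε : 0 < ε) : ∃ A ε₁ : ℝ, 1 ≤ A ∧ 0 < ε₁ ∧ ∀ᶠ X : ℝ in atTop,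
    ∀ T₁ : ℝ, 1 ≤ T₁ → T₁ ≤ X ^ 2 → ∀ (B : Finset ℕ) (y : ℝ), IsBlock B y → A * log (log X) ≤ y → y ≤ ε₁ * log X →
      (volume (badSet {(B, y)} α T₁)).toReal ≤ X ^ ε * T₁ ^ (2 * α) := by
  refine ⟨max 1 (48 / ε), ε / 8, le_max_left _ _, by positivity, ?_⟩
  set A := max 1 (48 / ε) with hA
  have hA1 : 1 ≤ A := le_max_left _ _
  have hA2 : 6 / A ≤ ε / 8 := by
    have : 48 / ε ≤ A := le_max_right _ _
    rw [div_le_iff₀ (by linarith)]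
    rw [div_le_iff₀ hε] at this
    linarith
  have hLL : Tendsto (fun X : ℝ => log (log X)) atTop atTop := tendsto_log_atTop.comp tendsto_log_atTop
  have hlo : ∀ᶠ X : ℝ in atTop, A * log (log X) ≤ log X := by
    have h := (isLittleO_log_id_atTop.comp_tendsto tendsto_log_atTop).bound (c := 1 / A) (by positivity)
    filter_upwards [h, tendsto_log_atTop.eventually_ge_atTop 1] with X hX hX1
    simp only [Function.comp_apply, id_eq] at hX
    rw [norm_of_nonneg (log_nonneg hX1), norm_of_nonneg (by linarith), div_mul_eq_mul_div, one_mul, le_div_iff₀ (by linarith)] at hX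
    linarith
  filter_upwards [hlo, hLL.eventually_ge_atTop 6, tendsto_log_atTop.eventually_ge_atTop 1, eventually_ge_atTop 1,
    (tendsto_rpow_atTop (show 0 < ε / 2 by positivity)).eventually_ge_atTop (6 * π * exp 6)] with X hlo hLL hL1 hX1 hXc
  intro T₁ hT1 hTX B y hB hAy hyX
  have hX0 : 0 < X := by linarith
  have hT0 : 0 < T₁ := by linarith
  set Lx := log X with hLx
  set LL := log Lx with hLLd
  have hy0 : 0 < y := lt_of_lt_of_le (by positivity) hAy
  have hlT0 : 0 ≤ log T₁ := log_nonneg hT1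
  have hlT : log T₁ ≤ 2 * Lx := by
    have := log_le_log hT0 hTX
    rwa [log_pow, Nat.cast_ofNat] at this
  set k := ⌈log T₁ / y⌉₊ with hk
  have hk1 : log T₁ ≤ k * y := by
    have := Nat.le_ceil (log T₁ / y)
    rwa [div_le_iff₀ hy0] at this
  have hk2 : (k:ℝ) ≤ log T₁ / y + 1 := (Nat.ceil_lt_add_one (by positivity)).le
  have hk3 : k * y ≤ log T₁ + y := by
    have := mul_le_mul_of_nonneg_right hk2 hy0.le
    rwa [add_mul, div_mul_cancel₀ _ hy0.ne', one_mul] at this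
  have hk4 : 2 * (k:ℝ) ≤ 6 * Lx / (A * LL) := by
    rw [le_div_iff₀ (by positivity)]
    have h1 : (k:ℝ) * (A * LL) ≤ log T₁ + A * LL := by
      calc (k:ℝ) * (A * LL) ≤ (log T₁ / y + 1) * (A * LL) := by gcongr
        _ = log T₁ / y * (A * LL) + A * LL := by ring
        _ ≤ log T₁ / y * y + A * LL := by gcongr
        _ = _ := by rw [div_mul_cancel₀ _ hy0.ne']
    linarith
  have hk5 : 2 * (k:ℝ) ≤ Lx := by
    refine hk4.trans ?_
    rw [div_le_iff₀ (by positivity)]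
    have : 6 ≤ A * LL := by nlinarith
    nlinarith
  have hk6 : 2 * (k:ℝ) * LL ≤ ε / 8 * Lx := by
    calc 2 * (k:ℝ) * LL ≤ 6 * Lx / (A * LL) * LL := by gcongr
      _ = 6 / A * Lx := by field_simp
      _ ≤ _ := by gcongr
  have hk7 : 2 * (k:ℝ) ≤ ε / 8 * Lx := by
    refine le_trans ?_ hk6
    have : (0:ℝ) ≤ 2 * k := by positivity
    nlinarith
  have hfac : ((2 * k).factorial : ℝ) ≤ exp (ε / 8 * Lx) := by
    calc ((2 * k).factorial : ℝ) ≤ ((2 * k : ℕ) : ℝ) ^ (2 * k) := by exact_mod_cast Nat.factorial_le_pow _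
      _ ≤ Lx ^ (2 * k) := by gcongr; push_cast; exact hk5
      _ = exp (2 * k * LL) := by
        rw [show 2 * (k:ℝ) = ((2 * k : ℕ) : ℝ) by push_cast; ring, exp_nat_mul, hLLd, exp_log (by linarith)]
      _ ≤ _ := exp_le_exp.2 hk6
  refine (volume_badSet_le_of_block hB hT0 (k := k) ?_).trans ?_
  · rwa [← log_le_iff_le_exp hT0]
  calc 6 * π * exp 6 * (exp (2 * α * (k * y)) * (exp (2 * k) * (2 * k).factorial))
      ≤ X ^ (ε / 2) * (exp (2 * α * log T₁ + ε / 4 * Lx) * (exp (ε / 8 * Lx) * exp (ε / 8 * Lx))) := by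
        gcongr
        have h1 : α * (k * y) ≤ α * (log T₁ + y) := by gcongr
        have h2 : α * y ≤ ε / 8 * Lx := by nlinarith
        linarith
    _ = _ := by
      rw [rpow_def_of_pos hX0, rpow_def_of_pos hX0, rpow_def_of_pos hT0, ← exp_add, ← exp_add, ← exp_add, ← exp_add]
      congr 1
      rw [← hLx]
      ring

/-- The scale consisting of `q` copies of the primes `p` with `a ≤ log p < b`. -/
noncomputable def largeScales (q : ℕ) (a b : ℝ) : ScaleList := List.replicate q (q, primesIn a b)

theorem replicate_isPrimeList (hr : 1 ≤ r) (hB : ∀ p ∈ B, p.Prime) (q : ℕ) :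
    ScaleList.IsPrimeList (List.replicate q (r, B)) := by
  induction q with
  | zero => trivial
  | succ q ih => exact ⟨hr, hB, ih⟩

theorem replicate_slack (r : ℕ) (B : Finset ℕ) (q : ℕ) : ScaleList.slack (List.replicate q (r, B)) = q * (1 / r) := by
  induction q with
  | zero => simp [ScaleList.slack]
  | succ q ih =>
    rw [List.replicate_succ, ScaleList.slack, ih]
    push_cast
    ring

theorem replicate_mass (r : ℕ) (B : Finset ℕ) (q : ℕ) : ScaleList.mass (List.replicate q (r, B)) = recipSum B ^ q := by
  induction q with
  | zero => simp [ScaleList.mass]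
  | succ q ih => rw [List.replicate_succ, ScaleList.mass, ih, pow_succ']

theorem replicate_omega (r : ℕ) (B : Finset ℕ) (q n : ℕ) : ScaleList.omega (List.replicate q (r, B)) n = omegaIn B n ^ q := by
  induction q with
  | zero => simp [ScaleList.omega]
  | succ q ih => rw [List.replicate_succ, ScaleList.omega, ih, pow_succ']

theorem replicate_support (h : p ∈ ScaleList.support (List.replicate q (r, B))) : p ∈ B := by
  induction q with
  | zero => simp [ScaleList.support] at h
  | succ q ih =>
    rw [List.replicate_succ, ScaleList.support] at h
    grind

section

variable {q : ℕ} {a b : ℝ}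

theorem largeScales_isPrimeList (hq : 1 ≤ q) : (largeScales q a b).IsPrimeList :=
  replicate_isPrimeList hq (fun _ hp => (mem_primesIn.1 hp).1) q

theorem largeScales_slack (hq : 1 ≤ q) : (largeScales q a b).slack = 1 := by
  have : (q:ℝ) ≠ 0 := by exact_mod_cast (by lia : q ≠ 0)
  rw [largeScales, replicate_slack]
  field_simp

theorem largeScales_mass : (largeScales q a b).mass = recipSum (primesIn a b) ^ q := replicate_mass _ _ _

theorem largeScales_omega_le (ha : 0 < a) (hn : 1 ≤ n) (hc : log n ≤ c * a) : (largeScales q a b).omega n ≤ c ^ q := by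
  rw [largeScales, replicate_omega]
  refine pow_le_pow_left₀ (omegaIn_nonneg _ _) ?_ q
  have := omegaIn_mul_le_log (B := primesIn a b) (fun p hp => ⟨(mem_primesIn.1 hp).1, (mem_primesIn.1 hp).2.1⟩) hn
  nlinarith

theorem le_rnd_of_mem_largeScales (hq : 1 ≤ q) : ∀ x ∈ largeScales q a b, ∀ p ∈ x.2, a - 1 / q ≤ rnd x.1 p := fun x hx p hp => by
  obtain rfl := List.eq_of_mem_replicate hx
  have := log_le_rnd_add (p := p) hq
  have := (mem_primesIn.1 hp).2.1
  simp only
  linarith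

theorem rnd_le_of_mem_largeScales (hq : 1 ≤ q) : ∀ x ∈ largeScales q a b, ∀ p ∈ x.2, rnd x.1 p ≤ b := fun x hx p hp => by
  obtain rfl := List.eq_of_mem_replicate hx
  exact (rnd_le_log hq (mem_primesIn.1 hp).1.one_le).trans (mem_primesIn.1 hp).2.2.le

end

/-- The kernel given by the smoothed zeta sum of length `X e ^ (-σ)`. -/
noncomputable def zetaKernel (X : ℝ) : ℝ → ℝ → ℂ := fun σ => zstar (X * exp (-σ))

theorem kernelBound_largeScales (hq : 1 ≤ q) (hX : 0 < X) (ha : 0 < a) (hc0 : 0 ≤ c) (hc : 8 + log X ≤ c * a) :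
    KernelBound X (c ^ q + (largeScales q a b).mass) (nested (largeScales q a b) (zetaKernel X))
      (nested (largeScales q a b) fun σ => zsum (X * exp (-σ))) (nested (largeScales q a b) fun σ => zint (X * exp (-σ))) := by
  have hl := largeScales_isPrimeList (a := a) (b := b) hq
  have hm := (largeScales q a b).mass_nonneg
  have hs := largeScales_slack (a := a) (b := b) hq
  have hk : kap = exp 7 := rfl
  refine ⟨by positivity, fun σ t => nested_sub hl .., fun σ hσ => ?_, fun σ hσ t => ?_, fun σ => ?_, fun σ => ?_⟩
  · have h1 := IsDP.nested hl (W := fun σ => zsum (X * exp (-σ))) (g := fun _ => 1) (a := X) (b := kap * X) hX.le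
      (mul_nonneg kap_pos.le hX.le) (divMono_const 1) (fun _ => zero_le_one) (fun σ _ => by simpa only [mul_assoc] using IsDP.zsum (X * exp (-σ))) hσ
    rw [hs, hk, show exp 7 * X * exp 1 = exp 8 * X by rw [mul_right_comm, ← exp_add]; norm_num] at h1
    refine h1.mono_on (fun n hn => ?_) fun n => by positivity
    have hn' := (mem_Ioc_floor (by positivity) (by positivity)).1 hn
    have hn1 : 1 ≤ n := by have := (mem_Ioc.1 hn).1; lia
    have h2 : log n ≤ c * a := by
      refine le_trans ?_ hc
      have h3 : (n:ℝ) ≤ exp 8 * X := hn'.2.trans (mul_le_of_le_one_right (by positivity) (exp_le_one_iff.2 (by linarith)))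
      have := log_le_log (by exact_mod_cast hn1) h3
      rwa [log_mul (by positivity) hX.ne', log_exp] at this
    have := largeScales_omega_le (q := q) (b := b) ha hn1 h2
    linarith
  · have h1 := norm_nested_le hl (W := fun σ => zint (X * exp (-σ))) (M := 4 * kap * X / (1 + |t|)) (t := t)
      (div_nonneg (mul_nonneg (mul_nonneg (by norm_num) kap_pos.le) hX.le) (by positivity)) hσ
      fun σ _ => (norm_zint_le (by positivity) t).trans (le_of_eq (by ring))
    refine h1.trans ?_
    rw [hs]
    calc 4 * kap * X / (1 + |t|) * exp (-σ) * exp 1 * (largeScales q a b).mass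
        = 4 * (exp 7 * exp 1) * (largeScales q a b).mass * X * exp (-σ) / (1 + |t|) := by rw [hk]; ring
      _ = 4 * exp 8 * (largeScales q a b).mass * X * exp (-σ) / (1 + |t|) := by rw [← exp_add]; norm_num
      _ ≤ _ := by
        gcongr
        simp_all
  · exact continuous_nested hl (fun σ => continuous_zint (by positivity)) σ
  · exact continuous_nested hl (fun σ => continuous_zsum _) σ

theorem eventually_const_mul_log_pow_le (C : ℝ) (k : ℕ) (he : 0 < e) : ∀ᶠ X : ℝ in atTop, C * log X ^ k ≤ X ^ e := by
  have h := ((isLittleO_log_rpow_atTop (show 0 < e / (k + 1) by positivity)).bound (c := 1) one_pos)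
  filter_upwards [h, eventually_ge_atTop 1, (tendsto_rpow_atTop (show 0 < e / (k + 1) by positivity)).eventually_ge_atTop C] with X hX hX1 hC
  rw [one_mul, norm_of_nonneg (log_nonneg hX1), norm_of_nonneg (by positivity)] at hX
  have hl := log_nonneg hX1
  calc C * log X ^ k ≤ X ^ (e / (k + 1)) * (X ^ (e / (k + 1))) ^ k := by gcongr
    _ = X ^ e := by
      rw [← pow_succ', ← rpow_natCast, ← rpow_mul (by linarith)]
      grind

theorem volume_badSet_le_card_mul {P : Finset (Finset ℕ × ℝ)} (h : ∀ b ∈ P, (volume (badSet {b} α T₁)).toReal ≤ V) :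
    (volume (badSet P α T₁)).toReal ≤ #P * V := by
  have h1 : badSet P α T₁ ⊆ ⋃ b ∈ P, badSet {b} α T₁ := by
    rintro t ⟨ht, b, hb, hbt⟩
    exact Set.mem_biUnion hb ⟨ht, b, mem_singleton_self b, hbt⟩
  have hfin : ∀ b ∈ P, volume (badSet {b} α T₁) ≠ ⊤ := fun b _ =>
    measure_ne_top_of_subset (fun t ht => ht.1) (by simp)
  calc (volume (badSet P α T₁)).toReal ≤ (∑ b ∈ P, volume (badSet {b} α T₁)).toReal :=
        ENNReal.toReal_mono (ENNReal.sum_ne_top.2 hfin) ((measure_mono h1).trans (measure_biUnion_finset_le _ _))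
    _ = ∑ b ∈ P, (volume (badSet {b} α T₁)).toReal := ENNReal.toReal_sum hfin
    _ ≤ ∑ _b ∈ P, V := sum_le_sum h
    _ = _ := by rw [sum_const, nsmul_eq_mul]

set_option maxHeartbeats 2000000 in
/-- The sum over large primes and a long variable is small on average over any set where some block
is exceptionally large. -/
theorem exists_integral_badSet_largeScales_le (hθ : 0 < θ) (hθ1 : θ ≤ 1 / 2) (hα0 : 0 ≤ α) (hαθ : 2 * α + θ ≤ 1 / 2) (hq : 1 ≤ q) :
    ∃ A ε₁ δ : ℝ, 1 ≤ A ∧ 0 < ε₁ ∧ ε₁ ≤ θ / 16 ∧ 0 < δ ∧ ∀ᶠ X : ℝ in atTop, ∀ a b T T₁ : ℝ, (1 - θ / 2) * log X ≤ q * a → 0 ≤ b →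
      q * b ≤ (1 - θ / 4) * log X → 0 < T → 1 ≤ T₁ → T₁ ≤ X ^ (1 + ε₁) → ∀ P : Finset (Finset ℕ × ℝ), (#P : ℝ) ≤ X ^ ε₁ →
      (∀ x ∈ P, IsBlock x.1 x.2 ∧ A * log (log X) ≤ x.2 ∧ x.2 ≤ ε₁ * log X) → ∀ σ, 0 ≤ σ → σ ≤ ε₁ * log X →
      ∫ t in badSet P α T₁, (exp σ * ‖nested (largeScales q a b) (zetaKernel X) σ t‖) ^ 2 * cauchyWeight T t ≤ X ^ (-δ) * (X ^ 2 / T) := by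
  obtain ⟨A, ε', hA, hε', hbad⟩ := exists_volume_badSet_le (ε := θ / 8) hα0 (by linarith) (by positivity)
  obtain ⟨δ, hδ, hδ1, C, hC, hz⟩ := exists_norm_zstar_le (16 / θ)
  set ε₁ := min ε' (θ / 16) with hε₁
  have hε0 : 0 < ε₁ := lt_min hε' (by positivity)
  have hε1 : ε₁ ≤ θ / 16 := min_le_right _ _
  have hkap := one_lt_kap
  have hq0 : (1:ℝ) ≤ q := by exact_mod_cast hq
  set c : ℝ := 4 * q with hc
  set C₁ : ℝ := 200 * kap ^ 2 * 4 * kap * (c ^ q) ^ 2 * exp 1 with hC₁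
  have hC₁0 : 0 < C₁ := by positivity
  refine ⟨A, ε₁, δ * θ / 8, hA, hε0, hε1, by positivity, ?_⟩
  filter_upwards [hbad, eventually_const_mul_log_pow_le ((q + 1) ^ 2 * C₁ * C ^ 2) 3 (show 0 < δ * θ / 8 by positivity), eventually_ge_atTop 3,
    tendsto_log_atTop.eventually_ge_atTop 8] with X hbad hlog hX3 hL8
  intro a b T T₁ hqa hb0 hqb hT hT1 hT1X P hP hPb σ hσ0 hσ1
  have hX0 : 0 < X := by linarith
  have hX1 : 1 ≤ X := by linarith
  set L := log X with hL
  have hXe : ∀ z : ℝ, exp (z * L) = X ^ z := fun z => by rw [rpow_def_of_pos hX0, mul_comm]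
  have hl := largeScales_isPrimeList (a := a) (b := b) hq
  have hs := largeScales_slack (a := a) (b := b) hq
  have hlen : (largeScales q a b).length = q := List.length_replicate
  have ha0 : 0 < a := by
    have : 0 < q * a := lt_of_lt_of_le (by nlinarith) hqa
    exact pos_of_mul_pos_right this (by linarith)
  have hT1X2 : T₁ ≤ X ^ 2 := by
    refine hT1X.trans ?_
    rw [← rpow_two]
    exact rpow_le_rpow_of_exponent_le hX1 (by linarith)
  set U := badSet P α T₁ with hU
  have hUm : MeasurableSet U := measurableSet_badSet _ _ _
  have hUT : U ⊆ Set.Icc (-T₁) T₁ := fun t ht => ht.1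
  -- the measure of the bad set
  have hUvol : (volume U).toReal * sqrt (1 + 2 * T₁) ≤ 2 * X ^ (1 - 3 * θ / 4) := by
    have h1 : (volume U).toReal ≤ X ^ ε₁ * (X ^ (θ / 8) * (X ^ (1 + ε₁)) ^ (2 * α)) := by
      refine (volume_badSet_le_card_mul (V := X ^ (θ / 8) * (X ^ (1 + ε₁)) ^ (2 * α)) fun x hx => ?_).trans (by gcongr)
      obtain ⟨hx1, hx2, hx3⟩ := hPb x hx
      refine (hbad T₁ hT1 hT1X2 x.1 x.2 hx1 hx2 (hx3.trans (by gcongr; exact min_le_left _ _))).trans ?_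
      gcongr
    have h2 : sqrt (1 + 2 * T₁) ≤ 2 * (X ^ (1 + ε₁)) ^ (1 / 2 : ℝ) := by
      rw [← sqrt_eq_rpow, show (2:ℝ) = sqrt 4 by rw [show (4:ℝ) = 2 ^ 2 by norm_num, sqrt_sq (by norm_num)], ← sqrt_mul (by norm_num)]
      refine sqrt_le_sqrt ?_
      rw [show sqrt 4 = 2 by rw [show (4:ℝ) = 2 ^ 2 by norm_num, sqrt_sq (by norm_num)]]
      linarith
    calc _ ≤ X ^ ε₁ * (X ^ (θ / 8) * (X ^ (1 + ε₁)) ^ (2 * α)) * (2 * (X ^ (1 + ε₁)) ^ (1 / 2 : ℝ)) := by gcongr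
      _ = 2 * X ^ (ε₁ + (θ / 8 + (1 + ε₁) * (2 * α)) + (1 + ε₁) * (1 / 2)) := by
        rw [← rpow_mul hX0.le, ← rpow_mul hX0.le, rpow_add hX0, rpow_add hX0 ε₁, rpow_add hX0 (θ / 8)]
        ring
      _ ≤ _ := by
        gcongr
        nlinarith
  -- splitting off the large primes
  obtain ⟨S, hS, hSs, hSsum⟩ := exists_nested_eq_sum_deltaKernel hl hq (fun x hx => by rw [List.eq_of_mem_replicate hx]) hb0
    (le_rnd_of_mem_largeScales hq) (rnd_le_of_mem_largeScales hq) σ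
  rw [hlen] at hS hSs
  have hScard : (#S : ℝ) ≤ (q + 1) * L := by
    refine hS.trans ?_
    have : (q:ℝ) * (q * b) ≤ q * L := by
      gcongr
      refine hqb.trans ?_
      nlinarith
    linarith
  have hSr : ∀ s ∈ S, X ^ (1 - θ / 2) * exp (-1) ≤ exp (s - σ) ∧ exp (s - σ) ≤ X ∧ X ^ (θ / 8) ≤ X * exp (-s) := fun s hs' => by
    obtain ⟨h1, h2⟩ := hSs s hs'
    have h3 : (q:ℝ) * (a - 1 / q) = q * a - 1 := by field_simp
    rw [h3] at h1
    refine ⟨?_, ?_, ?_⟩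
    · rw [← hXe, ← exp_add]
      exact exp_le_exp.2 (by linarith)
    · rw [← le_log_iff_exp_le hX0]
      nlinarith
    · nth_rewrite 2 [← exp_log hX0]
      rw [← hXe, ← exp_add, ← hL]
      refine exp_le_exp.2 ?_
      nlinarith
  set N : ℝ → ℝ → ℂ := fun s t => nested (largeScales q a b) (deltaKernel s) σ t with hN
  have hNdp : ∀ s, IsDP (N s) (fun n => (largeScales q a b).omega n * 1) (exp s / 2 * exp (-σ)) (exp s * exp 1 * exp (-σ)) := fun s => by
    have := IsDP.nested hl (W := deltaKernel s) (g := fun _ => 1) (a := exp s / 2) (b := exp s) (by positivity) (by positivity) (divMono_const 1)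
      (fun _ => zero_le_one) (fun σ _ => IsDP.deltaKernel s σ) hσ0
    rwa [hs] at this
  have hNc : ∀ s, Continuous (N s) := fun s => (hNdp s).continuous
  have hNint : ∀ s ∈ S, ∫ t in U, ‖N s t‖ ^ 2 ≤ C₁ * L * exp (s - σ) ^ 2 := fun s hs' => by
    obtain ⟨hs1, hs2, hs3⟩ := hSr s hs'
    set Z := exp (s - σ) with hZ
    have hZ0 : 0 < Z := exp_pos _
    have hY0 : exp s / 2 * exp (-σ) = Z / 2 := by rw [hZ, sub_eq_add_neg, exp_add]; ring
    have hY1 : exp s * exp 1 * exp (-σ) = exp 1 * Z := by rw [hZ, sub_eq_add_neg, exp_add]; ring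
    have h1 := hNdp s
    rw [hY0, hY1] at h1
    have he := exp_one_lt_d9
    have he' := exp_one_gt_d9
    have hkap2 : 4 * exp 1 ≤ kap := by
      have h2 : exp 7 = exp 1 ^ 7 := by rw [← exp_nat_mul]; norm_num
      have h3 : (4:ℝ) ≤ exp 1 ^ 6 := by
        calc (4:ℝ) ≤ 2 ^ 6 := by norm_num
          _ ≤ _ := by gcongr; linarith
      rw [kap, h2, pow_succ]
      gcongr
    have hX12 : X ^ (1 - 3 * θ / 4) ≤ X ^ (1 - θ / 2) := rpow_le_rpow_of_exponent_le hX1 (by linarith)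
    have hZX : X ^ (1 - θ / 2) ≤ exp 1 * Z := by
      rw [exp_neg] at hs1
      rwa [← div_eq_mul_inv, div_le_iff₀ (exp_pos 1), mul_comm] at hs1
    have hZ2 : 1 ≤ Z / 2 := by
      have h2 : X ^ (1 / 2 : ℝ) ≤ X ^ (1 - θ / 2) := rpow_le_rpow_of_exponent_le hX1 (by linarith)
      have h3 : exp 4 ≤ X ^ (1 / 2 : ℝ) := by rw [← hXe]; exact exp_le_exp.2 (by linarith)
      have h4 : exp 4 = exp 1 * exp 3 := by rw [← exp_add]; norm_num
      have h5 : exp 3 ≤ Z := by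
        have : exp 1 * exp 3 ≤ exp 1 * Z := by rw [← h4]; linarith
        exact le_of_mul_le_mul_left this (exp_pos 1)
      have := add_one_le_exp (3:ℝ)
      linarith
    have h2 := h1.large_values 1 hZ2 (by positivity) (by rw [pow_one]; nlinarith) (by linarith) hUm hUT
    refine h2.trans ?_
    have h3 : 1 + log (1 + 2 * T₁) ≤ 4 * L := by
      have : log (1 + 2 * T₁) ≤ log (X ^ 3) := log_le_log (by linarith) (by nlinarith)
      rw [log_pow] at this
      push_cast at this
      linarith
    have h4 : (volume U).toReal * sqrt (1 + 2 * T₁) ≤ kap * (Z / 2) := by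
      refine hUvol.trans ?_
      nlinarith
    have h5 : ∑ n ∈ Ioc ⌊Z / 2⌋₊ ⌊exp 1 * Z⌋₊, ((largeScales q a b).omega n * 1) ^ 2 ≤ (c ^ q) ^ 2 * (exp 1 * Z) := by
      calc _ ≤ ∑ n ∈ Ioc ⌊Z / 2⌋₊ ⌊exp 1 * Z⌋₊, (c ^ q) ^ 2 := by
            refine sum_le_sum fun n hn => ?_
            have hn' := (mem_Ioc_floor (by positivity) (by positivity)).1 hn
            have hn1 : 1 ≤ n := by have := (mem_Ioc.1 hn).1; lia
            rw [mul_one]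
            refine pow_le_pow_left₀ ((largeScales q a b).omega_nonneg n) (largeScales_omega_le ha0 hn1 ?_) 2
            have h6 : (n:ℝ) ≤ exp 1 * X := hn'.2.trans (by gcongr)
            have h7 := log_le_log (by exact_mod_cast hn1) h6
            rw [log_mul (by positivity) hX0.ne', log_exp, ← hL] at h7
            have h8 : c * a = 4 * (q * a) := by rw [hc]; ring
            rw [h8]
            nlinarith
        _ = #(Ioc ⌊Z / 2⌋₊ ⌊exp 1 * Z⌋₊) * (c ^ q) ^ 2 := by rw [sum_const, nsmul_eq_mul]
        _ ≤ (exp 1 * Z) * (c ^ q) ^ 2 := by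
          gcongr
          exact card_Ioc_floor_le (by positivity)
        _ = _ := by ring
    have h6 : 0 ≤ 1 + log (1 + 2 * T₁) := by have := log_nonneg (show 1 ≤ 1 + 2 * T₁ by linarith); linarith
    calc _ ≤ (1:ℕ) * (200 * kap ^ 2 * (4 * L) * (kap ^ 1 * (Z / 2) + kap * (Z / 2))) * ((c ^ q) ^ 2 * (exp 1 * Z)) := by
          gcongr
      _ = C₁ * L * Z ^ 2 := by rw [hC₁]; push_cast; ring
  -- the long variable
  have hzb : ∀ s ∈ S, ∀ t ∈ U, ‖zetaKernel X s t‖ ≤ C * (X * exp (-s)) * X ^ (-(δ * θ / 8)) := fun s hs' t ht => by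
    obtain ⟨hs1, hs2, hs3⟩ := hSr s hs'
    set Y := X * exp (-s) with hY
    have hY0 : 0 < Y := by positivity
    have h1 : 1 ≤ Y := (one_le_rpow hX1 (by positivity)).trans hs3
    have h2 : |t| ≤ Y ^ (16 / θ) := by
      refine (abs_le.2 ⟨(hUT ht).1, (hUT ht).2⟩).trans (hT1X2.trans ?_)
      calc X ^ 2 = (X ^ (θ / 8)) ^ (16 / θ) := by
            rw [← rpow_mul hX0.le, ← rpow_two]
            congr 1
            field_simp
            norm_num
        _ ≤ _ := by gcongr
    refine (hz Y t h1 h2).trans ?_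
    have h3 : Y ^ (-δ) ≤ X ^ (-(δ * θ / 8)) := by
      calc Y ^ (-δ) ≤ (X ^ (θ / 8)) ^ (-δ) := rpow_le_rpow_of_nonpos (by positivity) hs3 (by linarith)
        _ = _ := by rw [← rpow_mul hX0.le]; congr 1; ring
    calc C * Y ^ (1 - δ) = C * Y * Y ^ (-δ) := by rw [mul_assoc C Y, sub_eq_add_neg, rpow_add hY0, rpow_one]
      _ ≤ _ := by gcongr
  have hpt : ∀ t ∈ U, (exp σ * ‖nested (largeScales q a b) (zetaKernel X) σ t‖) ^ 2 * cauchyWeight T t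
      ≤ ∑ s ∈ S, #S * (C ^ 2 * (X ^ (-(δ * θ / 8))) ^ 2 * (X ^ 2 / T) * exp (σ - s) ^ 2) * ‖N s t‖ ^ 2 := fun t ht => by
    have h1 : exp σ * ‖nested (largeScales q a b) (zetaKernel X) σ t‖ ≤ ∑ s ∈ S, C * X ^ (-(δ * θ / 8)) * X * exp (σ - s) * ‖N s t‖ := by
      rw [hSsum]
      refine (mul_le_mul_of_nonneg_left (norm_sum_le _ _) (exp_pos σ).le).trans ?_
      rw [mul_sum]
      refine sum_le_sum fun s hs' => ?_
      rw [norm_mul]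
      calc exp σ * (‖N s t‖ * ‖zetaKernel X s t‖) ≤ exp σ * (‖N s t‖ * (C * (X * exp (-s)) * X ^ (-(δ * θ / 8)))) := by
            gcongr
            exact hzb s hs' t ht
        _ = _ := by rw [sub_eq_add_neg, exp_add]; ring
    calc _ ≤ (∑ s ∈ S, C * X ^ (-(δ * θ / 8)) * X * exp (σ - s) * ‖N s t‖) ^ 2 * (1 / T) := by
          gcongr
          · exact cauchyWeight_nonneg hT t
          · exact cauchyWeight_le hT t
      _ ≤ (#S * ∑ s ∈ S, (C * X ^ (-(δ * θ / 8)) * X * exp (σ - s) * ‖N s t‖) ^ 2) * (1 / T) := by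
          gcongr
          exact sq_sum_le_card_mul_sum_sq
      _ = _ := by
          rw [mul_sum, Finset.sum_mul]
          exact sum_congr rfl fun s _ => by ring
  have hNi : ∀ s, IntegrableOn (fun t => ‖N s t‖ ^ 2) U := fun s => (((hNc s).norm.pow 2).integrableOn_Icc (a := -T₁) (b := T₁)).mono_set hUT
  calc _ ≤ ∫ t in U, ∑ s ∈ S, #S * (C ^ 2 * (X ^ (-(δ * θ / 8))) ^ 2 * (X ^ 2 / T) * exp (σ - s) ^ 2) * ‖N s t‖ ^ 2 := by
        refine integral_mono_of_nonneg (.of_forall fun t => mul_nonneg (sq_nonneg _) (cauchyWeight_nonneg hT t))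
          (integrable_finsetSum _ fun s _ => (hNi s).const_mul _) ?_
        filter_upwards [ae_restrict_mem hUm] with t ht
        exact hpt t ht
    _ = ∑ s ∈ S, #S * (C ^ 2 * (X ^ (-(δ * θ / 8))) ^ 2 * (X ^ 2 / T) * exp (σ - s) ^ 2) * ∫ t in U, ‖N s t‖ ^ 2 := by
        rw [integral_finsetSum _ fun s _ => (hNi s).const_mul _]
        exact sum_congr rfl fun s _ => integral_const_mul _ _
    _ ≤ ∑ s ∈ S, #S * (C ^ 2 * (X ^ (-(δ * θ / 8))) ^ 2 * (X ^ 2 / T) * exp (σ - s) ^ 2) * (C₁ * L * exp (s - σ) ^ 2) :=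
        sum_le_sum fun s hs' => mul_le_mul_of_nonneg_left (hNint s hs') (mul_nonneg (Nat.cast_nonneg _) (by positivity))
    _ = ∑ s ∈ S, #S * (C ^ 2 * (X ^ (-(δ * θ / 8))) ^ 2 * (X ^ 2 / T)) * (C₁ * L) := by
        refine sum_congr rfl fun s _ => ?_
        have : exp (σ - s) * exp (s - σ) = 1 := by rw [← exp_add, show σ - s + (s - σ) = 0 by ring, exp_zero]
        calc _ = #S * (C ^ 2 * (X ^ (-(δ * θ / 8))) ^ 2 * (X ^ 2 / T)) * (C₁ * L) * (exp (σ - s) * exp (s - σ)) ^ 2 := by ring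
          _ = _ := by rw [this]; ring
    _ = #S ^ 2 * (C₁ * C ^ 2 * L) * (X ^ (-(δ * θ / 8))) ^ 2 * (X ^ 2 / T) := by
        rw [sum_const, nsmul_eq_mul]; ring
    _ ≤ ((q + 1) * L) ^ 2 * (C₁ * C ^ 2 * L) * (X ^ (-(δ * θ / 8))) ^ 2 * (X ^ 2 / T) := by
        have := pow_le_pow_left₀ (Nat.cast_nonneg _) hScard 2
        gcongr
    _ = ((q + 1) ^ 2 * C₁ * C ^ 2 * L ^ 3) * (X ^ (-(δ * θ / 8))) ^ 2 * (X ^ 2 / T) := by ring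
    _ ≤ X ^ (δ * θ / 8) * (X ^ (-(δ * θ / 8))) ^ 2 * (X ^ 2 / T) := by gcongr
    _ = _ := by
        have : X ^ (δ * θ / 8) * X ^ (-(δ * θ / 8)) = 1 := by rw [← rpow_add hX0, add_neg_cancel, rpow_zero]
        rw [pow_two (X ^ (-(δ * θ / 8))), ← mul_assoc (X ^ (δ * θ / 8)), this, one_mul]

namespace ScaleList

theorem support_append (l l' : ScaleList) : support (l ++ l') = support l ∪ support l' := by
  induction l with
  | nil => simp [support]
  | cons a l ih =>
    rw [List.cons_append, support, ih, support, union_assoc]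

theorem mass_append (l l' : ScaleList) : mass (l ++ l') = mass l * mass l' := by
  induction l with
  | nil => simp [mass]
  | cons a l ih => rw [List.cons_append, mass, ih, mass, mul_assoc]

theorem slack_append (l l' : ScaleList) : slack (l ++ l') = slack l + slack l' := by
  induction l with
  | nil => simp [slack]
  | cons a l ih => rw [List.cons_append, slack, ih, slack, add_assoc]

theorem IsPrimeList.append {l' : ScaleList} (h : l.IsPrimeList) (h' : l'.IsPrimeList) : IsPrimeList (l ++ l') := by
  induction l with
  | nil => exact h'
  | cons a l ih => exact ⟨h.1, h.2.1, ih h.2.2⟩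

end ScaleList

theorem exists_bigMass_scales_le : ∃ C : ℝ, 0 < C ∧ ∃ r₀ : ℕ, ∀ n r : ℕ, r₀ ≤ r →
    0 < (scales n r).mass ∧ (scales n r).bigMass ≤ C * (scales n r).mass := by
  obtain ⟨c, hc, j₀, hj₀, -, h⟩ := exists_recipSum_ge
  have key : ∀ n r : ℕ, max 3 j₀ ≤ r → 0 < (scales n r).mass ∧
      (scales n r).bigMass ≤ exp (1 / c / log r) * (scales n r).mass := fun n => by
    induction n with
    | zero =>
      intro r hr
      have hr3 : (1:ℝ) ≤ r := by exact_mod_cast (by grind : 1 ≤ r)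
      have := log_nonneg hr3
      refine ⟨one_pos, ?_⟩
      rw [scales, ScaleList.bigMass, ScaleList.mass, mul_one]
      exact one_le_exp (by positivity)
    | succ n ih =>
      intro r hr
      have hr3 : 3 ≤ r := (le_max_left 3 j₀).trans hr
      have hr3' : (3:ℝ) ≤ r := by exact_mod_cast hr3
      have hl : 0 < log r := log_pos (by linarith)
      obtain ⟨h1, h2⟩ := ih (r ^ 2) (hr.trans (Nat.le_self_pow two_ne_zero r))
      have h3 := h (r ^ 4) (r ^ 6) (((le_max_right 3 j₀).trans hr).trans (Nat.le_self_pow (by norm_num) r)) (Nat.pow_le_pow_right (by lia) (by norm_num))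
      push_cast at h3
      rw [show (r:ℝ) ^ 6 / (r:ℝ) ^ 4 = (r:ℝ) ^ 2 by field_simp, log_pow] at h3
      push_cast at h2 h3
      rw [log_pow] at h2
      push_cast at h2
      set S := recipSum (primesIn ((r:ℝ) ^ 4) ((r:ℝ) ^ 6)) with hS
      have hS0 : 0 < c * (2 * log r) := by positivity
      have hS1 : 0 < S := hS0.trans_le h3
      have h4 : 1 + S ≤ exp (1 / (c * (2 * log r))) * S := by
        have h5 : 1 / S ≤ 1 / (c * (2 * log r)) := one_div_le_one_div_of_le hS0 h3
        calc 1 + S = (1 / S + 1) * S := by field_simp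
          _ ≤ (1 / (c * (2 * log r)) + 1) * S := by gcongr
          _ ≤ _ := by gcongr; exact add_one_le_exp _
      refine ⟨mul_pos hS1 h1, ?_⟩
      rw [scales, ScaleList.bigMass, ScaleList.mass]
      calc (1 + S) * (scales n (r ^ 2)).bigMass ≤ exp (1 / (c * (2 * log r))) * S * (exp (1 / c / (2 * log r)) * (scales n (r ^ 2)).mass) := by
            have := (scales n (r ^ 2)).bigMass_nonneg
            gcongr
        _ = exp (1 / (c * (2 * log r)) + 1 / c / (2 * log r)) * (S * (scales n (r ^ 2)).mass) := by rw [exp_add]; ring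
        _ = _ := by congr 2; field_simp; norm_num
  refine ⟨exp (1 / c), exp_pos _, max 3 j₀, fun n r hr => ⟨(key n r hr).1, (key n r hr).2.trans ?_⟩⟩
  have hr3 : 3 ≤ r := (le_max_left 3 j₀).trans hr
  have hr3' : exp 1 ≤ r := by
    have := exp_one_lt_d9
    have : (3:ℝ) ≤ r := by exact_mod_cast hr3
    linarith
  have hl : 1 ≤ log r := by rw [le_log_iff_exp_le (by positivity)]; exact hr3'
  have := (scales n r).mass_nonneg
  have := div_le_self (show 0 ≤ 1 / c by positivity) hl
  gcongr

/-- The height of the hierarchy `r, r ^ 2, r ^ 4, …` needed to reach `v`. -/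
theorem exists_scales_height (r : ℕ) (hr : 2 ≤ r) (v : ℝ) : ∃ n : ℕ, v ≤ ((r:ℝ) ^ 2 ^ n) ^ 2 ∧ (n ≠ 0 → (r:ℝ) ^ 2 ^ n < v) := by
  have hr' : (1:ℝ) < r := by exact_mod_cast (by lia : 1 < r)
  have hex : ∃ n : ℕ, v ≤ ((r:ℝ) ^ 2 ^ n) ^ 2 := by
    obtain ⟨m, hm⟩ := pow_unbounded_of_one_lt v hr'
    refine ⟨m, hm.le.trans ?_⟩
    rw [← pow_mul]
    exact pow_le_pow_right₀ hr'.le ((Nat.lt_two_pow_self).le.trans (Nat.le_mul_of_pos_right _ two_pos))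
  refine ⟨Nat.find hex, Nat.find_spec hex, fun hn => ?_⟩
  obtain ⟨m, hm⟩ := Nat.exists_eq_succ_of_ne_zero hn
  have h := Nat.find_min hex (show m < Nat.find hex by lia)
  rw [hm, Nat.succ_eq_add_one, pow_succ 2 m, pow_mul]
  exact not_le.1 h

theorem exists_setIntegral_block_mul_nested_le (hα0 : 1 / 8 ≤ α) (hα : α ≤ 1 / 4) : ∃ C : ℝ, 0 < C ∧ ∃ r₀ : ℕ, 32 ≤ r₀ ∧
    ∀ {X T K T₁ M : ℝ} {W Ws Wi : ℝ → ℝ → ℂ}, 0 < X → 0 < T → T ≤ X → KernelBound X K W Ws Wi → ∀ n r : ℕ, r₀ ≤ r →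
    (∀ P : Finset (Finset ℕ × ℝ), (#P : ℝ) ≤ ((r:ℝ) ^ 2 ^ n) ^ 4 → (∀ b ∈ P, IsBlock b.1 b.2 ∧ ((r:ℝ) ^ 2 ^ n) ^ 2 ≤ b.2 ∧ b.2 ≤ M) →
      ∀ σ, 0 ≤ σ → σ ≤ M → ∫ t in badSet P α T₁, (exp σ * ‖W σ t‖) ^ 2 * cauchyWeight T t
        ≤ exp (-(2 * ((r:ℝ) ^ 2 ^ n) ^ 2)) * (K ^ 2 * X ^ 2 / T)) →
    (n ≠ 0 → 2 * ((r:ℝ) ^ 2 ^ n) ^ 3 ≤ M) →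
    ∀ (B : Finset ℕ) (y : ℝ), IsBlock B y → (r:ℝ) ^ 2 ≤ y → y ≤ ((r:ℝ) + 1) ^ 2 → y ≤ M → T ≤ exp 7 * X * exp (-y) →
      ∫ t in Set.Icc (-T₁) T₁, ‖(∑ p ∈ B, chi p t) * nested (scales n r) W y t‖ ^ 2 * cauchyWeight T t
        ≤ C * exp (-(2 * (α - 4 / r) * y)) * (K ^ 2 * (scales n r).bigMass ^ 2 * X ^ 2 / T) := by
  obtain ⟨C, hC, hblock⟩ := integral_block_pow_mul_nested_le
  obtain ⟨r₀, hr₀, hrec⟩ := exists_integral_badSet_nested_le hα0 hα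
  refine ⟨C + exp 2, by positivity, r₀, hr₀, ?_⟩
  intro X T K T₁ M W Ws Wi hX hT hTX h n r hr hbot hM B y hB hy hy' hyM hTy
  have hcw := fun t => cauchyWeight_nonneg hT t
  have hr32 : 32 ≤ r := hr₀.trans hr
  have hr' : (32:ℝ) ≤ r := by exact_mod_cast hr32
  have hl : (scales n r).IsPrimeList := isPrimeList_scales (by lia)
  have hd : (scales n r).IsDisjoint := isDisjoint_scales (by lia)
  have hs : (scales n r).slack ≤ 1 := (slack_scales_le (by lia)).trans (by rw [div_le_one (by linarith)]; linarith)
  have hy0 : 0 ≤ y := hB.1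
  have hy3 : y ≤ (r:ℝ) ^ 3 := hy'.trans (by nlinarith [sq_nonneg ((r:ℝ))])
  set G := K ^ 2 * (scales n r).bigMass ^ 2 * X ^ 2 / T with hG
  set N : ℝ → ℂ := fun t => nested (scales n r) W y t with hN
  set D : ℝ → ℂ := fun t => ∑ p ∈ B, chi p t with hD
  set U := badSet {(B, y)} (α - 4 / r) T₁ with hU
  have hUm : MeasurableSet U := measurableSet_badSet _ _ _
  set F : ℝ → ℝ := fun t => (exp y * ‖N t‖) ^ 2 * cauchyWeight T t with hF
  have hF0 : ∀ t, 0 ≤ F t := fun t => mul_nonneg (sq_nonneg _) (hcw t)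
  have hFi : Integrable F := by
    refine ((h.integrable_nested hX.le hT hl hy0).const_mul (exp y ^ 2)).congr (.of_forall fun t => ?_)
    simp only [hF]
    ring
  have hFtot : ∫ t, F t ≤ C * G := by
    have := hblock hX hT h hl hd hs hB (fun p hp hp' => ?_) 0 hy0 (by simpa using hTy)
    · simpa [hF, hG, mul_assoc, mul_div_assoc] using this
    · have h1 := le_log_of_mem_support_scales (by lia) hp'
      have h2 := (hB.2 p hp).2.2
      nlinarith [sq_nonneg ((r:ℝ) ^ 2)]
  have hFbad : ∫ t in U, F t ≤ exp (-(2 * (r:ℝ) ^ 2)) * G :=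
    hrec hX hT hTX h n r hr hbot hM {(B, y)} (by rw [card_singleton]; push_cast; exact one_le_pow₀ (by linarith))
      (fun b hb => by obtain rfl := mem_singleton.1 hb; exact ⟨hB, hy, hy3, hyM⟩) y hy0 (by linarith) hyM
  have hpt : ∀ t, ‖D t * N t‖ ^ 2 * cauchyWeight T t = (‖D t‖ * exp (-y)) ^ 2 * F t := fun t => by
    simp only [hF]
    rw [norm_mul]
    have : exp (-y) * exp y = 1 := by rw [← exp_add, neg_add_cancel, exp_zero]
    calc _ = ‖D t‖ ^ 2 * ‖N t‖ ^ 2 * cauchyWeight T t * (1:ℝ) ^ 2 := by ring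
      _ = _ := by rw [← this]; ring
  set E := exp (-(2 * (α - 4 / r) * y)) with hE
  have hD1 : ∀ t, (‖D t‖ * exp (-y)) ^ 2 ≤ exp 2 := fun t => by exact_mod_cast hB.norm_pow_le 2 t
  have hbd : ∀ t ∈ Set.Icc (-T₁) T₁, (‖D t‖ * exp (-y)) ^ 2 * F t ≤ E * F t + exp 2 * U.indicator F t := fun t ht => by
    by_cases htU : t ∈ U
    · rw [Set.indicator_of_mem htU]
      have := mul_le_mul_of_nonneg_right (hD1 t) (hF0 t)
      have := mul_nonneg (exp_pos (-(2 * (α - 4 / r) * y))).le (hF0 t)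
      linarith
    · rw [Set.indicator_of_notMem htU, mul_zero, add_zero]
      refine mul_le_mul_of_nonneg_right ?_ (hF0 t)
      have h1 : ‖D t‖ * exp (-y) ≤ exp (-((α - 4 / r) * y)) := by
        by_contra! hlt
        exact htU ⟨ht, (B, y), mem_singleton_self _, hlt⟩
      calc _ ≤ exp (-((α - 4 / r) * y)) ^ 2 := by gcongr
        _ = E := by rw [hE, ← exp_nat_mul]; congr 1; push_cast; ring
  have hEr : exp (-(2 * (r:ℝ) ^ 2)) ≤ E := by
    refine exp_le_exp.2 (neg_le_neg ?_)
    have h4 : 0 ≤ 4 / (r:ℝ) := by positivity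
    calc 2 * (α - 4 / r) * y ≤ 2 * (1 / 4) * ((r:ℝ) + 1) ^ 2 := by
          have : α - 4 / r ≤ 1 / 4 := by linarith
          gcongr
      _ ≤ _ := by nlinarith
  have hi1 : Integrable fun t => E * F t + exp 2 * U.indicator F t := by fun_prop
  calc ∫ t in Set.Icc (-T₁) T₁, ‖D t * N t‖ ^ 2 * cauchyWeight T t ≤ ∫ t in Set.Icc (-T₁) T₁, (E * F t + exp 2 * U.indicator F t) := by
        refine integral_mono_of_nonneg (.of_forall fun t => mul_nonneg (sq_nonneg _) (hcw t)) hi1.integrableOn ?_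
        filter_upwards [ae_restrict_mem measurableSet_Icc] with t ht
        rw [hpt]
        exact hbd t ht
    _ ≤ ∫ t, (E * F t + exp 2 * U.indicator F t) := setIntegral_le_integral hi1 (.of_forall fun t =>
        add_nonneg (mul_nonneg (exp_pos _).le (hF0 t)) (mul_nonneg (exp_pos _).le (Set.indicator_nonneg (fun t _ => hF0 t) t)))
    _ = E * (∫ t, F t) + exp 2 * ∫ t in U, F t := by
        rw [integral_add (hFi.const_mul _) ((hFi.indicator hUm).const_mul _), integral_const_mul, integral_const_mul, integral_indicator hUm]
    _ ≤ E * (C * G) + exp 2 * (E * G) := by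
        refine add_le_add (mul_le_mul_of_nonneg_left hFtot (exp_pos _).le) (mul_le_mul_of_nonneg_left (hFbad.trans ?_) (exp_pos _).le)
        gcongr
    _ = _ := by ring

theorem exists_largeScales_range (hθ : 0 < θ) (hθ1 : θ ≤ 1 / 2) (hq : 1 ≤ q) : ∃ m₀ : ℝ, 0 < m₀ ∧ ∀ᶠ X : ℝ in atTop,
    ∃ a b : ℕ, (1 - θ / 2) * log X ≤ q * a ∧ q * b ≤ (1 - θ / 4) * log X ∧ m₀ ≤ recipSum (primesIn a b) := by
  obtain ⟨c, hc, j₀, hj₀, -, h⟩ := exists_recipSum_ge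
  have hq0 : (0:ℝ) < q := by exact_mod_cast hq
  refine ⟨c * log (1 + θ / 8), mul_pos hc (log_pos (by linarith)), ?_⟩
  filter_upwards [tendsto_log_atTop.eventually_ge_atTop ((j₀ + 24 / θ) * (2 * q))] with X hX
  set l := (1 - θ / 2) * log X / q with hl
  have h24 : 0 < 24 / θ := by positivity
  have hLX : 0 ≤ log X := le_trans (by positivity) hX
  have hl1 : j₀ + 24 / θ ≤ l := by
    rw [hl, le_div_iff₀ hq0]
    nlinarith
  have hql : q * l = (1 - θ / 2) * log X := by rw [hl]; field_simp
  have hl0 : 0 < l := by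
    linarith
  have ha := Nat.le_ceil l
  have ha' := Nat.ceil_lt_add_one hl0.le
  have hb := Nat.floor_le (show 0 ≤ (1 + θ / 4) * l by positivity)
  have hb' := Nat.lt_floor_add_one ((1 + θ / 4) * l)
  have hj : j₀ ≤ ⌈l⌉₊ := by
    have : (j₀:ℝ) ≤ ⌈l⌉₊ := by linarith
    exact_mod_cast this
  have ha0 : (0:ℝ) < ⌈l⌉₊ := by linarith
  have hab : (1 + θ / 8) * ⌈l⌉₊ ≤ ⌊(1 + θ / 4) * l⌋₊ := by
    have h1 : 24 ≤ θ * l := by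
      have : 24 / θ ≤ l := by
        linarith
      rwa [div_le_iff₀ hθ, mul_comm] at this
    nlinarith
  refine ⟨⌈l⌉₊, ⌊(1 + θ / 4) * l⌋₊, ?_, ?_, ?_⟩
  · rw [← hql]
    gcongr
  · calc (q:ℝ) * ⌊(1 + θ / 4) * l⌋₊ ≤ q * ((1 + θ / 4) * l) := by gcongr
      _ = (1 + θ / 4) * (q * l) := by ring
      _ ≤ _ := by
        rw [hql, ← mul_assoc]
        gcongr
        nlinarith
  · refine le_trans ?_ (h _ _ hj ?_)
    · gcongr
      rwa [le_div_iff₀ ha0]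
    · have : (⌈l⌉₊ : ℝ) ≤ ⌊(1 + θ / 4) * l⌋₊ := by nlinarith
      exact_mod_cast this

theorem exists_sq_mul_exp_le (hαβ : β < 2 * α) : ∃ C : ℝ, 0 < C ∧ ∃ r₀ : ℕ, ∀ (r : ℕ) (y : ℝ), r₀ ≤ r → 0 ≤ y →
    y ^ 2 * exp (-(2 * (α - 4 / r) * y)) ≤ C * exp (-(β * y)) := by
  set η := 2 * α - β with hη
  have hη0 : 0 < η := by linarith
  refine ⟨8 / η ^ 2, by positivity, ⌈16 / η⌉₊ + 1, fun r y hr hy => ?_⟩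
  have hr1 : 16 / η ≤ r := (Nat.le_ceil _).trans (by exact_mod_cast (by lia : ⌈16 / η⌉₊ ≤ r))
  have hr0 : (0:ℝ) < r := lt_of_lt_of_le (by positivity) hr1
  have h8 : 8 / (r:ℝ) ≤ η / 2 := by
    rw [div_le_iff₀ hη0] at hr1
    rw [div_le_iff₀ hr0]
    linarith
  have h1 : (η * y / 2) ^ 2 / 2 ≤ exp (η * y / 2) := by
    have := quadratic_le_exp_of_nonneg (show 0 ≤ η * y / 2 by positivity)
    nlinarith
  calc y ^ 2 * exp (-(2 * (α - 4 / r) * y)) = 8 / η ^ 2 * ((η * y / 2) ^ 2 / 2) * exp (-(2 * (α - 4 / r) * y)) := by field_simp; norm_num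
    _ ≤ 8 / η ^ 2 * exp (η * y / 2) * exp (-(2 * (α - 4 / r) * y)) := by gcongr
    _ = 8 / η ^ 2 * exp (-(β * y) - (η / 2 - 8 / r) * y) := by
      rw [mul_assoc, ← exp_add]
      congr 2
      rw [hη]
      ring
    _ ≤ _ := by
      gcongr
      nlinarith

theorem eventually_scales_top_le (hA : 1 ≤ A) (hε : 0 < ε) (hε1 : ε ≤ 1) (hδ : 0 < δ) (hδε : δ ≤ ε) : ∀ᶠ X : ℝ in atTop,
    ∀ n r : ℕ, 2 * (r:ℝ) ^ 2 ≤ δ * log X → (n ≠ 0 → (r:ℝ) ^ 2 ^ n < A * log (log X)) →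
      ((r:ℝ) ^ 2 ^ n) ^ 4 ≤ X ^ ε ∧ 2 * ((r:ℝ) ^ 2 ^ n) ^ 2 ≤ δ * log X ∧ (n ≠ 0 → 2 * ((r:ℝ) ^ 2 ^ n) ^ 3 ≤ ε * log X) := by
  filter_upwards [tendsto_log_atTop.eventually (eventually_const_mul_log_pow_le (2 * A ^ 3 / δ) 3 one_pos),
    eventually_const_mul_log_pow_le 1 2 hε, (tendsto_log_atTop.comp tendsto_log_atTop).eventually_ge_atTop 1,
    tendsto_log_atTop.eventually_ge_atTop 1] with X h1 h2 h3 h4 n r hr hn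
  set L := log X with hL
  set v := A * log L with hv
  simp only [Function.comp] at h3
  rw [rpow_one] at h1
  rw [one_mul] at h2
  have hv1 : 1 ≤ v := by rw [hv]; nlinarith
  have hv3 : 2 * v ^ 3 ≤ δ * L := by
    have : 2 * v ^ 3 = δ * (2 * A ^ 3 / δ * log L ^ 3) := by rw [hv]; field_simp
    rw [this]
    gcongr
  have hδL : δ * L ≤ ε * L := by gcongr
  have hεL : ε * L ≤ L := by nlinarith
  rcases eq_or_ne n 0 with rfl | hn0
  · rw [pow_zero, pow_one]
    refine ⟨le_trans ?_ h2, hr, fun h => absurd rfl h⟩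
    calc (r:ℝ) ^ 4 = ((r:ℝ) ^ 2) ^ 2 := by ring
      _ ≤ L ^ 2 := by
        gcongr
        nlinarith [sq_nonneg (r:ℝ)]
  · have hρ := (hn hn0).le
    set ρ := (r:ℝ) ^ 2 ^ n with hρd
    have hv3' : v ^ 2 ≤ v ^ 3 := pow_le_pow_right₀ hv1 (by norm_num)
    have hv4 : v ^ 4 ≤ L ^ 2 := by
      calc v ^ 4 ≤ v ^ 6 := pow_le_pow_right₀ hv1 (by norm_num)
        _ = (v ^ 3) ^ 2 := by ring
        _ ≤ L ^ 2 := by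
          gcongr
          linarith
    have h5 : ρ ^ 2 ≤ v ^ 2 := by gcongr
    have h6 : ρ ^ 3 ≤ v ^ 3 := by gcongr
    have h7 : ρ ^ 4 ≤ v ^ 4 := by gcongr
    grind

set_option maxHeartbeats 2000000 in
theorem exists_scaleList_integral_le (hθ : 0 < θ) (hθ1 : θ ≤ 1 / 2) (hα0 : 1 / 8 ≤ α) (hα : α ≤ 1 / 4) (hαθ : 2 * α + θ ≤ 1 / 2)
    (hβ : β < 2 * α) : ∃ ε C : ℝ, 0 < ε ∧ 0 < C ∧ ∃ y₀ : ℕ, ∀ᶠ X : ℝ in atTop, ∀ y : ℕ, y₀ ≤ y → (y:ℝ) ≤ ε * log X →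
    ∃ l : ScaleList, l.IsPrimeList ∧ l.slack ≤ 3 ∧ (∀ p ∈ l.support, (p:ℝ) ≤ X ^ θ) ∧ 0 < l.mass ∧
      (∃ u : ℕ × Finset ℕ → ℝ, (∀ a ∈ l, ∀ p ∈ a.2, u a ≤ rnd a.1 p) ∧ (1 - θ / 2) * log X - 1 ≤ (l.map u).sum) ∧
      ∀ T T₁ : ℝ, 0 < T → T ≤ X → 1 ≤ T₁ → T₁ ≤ X ^ (1 + ε) → T ≤ exp 7 * X * exp (-y) →
        ∫ t in Set.Icc (-T₁) T₁, ‖nested l (zetaKernel X) 0 t‖ ^ 2 * cauchyWeight T t ≤ C * exp (-(β * y)) * (l.mass ^ 2 * X ^ 2 / T) := by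
  set q : ℕ := ⌈2 / θ⌉₊ with hqd
  have hqθ : 2 / θ ≤ q := Nat.le_ceil _
  have hq : 1 ≤ q := by simp_all
  have hq0 : (1:ℝ) ≤ q := by exact_mod_cast hq
  obtain ⟨A, ε, δ, hA, hε, hεθ, hδ, hlarge⟩ := exists_integral_badSet_largeScales_le hθ hθ1 (by linarith) hαθ hq
  obtain ⟨C₁, hC₁, r₁, hr₁, hmain⟩ := exists_setIntegral_block_mul_nested_le hα0 hα
  obtain ⟨C₂, hC₂, r₂, hmass⟩ := exists_bigMass_scales_le
  obtain ⟨C₃, hC₃, r₃, hnum⟩ := exists_sq_mul_exp_le hβ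
  obtain ⟨m₀, hm₀, hrange⟩ := exists_largeScales_range hθ hθ1 hq
  obtain ⟨c, hc, j₀, hj₀, hrec, -⟩ := exists_recipSum_ge
  set R := r₁ + r₂ + r₃ + j₀ with hR
  set δ' := min δ ε with hδ'
  have hδ'0 : 0 < δ' := lt_min hδ hε
  set κ : ℝ := (4 * q) ^ q / m₀ ^ q + 1 with hκ
  refine ⟨δ' / 2, C₁ * C₂ ^ 2 * C₃ * κ ^ 2 / c ^ 2, by positivity, by positivity, R ^ 2, ?_⟩
  filter_upwards [hlarge, hrange, eventually_scales_top_le hA hε (by linarith) hδ'0 (min_le_right _ _), tendsto_log_atTop.eventually_ge_atTop (8 + 2 / θ),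
    eventually_ge_atTop 1] with X hlarge hrange htop hLX hX1 y hy hyX
  obtain ⟨a, b, hqa, hqb, hm⟩ := hrange
  have hX0 : 0 < X := by linarith
  have h2θ : 0 < 2 / θ := by positivity
  set L := log X with hL
  have hL0 : 0 ≤ L := by linarith
  have hδδ' : δ' ≤ δ := min_le_left _ _
  have hδε' : δ' ≤ ε := min_le_right _ _
  set r := Nat.sqrt y with hr
  have hry : r ^ 2 ≤ y := Nat.sqrt_le' y
  have hyr : y < (r + 1) ^ 2 := Nat.lt_succ_sqrt' y
  have hRr : R ≤ r := by rw [hr, Nat.le_sqrt']; exact hy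
  have hry' : (r:ℝ) ^ 2 ≤ y := by exact_mod_cast hry
  have hyr' : (y:ℝ) ≤ (r + 1) ^ 2 := by exact_mod_cast hyr.le
  have hr32 : 32 ≤ r := by lia
  have hr32' : (32:ℝ) ≤ r := by exact_mod_cast hr32
  have hjy : j₀ ≤ y := by
    calc j₀ ≤ r := by lia
      _ ≤ r ^ 2 := Nat.le_self_pow two_ne_zero r
      _ ≤ y := hry
  have hy0 : (0:ℝ) < y := by
    have : 0 < y := by lia
    exact_mod_cast this
  obtain ⟨n, hn1, hn2⟩ := exists_scales_height r (by lia) (A * log L)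
  obtain ⟨ht1, ht2, ht3⟩ := htop n r (by linarith) hn2
  set ρ := (r:ℝ) ^ 2 ^ n with hρ
  set B := primesIn y (y + 1) with hB
  have hBB : IsBlock B y := ⟨hy0.le, fun p hp => ⟨(mem_primesIn.1 hp).1, (mem_primesIn.1 hp).2.1, (mem_primesIn.1 hp).2.2.le⟩⟩
  set Q := largeScales q a b with hQ
  have hQl : Q.IsPrimeList := largeScales_isPrimeList hq
  have hSl : (scales n r).IsPrimeList := isPrimeList_scales (by lia)
  have hyM : (y:ℝ) ≤ ε * L := by
    have : δ' / 2 * L ≤ ε * L := mul_le_mul_of_nonneg_right (by linarith) hL0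
    linarith
  have hεL : ε * L ≤ θ / 16 * L := by gcongr
  have hpX : ∀ p : ℕ, p.Prime → log p ≤ θ * L → (p:ℝ) ≤ X ^ θ := fun p hp h => by
    have hp0 : (0:ℝ) < p := by exact_mod_cast hp.pos
    rw [← exp_log hp0, rpow_def_of_pos hX0, mul_comm]
    exact exp_le_exp.2 h
  have hθL : 2 ≤ θ * L := by
    have : 2 / θ ≤ L := by linarith
    rwa [div_le_iff₀ hθ, mul_comm] at this
  obtain ⟨hsm, hsb⟩ := hmass n r (by lia)
  have hQm : Q.mass = recipSum (primesIn a b) ^ q := largeScales_mass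
  have hQm0 : m₀ ^ q ≤ Q.mass := by
    rw [hQm]
    gcongr
  have hQm1 : 0 < Q.mass := (pow_pos hm₀ q).trans_le hQm0
  have hBm : c / y ≤ recipSum B := hrec y hjy
  have hBm0 : 0 < recipSum B := (div_pos hc hy0).trans_le hBm
  have hla : ScaleList.mass ((1, B) :: (scales n r ++ Q)) = recipSum B * ((scales n r).mass * Q.mass) := by
    rw [ScaleList.mass, ScaleList.mass_append]
  have hrnd : ∀ p ∈ B, rnd 1 p = y := fun p hp => by
    have h1 := (mem_primesIn.1 hp).2
    have : ⌊log p⌋₊ = y := (Nat.floor_eq_iff (hy0.le.trans h1.1)).2 h1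
    rw [rnd, Nat.cast_one, one_mul, div_one, this]
  refine ⟨(1, B) :: (scales n r ++ Q), ⟨le_rfl, fun p hp => (mem_primesIn.1 hp).1, hSl.append hQl⟩, ?_, ?_, ?_, ?_, ?_⟩
  · rw [ScaleList.slack, ScaleList.slack_append, hQ, largeScales_slack hq, Nat.cast_one, div_one]
    have : (scales n r).slack ≤ 1 := (slack_scales_le (by lia)).trans (by rw [div_le_one (by linarith)]; linarith)
    linarith
  · intro p hp
    rw [ScaleList.support, ScaleList.support_append, mem_union, mem_union] at hp
    rcases hp with hp | hp | hp
    · refine hpX p (mem_primesIn.1 hp).1 ?_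
      have := (mem_primesIn.1 hp).2.2
      nlinarith
    · refine hpX p (ScaleList.IsPrimeList.prime_of_mem hSl hp) ?_
      have h1 := log_lt_of_mem_support_scales (by lia) hp
      have hn0 : n ≠ 0 := by
        rintro rfl
        simp [scales, ScaleList.support] at hp
      have := ht3 hn0
      linarith
    · have hp' := mem_primesIn.1 (replicate_support hp)
      refine hpX p hp'.1 ?_
      have h1 : (q:ℝ) * b ≤ L := hqb.trans (by nlinarith)
      have h2 : 2 / θ * b ≤ L := le_trans (by gcongr) h1
      have h3 : 2 * (b:ℝ) ≤ θ * L := by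
        calc 2 * (b:ℝ) = θ * (2 / θ * b) := by field_simp
          _ ≤ _ := by gcongr
      linarith
  · rw [hla]
    positivity
  · refine ⟨fun x => if x ∈ Q then (a:ℝ) - 1 / q else 0, fun x _ p hp => ?_, ?_⟩
    · beta_reduce
      split_ifs with hx
      · exact le_rnd_of_mem_largeScales hq x hx p hp
      · exact rnd_nonneg _ _
    · have ha1 : 0 ≤ (a:ℝ) - 1 / q := by
        have h1 : 1 ≤ q * (a:ℝ) := le_trans (by nlinarith) hqa
        rw [sub_nonneg, div_le_iff₀ (by linarith)]
        linarith
      have hu : ∀ x : ℕ × Finset ℕ, 0 ≤ (if x ∈ Q then (a:ℝ) - 1 / q else 0) := fun x => by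
        split_ifs
        exacts [ha1, le_rfl]
      rw [List.map_cons, List.sum_cons, List.map_append, List.sum_append]
      have h1 : (Q.map fun x => if x ∈ Q then (a:ℝ) - 1 / q else 0).sum = q * (a - 1 / q) := by
        rw [List.map_congr_left (g := fun _ => (a:ℝ) - 1 / q) fun x hx => if_pos hx, hQ, largeScales, List.map_replicate, List.sum_replicate, nsmul_eq_mul]
      have h2 : 0 ≤ ((scales n r).map fun x => if x ∈ Q then (a:ℝ) - 1 / q else 0).sum :=
        List.sum_nonneg fun z hz => by
          obtain ⟨x, -, rfl⟩ := List.mem_map.1 hz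
          exact hu x
      have h3 : (q:ℝ) * (a - 1 / q) = q * a - 1 := by field_simp
      have := hu (1, B)
      rw [h1, h3]
      linarith
  · intro T T₁ hT hTX hT1 hT1X hTy
    have ha0 : (0:ℝ) < a := by
      have : 0 < q * (a:ℝ) := lt_of_lt_of_le (by nlinarith) hqa
      exact pos_of_mul_pos_right this (by linarith)
    have hker := kernelBound_largeScales (b := b) hq hX0 ha0 (c := 4 * q) (by positivity) (by nlinarith)
    set K := (4 * q) ^ q + Q.mass with hK
    have hKm : K ≤ κ * Q.mass := by
      have : (4 * (q:ℝ)) ^ q = (4 * q) ^ q / m₀ ^ q * m₀ ^ q := by field_simp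
      rw [hK, hκ, add_mul, one_mul]
      gcongr
      rw [this]
      gcongr
      exact le_of_eq (by field_simp)
    have hK1 : 1 ≤ K := by
      have : 1 ≤ (4 * (q:ℝ)) ^ q := one_le_pow₀ (by linarith)
      linarith
    have hT1X' : T₁ ≤ X ^ (1 + ε) := hT1X.trans (rpow_le_rpow_of_exponent_le hX1 (by linarith))
    have key := hmain (M := ε * L) (T₁ := T₁) hX0 hT hTX hker n r (by lia) (fun P hP hPb σ hσ hσM => ?_) ht3 B y hBB hry' hyr' hyM hTy
    · have heq : ∀ t, nested ((1, B) :: (scales n r ++ Q)) (zetaKernel X) 0 t = (∑ p ∈ B, chi p t) * nested (scales n r) (nested Q (zetaKernel X)) y t := fun t => by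
        rw [nested, Finset.sum_mul]
        exact sum_congr rfl fun p hp => by rw [nested_append, hrnd p hp, zero_add]
      simp only [heq]
      refine key.trans ?_
      have hnum' := hnum r y (by lia) hy0.le
      set E := exp (-(2 * (α - 4 / r) * y)) with hE
      have hcy : 1 ≤ (y:ℝ) * recipSum B / c := by
        rw [le_div_iff₀ hc, one_mul]
        rwa [div_le_iff₀ hy0, mul_comm] at hBm
      have hbn := (scales n r).bigMass_nonneg
      calc C₁ * E * (K ^ 2 * (scales n r).bigMass ^ 2 * X ^ 2 / T)
          ≤ C₁ * E * ((κ * Q.mass) ^ 2 * (C₂ * (scales n r).mass) ^ 2 * X ^ 2 / T) := by gcongr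
        _ = C₁ * C₂ ^ 2 * κ ^ 2 * E * (((scales n r).mass * Q.mass) ^ 2 * X ^ 2 / T) * 1 ^ 2 := by ring
        _ ≤ C₁ * C₂ ^ 2 * κ ^ 2 * E * (((scales n r).mass * Q.mass) ^ 2 * X ^ 2 / T) * (y * recipSum B / c) ^ 2 := by gcongr
        _ = C₁ * C₂ ^ 2 * κ ^ 2 / c ^ 2 * (y ^ 2 * E) * ((recipSum B * ((scales n r).mass * Q.mass)) ^ 2 * X ^ 2 / T) := by field_simp
        _ ≤ C₁ * C₂ ^ 2 * κ ^ 2 / c ^ 2 * (C₃ * exp (-(β * y))) * ((recipSum B * ((scales n r).mass * Q.mass)) ^ 2 * X ^ 2 / T) := by gcongr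
        _ = _ := by rw [hla]; ring
    · refine (hlarge a b T T₁ hqa (Nat.cast_nonneg _) hqb hT hT1 hT1X' P (hP.trans ht1) (fun x hx => ?_) σ hσ hσM).trans ?_
      · obtain ⟨h1, h2, h3⟩ := hPb x hx
        exact ⟨h1, hn1.trans h2, h3⟩
      · have h1 : X ^ (-δ) ≤ exp (-(2 * ρ ^ 2)) := by
          rw [rpow_def_of_pos hX0]
          refine exp_le_exp.2 ?_
          nlinarith
        have h2 : X ^ 2 / T ≤ K ^ 2 * X ^ 2 / T := by
          gcongr
          exact le_mul_of_one_le_left (sq_nonneg _) (one_le_pow₀ hK1)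
        gcongr

set_option maxHeartbeats 1000000 in
/-- Most points are within bounded-power distance `H` of a smooth number, for small `H`. -/
theorem volume_far_from_smooth_le_of_small (hθ : 0 < θ) (hβ0 : 1 / 4 ≤ β) (hβ : β < 1 / 2) : ∃ ε C H₀ : ℝ, 0 < ε ∧ 0 < C ∧ 1 ≤ H₀ ∧
    ∀ᶠ X : ℝ in atTop, ∀ H : ℝ, H₀ ≤ H → H ≤ X ^ ε →
    volume {x : ℝ | exp 4 * X ≤ x ∧ x ≤ exp 6 * X ∧ ∀ n : ℕ, IsSmoothNat θ n → H < |(n : ℝ) - x|} ≤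
      ENNReal.ofReal (C * X * H ^ (-β)) := by
  set θ' := min θ (min (1 / 2) ((1 / 2 - β) / 2)) with hθ'
  have hθ'0 : 0 < θ' := by positivity
  have hθ'θ : θ' ≤ θ := min_le_left _ _
  have hθ'1 : θ' ≤ 1 / 2 := by grind
  have hθ'2 : θ' ≤ (1 / 2 - β) / 2 := by grind
  obtain ⟨ε, C, hε, hC, y₀, hmain⟩ := exists_scaleList_integral_le (α := (β + 1 / 2) / 4) (β := β) hθ'0 hθ'1 (by linarith) (by linarith) (by linarith) (by linarith)
  obtain ⟨c, C', X₀, hc, hC', hX₀, htr⟩ := transfer_trunc hε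
  have hkap := one_lt_kap
  refine ⟨min ε 1, C' * C * exp β, exp (y₀ + 10), lt_min hε one_pos, by positivity, one_le_exp (by positivity), ?_⟩
  have ev : ∀ᶠ X : ℝ in atTop, kap * exp 1 ≤ X ^ (θ' / 2) := (tendsto_rpow_atTop (by positivity)).eventually_ge_atTop _
  filter_upwards [hmain, ev, eventually_ge_atTop X₀] with X hmain hXk hXX H hH hHX
  have hX1 : 1 ≤ X := hX₀.trans hXX
  have hX0 : 0 < X := by linarith
  have hH0 : 0 < H := (exp_pos _).trans_le hH
  have hlH : y₀ + 10 ≤ log H := (le_log_iff_exp_le hH0).2 hH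
  have hlX : 0 ≤ log X := log_nonneg hX1
  have hlHX : log H ≤ min ε 1 * log X := by
    have := log_le_log hH0 hHX
    rwa [log_rpow hX0] at this
  have hy0 : 0 ≤ log H := by
    linarith
  set y := ⌊log H⌋₊ with hy
  have hy1 : (y:ℝ) ≤ log H := Nat.floor_le hy0
  have hy2 : log H < y + 1 := Nat.lt_floor_add_one _
  have hyy : y₀ ≤ y := Nat.le_floor (by linarith)
  obtain ⟨l, hl, hls, hlp, hlm, ⟨u, hu, hu'⟩, hint⟩ := hmain y hyy (hy1.trans (hlHX.trans (by gcongr; exact min_le_left _ _)))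
  obtain ⟨ι, I, d, v, hI, hIu, -, -, hmass, hsum⟩ := exists_nested_eq_sum hl
  have he6 : 2 * exp 6 ≤ exp 7 := by
    have : exp 7 = exp 1 * exp 6 := by rw [← exp_add]; norm_num
    rw [this]
    have := exp_one_gt_d9
    gcongr
    linarith
  have hH7 : exp 7 ≤ H := by
    refine le_trans (exp_le_exp.2 ?_) hH
    linarith
  have hHX' : H ≤ X := hHX.trans (by
    calc X ^ (min ε 1) ≤ X ^ (1:ℝ) := rpow_le_rpow_of_exponent_le hX1 (min_le_right _ _)
      _ = X := rpow_one X)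
  set T := 2 * exp 6 * X / H with hT
  have hT1 : 1 ≤ T := by
    rw [hT, le_div_iff₀ hH0]
    have := one_le_exp (show (0:ℝ) ≤ 6 by norm_num)
    nlinarith
  have hT0 : 0 < T := by linarith
  have hTX : T ≤ X := by
    rw [hT, div_le_iff₀ hH0, mul_comm]
    gcongr
    linarith
  have hXε : 1 ≤ X ^ ε := one_le_rpow hX1 hε.le
  have hfam : ∀ t, famPoly I d (fun i => X * exp (-v i)) t = nested l (zetaKernel X) 0 t := fun t => by
    rw [hsum, famPoly]
    exact sum_congr rfl fun i _ => by rw [zetaKernel, zero_add]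
  have hTy : T ≤ exp 7 * X * exp (-y) := by
    have h1 : exp y ≤ H := (le_log_iff_exp_le hH0).1 hy1
    have h2 : H⁻¹ ≤ exp (-y) := by
      rw [exp_neg]
      exact inv_anti₀ (exp_pos _) h1
    rw [hT, div_eq_mul_inv]
    gcongr
  have hbound := hint T (T * X ^ ε) hT0 hTX (by nlinarith) (by
    rw [rpow_add hX0, rpow_one]
    gcongr) hTy
  have hdv : ∀ i ∈ I, X ≤ d i * (X * exp (-v i)) ∧ d i * (X * exp (-v i)) ≤ exp 3 * X := fun i hi => by
    obtain ⟨h1, h2, h3, h4, -⟩ := hI i hi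
    have h5 : exp (v i) * exp (-v i) = 1 := by rw [← exp_add, add_neg_cancel, exp_zero]
    constructor
    · calc X = exp (v i) * (X * exp (-v i)) := by rw [mul_left_comm, h5, mul_one]
        _ ≤ _ := by gcongr
    · calc d i * (X * exp (-v i)) ≤ exp (v i + 3) * (X * exp (-v i)) := by
            gcongr
            exact h4.trans (exp_le_exp.2 (by linarith))
        _ = exp 3 * X * (exp (v i) * exp (-v i)) := by rw [exp_add]; ring
        _ = _ := by rw [h5, mul_one]
  refine (measure_mono ?_).trans ((htr X T hXX hT1 hTX I d (fun i => X * exp (-v i)) l.mass (fun i hi => (hI i hi).1) (fun i _ => by positivity)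
    hdv hlm hmass.symm (Set.Icc (-(T * X ^ ε)) (T * X ^ ε)) measurableSet_Icc ?_ H ?_).trans (ENNReal.ofReal_le_ofReal ?_))
  · rintro x ⟨hx1, hx2, hx3⟩
    refine ⟨hx1, hx2, fun i hi m hm1 hm2 => ?_⟩
    obtain ⟨h1, h2, h3, h4, h5⟩ := hI i hi
    have hm0 : 0 < m := by
      have : (0:ℝ) < m := lt_of_le_of_lt (by positivity) hm1
      exact_mod_cast this
    have hXm : X ≤ ((d i * m : ℕ) : ℝ) := by
      push_cast
      exact (hdv i hi).1.trans (by gcongr)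
    have := hx3 (d i * m) ⟨Nat.mul_pos h1 hm0, fun p hp hpd => ?_⟩
    · push_cast at this
      exact this
    · have hpθ : (p:ℝ) ≤ X ^ θ' := by
        rcases (Nat.Prime.dvd_mul hp).1 hpd with h | h
        · exact hlp p (h5 p hp h)
        · have h6 : (p:ℝ) ≤ m := by exact_mod_cast Nat.le_of_dvd hm0 h
          have h7 : X * exp (-v i) ≤ exp 1 * X ^ (θ' / 2) := by
            have := hIu i hi u hu
            nth_rewrite 1 [← exp_log hX0]
            rw [rpow_def_of_pos hX0, ← exp_add, ← exp_add]
            exact exp_le_exp.2 (by linarith)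
          calc (p:ℝ) ≤ kap * (X * exp (-v i)) := h6.trans hm2
            _ ≤ kap * (exp 1 * X ^ (θ' / 2)) := by gcongr
            _ = kap * exp 1 * X ^ (θ' / 2) := by ring
            _ ≤ X ^ (θ' / 2) * X ^ (θ' / 2) := by gcongr
            _ = X ^ θ' := by rw [← rpow_add hX0, add_halves]
      calc (p:ℝ) ≤ X ^ θ' := hpθ
        _ ≤ X ^ θ := by gcongr
        _ ≤ _ := by gcongr
  · rw [Set.compl_inter_self, setIntegral_empty]
    positivity
  · rw [hT]
    exact le_of_eq (by field_simp)
  · simp only [hfam]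
    have hyβ : exp (-(β * y)) ≤ exp β * H ^ (-β) := by
      rw [rpow_def_of_pos hH0, ← exp_add]
      refine exp_le_exp.2 ?_
      nlinarith
    calc _ ≤ C' * T / (X * l.mass ^ 2) * (C * exp (-(β * y)) * (l.mass ^ 2 * X ^ 2 / T)) := by gcongr
      _ = C' * C * X * exp (-(β * y)) := by field_simp
      _ ≤ C' * C * X * (exp β * H ^ (-β)) := by gcongr
      _ = _ := by ring

/-- The points of `[e ^ 4 * X, e ^ 6 * X]` at distance more than `H` from all smooth numbers. -/
def farSet (θ X H : ℝ) : Set ℝ :=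
  {x : ℝ | exp 4 * X ≤ x ∧ x ≤ exp 6 * X ∧ ∀ n : ℕ, IsSmoothNat θ n → H < |(n : ℝ) - x|}

theorem volume_farSet_le (hθ : 0 < θ) (hβ0 : 1 / 4 ≤ β) (hβ : β < 1 / 2) : ∃ C H₀ : ℝ, 0 < C ∧ 1 ≤ H₀ ∧
    ∀ᶠ X : ℝ in atTop, ∀ H : ℝ, H₀ ≤ H → H ≤ X ^ (7 / 10 : ℝ) → volume (farSet θ X H) ≤ ENNReal.ofReal (C * X * H ^ (-β)) := by
  obtain ⟨ε, C₁, H₀, hε, hC₁, hH₀, h1⟩ := volume_far_from_smooth_le_of_small hθ hβ0 hβ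
  obtain ⟨C₂, hC₂, h2⟩ := volume_far_from_smooth_le_of_large hθ hβ hε
  refine ⟨C₁ + C₂, H₀, by positivity, hH₀, ?_⟩
  filter_upwards [h1, h2, eventually_gt_atTop 1] with X h1 h2 hX H hH hHX
  have hH0 : 0 < H := by linarith
  have hX0 : 0 < X := by linarith
  rcases le_total H (X ^ ε) with h | h
  · refine (h1 H hH h).trans (ENNReal.ofReal_le_ofReal ?_)
    gcongr
    linarith
  · have hl : 0 < log X := log_pos hX
    set u := log H / log X with hu
    have hXu : X ^ u = H := by
      rw [rpow_def_of_pos hX0, hu, mul_div_cancel₀ _ hl.ne', exp_log hH0]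
    have hε1 : ε ≤ u := by rwa [← hXu, rpow_le_rpow_left_iff hX] at h
    have hu1 : u ≤ 7 / 10 := by rwa [← hXu, rpow_le_rpow_left_iff hX] at hHX
    have := h2 u hε1 hu1
    rw [hXu] at this
    refine this.trans (ENNReal.ofReal_le_ofReal ?_)
    have h3 : X ^ (1 - β * u) = X * H ^ (-β) := by
      rw [← hXu, ← rpow_mul hX0.le, sub_eq_add_neg, rpow_add hX0, rpow_one]
      congr 2
      ring
    rw [h3, ← mul_assoc]
    gcongr
    linarith

theorem volume_farSet_lt (hθ : 0 < θ) : ∀ᶠ X : ℝ in atTop,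
    volume (farSet θ X (X ^ (7 / 10 : ℝ))) < ENNReal.ofReal (X ^ (7 / 10 : ℝ)) := by
  obtain ⟨C, hC, h⟩ := volume_far_from_smooth_le_of_large (β := 49 / 100) (ε := 7 / 10) hθ (by norm_num) (by norm_num)
  filter_upwards [h, (tendsto_rpow_atTop (show (0:ℝ) < 43 / 1000 by norm_num)).eventually_gt_atTop C, eventually_gt_atTop 1] with X h hXC hX
  have hX0 : 0 < X := by linarith
  refine (h (7 / 10) le_rfl le_rfl).trans_lt ((ENNReal.ofReal_lt_ofReal_iff (by positivity)).2 ?_)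
  calc C * X ^ (1 - 49 / 100 * (7 / 10) : ℝ) < X ^ (43 / 1000 : ℝ) * X ^ (1 - 49 / 100 * (7 / 10) : ℝ) := by gcongr
    _ = _ := by
      rw [← rpow_add hX0]
      norm_num

section

variable {θ : ℝ} {a : ℕ → ℕ}

theorem lt_abs_sub_of_mem_gap (ha : StrictMono a) (hr : ∀ n, (∃ i, a i = n) ↔ IsSmoothNat θ n)
    (hn : IsSmoothNat θ n) {g : ℝ} (hx : (a i : ℝ) + g < x) (hx' : x + g < a (i + 1)) : g < |(n:ℝ) - x| := by
  obtain ⟨j, rfl⟩ := (hr n).2 hn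
  rw [lt_abs]
  rcases le_or_gt j i with h | h
  · have : (a j : ℝ) ≤ a i := by exact_mod_cast ha.monotone h
    right
    linarith
  · have : (a (i + 1) : ℝ) ≤ a j := by exact_mod_cast ha.monotone h
    left
    linarith

theorem card_mul_le_volume_farSet (ha : StrictMono a) (hr : ∀ n, (∃ i, a i = n) ↔ IsSmoothNat θ n) (hH : 0 ≤ H) (F : Finset ℕ)
    (hF : ∀ i ∈ F, exp 4 * X ≤ a i ∧ (a (i + 1) : ℝ) ≤ exp 6 * X ∧ 3 * H ≤ (a (i + 1) : ℝ) - a i) :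
    ENNReal.ofReal (#F * H) ≤ volume (farSet θ X H) := by
  set s : ℕ → Set ℝ := fun i => Set.Ioo ((a i : ℝ) + H) (a (i + 1) - H) with hs
  have hd : Set.PairwiseDisjoint (F : Set ℕ) s := by
    have key : ∀ i j, i < j → Disjoint (s i) (s j) := fun i j hij => by
      refine Set.disjoint_left.2 fun x hx hx' => ?_
      have : (a (i + 1) : ℝ) ≤ a j := by exact_mod_cast ha.monotone hij
      grind
    intro i _ j _ hij
    grind
  have hsub : ⋃ i ∈ F, s i ⊆ farSet θ X H := by
    intro x hx
    obtain ⟨i, hi, hx⟩ := Set.mem_iUnion₂.1 hx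
    obtain ⟨h1, h2, h3⟩ := hF i hi
    exact ⟨by linarith [hx.1], by linarith [hx.2], fun n hn => lt_abs_sub_of_mem_gap ha hr hn hx.1 (by linarith [hx.2])⟩
  calc ENNReal.ofReal (#F * H) = ∑ _i ∈ F, ENNReal.ofReal H := by
        simp
    _ ≤ ∑ i ∈ F, volume (s i) := sum_le_sum fun i hi => by
        rw [volume_Ioo]
        exact ENNReal.ofReal_le_ofReal (by linarith [(hF i hi).2.2])
    _ = volume (⋃ i ∈ F, s i) := (measure_biUnion_finset hd fun i _ => measurableSet_Ioo).symm
    _ ≤ _ := measure_mono hsub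

theorem exists_apply_succ_le (ha : StrictMono a) (hr : ∀ n, (∃ i, a i = n) ↔ IsSmoothNat θ n)
    (hθ : 0 < θ) : ∀ᶠ X : ℝ in atTop, ∀ i, X ≤ a i → (a (i + 1) : ℝ) ≤ 2 * a i := by
  filter_upwards [(tendsto_rpow_atTop hθ).eventually_ge_atTop 2, eventually_ge_atTop 1] with X hX hX1 i hi
  have hi1 : 1 ≤ a i := by
    have : (1:ℝ) ≤ a i := hX1.trans hi
    exact_mod_cast this
  have h1 : a i < 2 ^ (Nat.log 2 (a i) + 1) := Nat.lt_pow_succ_log_self one_lt_two _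
  have h2 : 2 ^ Nat.log 2 (a i) ≤ a i := Nat.pow_log_le_self 2 (by lia)
  have hsm : IsSmoothNat θ (2 ^ (Nat.log 2 (a i) + 1)) := by
    refine ⟨Nat.one_le_two_pow, fun p hp hpd => ?_⟩
    obtain rfl := (Nat.prime_dvd_prime_iff_eq hp Nat.prime_two).1 (hp.dvd_of_dvd_pow hpd)
    refine le_trans (by exact_mod_cast hX) (rpow_le_rpow (by linarith) (hi.trans ?_) hθ.le)
    exact_mod_cast h1.le
  obtain ⟨j, hj⟩ := (hr _).2 hsm
  have hij : i < j := ha.lt_iff_lt.1 (by rwa [hj])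
  have h3 : a (i + 1) ≤ 2 * a i := by
    calc a (i + 1) ≤ a j := ha.monotone hij
      _ = 2 * 2 ^ Nat.log 2 (a i) := by rw [hj, pow_succ']
      _ ≤ _ := by lia
  exact_mod_cast h3

theorem sum_gap_le (ha : StrictMono a) (hY : 0 ≤ Y) (F : Finset ℕ) (hF : ∀ i ∈ F, (a (i + 1) : ℝ) ≤ Y) : ∑ i ∈ F, ((a (i + 1) : ℝ) - a i) ≤ Y := by
  have hnn : ∀ i, 0 ≤ (a (i + 1) : ℝ) - a i := fun i => sub_nonneg.2 (by exact_mod_cast ha.monotone (Nat.le_succ i))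
  rcases F.eq_empty_or_nonempty with rfl | hne
  · simpa using hY
  · calc _ ≤ ∑ i ∈ range (F.max' hne + 1), ((a (i + 1) : ℝ) - a i) :=
          sum_le_sum_of_subset_of_nonneg (fun i hi => mem_range.2 (Nat.lt_succ_of_le (le_max' F i hi))) fun i _ _ => hnn i
      _ = a (F.max' hne + 1) - a 0 := sum_range_sub (fun i => (a i : ℝ)) _
      _ ≤ a (F.max' hne + 1) := sub_le_self _ (Nat.cast_nonneg _)
      _ ≤ Y := hF _ (max'_mem F hne)

end

theorem rpow_le_dyadic {g : ℝ} {K : ℕ} (hγ : 1 ≤ γ) (hH₀ : 1 ≤ H₀) (hg : 0 ≤ g) (hgT : g < 3 * T) (hTK : T ≤ (2:ℝ) ^ K) :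
    g ^ γ ≤ (3 * H₀) ^ (γ - 1) * g +
      ∑ k ∈ (range K).filter (fun k => H₀ * 2 ^ k ≤ T), if 3 * (H₀ * 2 ^ k) ≤ g then (6 * (H₀ * 2 ^ k)) ^ γ else 0 := by
  have hnn : ∀ k ∈ (range K).filter (fun k => H₀ * 2 ^ k ≤ T),
      0 ≤ if 3 * (H₀ * 2 ^ k) ≤ g then (6 * (H₀ * 2 ^ k)) ^ γ else 0 := fun k _ => by
    split_ifs <;> positivity
  rcases le_or_gt g (3 * H₀) with h | h
  · refine le_add_of_le_of_nonneg ?_ (sum_nonneg hnn)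
    rcases hg.eq_or_lt with rfl | hg
    · rw [zero_rpow (by linarith)]
      simp
    · calc g ^ γ = g ^ (γ - 1) * g := by rw [← rpow_add_one hg.ne', sub_add_cancel]
        _ ≤ _ := by gcongr
  · obtain ⟨k, hk1, hk2⟩ := exists_nat_pow_near (x := g / (3 * H₀)) (y := 2) ((one_le_div (by positivity)).2 h.le) one_lt_two
    rw [le_div_iff₀ (by positivity)] at hk1
    rw [div_lt_iff₀ (by positivity)] at hk2
    have hkT : H₀ * 2 ^ k < T := by linarith
    have hkK : k < K := by
      have : (2:ℝ) ^ k < 2 ^ K := by nlinarith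
      exact (pow_lt_pow_iff_right₀ one_lt_two).1 this
    refine le_add_of_nonneg_of_le (by positivity) (le_trans ?_ (single_le_sum hnn (mem_filter.2 ⟨mem_range.2 hkK, hkT.le⟩)))
    rw [if_pos (by linarith)]
    gcongr
    rw [pow_succ] at hk2
    linarith

theorem sum_rpow_dyadic_le (hH₀ : 1 ≤ H₀) (he : e < 0) (s : Finset ℕ) :
    ∑ k ∈ s, (H₀ * 2 ^ k) ^ e ≤ (1 - (2:ℝ) ^ e)⁻¹ := by
  have h2 : (2:ℝ) ^ e < 1 := rpow_lt_one_of_one_lt_of_neg one_lt_two he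
  have h0 : (0:ℝ) ≤ 2 ^ e := by positivity
  rw [← tsum_geometric_of_lt_one h0 h2]
  refine le_trans (sum_le_sum fun k _ => ?_) ((summable_geometric_of_lt_one h0 h2).sum_le_tsum s fun _ _ => by positivity)
  rw [mul_rpow (by positivity) (by positivity), ← rpow_natCast, ← rpow_natCast, ← rpow_mul (by norm_num),
    ← rpow_mul (by norm_num), mul_comm (k:ℝ) e]
  exact mul_le_of_le_one_left (by positivity) (rpow_le_one_of_one_le_of_nonpos hH₀ he.le)

theorem exists_sum_gap_rpow_le {a : ℕ → ℕ} (ha : StrictMono a) (hr : ∀ n, (∃ i, a i = n) ↔ IsSmoothNat θ n)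
    (hθ : 0 < θ) (hγ1 : 1 ≤ γ) (hγ2 : γ < 3 / 2) :
    ∃ C, 0 < C ∧ ∀ᶠ X : ℝ in atTop, ∀ F : Finset ℕ, (∀ i ∈ F, exp 4 * X ≤ a i ∧ (a i : ℝ) ≤ exp 5 * X) →
      ∑ i ∈ F, ((a (i + 1) : ℝ) - a i) ^ γ ≤ C * X := by
  set β := (γ - 1 / 2) / 2 with hβ
  obtain ⟨C, H₀, hC, hH₀, hvol⟩ := volume_farSet_le (β := β) hθ (by linarith) (by linarith)
  have he : γ - 1 - β < 0 := by linarith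
  have hS : 0 < 1 - (2:ℝ) ^ (γ - 1 - β) := sub_pos.2 (rpow_lt_one_of_one_lt_of_neg one_lt_two he)
  refine ⟨(3 * H₀) ^ (γ - 1) * exp 6 + 6 ^ γ * C * (1 - (2:ℝ) ^ (γ - 1 - β))⁻¹, by positivity, ?_⟩
  filter_upwards [hvol, volume_farSet_lt hθ, exists_apply_succ_le ha hr hθ, eventually_ge_atTop 1] with X hvol hlt hsucc hX F hF
  have hX0 : 0 < X := by linarith
  have hg : ∀ i, 0 ≤ (a (i + 1) : ℝ) - a i := fun i => sub_nonneg.2 (by exact_mod_cast ha.monotone (Nat.le_succ i))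
  have h6 : ∀ i ∈ F, (a (i + 1) : ℝ) ≤ exp 6 * X := fun i hi => by
    have h1 : X ≤ a i := le_trans (le_mul_of_one_le_left hX0.le (one_le_exp (by norm_num))) (hF i hi).1
    have h2 : exp 6 = exp 1 * exp 5 := by rw [← exp_add]; norm_num
    have h3 : (2:ℝ) ≤ exp 1 := by linarith [add_one_le_exp (1:ℝ)]
    calc (a (i + 1) : ℝ) ≤ 2 * a i := hsucc i h1
      _ ≤ exp 1 * (exp 5 * X) := by gcongr; exact (hF i hi).2
      _ = _ := by rw [h2]; ring
  set T := X ^ (7 / 10 : ℝ) with hT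
  have hT0 : 0 ≤ T := by positivity
  have hgT : ∀ i ∈ F, (a (i + 1) : ℝ) - a i < 3 * T := fun i hi => by
    by_contra! h
    have := card_mul_le_volume_farSet (X := X) ha hr hT0 {i} fun j hj => by
      grind
    rw [card_singleton, Nat.cast_one, one_mul] at this
    grind
  obtain ⟨K, hK⟩ := pow_unbounded_of_one_lt T (one_lt_two (α := ℝ))
  set R := (range K).filter (fun k => H₀ * 2 ^ k ≤ T) with hR
  have hcard : ∀ k ∈ R, (#(F.filter fun i => 3 * (H₀ * 2 ^ k) ≤ (a (i + 1) : ℝ) - a i) : ℝ) * (H₀ * 2 ^ k)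
      ≤ C * X * (H₀ * 2 ^ k) ^ (-β) := fun k hk => by
    have hH : H₀ ≤ H₀ * 2 ^ k := le_mul_of_one_le_right (by linarith) (one_le_pow₀ one_le_two)
    have := (card_mul_le_volume_farSet (X := X) ha hr (hH.trans' (by linarith)) (F.filter fun i => 3 * (H₀ * 2 ^ k) ≤ (a (i + 1) : ℝ) - a i)
      fun i hi => ⟨(hF i (mem_filter.1 hi).1).1, h6 i (mem_filter.1 hi).1, (mem_filter.1 hi).2⟩).trans
      (hvol _ hH (mem_filter.1 hk).2)
    rwa [ENNReal.ofReal_le_ofReal_iff (by positivity)] at this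
  calc ∑ i ∈ F, ((a (i + 1) : ℝ) - a i) ^ γ
      ≤ ∑ i ∈ F, ((3 * H₀) ^ (γ - 1) * ((a (i + 1) : ℝ) - a i) +
        ∑ k ∈ R, if 3 * (H₀ * 2 ^ k) ≤ (a (i + 1) : ℝ) - a i then (6 * (H₀ * 2 ^ k)) ^ γ else 0) :=
        sum_le_sum fun i hi => rpow_le_dyadic hγ1 hH₀ (hg i) (hgT i hi) hK.le
    _ = (3 * H₀) ^ (γ - 1) * ∑ i ∈ F, ((a (i + 1) : ℝ) - a i) +
        ∑ k ∈ R, (#(F.filter fun i => 3 * (H₀ * 2 ^ k) ≤ (a (i + 1) : ℝ) - a i) : ℝ) * (6 * (H₀ * 2 ^ k)) ^ γ := by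
      rw [sum_add_distrib, ← mul_sum, sum_comm]
      congr 1
      refine sum_congr rfl fun k _ => ?_
      rw [← sum_filter, sum_const, nsmul_eq_mul]
    _ ≤ (3 * H₀) ^ (γ - 1) * (exp 6 * X) + ∑ k ∈ R, 6 ^ γ * C * X * (H₀ * 2 ^ k) ^ (γ - 1 - β) := by
      refine add_le_add (mul_le_mul_of_nonneg_left (sum_gap_le ha (by positivity) F h6) (by positivity)) (sum_le_sum fun k hk => ?_)
      · have hp : 0 < H₀ * 2 ^ k := by positivity
        have e1 : (6 * (H₀ * 2 ^ k)) ^ γ = (H₀ * 2 ^ k) * (6 ^ γ * (H₀ * 2 ^ k) ^ (γ - 1)) := by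
          rw [mul_rpow (by norm_num) hp.le, rpow_sub_one hp.ne']
          field_simp
        rw [e1, ← mul_assoc]
        calc _ ≤ C * X * (H₀ * 2 ^ k) ^ (-β) * (6 ^ γ * (H₀ * 2 ^ k) ^ (γ - 1)) :=
              mul_le_mul_of_nonneg_right (hcard k hk) (by positivity)
          _ = 6 ^ γ * C * X * ((H₀ * 2 ^ k) ^ (γ - 1) * (H₀ * 2 ^ k) ^ (-β)) := by ring
          _ = _ := by rw [← rpow_add hp, ← sub_eq_add_neg]
    _ ≤ (3 * H₀) ^ (γ - 1) * (exp 6 * X) + 6 ^ γ * C * X * (1 - (2:ℝ) ^ (γ - 1 - β))⁻¹ := by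
      rw [← mul_sum]
      gcongr
      exact sum_rpow_dyadic_le hH₀ he R
    _ = _ := by ring

/-- A nonnegative weight whose sums over long intervals `[e ^ (4 + t), e ^ (5 + t)]` are `O(e ^ t)`
has partial sums `O(x)`. -/
theorem exists_sum_le_of_window {a : ℕ → ℕ} (ha : StrictMono a) {w : ℕ → ℝ} (hw : ∀ i, 0 ≤ w i) (hC : 0 < C)
    (h : ∀ᶠ X : ℝ in atTop, ∀ F : Finset ℕ, (∀ i ∈ F, exp 4 * X ≤ a i ∧ (a i : ℝ) ≤ exp 5 * X) → ∑ i ∈ F, w i ≤ C * X) :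
    ∃ c, 0 < c ∧ ∀ x : ℝ, 1 ≤ x → ∀ F : Finset ℕ, (∀ i ∈ F, (a i : ℝ) ≤ x) → ∑ i ∈ F, w i ≤ c * x := by
  obtain ⟨X₀, hX₀⟩ := eventually_atTop.1 h
  set X₁ := max X₀ 1 with hX₁
  have hX₁1 : 1 ≤ X₁ := le_max_right _ _
  set M := ∑ i ∈ range ⌈exp 5 * X₁⌉₊, w i with hM
  have hM0 : 0 ≤ M := sum_nonneg fun i _ => hw i
  have hai : ∀ i : ℕ, (i:ℝ) ≤ a i := fun i => by exact_mod_cast ha.le_apply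
  have he : (2:ℝ) ≤ exp 1 := by linarith [add_one_le_exp (1:ℝ)]
  have h54 : exp 5 = exp 4 * exp 1 := by rw [← exp_add]; norm_num
  have key : ∀ n : ℕ, ∀ x : ℝ, 1 ≤ x → x < exp 5 * X₁ * 2 ^ n → ∀ F : Finset ℕ, (∀ i ∈ F, (a i : ℝ) ≤ x) →
      ∑ i ∈ F, w i ≤ M + 2 * C * x := by
    intro n
    induction n with
    | zero =>
      intro x hx1 hx F hF
      rw [pow_zero, mul_one] at hx
      have : ∑ i ∈ F, w i ≤ M := sum_le_sum_of_subset_of_nonneg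
        (fun i hi => mem_range.2 (Nat.lt_ceil.2 (((hai i).trans (hF i hi)).trans_lt hx))) fun i _ _ => hw i
      nlinarith
    | succ n ih =>
      intro x hx1 hx F hF
      rcases lt_or_ge x (exp 5 * X₁) with hs | hs
      · refine ih x hx1 (hs.trans_le (le_mul_of_one_le_right (by positivity) (one_le_pow₀ one_le_two))) F hF
      · have h5 : 1 ≤ exp 4 := one_le_exp (by norm_num)
        have hlo : ∑ i ∈ F.filter (fun i => (a i : ℝ) ≤ x / 2), w i ≤ M + 2 * C * (x / 2) := by
          refine ih (x / 2) ?_ ?_ _ fun i hi => (mem_filter.1 hi).2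
          · have : (2:ℝ) ≤ exp 5 := by linarith [add_one_le_exp (5:ℝ)]
            nlinarith
          · rw [pow_succ] at hx
            linarith
        have hhi : ∑ i ∈ F.filter (fun i => ¬ (a i : ℝ) ≤ x / 2), w i ≤ C * (x / exp 5) := by
          refine hX₀ _ ?_ _ fun i hi => ⟨?_, ?_⟩
          · exact (le_max_left X₀ 1).trans ((le_div_iff₀ (exp_pos 5)).2 (by linarith))
          · have h2 : exp 4 * (x / exp 5) = x / exp 1 := by rw [h54]; field_simp
            rw [h2]
            refine le_trans ?_ (not_le.1 (mem_filter.1 hi).2).le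
            gcongr
          · rw [mul_div_cancel₀ _ (exp_ne_zero 5)]
            exact hF i (mem_filter.1 hi).1
        have hx5 : C * (x / exp 5) ≤ C * x := by
          gcongr
          exact div_le_self (by linarith) (one_le_exp (by norm_num))
        rw [← sum_filter_add_sum_filter_not F (fun i => (a i : ℝ) ≤ x / 2)]
        linarith
  refine ⟨M + 2 * C, by positivity, fun x hx F hF => ?_⟩
  obtain ⟨n, hn⟩ := pow_unbounded_of_one_lt x (one_lt_two (α := ℝ))
  have h1 : x < exp 5 * X₁ * 2 ^ n := hn.trans_le (le_mul_of_one_le_left (by positivity)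
    (one_le_mul_of_one_le_of_one_le (one_le_exp (by norm_num)) hX₁1))
  have := key n x hx h1 F hF
  nlinarith

theorem le_gapPowerSum {a : ℕ → ℕ} (ha : StrictMono a) (hγ : 1 ≤ γ) : x - a 0 ≤ gapPowerSum a γ x := by
  have hai : ∀ i : ℕ, (i:ℝ) ≤ a i := fun i => by exact_mod_cast ha.le_apply
  have hex : ∃ N, x < a N := ⟨⌊x⌋₊ + 1, by
    have h1 := Nat.lt_floor_add_one x
    grind⟩
  set N := Nat.find hex with hN
  have hg : ∀ i, (1:ℝ) ≤ (a (i + 1) : ℝ) - a i := fun i => by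
    have : a i + 1 ≤ a (i + 1) := ha (Nat.lt_succ_self i)
    have : (a i : ℝ) + 1 ≤ a (i + 1) := by exact_mod_cast this
    linarith
  calc x - a 0 ≤ a N - a 0 := by linarith [Nat.find_spec hex]
    _ = ∑ i ∈ range N, ((a (i + 1) : ℝ) - a i) := (sum_range_sub (fun i => (a i : ℝ)) N).symm
    _ ≤ ∑ i ∈ range N, ((a (i + 1) : ℝ) - a i) ^ γ := sum_le_sum fun i _ => self_le_rpow_of_one_le (hg i) hγ
    _ ≤ _ := by
      refine sum_le_sum_of_subset_of_nonneg (fun i hi => ?_) fun i _ _ => rpow_nonneg (by linarith [hg i]) _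
      have h1 : (a i : ℝ) ≤ x := by simp_all
      exact mem_filter.2 ⟨mem_range.2 (Nat.lt_succ_of_le (Nat.le_floor ((hai i).trans h1))), h1⟩

end SmoothGaps

theorem stmt_4 (θ : ℝ) (hθ : 0 < θ) (γ : ℝ) (hγ1 : 1 ≤ γ) (hγ2 : γ < 3 / 2)
    (a : ℕ → ℕ) (ha : StrictMono a)
    (haRange : ∀ n : ℕ, (∃ i, a i = n) ↔
      (1 ≤ n ∧ ∀ p : ℕ, p.Prime → p ∣ n → (p : ℝ) ≤ (n : ℝ) ^ θ)) :
    ∃ c₁ : ℝ, 0 < c₁ ∧ ∃ c₂ : ℝ, 0 < c₂ ∧ ∃ x₀ : ℝ, ∀ x : ℝ, x₀ ≤ x →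
      c₁ * x ≤ gapPowerSum a γ x ∧ gapPowerSum a γ x ≤ c₂ * x := by
  obtain ⟨C, hC, h⟩ := SmoothGaps.exists_sum_gap_rpow_le ha haRange hθ hγ1 hγ2
  have hg : ∀ i, 0 ≤ ((a (i + 1) : ℝ) - a i) ^ γ := fun i =>
    Real.rpow_nonneg (sub_nonneg.2 (by exact_mod_cast ha.monotone (Nat.le_succ i))) _
  obtain ⟨c, hc, hsum⟩ := SmoothGaps.exists_sum_le_of_window ha hg hC h
  refine ⟨1 / 2, by norm_num, c, hc, 2 * a 0 + 1, fun x hx => ?_⟩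
  refine ⟨?_, hsum x (by linarith) _ fun i hi => (Finset.mem_filter.1 hi).2⟩
  linarith [SmoothGaps.le_gapPowerSum ha hγ1 (x := x)]
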